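/- There exists a positive integer K such that for every k ≥ K and every admissible k-tuple H = {h_1 < h_2 < ... < h_k} of integers, there exist infinitely many positive integers n such that at least 2 of the numbers n + h_1, n + h_2, ..., n + h_k are prime. -/

import Mathlib

open Filter
open scoped Classical

/-- A finite set `H` of integers is admissible if for every prime `p` there is an integer `n`
such that `p` does not divide `∏_{h ∈ H} (n + h)`. -/
def IsAdmissible (H : Finset ℤ) : Prop :=
  ∀ p : ℕ, p.Prime → ∃ n : ℤ, ¬ (p : ℤ) ∣ ∏ h ∈ H, (n + h)

namespace BoundedGaps

/-- Partial sums of a mean-zero function on `ZMod q` bounded by `1` are at most `q`. -/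
lemma norm_sum_range_le_of_sum_eq_zero {q : ℕ} [NeZero q] (f : ZMod q → ℂ) (h0 : ∑ a, f a = 0)
    (h1 : ∀ a, ‖f a‖ ≤ 1) (N : ℕ) : ‖∑ n ∈ Finset.range N, f (n : ZMod q)‖ ≤ q := by
  have hper : ∑ n ∈ Finset.range q, f (n : ZMod q) = 0 := by
    rw [← h0]
    refine Finset.sum_bij (fun n _ => (n : ZMod q)) (by simp) ?_ ?_ (by simp)
    · intro a ha b hb hab
      have := (ZMod.natCast_eq_natCast_iff' a b q).1 hab
      rwa [Nat.mod_eq_of_lt (by simpa using ha), Nat.mod_eq_of_lt (by simpa using hb)] at this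
    · intro b _
      exact ⟨b.val, by simpa using ZMod.val_lt b, by simp⟩
  induction N using Nat.strong_induction_on with
  | _ N ih =>
    by_cases hN : N < q
    · refine (norm_sum_le _ _).trans ?_
      refine (Finset.sum_le_sum fun i _ => h1 _).trans ?_
      simpa using hN.le
    · obtain ⟨m, rfl⟩ := Nat.exists_eq_add_of_le (not_lt.1 hN)
      rw [Finset.sum_range_add, hper, zero_add]
      have : ∀ x : ℕ, ((q + x : ℕ) : ZMod q) = x := by intro x; simp
      simp only [this]
      exact ih m (by have := NeZero.pos q; omega)

lemma norm_sum_range_char_le {q : ℕ} [NeZero q] {χ : DirichletCharacter ℂ q} (hχ : χ ≠ 1) (N : ℕ) :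
    ‖∑ n ∈ Finset.range N, χ (n : ZMod q)‖ ≤ q :=
  norm_sum_range_le_of_sum_eq_zero _ (MulChar.sum_eq_zero_of_ne_one hχ) (fun a => χ.norm_le_one a) N

lemma sum_Icc_one_eq_sum_range {f : ℕ → ℂ} (h0 : f 0 = 0) (N : ℕ) :
    ∑ n ∈ Finset.Icc 1 N, f n = ∑ n ∈ Finset.range (N + 1), f n := by
  rw [Finset.range_eq_Ico, Finset.sum_eq_sum_Ico_succ_bot (by omega), h0, zero_add]
  rfl

lemma char_natCast_zero {q : ℕ} {χ : DirichletCharacter ℂ q} (hχ : χ ≠ 1) :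
    χ ((0 : ℕ) : ZMod q) = 0 := by
  have : q ≠ 1 := by rintro rfl; exact hχ (Subsingleton.elim _ _)
  simpa using χ.map_zero' this

lemma norm_sum_Icc_char_le {q : ℕ} [NeZero q] {χ : DirichletCharacter ℂ q} (hχ : χ ≠ 1) (N : ℕ) :
    ‖∑ n ∈ Finset.Icc 1 N, χ (n : ZMod q)‖ ≤ q := by
  rw [sum_Icc_one_eq_sum_range (f := fun n : ℕ => χ (n : ZMod q)) (char_natCast_zero hχ)]
  exact norm_sum_range_char_le hχ _

lemma norm_sum_Icc_char_le' {q : ℕ} (χ : DirichletCharacter ℂ q) (N : ℕ) :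
    ‖∑ n ∈ Finset.Icc 1 N, χ (n : ZMod q)‖ ≤ N := by
  refine (norm_sum_le _ _).trans ((Finset.sum_le_sum fun i _ => χ.norm_le_one _).trans ?_)
  simp

/-- The summatory function of a character, set to zero on `(-∞, 1]`. -/
noncomputable def charSum {q : ℕ} (χ : DirichletCharacter ℂ q) (t : ℝ) : ℂ :=
  (Set.Ioi (1 : ℝ)).indicator (fun t => ∑ n ∈ Finset.Icc 1 ⌊t⌋₊, χ (n : ZMod q)) t

lemma norm_charSum_le {q : ℕ} [NeZero q] {χ : DirichletCharacter ℂ q} (hχ : χ ≠ 1) (t : ℝ) :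
    ‖charSum χ t‖ ≤ q := by
  unfold charSum
  refine (norm_indicator_le_norm_self _ _).trans (norm_sum_Icc_char_le hχ _)

lemma norm_charSum_le' {q : ℕ} (χ : DirichletCharacter ℂ q) {t : ℝ} (ht : 0 ≤ t) :
    ‖charSum χ t‖ ≤ t := by
  unfold charSum
  exact (norm_indicator_le_norm_self _ _).trans
    ((norm_sum_Icc_char_le' χ _).trans (Nat.floor_le ht))

lemma measurable_charSum {q : ℕ} (χ : DirichletCharacter ℂ q) : Measurable (charSum χ) := by
  unfold charSum
  refine Measurable.indicator ?_ measurableSet_Ioi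
  exact (measurable_from_nat (f := fun m : ℕ => ∑ n ∈ Finset.Icc 1 m, χ (n : ZMod q))).comp
    Nat.measurable_floor

lemma mellin_charSum_differentiableAt {q : ℕ} [NeZero q] {χ : DirichletCharacter ℂ q} (hχ : χ ≠ 1)
    {s : ℂ} (hs : s.re < 0) : DifferentiableAt ℂ (mellin (charSum χ)) s := by
  refine mellin_differentiableAt_of_isBigO_rpow (a := 0) (b := s.re - 1) ?_ ?_ hs ?_ (by linarith)
  · have h : MeasureTheory.LocallyIntegrable (charSum χ) MeasureTheory.volume := by
      refine (MeasureTheory.locallyIntegrable_const (q : ℝ)).mono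
        (measurable_charSum χ).aestronglyMeasurable (Eventually.of_forall fun t => ?_)
      simpa using norm_charSum_le hχ t
    exact h.locallyIntegrableOn _
  · refine Asymptotics.IsBigO.of_bound q (Eventually.of_forall fun t => ?_)
    simpa using norm_charSum_le hχ t
  · have : charSum χ =ᶠ[nhdsWithin 0 (Set.Ioi 0)] fun _ => 0 := by
      have : Set.Iio (1 : ℝ) ∈ nhdsWithin (0 : ℝ) (Set.Ioi 0) :=
        mem_nhdsWithin_of_mem_nhds (Iio_mem_nhds one_pos)
      filter_upwards [this] with t ht
      simp only [charSum]
      exact Set.indicator_of_notMem (by simpa using (le_of_lt ht)) _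
    exact this.trans_isBigO (Asymptotics.isBigO_zero _ _)

lemma LFunction_eq_mul_mellin {q : ℕ} [NeZero q] {χ : DirichletCharacter ℂ q} (hχ : χ ≠ 1)
    {s : ℂ} (hs : 0 < s.re) : χ.LFunction s = s * mellin (charSum χ) (-s) := by
  have hU : IsPreconnected {z : ℂ | 0 < z.re} := (convex_halfSpace_re_gt 0).isPreconnected
  have hopen : IsOpen {z : ℂ | 0 < z.re} := isOpen_lt continuous_const Complex.continuous_re
  have hopen1 : IsOpen {z : ℂ | 1 < z.re} := isOpen_lt continuous_const Complex.continuous_re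
  have hf : AnalyticOnNhd ℂ χ.LFunction {z : ℂ | 0 < z.re} :=
    (DirichletCharacter.differentiable_LFunction hχ).differentiableOn.analyticOnNhd hopen
  have hg : AnalyticOnNhd ℂ (fun s => s * mellin (charSum χ) (-s)) {z : ℂ | 0 < z.re} := by
    refine DifferentiableOn.analyticOnNhd (fun z hz => DifferentiableAt.differentiableWithinAt ?_)
      hopen
    have hz' : (-z).re < 0 := by simpa using hz
    exact differentiableAt_id.mul (DifferentiableAt.comp (g := mellin (charSum χ)) z
      (mellin_charSum_differentiableAt hχ hz') differentiableAt_id.neg)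
  refine hf.eqOn_of_preconnected_of_eventuallyEq hg hU (z₀ := 2) (by simp) ?_ hs
  filter_upwards [hopen1.mem_nhds (by simp : (2 : ℂ) ∈ {z : ℂ | 1 < z.re})] with z hz
  have hz : 1 < z.re := hz
  rw [DirichletCharacter.LFunction_eq_LSeries χ hz, LSeries_eq_mul_integral _ le_rfl (by linarith)
    (χ.LSeriesSummable_of_one_lt_re hz)]
  · congr 1
    rw [mellin, ← MeasureTheory.integral_indicator measurableSet_Ioi,
      ← MeasureTheory.integral_indicator measurableSet_Ioi]
    congr 1
    ext t
    by_cases ht : 1 < t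
    · have ht0 : 0 < t := by linarith
      simp only [charSum, Set.indicator, Set.mem_Ioi, ht, ht0, if_true, smul_eq_mul]
      rw [mul_comm]; congr 2; ring
    · simp [charSum, Set.indicator, Set.mem_Ioi, ht]
  · refine Asymptotics.IsBigO.of_bound q (Eventually.of_forall fun t => ?_)
    simpa using norm_sum_Icc_char_le hχ t

/-- Upper bound for `L(s, χ)` slightly to the left of `Re s = 1`. -/
lemma norm_LFunction_le {q : ℕ} [NeZero q] {χ : DirichletCharacter ℂ q} (hχ : χ ≠ 1) {l : ℝ}
    (hl : 1 ≤ l) (hq : (q : ℝ) ≤ Real.exp l) {s : ℂ} (hs : 1 - 1 / (2 * l) ≤ s.re) :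
    ‖χ.LFunction s‖ ≤ 6 * l * ‖s‖ := by
  have hl0 : 0 < l := by linarith
  have hl1 : 1 / (2 * l) ≤ 1 / 2 := by
    apply one_div_le_one_div_of_le <;> linarith
  have hs0 : 0 < s.re := by linarith
  have hq0 : (0 : ℝ) < q := by exact_mod_cast NeZero.pos q
  rw [LFunction_eq_mul_mellin hχ hs0, norm_mul, mul_comm (6 * l)]
  refine mul_le_mul_of_nonneg_left ?_ (norm_nonneg _)
  have hb : ∀ t : ℝ, 1 < t → ‖charSum χ t‖ ≤ Real.exp 1 * t ^ (1 - 1 / l) := by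
    intro t ht
    have ht0 : 0 < t := by linarith
    by_cases hqt : t ≤ Real.exp l
    · refine (norm_charSum_le' χ ht0.le).trans ?_
      have : t ^ (1 / l) ≤ Real.exp 1 := by
        refine (Real.rpow_le_rpow ht0.le hqt (by positivity)).trans ?_
        rw [← Real.exp_mul]; field_simp; exact le_rfl
      calc t = t ^ (1 / l) * t ^ (1 - 1 / l) := by
            rw [← Real.rpow_add ht0]; simp
        _ ≤ _ := by gcongr
    · refine (norm_charSum_le hχ t).trans (hq.trans ?_)
      have : Real.exp l ^ (1 - 1 / l) ≤ t ^ (1 - 1 / l) := by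
        refine Real.rpow_le_rpow (Real.exp_pos _).le (not_le.1 hqt).le ?_
        rw [sub_nonneg, div_le_one hl0]; exact hl
      refine le_trans (le_of_eq ?_) (mul_le_mul_of_nonneg_left this (Real.exp_pos _).le)
      rw [← Real.exp_mul, ← Real.exp_add]; congr 1; field_simp; ring
  have hexp : -(s.re) - 1 + (1 - 1 / l) < -1 := by
    have : 1 / l = 2 * (1 / (2 * l)) := by field_simp
    have : 0 < 1 / (2 * l) := by positivity
    linarith
  have key : ‖mellin (charSum χ) (-s)‖ ≤
      ∫ t in Set.Ioi (1 : ℝ), Real.exp 1 * t ^ (-(s.re) - 1 + (1 - 1 / l)) := by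
    have hm : mellin (charSum χ) (-s) =
        ∫ t in Set.Ioi (1 : ℝ), (t : ℂ) ^ (-s - 1) • charSum χ t := by
      rw [mellin, ← MeasureTheory.integral_indicator measurableSet_Ioi,
        ← MeasureTheory.integral_indicator measurableSet_Ioi]
      congr 1
      ext t
      by_cases ht : 1 < t
      · have ht0 : 0 < t := by linarith
        simp [Set.indicator, ht, ht0]
      · simp [charSum, Set.indicator, Set.mem_Ioi, ht]
    rw [hm]
    refine MeasureTheory.norm_integral_le_of_norm_le
      ((integrableOn_Ioi_rpow_of_lt hexp one_pos).const_mul _) ?_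
    refine (MeasureTheory.ae_restrict_iff' measurableSet_Ioi).2 (Eventually.of_forall fun t ht => ?_)
    have ht : 1 < t := ht
    have ht0 : 0 < t := by linarith
    rw [norm_smul, Complex.norm_cpow_eq_rpow_re_of_pos ht0, Real.rpow_add ht0, ← mul_assoc,
      mul_comm (Real.exp 1), mul_assoc]
    simpa using mul_le_mul_of_nonneg_left (hb t ht) (Real.rpow_nonneg ht0.le _)
  refine key.trans ?_
  rw [MeasureTheory.integral_const_mul, integral_Ioi_rpow_of_lt hexp one_pos, Real.one_rpow]
  have h2 : 1 / (2 * l) ≤ -(-(s.re) - 1 + (1 - 1 / l) + 1) := by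
    have : 1 / l = 2 * (1 / (2 * l)) := by field_simp
    linarith
  have h3 : -1 / (-(s.re) - 1 + (1 - 1 / l) + 1) ≤ 2 * l := by
    rw [← neg_div_neg_eq, neg_neg]
    calc 1 / -(-(s.re) - 1 + (1 - 1 / l) + 1) ≤ 1 / (1 / (2 * l)) :=
          one_div_le_one_div_of_le (by positivity) h2
      _ = 2 * l := by simp
  have h4 : Real.exp 1 ≤ 3 := by have := Real.exp_one_lt_d9; linarith
  calc Real.exp 1 * (-1 / (-(s.re) - 1 + (1 - 1 / l) + 1)) ≤ 3 * (2 * l) :=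
        mul_le_mul h4 h3 (div_nonneg_of_nonpos (by norm_num) (by linarith)) (by norm_num)
    _ = 6 * l := by ring

/-- Upper bound for `L'(s, χ)` slightly to the left of `Re s = 1`. -/
lemma norm_deriv_LFunction_le {q : ℕ} [NeZero q] {χ : DirichletCharacter ℂ q} (hχ : χ ≠ 1) {l : ℝ}
    (hl : 1 ≤ l) (hq : (q : ℝ) ≤ Real.exp l) {s : ℂ} (hs : 1 - 1 / (4 * l) ≤ s.re) :
    ‖deriv χ.LFunction s‖ ≤ 24 * l ^ 2 * (‖s‖ + 1) := by
  have hl0 : 0 < l := by linarith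
  have hr : (0 : ℝ) < 1 / (4 * l) := by positivity
  have hr1 : 1 / (4 * l) ≤ 1 := by
    rw [div_le_one (by positivity)]; linarith
  have h := Complex.norm_deriv_le_of_forall_mem_sphere_norm_le (c := s) (R := 1 / (4 * l))
    (C := 6 * l * (‖s‖ + 1)) (f := χ.LFunction) hr
    (DirichletCharacter.differentiable_LFunction hχ).diffContOnCl ?_
  · refine h.trans (le_of_eq ?_)
    field_simp; ring
  · intro z hz
    rw [mem_sphere_iff_norm] at hz
    have h1 : |(z - s).re| ≤ 1 / (4 * l) := hz ▸ Complex.abs_re_le_norm _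
    have h2 : 1 / (2 * l) = 2 * (1 / (4 * l)) := by field_simp; norm_num
    refine (norm_LFunction_le hχ hl hq ?_).trans ?_
    · rw [abs_le, Complex.sub_re] at h1
      linarith [h1.1]
    · gcongr
      calc ‖z‖ = ‖s + (z - s)‖ := by ring_nf
        _ ≤ ‖s‖ + ‖z - s‖ := norm_add_le _ _
        _ ≤ _ := by rw [hz]; gcongr

lemma changeLevel_natCast {n m : ℕ} (χ : DirichletCharacter ℂ n) (h : n ∣ m) {a : ℕ}
    (ha : a.Coprime m) : DirichletCharacter.changeLevel h χ (a : ZMod m) = χ (a : ZMod n) := by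
  have := DirichletCharacter.changeLevel_eq_cast_of_dvd' χ h (a := (a : ℤ))
    (Nat.isCoprime_iff_coprime.2 ha)
  simpa using this

lemma char_natCast_eq_zero {n : ℕ} (χ : DirichletCharacter ℂ n) {a : ℕ} (ha : ¬ a.Coprime n) :
    χ (a : ZMod n) = 0 := by
  apply χ.map_nonunit
  rwa [ZMod.isUnit_iff_coprime]

/-- The product of two characters, to the product of their moduli. -/
noncomputable def mulLift {q₁ q₂ : ℕ} (χ₁ : DirichletCharacter ℂ q₁) (χ₂ : DirichletCharacter ℂ q₂) :
    DirichletCharacter ℂ (q₁ * q₂) :=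
  DirichletCharacter.changeLevel (dvd_mul_right q₁ q₂) χ₁ *
    DirichletCharacter.changeLevel (dvd_mul_left q₂ q₁) χ₂

lemma mulLift_natCast {q₁ q₂ : ℕ} (χ₁ : DirichletCharacter ℂ q₁) (χ₂ : DirichletCharacter ℂ q₂)
    (a : ℕ) : mulLift χ₁ χ₂ (a : ZMod (q₁ * q₂)) = χ₁ (a : ZMod q₁) * χ₂ (a : ZMod q₂) := by
  by_cases ha : a.Coprime (q₁ * q₂)
  · rw [mulLift, MulChar.mul_apply, changeLevel_natCast _ _ ha, changeLevel_natCast _ _ ha]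
  · rw [char_natCast_eq_zero _ ha]
    rw [Nat.coprime_mul_iff_right, not_and_or] at ha
    rcases ha with ha | ha <;> rw [char_natCast_eq_zero _ ha] <;> simp

lemma sigma_eq_of_mulLift_inv_eq_one {q₁ q₂ : ℕ} [NeZero q₁] [NeZero q₂]
    {χ₁ : DirichletCharacter ℂ q₁}
    {χ₂ : DirichletCharacter ℂ q₂} (h₁ : χ₁.IsPrimitive) (h₂ : χ₂.IsPrimitive)
    (h : mulLift χ₁ χ₂⁻¹ = 1) :
    (⟨q₁, χ₁⟩ : Σ q, DirichletCharacter ℂ q) = ⟨q₂, χ₂⟩ := by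
  have h' : DirichletCharacter.changeLevel (dvd_mul_right q₁ q₂) χ₁ =
      DirichletCharacter.changeLevel (dvd_mul_left q₂ q₁) χ₂ := by
    rw [mulLift, map_inv, mul_inv_eq_one] at h
    exact h
  have hq : q₁ = q₂ := by
    rw [← h₁, ← h₂, ← DirichletCharacter.conductor_changeLevel χ₁ (dvd_mul_right q₁ q₂), h',
      DirichletCharacter.conductor_changeLevel]
  subst hq
  rw [DirichletCharacter.changeLevel_injective _ h']

lemma integral_bound {F : ℝ → ℂ} {C l : ℝ} (hC : 0 ≤ C) (hl : 1 ≤ l) {s : ℂ}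
    (hs : 1 - 1 / (2 * l) ≤ s.re)
    (hb : ∀ t : ℝ, 1 < t → ‖F t‖ ≤ C * t ^ (1 - 1 / l)) :
    ‖∫ t in Set.Ioi (1 : ℝ), F t * (t : ℂ) ^ (-(s + 1))‖ ≤ C * (2 * l) := by
  have hl0 : 0 < l := by linarith
  have hexp : -(s.re) - 1 + (1 - 1 / l) < -1 := by
    have : 1 / l = 2 * (1 / (2 * l)) := by field_simp
    have : 0 < 1 / (2 * l) := by positivity
    linarith
  have key : ‖∫ t in Set.Ioi (1 : ℝ), F t * (t : ℂ) ^ (-(s + 1))‖ ≤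
      ∫ t in Set.Ioi (1 : ℝ), C * t ^ (-(s.re) - 1 + (1 - 1 / l)) := by
    refine MeasureTheory.norm_integral_le_of_norm_le
      ((integrableOn_Ioi_rpow_of_lt hexp one_pos).const_mul _) ?_
    refine (MeasureTheory.ae_restrict_iff' measurableSet_Ioi).2 (Eventually.of_forall fun t ht => ?_)
    have ht : 1 < t := ht
    have ht0 : 0 < t := by linarith
    rw [norm_mul, Complex.norm_cpow_eq_rpow_re_of_pos ht0, Real.rpow_add ht0, mul_comm (t ^ _ : ℝ),
      ← mul_assoc]
    have e : (-(s + 1)).re = -s.re - 1 := by simp; ring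
    rw [e]
    exact mul_le_mul_of_nonneg_right (hb t ht) (Real.rpow_nonneg ht0.le _)
  refine key.trans ?_
  rw [MeasureTheory.integral_const_mul, integral_Ioi_rpow_of_lt hexp one_pos, Real.one_rpow]
  have h2 : 1 / (2 * l) ≤ -(-(s.re) - 1 + (1 - 1 / l) + 1) := by
    have : 1 / l = 2 * (1 / (2 * l)) := by field_simp
    linarith
  have h3 : -1 / (-(s.re) - 1 + (1 - 1 / l) + 1) ≤ 2 * l := by
    rw [← neg_div_neg_eq, neg_neg]
    calc 1 / -(-(s.re) - 1 + (1 - 1 / l) + 1) ≤ 1 / (1 / (2 * l)) :=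
          one_div_le_one_div_of_le (by positivity) h2
      _ = 2 * l := by simp
  exact mul_le_mul_of_nonneg_left h3 hC

lemma min_le_rpow {l X t : ℝ} (hl : 1 ≤ l) (ht : 1 < t) (h1 : X ≤ t)
    (h2 : X ≤ 2 * Real.exp l) : X ≤ 2 * Real.exp 1 * t ^ (1 - 1 / l) := by
  have hl0 : 0 < l := by linarith
  have ht0 : 0 < t := by linarith
  by_cases hqt : t ≤ Real.exp l
  · refine h1.trans ?_
    have : t ^ (1 / l) ≤ Real.exp 1 := by
      refine (Real.rpow_le_rpow ht0.le hqt (by positivity)).trans ?_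
      rw [← Real.exp_mul]; field_simp; exact le_rfl
    calc t = t ^ (1 / l) * t ^ (1 - 1 / l) := by
          rw [← Real.rpow_add ht0]; simp
      _ ≤ Real.exp 1 * t ^ (1 - 1 / l) := by gcongr
      _ ≤ _ := by have := mul_pos (Real.exp_pos 1) (Real.rpow_pos_of_pos ht0 (1 - 1/l)); nlinarith
  · refine h2.trans ?_
    have : Real.exp l ^ (1 - 1 / l) ≤ t ^ (1 - 1 / l) := by
      refine Real.rpow_le_rpow (Real.exp_pos _).le (not_le.1 hqt).le ?_
      rw [sub_nonneg, div_le_one hl0]; exact hl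
    rw [mul_assoc]
    refine mul_le_mul_of_nonneg_left ?_ (by norm_num)
    refine le_trans (le_of_eq ?_) (mul_le_mul_of_nonneg_left this (Real.exp_pos _).le)
    rw [← Real.exp_mul, ← Real.exp_add]; congr 1; field_simp; ring

/-- Upper bound for the `L`-series of the trivial character to the right of `Re s = 1`. -/
lemma norm_LSeries_one_le {q : ℕ} [NeZero q] {l : ℝ}
    (hl : 1 ≤ l) (hq : (q : ℝ) ≤ Real.exp l) {s : ℂ} (hs : 1 < s.re) :
    ‖LSeries (fun n => (1 : DirichletCharacter ℂ q) (n : ZMod q)) s‖ ≤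
      ‖s‖ / ‖s - 1‖ + 12 * l * ‖s‖ := by
  set χ : DirichletCharacter ℂ q := 1 with hχ
  have hl0 : 0 < l := by linarith
  have hq0 : (0 : ℝ) < q := by exact_mod_cast NeZero.pos q
  have hq1 : (1 : ℝ) ≤ q := by exact_mod_cast NeZero.one_le
  -- mean value
  set S : ℂ := ∑ a : ZMod q, χ a with hS
  have hSn : ‖S‖ ≤ q := by
    refine (norm_sum_le _ _).trans ((Finset.sum_le_sum fun i _ => χ.norm_le_one _).trans ?_)
    simp
  have hSre : S = ((S.re : ℝ) : ℂ) ∧ 0 ≤ S.re := by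
    have : S = ((∑ a : ZMod q, if IsUnit a then (1 : ℝ) else 0 : ℝ) : ℂ) := by
      rw [hS]; push_cast
      refine Finset.sum_congr rfl fun a _ => ?_
      by_cases ha : IsUnit a
      · rw [hχ, MulChar.one_apply ha]; simp [ha]
      · rw [hχ, MulChar.map_nonunit _ ha]; simp [ha]
    rw [this]
    refine ⟨by simp, ?_⟩
    rw [Complex.ofReal_re]
    exact Finset.sum_nonneg fun a _ => by split_ifs <;> norm_num
  set c : ℝ := S.re / q with hc
  have hc0 : 0 ≤ c := div_nonneg hSre.2 hq0.le
  have hc1 : c ≤ 1 := by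
    rw [hc, div_le_one hq0]
    exact (Complex.re_le_norm S).trans hSn
  have hreal : ∀ N : ℕ, ∃ y : ℝ, 0 ≤ y ∧ y ≤ N ∧
      ∑ n ∈ Finset.Icc 1 N, χ (n : ZMod q) = (y : ℂ) := by
    intro N
    refine ⟨∑ n ∈ Finset.Icc 1 N, if IsUnit (n : ZMod q) then (1 : ℝ) else 0,
      Finset.sum_nonneg fun a _ => by split_ifs <;> norm_num, ?_, ?_⟩
    · refine (Finset.sum_le_sum (g := fun _ => (1 : ℝ)) fun a _ => ?_).trans (by simp)
      split_ifs <;> norm_num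
    · push_cast
      refine Finset.sum_congr rfl fun a _ => ?_
      by_cases ha : IsUnit (a : ZMod q)
      · rw [hχ, MulChar.one_apply ha]; simp [ha]
      · rw [hχ, MulChar.map_nonunit _ ha]; simp [ha]
  have hmean : ∀ N : ℕ, ‖∑ n ∈ Finset.Icc 1 N, χ (n : ZMod q) - c * N‖ ≤ q := by
    intro N
    have h := norm_sum_range_le_of_sum_eq_zero (q := q) (fun a => χ (a + 1) - c) ?_ ?_ N
    · convert h using 2
      rw [Finset.sum_sub_distrib]
      congr 1
      · have := Finset.sum_Ico_add' (fun n : ℕ => χ (n : ZMod q)) 0 N 1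
        rw [Finset.range_eq_Ico]
        push_cast at this
        rw [this]
        rfl
      · simp [mul_comm]
    · rw [Finset.sum_sub_distrib, show ∑ a : ZMod q, χ (a + 1) = S from
        Equiv.sum_comp (Equiv.addRight (1 : ZMod q)) (fun a => χ a), hSre.1]
      simp only [Finset.sum_const, Finset.card_univ, ZMod.card, nsmul_eq_mul]
      rw [hc]; push_cast
      have : (q : ℂ) ≠ 0 := by exact_mod_cast hq0.ne'
      field_simp; simp
    · intro a
      by_cases ha : IsUnit (a + 1)
      · rw [hχ, MulChar.one_apply ha]
        rw [show (1 - (c : ℂ)) = ((1 - c : ℝ) : ℂ) by push_cast; rfl, Complex.norm_real,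
          Real.norm_of_nonneg (by linarith)]
        linarith
      · rw [hχ, MulChar.map_nonunit _ ha]
        simpa [abs_of_nonneg hc0] using hc1
  set F : ℝ → ℂ := fun t => ∑ n ∈ Finset.Icc 1 ⌊t⌋₊, χ (n : ZMod q) - c * t with hF
  have hFb : ∀ t : ℝ, 1 < t → ‖F t‖ ≤ 2 * Real.exp 1 * t ^ (1 - 1 / l) := by
    intro t ht
    have ht0 : 0 < t := by linarith
    apply min_le_rpow hl ht
    · obtain ⟨y, hy0, hy1, hy⟩ := hreal ⌊t⌋₊
      simp only [hF]
      rw [hy, show (y : ℂ) - c * t = ((y - c * t : ℝ) : ℂ) by push_cast; rfl, Complex.norm_real,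
        Real.norm_eq_abs, abs_le]
      have := hy1.trans (Nat.floor_le ht0.le)
      constructor <;> nlinarith
    · have h1 := hmean ⌊t⌋₊
      have h2 : ‖(c : ℂ) * ((⌊t⌋₊ : ℕ) : ℂ) - c * t‖ ≤ 1 := by
        rw [← mul_sub, show ((⌊t⌋₊ : ℕ) : ℂ) - (t : ℂ) = (((⌊t⌋₊ : ℕ) : ℝ) - t : ℝ) by push_cast; rfl,
          ← Complex.ofReal_mul, Complex.norm_real, Real.norm_eq_abs, abs_le]
        have := Nat.floor_le ht0.le
        have := Nat.lt_floor_add_one t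
        constructor <;> nlinarith
      calc ‖F t‖ = ‖(∑ n ∈ Finset.Icc 1 ⌊t⌋₊, χ (n : ZMod q) - c * ((⌊t⌋₊ : ℕ) : ℂ)) +
            ((c : ℂ) * ((⌊t⌋₊ : ℕ) : ℂ) - c * t)‖ := by simp only [hF]; ring_nf
        _ ≤ _ := norm_add_le _ _
        _ ≤ 2 * Real.exp l := by linarith
  have hre0 : (-(s+1)).re = -s.re - 1 := by simp; ring
  rw [LSeries_eq_mul_integral (r := 1) _ zero_le_one hs (χ.LSeriesSummable_of_one_lt_re hs)]
  · have hmeasF : Measurable F := by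
      refine Measurable.sub ?_ (by fun_prop)
      exact (measurable_from_nat (f := fun m : ℕ => ∑ n ∈ Finset.Icc 1 m, χ (n : ZMod q))).comp
        Nat.measurable_floor
    have hexp : -s.re - 1 + (1 - 1 / l) < -1 := by
      have : 0 < 1 / l := by positivity
      linarith
    have hint1 : MeasureTheory.IntegrableOn (fun t : ℝ => F t * (t : ℂ) ^ (-(s + 1)))
        (Set.Ioi 1) := by
      refine MeasureTheory.Integrable.mono'
        ((integrableOn_Ioi_rpow_of_lt hexp one_pos).const_mul (2 * Real.exp 1)) ?_ ?_
      · refine AEMeasurable.aestronglyMeasurable (Measurable.aemeasurable ?_)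
        exact hmeasF.mul (by fun_prop)
      · refine (MeasureTheory.ae_restrict_iff' measurableSet_Ioi).2
          (Eventually.of_forall fun t ht => ?_)
        have ht : 1 < t := ht
        have ht0 : 0 < t := by linarith
        rw [norm_mul, Complex.norm_cpow_eq_rpow_re_of_pos ht0, Real.rpow_add ht0,
          mul_comm (t ^ _ : ℝ), ← mul_assoc, hre0]
        exact mul_le_mul_of_nonneg_right (hFb t ht) (Real.rpow_nonneg ht0.le _)
    have hint2 : MeasureTheory.IntegrableOn (fun t : ℝ => (c : ℂ) * (t : ℂ) ^ (-s))
        (Set.Ioi 1) :=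
      (integrableOn_Ioi_cpow_of_lt (by simpa using hs) one_pos).const_mul _
    have hsplit : ∫ t in Set.Ioi (1 : ℝ), (∑ n ∈ Finset.Icc 1 ⌊t⌋₊, χ (n : ZMod q)) *
        (t : ℂ) ^ (-(s + 1)) = (∫ t in Set.Ioi (1 : ℝ), F t * (t : ℂ) ^ (-(s + 1))) +
          ∫ t in Set.Ioi (1 : ℝ), (c : ℂ) * (t : ℂ) ^ (-s) := by
      rw [← MeasureTheory.integral_add hint1 hint2]
      refine MeasureTheory.setIntegral_congr_fun measurableSet_Ioi fun t ht => ?_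
      have ht : 1 < t := ht
      have ht0 : (t : ℂ) ≠ 0 := by
        have : t ≠ 0 := by linarith
        exact_mod_cast this
      have : (t : ℂ) ^ (-s) = t * (t : ℂ) ^ (-(s + 1)) := by
        rw [show -s = 1 + -(s+1) by ring, Complex.cpow_add _ _ ht0, Complex.cpow_one]
      simp only [this, hF]; ring
    rw [hsplit, mul_add]
    refine (norm_add_le _ _).trans ?_
    rw [add_comm]
    refine add_le_add ?_ ?_
    · rw [MeasureTheory.integral_const_mul, integral_Ioi_cpow_of_lt (by simpa using hs) one_pos]
      rw [norm_mul, norm_mul, norm_div, Complex.norm_real, Real.norm_of_nonneg hc0]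
      simp only [Complex.ofReal_one, Complex.one_cpow, norm_neg, norm_one]
      rw [show -s + 1 = -(s - 1) by ring, norm_neg, div_eq_mul_one_div ‖s‖]
      gcongr
      have : 0 ≤ 1 / ‖s - 1‖ := by positivity
      nlinarith
    · rw [norm_mul, mul_comm (12 * l)]
      refine mul_le_mul_of_nonneg_left ?_ (norm_nonneg _)
      have h1 : 0 < 1 / (2 * l) := by positivity
      refine (integral_bound (by positivity) hl (by linarith) hFb).trans ?_
      have h4 : Real.exp 1 ≤ 3 := by have := Real.exp_one_lt_d9; linarith
      nlinarith
  · refine Asymptotics.IsBigO.of_bound 1 (Eventually.of_forall fun t => ?_)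
    simpa using norm_sum_Icc_char_le' χ t

lemma one_le_norm_of_hasProd {ι : Type*} {f : ι → ℂ} {z : ℂ} (h : HasProd f z)
    (hf : ∀ i, 1 ≤ ‖f i‖) : 1 ≤ ‖z‖ := by
  refine ge_of_tendsto (Tendsto.norm h) (Eventually.of_forall fun s => ?_)
  rw [norm_prod]
  exact Finset.prod_induction _ (fun x : ℝ => 1 ≤ x)
    (fun a b ha hb => one_le_mul_of_one_le_of_one_le ha hb) le_rfl fun i _ => hf i

lemma local_factor_le {u : ℝ} (h0 : 0 < u) (h1 : u < 1) {a b : ℂ} (ha : a = 0 ∨ a = 1 ∨ a = -1)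
    (hb : b = 0 ∨ b = 1 ∨ b = -1) :
    ‖(1 - (u : ℂ)) * (1 - a * u) * (1 - b * u) * (1 - a * b * u)‖ ≤ 1 ∧
    (1 - (u : ℂ)) * (1 - a * u) * (1 - b * u) * (1 - a * b * u) ≠ 0 := by
  have key : ∀ v : ℝ, (1 - (u : ℂ)) * (1 - a * u) * (1 - b * u) * (1 - a * b * u) = v →
      0 < v → v ≤ 1 → ‖(1 - (u : ℂ)) * (1 - a * u) * (1 - b * u) * (1 - a * b * u)‖ ≤ 1 ∧
    (1 - (u : ℂ)) * (1 - a * u) * (1 - b * u) * (1 - a * b * u) ≠ 0 := by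
    intro v hv hv0 hv1
    rw [hv, Complex.norm_real, Real.norm_of_nonneg hv0.le]
    exact ⟨hv1, by exact_mod_cast hv0.ne'⟩
  have hp : 0 < 1 - u := by linarith
  have hq : 0 < 1 - u ^ 2 := by nlinarith
  have hu2 : 0 < u ^ 2 := by positivity
  rcases ha with rfl | rfl | rfl <;> rcases hb with rfl | rfl | rfl
  · exact key (1 - u) (by push_cast; ring) hp (by linarith)
  · exact key ((1 - u) ^ 2) (by push_cast; ring) (by positivity) (by nlinarith)
  · exact key (1 - u ^ 2) (by push_cast; ring) hq (by linarith)
  · exact key ((1 - u) ^ 2) (by push_cast; ring) (by positivity) (by nlinarith)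
  · exact key ((1 - u) ^ 4) (by push_cast; ring) (by positivity)
      (pow_le_one₀ hp.le (by linarith))
  · exact key ((1 - u ^ 2) ^ 2) (by push_cast; ring) (by positivity)
      (pow_le_one₀ hq.le (by linarith))
  · exact key (1 - u ^ 2) (by push_cast; ring) hq (by linarith)
  · exact key ((1 - u ^ 2) ^ 2) (by push_cast; ring) (by positivity)
      (pow_le_one₀ hq.le (by linarith))
  · exact key ((1 - u ^ 2) ^ 2) (by push_cast; ring) (by positivity)
      (pow_le_one₀ hq.le (by linarith))

lemma one_le_norm_prod_LSeries {q₁ q₂ : ℕ} {χ₁ : DirichletCharacter ℂ q₁}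
    {χ₂ : DirichletCharacter ℂ q₂} (h₁ : χ₁ ^ 2 = 1) (h₂ : χ₂ ^ 2 = 1) {x : ℝ} (hx : 0 < x) :
    1 ≤ ‖LSeries (fun n => (1 : DirichletCharacter ℂ 1) (n : ZMod 1)) (1 + x)‖ *
      ‖LSeries (fun n => χ₁ (n : ZMod q₁)) (1 + x)‖ *
      ‖LSeries (fun n => χ₂ (n : ZMod q₂)) (1 + x)‖ *
      ‖LSeries (fun n => mulLift χ₁ χ₂ (n : ZMod (q₁ * q₂))) (1 + x)‖ := by
  have hs : 1 < ((1 : ℂ) + x).re := by simp [hx]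
  have H := (((DirichletCharacter.LSeries_eulerProduct_hasProd (1 : DirichletCharacter ℂ 1) hs).mul
    (DirichletCharacter.LSeries_eulerProduct_hasProd χ₁ hs)).mul
    (DirichletCharacter.LSeries_eulerProduct_hasProd χ₂ hs)).mul
    (DirichletCharacter.LSeries_eulerProduct_hasProd (mulLift χ₁ χ₂) hs)
  rw [← norm_mul, ← norm_mul, ← norm_mul]
  refine one_le_norm_of_hasProd H fun p => ?_
  have hp0 : (0 : ℝ) < p := by exact_mod_cast p.2.pos
  have hp1 : (1 : ℝ) < p := by exact_mod_cast p.2.one_lt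
  have hu : ((p : ℕ) : ℂ) ^ (-((1 : ℂ) + x)) = (((p : ℝ) ^ (-(1 + x)) : ℝ) : ℂ) := by
    rw [Complex.ofReal_cpow hp0.le]; push_cast; rfl
  rw [mulLift_natCast, hu]
  have hone : (1 : DirichletCharacter ℂ 1) ((p : ℕ) : ZMod 1) = 1 := by
    rw [MulChar.one_apply]; exact isUnit_of_subsingleton _
  rw [hone, one_mul, ← mul_inv, ← mul_inv, ← mul_inv, norm_inv]
  have := local_factor_le (u := (p : ℝ) ^ (-(1 + x))) (Real.rpow_pos_of_pos hp0 _)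
    (Real.rpow_lt_one_of_one_lt_of_neg hp1 (by linarith))
    ((MulChar.isQuadratic_iff_sq_eq_one.2 h₁) ((p : ℕ) : ZMod q₁))
    ((MulChar.isQuadratic_iff_sq_eq_one.2 h₂) ((p : ℕ) : ZMod q₂))
  exact (one_le_inv₀ (norm_pos_iff.2 this.2)).2 this.1

/-- Moving from `1` to `1 + x`. -/
lemma norm_LFunction_one_add_le {q : ℕ} [NeZero q] {χ : DirichletCharacter ℂ q} (hχ : χ ≠ 1) {l : ℝ}
    (hl : 1 ≤ l) (hq : (q : ℝ) ≤ Real.exp l) {x : ℝ} (hx : 0 < x) (hx1 : x ≤ 1) :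
    ‖χ.LFunction (1 + x)‖ ≤ ‖χ.LFunction 1‖ + 72 * l ^ 2 * x := by
  have h := (convex_segment (𝕜 := ℝ) (1 : ℂ) (1 + x)).norm_image_sub_le_of_norm_deriv_le
    (f := χ.LFunction) (C := 72 * l ^ 2) (x := 1) (y := 1 + x)
    (fun z _ => DirichletCharacter.differentiable_LFunction hχ z) ?_
    (left_mem_segment _ _ _) (right_mem_segment _ _ _)
  · have h2 : ‖(1 : ℂ) + x - 1‖ = x := by simp [abs_of_pos hx]
    rw [h2] at h
    calc ‖χ.LFunction (1 + x)‖ = ‖χ.LFunction 1 + (χ.LFunction (1 + x) - χ.LFunction 1)‖ := by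
          ring_nf
      _ ≤ _ := (norm_add_le _ _).trans (by linarith)
  · intro z hz
    rw [segment_eq_image'] at hz
    obtain ⟨t, ht, rfl⟩ := hz
    have e : (1 : ℂ) + t • ((1 : ℂ) + x - 1) = ((1 + t * x : ℝ) : ℂ) := by
      simp
    simp only [e]
    have htx : 0 ≤ t * x := mul_nonneg ht.1 hx.le
    have htx1 : t * x ≤ 1 := by nlinarith [ht.1, ht.2]
    refine (norm_deriv_LFunction_le hχ hl hq ?_).trans ?_
    · rw [Complex.ofReal_re]
      have : 0 < 1 / (4 * l) := by positivity
      linarith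
    · rw [Complex.norm_real, Real.norm_of_nonneg (by linarith)]
      nlinarith [sq_nonneg l]

/-- Two distinct quadratic characters cannot both have a tiny `L(1, χ)`. -/
lemma repulsion {q₁ q₂ : ℕ} [NeZero q₁] [NeZero q₂] {χ₁ : DirichletCharacter ℂ q₁}
    {χ₂ : DirichletCharacter ℂ q₂} (n₁ : χ₁ ≠ 1) (n₂ : χ₂ ≠ 1) (h₁ : χ₁ ^ 2 = 1) (h₂ : χ₂ ^ 2 = 1)
    (h₁₂ : mulLift χ₁ χ₂ ≠ 1) {l : ℝ} (hl : 1 ≤ l) (hq₁ : (q₁ : ℝ) ≤ Real.exp l)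
    (hq₂ : (q₂ : ℝ) ≤ Real.exp l) (b₁ : ‖χ₁.LFunction 1‖ ≤ 1 / (10 ^ 7 * l ^ 3))
    (b₂ : ‖χ₂.LFunction 1‖ ≤ 1 / (10 ^ 7 * l ^ 3)) : False := by
  have hl0 : 0 < l := by linarith
  set x : ℝ := 1 / (10 ^ 7 * l ^ 5) with hx
  have hx0 : 0 < x := by positivity
  have hx1 : x ≤ 1 := by
    rw [hx, div_le_one (by positivity)]
    have : 1 ≤ l ^ 5 := one_le_pow₀ hl
    linarith
  have hb : 1 / (10 ^ 7 * l ^ 3) = l ^ 2 * x := by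
    rw [hx]; field_simp
  have hs : 1 < ((1 : ℂ) + x).re := by simp [hx0]
  have hns : ‖(1 : ℂ) + x‖ ≤ 2 := by
    rw [show (1 : ℂ) + x = ((1 + x : ℝ) : ℂ) by push_cast; rfl, Complex.norm_real,
      Real.norm_of_nonneg (by linarith)]
    linarith
  have h := one_le_norm_prod_LSeries h₁ h₂ hx0
  rw [← DirichletCharacter.LFunction_eq_LSeries χ₁ hs,
    ← DirichletCharacter.LFunction_eq_LSeries χ₂ hs,
    ← DirichletCharacter.LFunction_eq_LSeries (mulLift χ₁ χ₂) hs] at h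
  have e1 := norm_LFunction_one_add_le n₁ hl hq₁ hx0 hx1
  have e2 := norm_LFunction_one_add_le n₂ hl hq₂ hx0 hx1
  have e3 : ‖(mulLift χ₁ χ₂).LFunction (1 + x)‖ ≤ 24 * l := by
    refine (norm_LFunction_le h₁₂ (l := 2 * l) (by linarith) ?_ ?_).trans ?_
    · push_cast
      rw [two_mul, Real.exp_add]
      gcongr
    · have : 0 < 1 / (2 * (2 * l)) := by positivity
      linarith
    · nlinarith
  have e0 : ‖LSeries (fun n => (1 : DirichletCharacter ℂ 1) (n : ZMod 1)) (1 + x)‖ ≤ 26 / x := by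
    refine (norm_LSeries_one_le (l := 1) le_rfl (by simp) hs).trans ?_
    have : ‖(1 : ℂ) + x - 1‖ = x := by simp [abs_of_pos hx0]
    rw [this]
    calc ‖(1 : ℂ) + x‖ / x + 12 * 1 * ‖(1 : ℂ) + x‖ ≤ 2 / x + 12 * 1 * 2 := by gcongr
      _ ≤ 26 / x := by
        rw [div_add' _ _ _ hx0.ne']; gcongr; linarith
  have e1' : ‖χ₁.LFunction (1 + x)‖ ≤ 73 * l ^ 2 * x := by linarith
  have e2' : ‖χ₂.LFunction (1 + x)‖ ≤ 73 * l ^ 2 * x := by linarith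
  have : (1 : ℝ) ≤ 26 / x * (73 * l ^ 2 * x) * (73 * l ^ 2 * x) * (24 * l) := by
    refine h.trans ?_
    gcongr
  have e : 26 / x * (73 * l ^ 2 * x) * (73 * l ^ 2 * x) * (24 * l) = 3325296 * (l ^ 5 * x) := by
    field_simp; ring
  have e' : l ^ 5 * x = 1 / 10 ^ 7 := by rw [hx]; field_simp
  rw [e, e'] at this
  norm_num at this

/-- `l` is good if no primitive quadratic character of conductor at most `exp l` has a
small value at `1`. -/
def Good (l : ℝ) : Prop := ∀ (r : ℕ) [NeZero r] (χ : DirichletCharacter ℂ r), (r : ℝ) ≤ Real.exp l →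
  χ.IsPrimitive → χ ≠ 1 → χ ^ 2 = 1 → 1 / (10 ^ 8 * l ^ 3) ≤ ‖χ.LFunction 1‖

lemma exists_good (n₀ : ℕ) : ∃ n ≥ n₀, Good (2 ^ n) := by
  by_contra! hcon
  have hbad : ∀ n : ℕ, ∃ (r : ℕ) (_ : NeZero r) (χ : DirichletCharacter ℂ r),
      (r : ℝ) ≤ Real.exp (2 ^ (n₀ + n)) ∧ χ.IsPrimitive ∧ χ ≠ 1 ∧ χ ^ 2 = 1 ∧
      ‖χ.LFunction 1‖ < 1 / (10 ^ 8 * (2 ^ (n₀ + n)) ^ 3) := by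
    intro n
    have := hcon (n₀ + n) (by omega)
    unfold Good at this
    push Not at this
    obtain ⟨r, h, χ, h1, h2, h3, h4, h5⟩ := this
    exact ⟨r, h, χ, h1, h2, h3, h4, h5⟩
  choose r hr χ h1 h2 h3 h4 h5 using hbad
  have hstep : ∀ n, (⟨r n, χ n⟩ : Σ q, DirichletCharacter ℂ q) = ⟨r (n + 1), χ (n + 1)⟩ := by
    intro n
    by_contra hne
    have hl : (1 : ℝ) ≤ 2 ^ (n₀ + (n + 1)) := one_le_pow₀ (by norm_num)
    have hpow : (2 : ℝ) ^ (n₀ + (n + 1)) = 2 * 2 ^ (n₀ + n) := by rw [← add_assoc, pow_succ]; ring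
    have hpos : (0 : ℝ) < 2 ^ (n₀ + n) := by positivity
    have hinv : (χ (n + 1))⁻¹ = χ (n + 1) := by
      rw [inv_eq_iff_mul_eq_one, ← sq, h4]
    refine repulsion (χ₁ := χ n) (χ₂ := χ (n + 1)) (h3 n) (h3 _) (h4 n) (h4 _) ?_ hl
      ((h1 n).trans (Real.exp_le_exp.2 (by rw [hpow]; linarith))) (h1 _) ((h5 n).le.trans ?_)
      ((h5 _).le.trans ?_)
    · intro h
      apply hne
      apply sigma_eq_of_mulLift_inv_eq_one (h2 _) (h2 _)
      rwa [hinv]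
    · rw [hpow]
      apply one_div_le_one_div_of_le (by positivity)
      rw [mul_pow]; have := pow_pos hpos 3; linarith
    · apply one_div_le_one_div_of_le (by positivity)
      gcongr <;> norm_num
  have hall : ∀ n, (⟨r n, χ n⟩ : Σ q, DirichletCharacter ℂ q) = ⟨r 0, χ 0⟩ := by
    intro n
    induction n with
    | zero => rfl
    | succ n ih => rw [← hstep, ih]
  have hL : ∀ n, ‖(χ 0).LFunction 1‖ ≤ (1 / 2 : ℝ) ^ n := by
    intro n
    have e : ∀ (a b : Σ q, DirichletCharacter ℂ q) [NeZero a.1] [NeZero b.1], a = b →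
      a.2.LFunction 1 = b.2.LFunction 1 := by rintro a b _ _ rfl; rfl
    rw [← e _ _ (hall n)]
    refine (h5 n).le.trans ?_
    rw [one_div_pow]
    apply one_div_le_one_div_of_le (by positivity)
    have a1 : (1 : ℝ) ≤ 2 ^ (n₀ + n) := one_le_pow₀ (by norm_num)
    have a2 : (2 : ℝ) ^ n ≤ 2 ^ (n₀ + n) := pow_le_pow_right₀ (by norm_num) (by omega)
    have a3 : (2 : ℝ) ^ (n₀ + n) ≤ (2 ^ (n₀ + n)) ^ 3 := le_self_pow₀ a1 (by norm_num)
    linarith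
  have h0 : ‖(χ 0).LFunction 1‖ ≤ 0 :=
    ge_of_tendsto' (tendsto_pow_atTop_nhds_zero_of_lt_one (by norm_num) (by norm_num)) hL
  exact DirichletCharacter.LFunction_apply_one_ne_zero (h3 0) (norm_le_zero_iff.1 h0)

lemma norm_LFunction_sub_le {q : ℕ} [NeZero q] {χ : DirichletCharacter ℂ q} (hχ : χ ≠ 1) {l M : ℝ}
    (hl : 1 ≤ l) (hq : (q : ℝ) ≤ Real.exp l) {z w : ℂ} (hz : 1 - 1 / (4 * l) ≤ z.re)
    (hw : 1 - 1 / (4 * l) ≤ w.re) (hzM : ‖z‖ ≤ M) (hwM : ‖w‖ ≤ M) :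
    ‖χ.LFunction z - χ.LFunction w‖ ≤ 24 * l ^ 2 * (M + 1) * ‖z - w‖ := by
  refine ((convex_halfSpace_re_ge (1 - 1 / (4 * l))).inter
    (convex_closedBall (0 : ℂ) M)).norm_image_sub_le_of_norm_deriv_le
    (f := χ.LFunction) (fun z _ => DirichletCharacter.differentiable_LFunction hχ z) ?_
    ⟨hw, by simpa using hwM⟩ ⟨hz, by simpa using hzM⟩
  rintro u ⟨hu, huM⟩
  refine (norm_deriv_LFunction_le hχ hl hq hu).trans ?_
  have : ‖u‖ ≤ M := by simpa using huM
  gcongr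

lemma norm_one_add_le (x y : ℝ) : ‖(1 : ℂ) + x + Complex.I * y‖ ≤ 1 + |x| + |y| := by
  refine (norm_add_le _ _).trans (add_le_add ((norm_add_le _ _).trans ?_) ?_) <;> simp

lemma three_four_one {q : ℕ} [NeZero q] {χ : DirichletCharacter ℂ q} {l : ℝ}
    (hl : 1 ≤ l) (hq : (q : ℝ) ≤ Real.exp l) {x y : ℝ} (hx : 0 < x) (hx1 : x ≤ 1)
    (h : χ ^ 2 ≠ 1 ∨ 1 / (10 ^ 12 * l ^ 5) ≤ x ∨ 1 / (10 ^ 12 * l ^ 5) ≤ |y|) :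
    x ^ 3 / (10 ^ 18 * (l * (1 + |y|)) ^ 9) ≤ ‖χ.LFunction (1 + x + Complex.I * y)‖ ^ 4 := by
  have hl0 : 0 < l := by linarith
  have hy := abs_nonneg y
  set τ := l * (1 + |y|) with hτ
  have hlτ : l ≤ τ := by nlinarith
  have hτ1 : 1 ≤ τ := by linarith
  have h341 := DirichletCharacter.norm_LSeries_product_ge_one χ hx y
  have hs0 : 1 < ((1 : ℂ) + x).re := by simp [hx]
  have hs1 : 1 < ((1 : ℂ) + x + Complex.I * y).re := by simp [hx]
  have hs2 : 1 < ((1 : ℂ) + x + 2 * Complex.I * y).re := by simp [hx]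
  have e0 : ‖LSeries (fun n => (1 : DirichletCharacter ℂ q) (n : ZMod q)) (1 + x)‖ ≤
      26 * l / x := by
    refine (norm_LSeries_one_le hl hq hs0).trans ?_
    have h1 : ‖(1 : ℂ) + x - 1‖ = x := by simp [abs_of_pos hx]
    have h2 : ‖(1 : ℂ) + x‖ ≤ 2 := by
      rw [show (1 : ℂ) + x = ((1 + x : ℝ) : ℂ) by push_cast; rfl, Complex.norm_real,
        Real.norm_of_nonneg (by linarith)]
      linarith
    rw [h1]
    calc ‖(1 : ℂ) + x‖ / x + 12 * l * ‖(1 : ℂ) + x‖ ≤ 2 / x + 12 * l * 2 := by gcongr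
      _ ≤ 26 * l / x := by
        rw [div_add' _ _ _ hx.ne']; gcongr; nlinarith
  have hn2 : ‖(1 : ℂ) + x + 2 * Complex.I * y‖ ≤ 2 * (1 + |y|) := by
    have := norm_one_add_le x (2 * y)
    rw [abs_mul, abs_two, abs_of_pos hx] at this
    refine (le_of_eq ?_).trans (this.trans (by linarith))
    push_cast; ring_nf
  have e2 : ‖LSeries (fun n => (χ ^ 2) (n : ZMod q)) (1 + x + 2 * Complex.I * y)‖ ≤
      3 * 10 ^ 13 * τ ^ 6 := by
    by_cases h1 : χ ^ 2 = 1
    · have h' : 1 / (10 ^ 12 * l ^ 5) ≤ x ∨ 1 / (10 ^ 12 * l ^ 5) ≤ |y| := by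
        rcases h with h | h
        · exact absurd h1 h
        · exact h
      rw [h1]
      refine (norm_LSeries_one_le hl hq hs2).trans ?_
      have hη : 1 / (10 ^ 12 * l ^ 5) ≤ ‖(1 : ℂ) + x + 2 * Complex.I * y - 1‖ := by
        rcases h' with h' | h'
        · refine h'.trans ((le_abs_self x).trans (le_of_eq_of_le ?_ (Complex.abs_re_le_norm _)))
          simp
        · refine h'.trans (le_trans ?_ (Complex.abs_im_le_norm _))
          simp; linarith
      have hη0 : 0 < 1 / (10 ^ 12 * l ^ 5) := by positivity
      calc _ ≤ 2 * (1 + |y|) / (1 / (10 ^ 12 * l ^ 5)) + 12 * l * (2 * (1 + |y|)) := by gcongr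
        _ = 2 * 10 ^ 12 * (τ * l ^ 4) + 24 * τ := by
          rw [hτ]; field_simp; ring
        _ ≤ 2 * 10 ^ 12 * (τ * τ ^ 4) + 24 * τ := by gcongr
        _ ≤ 2 * 10 ^ 12 * τ ^ 6 + 24 * τ ^ 6 := by
          have a1 : τ * τ ^ 4 ≤ τ ^ 6 := by
            rw [← pow_succ']; exact pow_le_pow_right₀ hτ1 (by norm_num)
          have a2 : τ ≤ τ ^ 6 := le_self_pow₀ hτ1 (by norm_num)
          linarith
        _ ≤ _ := by have := pow_pos (lt_of_lt_of_le one_pos hτ1) 6; linarith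
    · rw [← DirichletCharacter.LFunction_eq_LSeries _ hs2]
      refine (norm_LFunction_le h1 hl hq ?_).trans ?_
      · have : 0 < 1 / (2 * l) := by positivity
        linarith
      · calc _ ≤ 6 * l * (2 * (1 + |y|)) := by gcongr
          _ = 12 * τ := by rw [hτ]; ring
          _ ≤ _ := by
            have a2 : τ ≤ τ ^ 6 := le_self_pow₀ hτ1 (by norm_num)
            linarith
  rw [← DirichletCharacter.LFunction_eq_LSeries χ hs1, norm_mul, norm_mul, norm_pow, norm_pow] at h341
  set A := ‖χ.LFunction (1 + x + Complex.I * y)‖ ^ 4 with hA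
  have hA0 : 0 ≤ A := by positivity
  have h3 : 1 ≤ (26 * l / x) ^ 3 * A * (3 * 10 ^ 13 * τ ^ 6) := by
    refine h341.le.trans ?_
    gcongr
  rw [div_le_iff₀ (by positivity)]
  have h4 : (26 * l / x) ^ 3 * A * (3 * 10 ^ 13 * τ ^ 6) ≤
      (26 * τ / x) ^ 3 * A * (3 * 10 ^ 13 * τ ^ 6) := by gcongr
  have h5 : (26 * τ / x) ^ 3 * A * (3 * 10 ^ 13 * τ ^ 6) =
      (17576 * 3 * 10 ^ 13) * τ ^ 9 * A / x ^ 3 := by field_simp; ring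
  have h6 := h3.trans (h4.trans h5.le)
  rw [le_div_iff₀ (by positivity)] at h6
  have : 0 ≤ τ ^ 9 * A := by positivity
  linarith

/-- Lower bound for `L(s, χ)` at the edge of the critical strip. -/
lemma LFunction_lower {q : ℕ} [NeZero q] {χ : DirichletCharacter ℂ q} (hχ : χ ≠ 1)
    (hp : χ.IsPrimitive) {l : ℝ} (hl : 1 ≤ l) (hG : Good l) (hq : (q : ℝ) ≤ Real.exp l) {σ y : ℝ}
    (hσ : 0 < σ) (hσ1 : σ ≤ 1) :
    1 / (10 ^ 26 * (l * (1 + |y|)) ^ 15) ≤ ‖χ.LFunction (1 + σ + Complex.I * y)‖ := by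
  have hl0 : 0 < l := by linarith
  have hy := abs_nonneg y
  set τ := l * (1 + |y|) with hτ
  have hlτ : l ≤ τ := by nlinarith
  have hτ1 : 1 ≤ τ := by linarith
  have hτ0 : 0 < τ := by linarith
  set x₀ := 1 / (10 ^ 28 * τ ^ 17) with hx₀
  have hx₀0 : 0 < x₀ := by positivity
  have hx₀1 : x₀ ≤ 1 := by
    rw [hx₀, div_le_one (by positivity)]
    have : 1 ≤ τ ^ 17 := one_le_pow₀ hτ1
    linarith
  have hτ15 : 1 / (10 ^ 26 * τ ^ 15) = 100 * τ ^ 2 * x₀ := by rw [hx₀]; field_simp; norm_num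
  have hconv : ∀ x : ℝ, x₀ ≤ x → x ≤ 1 →
      (χ ^ 2 ≠ 1 ∨ 1 / (10 ^ 12 * l ^ 5) ≤ x ∨ 1 / (10 ^ 12 * l ^ 5) ≤ |y|) →
      240 * τ ^ 2 * x₀ ≤ ‖χ.LFunction (1 + x + Complex.I * y)‖ := by
    intro x hx hx1 h
    have h1 := three_four_one (χ := χ) hl hq (hx₀0.trans_le hx) hx1 h
    refine le_of_pow_le_pow_left₀ (n := 4) (by norm_num) (norm_nonneg _) (le_trans ?_ h1)
    rw [le_div_iff₀ (by positivity)]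
    have : (240 * τ ^ 2 * x₀) ^ 4 * (10 ^ 18 * τ ^ 9) =
      (240 ^ 4 * 10 ^ 18) * (τ ^ 17 * x₀) * x₀ ^ 3 := by ring
    rw [← hτ, this]
    have h2 : τ ^ 17 * x₀ = 1 / 10 ^ 28 := by rw [hx₀]; field_simp
    rw [h2]
    calc (240 ^ 4 * 10 ^ 18 : ℝ) * (1 / 10 ^ 28) * x₀ ^ 3 ≤ 1 * x₀ ^ 3 := by gcongr; norm_num
      _ ≤ x ^ 3 := by rw [one_mul]; gcongr
  have hmv : ∀ a b u v : ℝ, 0 ≤ a → a ≤ 1 → 0 ≤ b → b ≤ 1 → |u| ≤ |y| → |v| ≤ |y| →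
      ‖χ.LFunction (1 + a + Complex.I * u) - χ.LFunction (1 + b + Complex.I * v)‖ ≤
        120 * τ ^ 2 * (|a - b| + |u - v|) := by
    intro a b u v ha ha1 hb hb1 hu hv
    have h4 : 0 < 1 / (4 * l) := by positivity
    refine (norm_LFunction_sub_le (M := 2 + |y|) hχ hl hq ?_ ?_ ?_ ?_).trans ?_
    · rw [show ((1 : ℂ) + a + Complex.I * u).re = 1 + a by simp]; linarith
    · rw [show ((1 : ℂ) + b + Complex.I * v).re = 1 + b by simp]; linarith
    · refine (norm_one_add_le _ _).trans ?_
      rw [abs_of_nonneg ha]; linarith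
    · refine (norm_one_add_le _ _).trans ?_
      rw [abs_of_nonneg hb]; linarith
    · have e : ‖(1 : ℂ) + a + Complex.I * u - (1 + b + Complex.I * v)‖ ≤ |a - b| + |u - v| := by
        have : (1 : ℂ) + a + Complex.I * u - (1 + b + Complex.I * v) =
          ((a - b : ℝ) : ℂ) + Complex.I * ((u - v : ℝ) : ℂ) := by push_cast; ring
        rw [this]
        refine (norm_add_le _ _).trans ?_
        rw [norm_mul, Complex.norm_I, one_mul, Complex.norm_real, Complex.norm_real,
          Real.norm_eq_abs, Real.norm_eq_abs]
      refine mul_le_mul ?_ e (norm_nonneg _) (by positivity)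
      rw [hτ, mul_pow]
      nlinarith [sq_nonneg l, mul_nonneg (sq_nonneg l) hy, mul_nonneg (sq_nonneg l) (sq_nonneg |y|)]
  rw [hτ15]
  have hpos : 0 < τ ^ 2 * x₀ := by positivity
  have hpert : ∀ z w : ℂ, ‖z‖ ≤ ‖w‖ + ‖w - z‖ := fun z w => by
    calc ‖z‖ = ‖w - (w - z)‖ := by ring_nf
      _ ≤ _ := norm_sub_le _ _
  by_cases hc : χ ^ 2 ≠ 1 ∨ 1 / (10 ^ 12 * l ^ 5) ≤ |y|
  · by_cases hσx : x₀ ≤ σ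
    · refine le_trans (by linarith) (hconv σ hσx hσ1 (hc.imp_right Or.inr))
    · have h1 := hconv x₀ le_rfl hx₀1 (hc.imp_right Or.inr)
      have h2 := hmv σ x₀ y y hσ.le hσ1 hx₀0.le hx₀1 le_rfl le_rfl
      rw [sub_self, abs_zero, add_zero] at h2
      have h3 : |σ - x₀| ≤ x₀ := by rw [abs_le]; constructor <;> linarith
      have h4 := hpert (χ.LFunction (1 + x₀ + Complex.I * y)) (χ.LFunction (1 + σ + Complex.I * y))
      have h5 : 120 * τ ^ 2 * |σ - x₀| ≤ 120 * τ ^ 2 * x₀ := by gcongr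
      linarith
  · push Not at hc
    obtain ⟨hc1, hc2⟩ := hc
    set η := 1 / (10 ^ 12 * l ^ 5) with hη
    have hη0 : 0 < η := by positivity
    by_cases hση : η ≤ σ
    · refine le_trans (by linarith) (hconv σ (le_trans ?_ hση) hσ1 (Or.inr (Or.inl hση)))
      apply one_div_le_one_div_of_le (by positivity)
      have : l ^ 5 ≤ τ ^ 17 := (pow_le_pow_left₀ hl0.le hlτ 5).trans
        (pow_le_pow_right₀ hτ1 (by norm_num))
      have : 0 < τ ^ 17 := by positivity
      linarith
    · push Not at hση
      have h1 := hG q χ hq hp hχ hc1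
      have hη1 : η ≤ 1 := by
        rw [hη, div_le_one (by positivity)]
        have : 1 ≤ l ^ 5 := one_le_pow₀ hl
        linarith
      have h2 := hmv σ 0 y 0 hσ.le hσ1 le_rfl zero_le_one le_rfl (by simp)
      simp only [sub_zero, Complex.ofReal_zero, add_zero, mul_zero, abs_of_pos hσ] at h2
      have h4 := hpert (χ.LFunction 1) (χ.LFunction (1 + σ + Complex.I * y))
      have hτ2 : τ ≤ 2 * l := by rw [hτ]; nlinarith
      have h5 : 120 * τ ^ 2 * (σ + |y|) ≤ 120 * (2 * l) ^ 2 * (η + η) := by gcongr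
      have h6 : 120 * (2 * l) ^ 2 * (η + η) = 960 / 10 ^ 12 * (1 / l ^ 3) := by
        rw [hη]; field_simp; norm_num
      have h7 : 1 / (10 ^ 8 * l ^ 3) = 1 / 10 ^ 8 * (1 / l ^ 3) := by field_simp
      have h8 : 100 * τ ^ 2 * x₀ ≤ 1 / 10 ^ 26 * (1 / l ^ 3) := by
        rw [← hτ15, one_div_mul_one_div]
        apply one_div_le_one_div_of_le (by positivity)
        have : l ^ 3 ≤ τ ^ 15 := (pow_le_pow_left₀ hl0.le hlτ 3).trans
          (pow_le_pow_right₀ hτ1 (by norm_num))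
        gcongr
      have h9 : 0 < 1 / l ^ 3 := by positivity
      rw [norm_sub_rev] at h2
      rw [norm_sub_rev] at h4
      linarith

/-- The logarithmic derivative of `L(s, χ)`. -/
noncomputable def logD {q : ℕ} [NeZero q] (χ : DirichletCharacter ℂ q) (z : ℂ) : ℂ :=
  deriv χ.LFunction z / χ.LFunction z

lemma norm_iteratedDeriv_logD_le {q : ℕ} [NeZero q] {χ : DirichletCharacter ℂ q} (hχ : χ ≠ 1)
    (hp : χ.IsPrimitive) {l : ℝ} (hl : 1 ≤ l) (hG : Good l) (hq : (q : ℝ) ≤ Real.exp l) {σ y : ℝ}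
    (hσ : 0 < σ) (hσ1 : σ ≤ 1) (i : ℕ) :
    ‖iteratedDeriv i (logD χ) (1 + σ + Complex.I * y)‖ ≤
      i.factorial * (10 ^ 30 * (l * (1 + |y|)) ^ 17) ^ (i + 2) := by
  have hl0 : 0 < l := by linarith
  have hy := abs_nonneg y
  have hlow := LFunction_lower hχ hp hl hG hq hσ hσ1 (y := y)
  set τ := l * (1 + |y|) with hτ
  have hlτ : l ≤ τ := by nlinarith
  have hτ1 : 1 ≤ τ := by linarith
  have hτ0 : 0 < τ := by linarith
  set s : ℂ := 1 + σ + Complex.I * y with hs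
  set ρ := 1 / (10 ^ 30 * τ ^ 17) with hρ
  have hρ0 : 0 < ρ := by positivity
  have hτ17 : 1 ≤ τ ^ 17 := one_le_pow₀ hτ1
  have hρ4 : ρ ≤ 1 / (4 * l) := by
    apply one_div_le_one_div_of_le (by positivity)
    have : τ ≤ τ ^ 17 := le_self_pow₀ hτ1 (by norm_num)
    linarith
  have hρ1 : ρ ≤ 1 := by
    refine hρ4.trans ?_
    rw [div_le_one (by positivity)]; linarith
  have hre : s.re = 1 + σ := by simp [hs]
  have hns : ‖s‖ ≤ 2 + |y| := by
    have := norm_one_add_le σ y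
    rw [abs_of_pos hσ] at this
    linarith
  have hball : ∀ z ∈ Metric.closedBall s ρ, 1 - 1 / (4 * l) ≤ z.re ∧ ‖z‖ ≤ 3 + |y| := by
    intro z hz
    rw [mem_closedBall_iff_norm] at hz
    constructor
    · have h1 := (Complex.abs_re_le_norm _).trans hz
      rw [Complex.sub_re, hre, abs_le] at h1
      linarith [h1.1]
    · have : ‖z‖ ≤ ‖s‖ + ‖z - s‖ := by
        calc ‖z‖ = ‖s + (z - s)‖ := by ring_nf
          _ ≤ _ := norm_add_le _ _
      linarith
  have hl2 : 24 * l ^ 2 * (3 + |y| + 1) ≤ 120 * τ ^ 2 := by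
    rw [hτ, mul_pow]
    nlinarith [sq_nonneg l, mul_nonneg (sq_nonneg l) hy, mul_nonneg (sq_nonneg l) (sq_nonneg |y|)]
  have hlowball : ∀ z ∈ Metric.closedBall s ρ, ρ ≤ ‖χ.LFunction z‖ := by
    intro z hz
    have h1 := norm_LFunction_sub_le (M := 3 + |y|) hχ hl hq (z := s) (w := z)
      (by rw [hre]; have : 0 < 1 / (4 * l) := by positivity
          linarith) (hball z hz).1 (by linarith) (hball z hz).2
    rw [mem_closedBall_iff_norm, norm_sub_rev] at hz
    have h2 : 24 * l ^ 2 * (3 + |y| + 1) * ‖s - z‖ ≤ 120 * τ ^ 2 * ρ := by gcongr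
    have h3 : ‖χ.LFunction s‖ ≤ ‖χ.LFunction z‖ + ‖χ.LFunction s - χ.LFunction z‖ := by
      calc ‖χ.LFunction s‖ = ‖χ.LFunction z + (χ.LFunction s - χ.LFunction z)‖ := by ring_nf
        _ ≤ _ := norm_add_le _ _
    have h4 : 1 / (10 ^ 26 * τ ^ 15) = 10 ^ 4 * (τ ^ 2 * ρ) := by
      rw [hρ]; field_simp
    have h5 : ρ ≤ τ ^ 2 * ρ := le_mul_of_one_le_left hρ0.le (one_le_pow₀ hτ1)
    rw [h4] at hlow
    linarith
  have hder : ∀ z ∈ Metric.closedBall s ρ, ‖deriv χ.LFunction z‖ ≤ 1 / ρ := by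
    intro z hz
    refine (norm_deriv_LFunction_le hχ hl hq (hball z hz).1).trans ?_
    have h1 : 24 * l ^ 2 * (‖z‖ + 1) ≤ 24 * l ^ 2 * (3 + |y| + 1) := by
      have := (hball z hz).2
      gcongr
    have h2 : τ ^ 2 ≤ τ ^ 17 := pow_le_pow_right₀ hτ1 (by norm_num)
    have h3 : 1 / ρ = 10 ^ 30 * τ ^ 17 := by rw [hρ, one_div_one_div]
    rw [h3]
    linarith
  have hdiff : DiffContOnCl ℂ (logD χ) (Metric.ball s ρ) := by
    refine DifferentiableOn.diffContOnCl fun z hz => DifferentiableAt.differentiableWithinAt ?_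
    have hz' := Metric.closure_ball_subset_closedBall hz
    have hL := DirichletCharacter.differentiable_LFunction hχ
    refine DifferentiableAt.div ?_ (hL z) ?_
    · exact (hL.differentiableOn.deriv isOpen_univ (s := Set.univ)).differentiableAt univ_mem
    · intro h0
      have := hlowball z hz'
      rw [h0, norm_zero] at this
      linarith
  refine (Complex.norm_iteratedDeriv_le_of_forall_mem_sphere_norm_le i hρ0 hdiff
    (C := (1 / ρ) ^ 2) ?_).trans (le_of_eq ?_)
  · intro z hz
    have hz' := Metric.sphere_subset_closedBall hz
    rw [logD, norm_div, sq, div_eq_mul_one_div]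
    exact mul_le_mul (hder z hz') (one_div_le_one_div_of_le hρ0 (hlowball z hz')) (by positivity)
      (by positivity)
  · rw [hρ, one_div_one_div]
    rw [pow_add _ i 2, one_div_pow]
    field_simp

open FourierTransform in
/-- Fourier representation of smooth compactly supported functions. -/
lemma exists_kernel {φ : ℝ → ℂ} (hc : HasCompactSupport φ) (hs : ContDiff ℝ (⊤ : ℕ∞) φ) :
    ∃ K : ℝ → ℂ, Continuous K ∧
      (∀ m : ℕ, MeasureTheory.Integrable (fun t => (1 + |t|) ^ m * ‖K t‖)) ∧
      ∀ u, φ u = ∫ t, K t * Complex.exp ((2 * Real.pi * t * u : ℝ) * Complex.I) := by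
  set f : SchwartzMap ℝ ℂ := hc.toSchwartzMap hs with hf
  have hfφ : ∀ u, f u = φ u := fun u => rfl
  refine ⟨⇑(𝓕 f : SchwartzMap ℝ ℂ), (𝓕 f).continuous, fun m => ?_, fun u => ?_⟩
  · simp_rw [add_pow, Finset.sum_mul, one_pow, one_mul]
    refine MeasureTheory.integrable_finsetSum _ fun i _ => ?_
    have := ((𝓕 f).integrable_pow_mul MeasureTheory.volume (m - i)).const_mul (m.choose i : ℝ)
    refine this.congr (Eventually.of_forall fun t => ?_)
    simp only [Real.norm_eq_abs]
    ring
  · have h1 : (𝓕⁻ (𝓕 f) : SchwartzMap ℝ ℂ) = f := FourierTransform.fourierInv_fourier_eq f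
    have h2 : (𝓕⁻ (𝓕 f) : SchwartzMap ℝ ℂ) u = φ u := by rw [h1, hfφ]
    rw [SchwartzMap.fourierInv_coe, Real.fourierInv_eq'] at h2
    rw [← h2]
    congr 1
    ext t
    rw [smul_eq_mul, mul_comm]
    congr 2
    simp only [RCLike.inner_apply, conj_trivial]
    push_cast
    ring

lemma logMul_iterate (f : ℕ → ℂ) (i n : ℕ) :
    LSeries.logMul^[i] f n = Complex.log n ^ i * f n := by
  induction i with
  | zero => simp
  | succ i ih => rw [Function.iterate_succ_apply', LSeries.logMul, ih, pow_succ]; ring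

/-- The twisted von Mangoldt function. -/
noncomputable def twist {q : ℕ} (χ : DirichletCharacter ℂ q) : ℕ → ℂ :=
  (fun n : ℕ => χ (n : ZMod q)) * fun n => (ArithmeticFunction.vonMangoldt n : ℂ)

lemma abscissa_twist_le {q : ℕ} (χ : DirichletCharacter ℂ q) :
    LSeries.abscissaOfAbsConv (twist χ) ≤ 1 := by
  have := LSeries.abscissaOfAbsConv_le_of_forall_lt_LSeriesSummable (f := twist χ) (x := 1)
    (fun y hy => χ.LSeriesSummable_twist_vonMangoldt (by simpa using hy))
  simpa using this

lemma LSeries_logMul_twist {q : ℕ} [NeZero q] (χ : DirichletCharacter ℂ q) (i : ℕ) {s : ℂ}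
    (hs : 1 < s.re) :
    ‖LSeries (LSeries.logMul^[i] (twist χ)) s‖ = ‖iteratedDeriv i (logD χ) s‖ := by
  have h1 := LSeries_iteratedDeriv (f := twist χ) i (s := s)
    ((abscissa_twist_le χ).trans_lt (by exact_mod_cast hs))
  have h2 : LSeries (twist χ) =ᶠ[nhds s] fun z => -logD χ z := by
    have hopen : IsOpen {z : ℂ | 1 < z.re} := isOpen_lt continuous_const Complex.continuous_re
    filter_upwards [hopen.mem_nhds hs] with z hz
    have hz : 1 < z.re := hz
    rw [twist, DirichletCharacter.LSeries_twist_vonMangoldt_eq χ hz, logD,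
      DirichletCharacter.deriv_LFunction_eq_deriv_LSeries χ hz,
      DirichletCharacter.LFunction_eq_LSeries χ hz, neg_div]
  rw [h2.iteratedDeriv_eq] at h1
  have h3 : iteratedDeriv i (fun z => -logD χ z) s = - iteratedDeriv i (logD χ) s := by
    simp
  rw [h3] at h1
  have h4 := congrArg norm h1
  rw [norm_neg, norm_mul, norm_pow, norm_neg, norm_one, one_pow, one_mul] at h4
  exact h4.symm

lemma smooth_sum_bound_pos (i : ℕ) {φ : ℝ → ℂ} (hc : HasCompactSupport φ)
    (hs : ContDiff ℝ (⊤ : ℕ∞) φ) :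
    ∃ C : ℝ, 0 ≤ C ∧ ∀ (q : ℕ) [NeZero q] (χ : DirichletCharacter ℂ q) (l : ℝ), 1 ≤ l → Good l →
      (q : ℝ) ≤ Real.exp l → χ ≠ 1 → χ.IsPrimitive → ∀ x : ℝ, 0 < x → ∀ σ : ℝ, 0 < σ → σ ≤ 1 →
      ∀ N : ℕ, (∀ n : ℕ, N ≤ n → φ (Real.log (n / x)) = 0) →
      ‖∑ n ∈ Finset.range N, LSeries.term (LSeries.logMul^[i] (twist χ)) (1 + σ) n *
        φ (Real.log (n / x))‖ ≤ C * l ^ (17 * (i + 2)) := by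
  obtain ⟨K, hKc, hKi, hK⟩ := exists_kernel hc hs
  refine ⟨i.factorial * (10 ^ 30 * 7 ^ 17) ^ (i + 2) * ∫ t, (1 + |t|) ^ (17 * (i + 2)) * ‖K t‖,
    mul_nonneg (by positivity) (MeasureTheory.integral_nonneg fun t => by positivity), ?_⟩
  intro q _ χ l hl hG hq hχ hp x hx σ hσ hσ1 N hN
  have hKint : MeasureTheory.Integrable K := by
    have := hKi 0
    simp only [pow_zero, one_mul] at this
    exact (MeasureTheory.integrable_norm_iff hKc.aestronglyMeasurable).1 this
  set g := LSeries.logMul^[i] (twist χ) with hg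
  set a : ℕ → ℂ := fun n => LSeries.term g (1 + σ) n with ha
  have hre : ∀ y : ℝ, 1 < ((1 : ℂ) + σ + Complex.I * y).re := by intro y; simp [hσ]
  have hasum : Summable a := by
    refine LSeriesSummable_of_abscissaOfAbsConv_lt_re ?_
    rw [hg, LSeries.absicssaOfAbsConv_logPowMul]
    refine (abscissa_twist_le χ).trans_lt ?_
    have : (1 : ℝ) < (1 + (σ : ℂ)).re := by simp [hσ]
    exact_mod_cast this
  set F : ℕ → ℝ → ℂ := fun n t =>
    a n * (K t * Complex.exp ((2 * Real.pi * t * Real.log (n / x) : ℝ) * Complex.I)) with hF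
  have hFnorm : ∀ n t, ‖F n t‖ = ‖a n‖ * ‖K t‖ := by
    intro n t
    simp only [hF]
    rw [norm_mul, norm_mul, Complex.norm_exp_ofReal_mul_I, mul_one]
  have hFint : ∀ n, MeasureTheory.Integrable (F n) := by
    intro n
    refine MeasureTheory.Integrable.const_mul ?_ _
    refine hKint.mul_bdd (c := 1) ?_ (Eventually.of_forall fun t => ?_)
    · exact Continuous.aestronglyMeasurable (by fun_prop)
    · rw [Complex.norm_exp_ofReal_mul_I]
  have hswap := MeasureTheory.integral_tsum_of_summable_integral_norm hFint (by
    simp_rw [hFnorm, MeasureTheory.integral_const_mul]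
    exact (hasum.norm).mul_right _)
  have hLHS : ∑' n, ∫ t, F n t = ∑ n ∈ Finset.range N, a n * φ (Real.log (n / x)) := by
    have : ∀ n, ∫ t, F n t = a n * φ (Real.log (n / x)) := by
      intro n
      simp only [hF]
      rw [MeasureTheory.integral_const_mul, ← hK]
    simp_rw [this]
    refine tsum_eq_sum fun n hn => ?_
    rw [hN n (by simpa using hn), mul_zero]
  have hRHS : ∀ t, ∑' n, F n t = K t * Complex.exp ((-(2 * Real.pi * t * Real.log x) : ℝ) * Complex.I)
      * LSeries g (1 + σ + Complex.I * (-(2 * Real.pi * t) : ℝ)) := by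
    intro t
    rw [LSeries, ← tsum_mul_left]
    congr 1
    ext n
    simp only [hF, ha]
    rcases Nat.eq_zero_or_pos n with rfl | hn
    · simp
    · have hn0 : (n : ℂ) ≠ 0 := by exact_mod_cast hn.ne'
      have hn1 : (0 : ℝ) < n := by exact_mod_cast hn
      have e2 : (n : ℂ) ^ ((1 : ℂ) + σ + Complex.I * (-(2 * Real.pi * t) : ℝ)) =
          (n : ℂ) ^ ((1 : ℂ) + σ) * (n : ℂ) ^ (Complex.I * (-(2 * Real.pi * t) : ℝ)) :=
        Complex.cpow_add _ _ hn0
      rw [LSeries.term_of_ne_zero hn.ne', LSeries.term_of_ne_zero hn.ne', e2,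
        Real.log_div hn1.ne' hx.ne']
      have e : (n : ℂ) ^ (Complex.I * (-(2 * Real.pi * t) : ℝ)) =
          Complex.exp ((-(2 * Real.pi * t * Real.log n) : ℝ) * Complex.I) := by
        rw [Complex.cpow_def_of_ne_zero hn0, ← Complex.ofReal_natCast, ← Complex.ofReal_log hn1.le]
        congr 1; push_cast; ring
      rw [e, show ((2 * Real.pi * t * (Real.log n - Real.log x) : ℝ) : ℂ) * Complex.I =
        (-(2 * Real.pi * t * Real.log x) : ℝ) * Complex.I -
          (-(2 * Real.pi * t * Real.log n) : ℝ) * Complex.I by push_cast; ring, Complex.exp_sub]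
      field_simp
  rw [hLHS] at hswap
  rw [hswap]
  simp_rw [hRHS]
  have hbd : ∀ t, ‖K t * Complex.exp ((-(2 * Real.pi * t * Real.log x) : ℝ) * Complex.I)
      * LSeries g (1 + σ + Complex.I * (-(2 * Real.pi * t) : ℝ))‖ ≤
      (i.factorial * (10 ^ 30 * 7 ^ 17) ^ (i + 2) * l ^ (17 * (i + 2))) *
        ((1 + |t|) ^ (17 * (i + 2)) * ‖K t‖) := by
    intro t
    rw [norm_mul, norm_mul, Complex.norm_exp_ofReal_mul_I, mul_one, hg, LSeries_logMul_twist χ i (hre _)]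
    have h1 := norm_iteratedDeriv_logD_le hχ hp hl hG hq hσ hσ1 i (y := -(2 * Real.pi * t))
    have h2 : l * (1 + |-(2 * Real.pi * t)|) ≤ 7 * l * (1 + |t|) := by
      rw [abs_neg, abs_mul, abs_of_pos (by positivity : 0 < 2 * Real.pi)]
      have := Real.pi_lt_d2
      have h3 : 2 * Real.pi * |t| ≤ 7 * |t| := by
        apply mul_le_mul_of_nonneg_right _ (abs_nonneg t); linarith
      nlinarith
    calc _ ≤ ‖K t‖ * (i.factorial * (10 ^ 30 * (l * (1 + |-(2 * Real.pi * t)|)) ^ 17) ^ (i + 2)) := by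
          gcongr
      _ ≤ ‖K t‖ * (i.factorial * (10 ^ 30 * (7 * l * (1 + |t|)) ^ 17) ^ (i + 2)) := by
          gcongr
      _ = _ := by
          simp only [mul_pow, pow_mul]
          ring
  refine (MeasureTheory.norm_integral_le_of_norm_le ((hKi (17 * (i + 2))).const_mul _)
    (Eventually.of_forall hbd)).trans (le_of_eq ?_)
  rw [MeasureTheory.integral_const_mul]
  ring

lemma smooth_sum_bound (i : ℕ) {φ : ℝ → ℂ} (hc : HasCompactSupport φ)
    (hs : ContDiff ℝ (⊤ : ℕ∞) φ) :
    ∃ C : ℝ, 0 ≤ C ∧ ∀ (q : ℕ) [NeZero q] (χ : DirichletCharacter ℂ q) (l : ℝ), 1 ≤ l → Good l →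
      (q : ℝ) ≤ Real.exp l → χ ≠ 1 → χ.IsPrimitive → ∀ x : ℝ, 0 < x →
      ∀ N : ℕ, (∀ n : ℕ, N ≤ n → φ (Real.log (n / x)) = 0) →
      ‖∑ n ∈ Finset.range N, (Real.log n : ℂ) ^ i * twist χ n / n *
        φ (Real.log (n / x))‖ ≤ C * l ^ (17 * (i + 2)) := by
  obtain ⟨C, hC, h⟩ := smooth_sum_bound_pos i hc hs
  refine ⟨C, hC, ?_⟩
  intro q _ χ l hl hG hq hχ hp x hx N hN
  have hlim : Tendsto (fun σ : ℝ => ‖∑ n ∈ Finset.range N,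
      LSeries.term (LSeries.logMul^[i] (twist χ)) (1 + σ) n * φ (Real.log (n / x))‖)
      (nhdsWithin 0 (Set.Ioi 0)) (nhds ‖∑ n ∈ Finset.range N, (Real.log n : ℂ) ^ i * twist χ n / n *
        φ (Real.log (n / x))‖) := by
    refine tendsto_nhdsWithin_of_tendsto_nhds ?_
    refine Tendsto.norm (tendsto_finsetSum _ fun n _ => Tendsto.mul_const _ ?_)
    rcases Nat.eq_zero_or_pos n with rfl | hn
    · simp [twist]
    · have hn0 : (n : ℂ) ≠ 0 := by exact_mod_cast hn.ne'
      have hc : Continuous fun σ : ℝ => LSeries.term (LSeries.logMul^[i] (twist χ)) (1 + σ) n := by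
        simp_rw [LSeries.term_of_ne_zero hn.ne', logMul_iterate]
        refine Continuous.div continuous_const ?_ ?_
        · exact Continuous.const_cpow (by fun_prop) (Or.inl hn0)
        · intro σ; simp [Complex.cpow_eq_zero_iff, hn0]
      have := hc.tendsto 0
      have e : LSeries.term (LSeries.logMul^[i] (twist χ)) (1 + ((0 : ℝ) : ℂ)) n =
          (Real.log n : ℂ) ^ i * twist χ n / n := by
        rw [LSeries.term_of_ne_zero hn.ne', logMul_iterate, Complex.ofReal_zero, add_zero,
          Complex.cpow_one, Complex.natCast_log]
      rwa [e] at this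
  refine le_of_tendsto hlim ?_
  have : Set.Ioc (0 : ℝ) 1 ∈ nhdsWithin (0 : ℝ) (Set.Ioi 0) := Ioc_mem_nhdsGT one_pos
  filter_upwards [this] with σ hσ
  exact h q χ l hl hG hq hχ hp x hx σ hσ.1 hσ.2 N hN

/-- A fixed smooth cutoff, equal to `1` on `[-1, 1]` and supported in `[-2, 2]`. -/
noncomputable def bump : ContDiffBump (0 : ℝ) := ⟨1, 2, one_pos, one_lt_two⟩

/-- Smooth weight localising `n` to the multiplicative neighbourhood `[e⁻²x, e²x]` of `x`. -/
noncomputable def wt (x : ℝ) (n : ℕ) : ℝ := bump (Real.log (n / x))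

lemma wt_nonneg (x : ℝ) (n : ℕ) : 0 ≤ wt x n := bump.nonneg

lemma wt_le_one (x : ℝ) (n : ℕ) : wt x n ≤ 1 := bump.le_one

lemma bump_eq_zero {u : ℝ} (h : 2 ≤ |u|) : bump u = 0 :=
  bump.zero_of_le_dist (by simpa [bump, Real.dist_eq] using h)

lemma bump_eq_one {u : ℝ} (h : |u| ≤ 1) : bump u = 1 :=
  bump.one_of_mem_closedBall (by simpa [bump, Real.dist_eq] using h)

/-- Length of the summation range on which `wt x` is supported. -/
noncomputable def cut (x : ℝ) : ℕ := ⌊Real.exp 2 * x⌋₊ + 1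

lemma two_le_log_of_cut_le {x : ℝ} (hx : 0 < x) {n : ℕ} (hn : cut x ≤ n) :
    2 ≤ Real.log (n / x) := by
  have h1 : Real.exp 2 * x < n := (Nat.lt_floor_add_one _).trans_le (by
    have : ((cut x : ℕ) : ℝ) ≤ n := by exact_mod_cast hn
    simpa [cut] using this)
  have h2 : Real.exp 2 ≤ n / x := by rw [le_div_iff₀ hx]; exact h1.le
  rw [Real.le_log_iff_exp_le (lt_of_lt_of_le (Real.exp_pos _) h2)]
  exact h2

lemma wt_eq_zero_of_cut_le {x : ℝ} (hx : 0 < x) {n : ℕ} (hn : cut x ≤ n) : wt x n = 0 :=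
  bump_eq_zero ((two_le_log_of_cut_le hx hn).trans (le_abs_self _))

/-- Smoothed sum of the twisted von Mangoldt function. -/
noncomputable def psiW {q : ℕ} (x : ℝ) (χ : DirichletCharacter ℂ q) : ℂ :=
  ∑ n ∈ Finset.range (cut x), twist χ n * (wt x n : ℂ)

lemma siegel_walfisz (j : ℕ) : ∃ C : ℝ, 0 ≤ C ∧ ∀ (q : ℕ) [NeZero q] (χ : DirichletCharacter ℂ q)
    (l : ℝ), 1 ≤ l → Good l → (q : ℝ) ≤ Real.exp l → χ ≠ 1 → χ.IsPrimitive → ∀ x : ℝ, 1 ≤ x →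
    ‖psiW x χ‖ * Real.log x ^ j ≤ C * x * l ^ (17 * (j + 2)) := by
  set φ : ℕ → ℝ → ℂ := fun m u => (((-u) ^ m * bump u * Real.exp u : ℝ) : ℂ) with hφ
  have hsm : ∀ m, ContDiff ℝ (⊤ : ℕ∞) (φ m) := by
    intro m
    refine Complex.ofRealCLM.contDiff.comp ?_
    refine ((contDiff_neg.pow m).mul bump.contDiff).mul Real.contDiff_exp
  have hcs : ∀ m, HasCompactSupport (φ m) := by
    intro m
    refine HasCompactSupport.comp_left (g := fun t : ℝ => (t : ℂ)) ?_ (by simp)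
    exact (bump.hasCompactSupport.mul_left).mul_right
  choose C hC h using fun p : ℕ × ℕ => smooth_sum_bound p.1 (hcs p.2) (hsm p.2)
  refine ⟨∑ i ∈ Finset.range (j + 1), C (i, j - i) * (j.choose i : ℝ),
    Finset.sum_nonneg fun i _ => mul_nonneg (hC _) (by positivity), ?_⟩
  intro q _ χ l hl hG hq hχ hp x hx
  have hx0 : 0 < x := by linarith
  have key : psiW x χ * ((Real.log x ^ j : ℝ) : ℂ) =
      ∑ i ∈ Finset.range (j + 1), (j.choose i : ℂ) * x * ∑ n ∈ Finset.range (cut x),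
        (Real.log n : ℂ) ^ i * twist χ n / n * φ (j - i) (Real.log (n / x)) := by
    simp_rw [Finset.mul_sum]
    rw [Finset.sum_comm, psiW, Finset.sum_mul]
    refine Finset.sum_congr rfl fun n _ => ?_
    rcases Nat.eq_zero_or_pos n with rfl | hn
    · simp [twist]
    have hn1 : (0 : ℝ) < n := by exact_mod_cast hn
    have hn0 : (n : ℂ) ≠ 0 := by exact_mod_cast hn.ne'
    have hxc : (x : ℂ) ≠ 0 := by exact_mod_cast hx0.ne'
    have e1 : Real.log x = Real.log n + (-Real.log (n / x)) := by
      rw [Real.log_div hn1.ne' hx0.ne']; ring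
    have e2 : Real.exp (Real.log (n / x)) = n / x := Real.exp_log (by positivity)
    rw [e1, add_pow]
    simp only [hφ, e2]
    rw [wt]
    push_cast
    rw [Finset.mul_sum]
    refine Finset.sum_congr rfl fun i _ => ?_
    field_simp
  have hb : ∀ i ∈ Finset.range (j + 1), ‖(j.choose i : ℂ) * x * ∑ n ∈ Finset.range (cut x),
        (Real.log n : ℂ) ^ i * twist χ n / n * φ (j - i) (Real.log (n / x))‖ ≤
      C (i, j - i) * (j.choose i : ℝ) * (x * l ^ (17 * (j + 2))) := by
    intro i hi
    rw [Finset.mem_range] at hi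
    rw [norm_mul, norm_mul, Complex.norm_natCast, Complex.norm_real, Real.norm_of_nonneg hx0.le]
    have := h (i, j - i) q χ l hl hG hq hχ hp x hx0 (cut x) (fun n hn => by
      have := wt_eq_zero_of_cut_le hx0 hn
      rw [wt] at this
      simp [hφ, this])
    calc _ ≤ (j.choose i : ℝ) * x * (C (i, j - i) * l ^ (17 * (i + 2))) := by
          gcongr
      _ ≤ (j.choose i : ℝ) * x * (C (i, j - i) * l ^ (17 * (j + 2))) := by
          have := hC (i, j - i)
          gcongr
          omega
      _ = _ := by ring
  have hlog : 0 ≤ Real.log x := Real.log_nonneg hx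
  have e : ‖psiW x χ‖ * Real.log x ^ j = ‖psiW x χ * ((Real.log x ^ j : ℝ) : ℂ)‖ := by
    rw [norm_mul, Complex.norm_real, Real.norm_of_nonneg (by positivity)]
  rw [e, key]
  refine (norm_sum_le _ _).trans ((Finset.sum_le_sum hb).trans (le_of_eq ?_))
  rw [← Finset.sum_mul]; ring

/-- Abel summation bound: bounded partial sums against a sequence of bounded variation. -/
lemma norm_sum_mul_le_of_variation {g : ℕ → ℂ} {E : ℝ} (hg : ∀ N, ‖∑ n ∈ Finset.range N, g n‖ ≤ E)
    (u : ℕ → ℝ) (N : ℕ) :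
    ‖∑ n ∈ Finset.range N, g n * (u n : ℂ)‖ ≤
      E * (|u N| + ∑ n ∈ Finset.range N, |u (n + 1) - u n|) := by
  have h : ∀ N, ∑ n ∈ Finset.range N, g n * (u n : ℂ) = (∑ n ∈ Finset.range N, g n) * u N -
      ∑ n ∈ Finset.range N, (∑ i ∈ Finset.range (n + 1), g i) * ((u (n + 1) - u n : ℝ) : ℂ) := by
    intro N
    induction N with
    | zero => simp
    | succ N ih =>
      rw [Finset.sum_range_succ, ih]
      simp only [Finset.sum_range_succ _ N]
      push_cast
      ring
  rw [h]
  refine (norm_sub_le _ _).trans ?_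
  rw [mul_add, Finset.mul_sum]
  refine add_le_add ?_ ((norm_sum_le _ _).trans (Finset.sum_le_sum fun n _ => ?_))
  · rw [norm_mul, Complex.norm_real, Real.norm_eq_abs]
    exact mul_le_mul_of_nonneg_right (hg N) (abs_nonneg _)
  · rw [norm_mul, Complex.norm_real, Real.norm_eq_abs]
    exact mul_le_mul_of_nonneg_right (hg _) (abs_nonneg _)

lemma norm_sum_mul_le_of_antitone {g : ℕ → ℂ} {E : ℝ} (hg : ∀ N, ‖∑ n ∈ Finset.range N, g n‖ ≤ E)
    {u : ℕ → ℝ} (hu : Antitone u) (h0 : ∀ n, 0 ≤ u n) (N : ℕ) :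
    ‖∑ n ∈ Finset.range N, g n * (u n : ℂ)‖ ≤ E * u 0 := by
  refine (norm_sum_mul_le_of_variation hg u N).trans (le_of_eq ?_)
  have : ∀ n ∈ Finset.range N, |u (n + 1) - u n| = u n - u (n + 1) := fun n _ => by
    rw [abs_sub_comm, abs_of_nonneg]; linarith [hu (Nat.le_succ n)]
  rw [Finset.sum_congr rfl this, Finset.sum_range_sub', abs_of_nonneg (h0 N)]
  ring

/-- A weighted large sieve inequality for almost orthogonal functions. -/
lemma weighted_large_sieve {ι : Type*} (s : Finset ι) (f : ι → ℕ → ℂ) (hf : ∀ i n, ‖f i n‖ ≤ 1)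
    {E : ℝ} (hE0 : 0 ≤ E) (hE : ∀ i ∈ s, ∀ j ∈ s, i ≠ j → ∀ N, ‖∑ n ∈ Finset.range N,
      f i n * starRingEnd ℂ (f j n)‖ ≤ E) {v : ℕ → ℝ} (hv : Antitone v) (hv0 : ∀ n, 0 < v n)
    (a : ℕ → ℂ) (N : ℕ) :
    ∑ i ∈ s, ‖∑ n ∈ Finset.range N, a n * f i n‖ ^ 2 ≤
      (∑ n ∈ Finset.range N, v n + s.card * (E * v 0)) *
        ∑ n ∈ Finset.range N, ‖a n‖ ^ 2 / v n := by
  set S : ι → ℂ := fun i => ∑ n ∈ Finset.range N, a n * f i n with hS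
  set T : ℝ := ∑ i ∈ s, ‖S i‖ ^ 2 with hT
  set A : ℝ := ∑ n ∈ Finset.range N, ‖a n‖ ^ 2 / v n with hA
  set V : ℝ := ∑ n ∈ Finset.range N, v n with hV
  set G : ℕ → ℂ := fun n => ∑ i ∈ s, starRingEnd ℂ (S i) * f i n with hG
  have hV0 : 0 ≤ V := Finset.sum_nonneg fun n _ => (hv0 n).le
  have hT0 : 0 ≤ T := Finset.sum_nonneg fun n _ => by positivity
  have hA0 : 0 ≤ A := Finset.sum_nonneg fun n _ => by have := hv0 n; positivity
  have h1 : T ≤ ∑ n ∈ Finset.range N, ‖a n‖ * ‖G n‖ := by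
    have e : (T : ℂ) = ∑ n ∈ Finset.range N, a n * G n := by
      simp only [hT, hG, Finset.mul_sum]
      rw [Finset.sum_comm]
      push_cast
      refine Finset.sum_congr rfl fun i _ => ?_
      rw [← Complex.conj_mul']
      conv_lhs => rw [hS]
      rw [Finset.mul_sum]
      exact Finset.sum_congr rfl fun n _ => by ring
    have : T = ‖(T : ℂ)‖ := by rw [Complex.norm_real, Real.norm_of_nonneg hT0]
    rw [this, e]
    refine (norm_sum_le _ _).trans (Finset.sum_le_sum fun n _ => ?_)
    rw [norm_mul]
  have h2 : (∑ n ∈ Finset.range N, ‖a n‖ * ‖G n‖) ^ 2 ≤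
      A * ∑ n ∈ Finset.range N, v n * ‖G n‖ ^ 2 := by
    refine Finset.sum_sq_le_sum_mul_sum_of_sq_le_mul _ (fun n _ => ?_) (fun n _ => ?_)
      (fun n _ => ?_)
    · have := hv0 n; positivity
    · have := hv0 n; positivity
    · have := (hv0 n).ne'
      exact le_of_eq (by field_simp)
  have h3 : ∑ n ∈ Finset.range N, v n * ‖G n‖ ^ 2 ≤ (V + s.card * (E * v 0)) * T := by
    have e : ((∑ n ∈ Finset.range N, v n * ‖G n‖ ^ 2 : ℝ) : ℂ) = ∑ i ∈ s, ∑ j ∈ s,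
        (starRingEnd ℂ (S i) * S j) *
          ∑ n ∈ Finset.range N, f i n * starRingEnd ℂ (f j n) * (v n : ℂ) := by
      simp_rw [Finset.mul_sum]
      have e1 : ∀ i ∈ s, ∑ j ∈ s, ∑ n ∈ Finset.range N, starRingEnd ℂ (S i) * S j *
          (f i n * starRingEnd ℂ (f j n) * (v n : ℂ)) = ∑ n ∈ Finset.range N, ∑ j ∈ s,
          starRingEnd ℂ (S i) * S j * (f i n * starRingEnd ℂ (f j n) * (v n : ℂ)) :=
        fun i _ => Finset.sum_comm
      rw [Finset.sum_congr rfl e1, Finset.sum_comm]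
      push_cast
      refine Finset.sum_congr rfl fun n _ => ?_
      rw [← Complex.mul_conj']
      simp only [hG, map_sum, map_mul, Complex.conj_conj]
      rw [Finset.sum_mul_sum, Finset.mul_sum]
      refine Finset.sum_congr rfl fun i _ => ?_
      rw [Finset.mul_sum]
      refine Finset.sum_congr rfl fun j _ => ?_
      ring
    have hnn : 0 ≤ ∑ n ∈ Finset.range N, v n * ‖G n‖ ^ 2 :=
      Finset.sum_nonneg fun n _ => by have := hv0 n; positivity
    have : ∑ n ∈ Finset.range N, v n * ‖G n‖ ^ 2 =
        ‖((∑ n ∈ Finset.range N, v n * ‖G n‖ ^ 2 : ℝ) : ℂ)‖ := by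
      rw [Complex.norm_real, Real.norm_of_nonneg hnn]
    rw [this, e]
    have hb : ∀ i ∈ s, ∀ j ∈ s, ‖(starRingEnd ℂ (S i) * S j) *
        ∑ n ∈ Finset.range N, f i n * starRingEnd ℂ (f j n) * (v n : ℂ)‖ ≤
        (if i = j then V * ‖S i‖ ^ 2 else 0) + (E * v 0) * ((‖S i‖ ^ 2 + ‖S j‖ ^ 2) / 2) := by
      intro i hi j hj
      rw [norm_mul, norm_mul, RCLike.norm_conj]
      have hEv : 0 ≤ E * v 0 := mul_nonneg hE0 (hv0 0).le
      split_ifs with hij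
      · subst hij
        have : ‖∑ n ∈ Finset.range N, f i n * starRingEnd ℂ (f i n) * (v n : ℂ)‖ ≤ V := by
          refine (norm_sum_le _ _).trans (Finset.sum_le_sum fun n _ => ?_)
          rw [norm_mul, norm_mul, RCLike.norm_conj, Complex.norm_real,
            Real.norm_of_nonneg (hv0 n).le]
          have h1 := hf i n
          have : ‖f i n‖ * ‖f i n‖ ≤ 1 := mul_le_one₀ h1 (norm_nonneg _) h1
          nlinarith [hv0 n]
        have h5 : 0 ≤ (E * v 0) * ((‖S i‖ ^ 2 + ‖S i‖ ^ 2) / 2) := by positivity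
        nlinarith [sq_nonneg ‖S i‖]
      · have h1 := norm_sum_mul_le_of_antitone (hE i hi j hj hij) hv (fun n => (hv0 n).le) N
        have h2 : ‖S i‖ * ‖S j‖ ≤ (‖S i‖ ^ 2 + ‖S j‖ ^ 2) / 2 := by
          nlinarith [sq_nonneg (‖S i‖ - ‖S j‖)]
        rw [zero_add, mul_comm]
        exact mul_le_mul h1 h2 (by positivity) hEv
    refine (norm_sum_le _ _).trans ((Finset.sum_le_sum fun i hi => (norm_sum_le _ _).trans
      (Finset.sum_le_sum fun j hj => hb i hi j hj)).trans (le_of_eq ?_))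
    have e2 : ∀ i ∈ s, ∑ j ∈ s, ((if i = j then V * ‖S i‖ ^ 2 else 0) +
        (E * v 0) * ((‖S i‖ ^ 2 + ‖S j‖ ^ 2) / 2)) =
        V * ‖S i‖ ^ 2 + E * v 0 / 2 * (s.card * ‖S i‖ ^ 2 + T) := by
      intro i hi
      rw [Finset.sum_add_distrib, Finset.sum_ite_eq, if_pos hi, ← Finset.mul_sum,
        ← Finset.sum_div, Finset.sum_add_distrib, Finset.sum_const, nsmul_eq_mul]
      ring
    rw [Finset.sum_congr rfl e2, Finset.sum_add_distrib, ← Finset.mul_sum, ← Finset.mul_sum,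
      Finset.sum_add_distrib, ← Finset.mul_sum, Finset.sum_const, nsmul_eq_mul]
    ring
  have h4 : T ^ 2 ≤ A * ((V + s.card * (E * v 0)) * T) :=
    (pow_le_pow_left₀ hT0 h1 2).trans (h2.trans (mul_le_mul_of_nonneg_left h3 hA0))
  rcases hT0.eq_or_lt with h0 | h0
  · rw [← h0]
    have : 0 ≤ E * v 0 := mul_nonneg hE0 (hv0 0).le
    positivity
  · have : T * T ≤ ((V + s.card * (E * v 0)) * A) * T := by nlinarith
    exact le_of_mul_le_mul_right this h0

/-- Opening a Dirichlet convolution against a function vanishing beyond `N`. -/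
lemma sum_convolution (a b : ArithmeticFunction ℝ) (F : ℕ → ℂ) (N : ℕ)
    (hF : ∀ n, N ≤ n → F n = 0) :
    ∑ n ∈ Finset.range N, (((a * b) n : ℝ) : ℂ) * F n =
      ∑ d ∈ Finset.range N, ∑ m ∈ Finset.range N, (a d : ℂ) * (b m : ℂ) * F (d * m) := by
  rw [← Finset.sum_product']
  set G : ℕ × ℕ → ℂ := fun p => (a p.1 : ℂ) * (b p.2 : ℂ) * F (p.1 * p.2) with hG
  have h1 : ∀ n ∈ Finset.range N, (((a * b) n : ℝ) : ℂ) * F n =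
      ∑ p ∈ n.divisorsAntidiagonal, G p := by
    intro n _
    rw [ArithmeticFunction.mul_apply]
    push_cast
    rw [Finset.sum_mul]
    refine Finset.sum_congr rfl fun p hp => ?_
    rw [hG, ← (Nat.mem_divisorsAntidiagonal.1 hp).1]
  rw [Finset.sum_congr rfl h1, Finset.sum_sigma']
  refine Finset.sum_bij_ne_zero (fun x _ _ => x.2) ?_ ?_ ?_ ?_
  · rintro ⟨n, p⟩ h _
    simp only [Finset.mem_sigma, Finset.mem_range, Nat.mem_divisorsAntidiagonal] at h
    obtain ⟨hn, hp, h0⟩ := h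
    simp only [Finset.mem_product, Finset.mem_range]
    have : 0 < n := Nat.pos_of_ne_zero h0
    exact ⟨(Nat.le_of_dvd this ⟨_, hp.symm⟩).trans_lt hn,
      (Nat.le_of_dvd this ⟨_, by rw [← hp, mul_comm]⟩).trans_lt hn⟩
  · rintro ⟨n, p⟩ h _ ⟨n', p'⟩ h' _ e
    simp only [Finset.mem_sigma, Nat.mem_divisorsAntidiagonal] at h h' e
    obtain rfl : p = p' := e
    obtain rfl : n = n' := by rw [← h.2.1, ← h'.2.1]
    rfl
  · rintro p _ hp
    have h1 : p.1 ≠ 0 := by rintro h; simp [h] at hp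
    have h2 : p.2 ≠ 0 := by rintro h; simp [h] at hp
    have h3 : p.1 * p.2 < N := by
      by_contra h
      simp [hF _ (not_lt.1 h)] at hp
    exact ⟨⟨p.1 * p.2, p⟩, by simp [h3, h1, h2], hp, rfl⟩
  · intros; rfl

lemma sum_divisors_le {g : ℕ × ℕ → ℝ} (hg : ∀ p, 0 ≤ g p) (N : ℕ) :
    ∑ n ∈ Finset.range N, ∑ p ∈ n.divisorsAntidiagonal, g p ≤
      ∑ d ∈ Finset.range N, ∑ m ∈ Finset.range N, g (d, m) := by
  rw [← Finset.sum_product', Finset.sum_sigma']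
  rw [← Finset.sum_image (s := (Finset.range N).sigma fun n => n.divisorsAntidiagonal)
    (g := fun x => x.2) (f := g)]
  · refine Finset.sum_le_sum_of_subset_of_nonneg ?_ fun p _ _ => hg p
    intro p hp
    simp only [Finset.mem_image, Finset.mem_sigma, Finset.mem_range,
      Nat.mem_divisorsAntidiagonal] at hp
    obtain ⟨⟨n, p'⟩, ⟨hn, hp, h0⟩, rfl⟩ := hp
    dsimp only at hn hp h0 ⊢
    simp only [Finset.mem_product, Finset.mem_range]
    have : 0 < n := Nat.pos_of_ne_zero h0
    exact ⟨(Nat.le_of_dvd this ⟨_, hp.symm⟩).trans_lt hn,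
      (Nat.le_of_dvd this ⟨_, by rw [← hp, mul_comm]⟩).trans_lt hn⟩
  · rintro ⟨n, p⟩ h ⟨n', p'⟩ h' e
    simp only [Finset.coe_sigma, Set.mem_sigma_iff, Finset.mem_coe,
      Nat.mem_divisorsAntidiagonal] at h h' e
    obtain rfl : p = p' := e
    obtain rfl : n = n' := by rw [← h.2.1, ← h'.2.1]
    rfl

lemma card_divisors_mul_le (a b : ℕ) :
    (a * b).divisors.card ≤ a.divisors.card * b.divisors.card := by
  rw [Nat.divisors_mul]
  exact Finset.card_mul_le

/-- Moments of the divisor function with logarithmic weights. -/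
lemma sum_card_divisors_pow_div_le (c N : ℕ) :
    ∑ n ∈ Finset.range N, (n.divisors.card : ℝ) ^ c / n ≤
      (∑ n ∈ Finset.range N, (1 : ℝ) / n) ^ 2 ^ c := by
  induction c with
  | zero => simp
  | succ c ih =>
    have h0 : 0 ≤ ∑ n ∈ Finset.range N, (n.divisors.card : ℝ) ^ c / n :=
      Finset.sum_nonneg fun n _ => by positivity
    calc _ = ∑ n ∈ Finset.range N, ∑ p ∈ n.divisorsAntidiagonal,
          (n.divisors.card : ℝ) ^ c / n := by
          refine Finset.sum_congr rfl fun n _ => ?_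
          rw [Finset.sum_const, nsmul_eq_mul, ← Nat.map_div_right_divisors, Finset.card_map]
          ring
      _ ≤ ∑ n ∈ Finset.range N, ∑ p ∈ n.divisorsAntidiagonal,
          ((p.1.divisors.card : ℝ) ^ c / p.1) * ((p.2.divisors.card : ℝ) ^ c / p.2) := by
          refine Finset.sum_le_sum fun n _ => Finset.sum_le_sum fun p hp => ?_
          rw [← (Nat.mem_divisorsAntidiagonal.1 hp).1, div_mul_div_comm, ← mul_pow]
          push_cast
          gcongr
          exact_mod_cast card_divisors_mul_le _ _
      _ ≤ ∑ d ∈ Finset.range N, ∑ m ∈ Finset.range N,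
          ((d.divisors.card : ℝ) ^ c / d) * ((m.divisors.card : ℝ) ^ c / m) :=
          sum_divisors_le (g := fun p => ((p.1.divisors.card : ℝ) ^ c / p.1) *
            ((p.2.divisors.card : ℝ) ^ c / p.2)) (fun p => by positivity) N
      _ = (∑ n ∈ Finset.range N, (n.divisors.card : ℝ) ^ c / n) ^ 2 := by
          rw [sq, Finset.sum_mul_sum]
      _ ≤ _ := by
          rw [pow_succ 2 c, pow_mul]
          exact pow_le_pow_left₀ h0 ih 2

lemma sum_inv_le (N : ℕ) : ∑ n ∈ Finset.range N, (1 : ℝ) / n ≤ 1 + Real.log N := by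
  have h := harmonic_le_one_add_log N
  refine le_trans ?_ h
  have h1 : ∑ n ∈ Finset.range N, (1 : ℝ) / n ≤ ∑ n ∈ Finset.range (N + 1), (1 : ℝ) / n := by
    rw [Finset.sum_range_succ]
    have : (0 : ℝ) ≤ 1 / N := by positivity
    linarith
  refine h1.trans (le_of_eq ?_)
  rw [Finset.sum_range_succ', harmonic]
  push_cast
  simp

lemma exists_bump_lipschitz : ∃ C : ℝ, 0 ≤ C ∧ ∀ u v, |bump u - bump v| ≤ C * |u - v| := by
  have h : ContDiff ℝ 1 (bump : ℝ → ℝ) := bump.contDiff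
  obtain ⟨C, hC⟩ := h.lipschitzWith_of_hasCompactSupport bump.hasCompactSupport one_ne_zero
  refine ⟨C, C.2, fun u v => ?_⟩
  simpa [Real.dist_eq] using hC.dist_le_mul u v

lemma one_le_one_add_log {N : ℕ} : 1 ≤ 1 + Real.log N := by
  have := Real.log_natCast_nonneg N
  linarith

lemma log_succ_sub_log_le {m : ℕ} (hm : 0 < m) : |Real.log (m + 1) - Real.log m| ≤ 1 / m := by
  have hm' : (0 : ℝ) < m := by exact_mod_cast hm
  rw [abs_of_nonneg (sub_nonneg.2 (Real.log_le_log hm' (by linarith))),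
    ← Real.log_div (by positivity) hm'.ne']
  refine (Real.log_le_sub_one_of_pos (by positivity)).trans (le_of_eq ?_)
  field_simp
  ring

lemma type_one_bound {C : ℝ} (hC : 0 ≤ C) (hlip : ∀ u v, |bump u - bump v| ≤ C * |u - v|)
    {f : ℕ → ℂ} (hmul : ∀ m n, f (m * n) = f m * f n) (hf : ∀ n, ‖f n‖ ≤ 1) {E : ℝ}
    (hE : ∀ N, ‖∑ n ∈ Finset.range N, f n‖ ≤ E) {x : ℝ} (hx : 0 < x)
    {a b : ArithmeticFunction ℝ} {Y : ℕ} (haY : ∀ d, Y < d → a d = 0)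
    (ha : ∀ d, d < cut x → |a d| ≤ 1 + Real.log (cut x))
    (hb : ∀ d, d < cut x → |b d| ≤ 1 + Real.log (cut x)) (hb1 : |b 1| ≤ 1)
    (hbs : ∀ m, 0 < m → |b (m + 1) - b m| ≤ 1 / m) :
    ‖∑ n ∈ Finset.range (cut x), (((a * b) n : ℝ) : ℂ) * (f n * (wt x n : ℂ))‖ ≤
      (Y + 1) * (E * ((2 + C) * (1 + Real.log (cut x)) ^ 3)) := by
  set N := cut x with hN
  set L := 1 + Real.log N with hL
  have hL1 : 1 ≤ L := one_le_one_add_log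
  have hE0 : 0 ≤ E := by simpa using hE 0
  rw [sum_convolution a b _ N (fun n hn => by rw [wt_eq_zero_of_cut_le hx hn]; simp)]
  have hin : ∀ d, 0 < d → ‖∑ m ∈ Finset.range N, f m * ((b m * wt x (d * m) : ℝ) : ℂ)‖ ≤
      E * ((2 + C) * L ^ 2) := by
    intro d hd
    have hd' : (0 : ℝ) < d := by exact_mod_cast hd
    refine (norm_sum_mul_le_of_variation hE (fun m => b m * wt x (d * m)) N).trans
      (mul_le_mul_of_nonneg_left ?_ hE0)
    have h0 : wt x (d * N) = 0 := wt_eq_zero_of_cut_le hx (Nat.le_mul_of_pos_left _ hd)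
    rw [h0, mul_zero, abs_zero, zero_add]
    have hterm : ∀ m ∈ Finset.range N, |b (m + 1) * wt x (d * (m + 1)) - b m * wt x (d * m)| ≤
        (if m = 0 then 1 else 0) + (1 + L * C) * (1 / (m : ℝ)) := by
      intro m hm
      rw [Finset.mem_range] at hm
      rcases Nat.eq_zero_or_pos m with rfl | hm0
      · simp only [zero_add, mul_one, mul_zero, ArithmeticFunction.map_zero, zero_mul, sub_zero,
          if_true, Nat.cast_zero, div_zero, add_zero]
        rw [abs_mul, abs_of_nonneg (wt_nonneg _ _)]
        exact mul_le_one₀ hb1 (wt_nonneg _ _) (wt_le_one _ _)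
      · rw [if_neg hm0.ne', zero_add]
        have hm' : (0 : ℝ) < m := by exact_mod_cast hm0
        have h2 : |wt x (d * (m + 1)) - wt x (d * m)| ≤ C * (1 / m) := by
          refine (hlip _ _).trans (mul_le_mul_of_nonneg_left ?_ hC)
          refine le_trans (le_of_eq ?_) (log_succ_sub_log_le hm0)
          congr 1
          push_cast
          rw [mul_div_assoc, mul_div_assoc, Real.log_mul hd'.ne' (by positivity),
            Real.log_mul hd'.ne' (by positivity), Real.log_div (by positivity) hx.ne',
            Real.log_div (by positivity) hx.ne']
          ring
        have e : b (m + 1) * wt x (d * (m + 1)) - b m * wt x (d * m) =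
          (b (m + 1) - b m) * wt x (d * (m + 1)) + b m * (wt x (d * (m + 1)) - wt x (d * m)) := by
          ring
        rw [e]
        refine (abs_add_le _ _).trans ?_
        rw [abs_mul, abs_mul, abs_of_nonneg (wt_nonneg _ _)]
        have h3 : |b (m + 1) - b m| * wt x (d * (m + 1)) ≤ 1 / m * 1 :=
          mul_le_mul (hbs m hm0) (wt_le_one _ _) (wt_nonneg _ _) (by positivity)
        have h4 : |b m| * |wt x (d * (m + 1)) - wt x (d * m)| ≤ L * (C * (1 / m)) :=
          mul_le_mul (hb m hm) h2 (abs_nonneg _) (by linarith)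
        linarith
    refine (Finset.sum_le_sum hterm).trans ?_
    rw [Finset.sum_add_distrib, ← Finset.mul_sum]
    have h5 : ∑ m ∈ Finset.range N, (if m = 0 then (1 : ℝ) else 0) ≤ 1 := by
      rw [Finset.sum_ite_eq']; split_ifs <;> norm_num
    have h6 := mul_le_mul_of_nonneg_left (sum_inv_le N) (by positivity : 0 ≤ 1 + L * C)
    rw [← hL] at h6
    have h7 : L * 1 ≤ L * L := mul_le_mul_of_nonneg_left hL1 (by linarith)
    nlinarith
  have hout : ∀ d ∈ Finset.range N, ‖∑ m ∈ Finset.range N, (a d : ℂ) * (b m : ℂ) *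
      (f (d * m) * (wt x (d * m) : ℂ))‖ ≤
      if d ∈ Finset.range (Y + 1) then L * (E * ((2 + C) * L ^ 2)) else 0 := by
    intro d hd
    rw [Finset.mem_range] at hd
    have hnn : 0 ≤ L * (E * ((2 + C) * L ^ 2)) := by positivity
    rcases Nat.eq_zero_or_pos d with rfl | hd0
    · simpa using hnn
    split_ifs with h
    · have e : ∑ m ∈ Finset.range N, (a d : ℂ) * (b m : ℂ) * (f (d * m) * (wt x (d * m) : ℂ)) =
          (a d : ℂ) * f d * ∑ m ∈ Finset.range N, f m * ((b m * wt x (d * m) : ℝ) : ℂ) := by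
        rw [Finset.mul_sum]
        refine Finset.sum_congr rfl fun m _ => ?_
        rw [hmul]; push_cast; ring
      rw [e, norm_mul, norm_mul, Complex.norm_real, Real.norm_eq_abs]
      refine mul_le_mul ?_ (hin d hd0) (norm_nonneg _) (by linarith)
      calc |a d| * ‖f d‖ ≤ L * 1 := mul_le_mul (ha d hd) (hf d) (norm_nonneg _) (by linarith)
        _ = L := mul_one L
    · rw [haY d (by simpa using h)]
      simp
  refine (norm_sum_le _ _).trans ((Finset.sum_le_sum hout).trans ?_)
  rw [← Finset.sum_filter]
  refine (Finset.sum_le_sum_of_subset_of_nonneg (t := Finset.range (Y + 1))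
    (fun d hd => (Finset.mem_filter.1 hd).2) (fun d _ _ => by positivity)).trans (le_of_eq ?_)
  rw [Finset.sum_const, Finset.card_range, nsmul_eq_mul]
  push_cast
  ring

lemma large_sieve_side {ι : Type*} {s : Finset ι} {f : ι → ℕ → ℂ} (hf : ∀ i n, ‖f i n‖ ≤ 1)
    {E : ℝ} (hE0 : 0 ≤ E) (hE : ∀ i ∈ s, ∀ j ∈ s, i ≠ j → ∀ N, ‖∑ n ∈ Finset.range N,
      f i n * starRingEnd ℂ (f j n)‖ ≤ E) {U : ℕ} (hU : 1 ≤ U) (hs : s.card * E ≤ U)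
    {a : ℕ → ℝ} (ha : ∀ n, n ≤ U → a n = 0) (N : ℕ) {S : ℝ}
    (hS : ∑ n ∈ Finset.range N, (a n) ^ 2 / n ≤ S) {e : ℕ → ℂ} (he : ∀ n, ‖e n‖ = 1) :
    ∑ i ∈ s, ‖∑ n ∈ Finset.range N, ((a n / n : ℝ) : ℂ) * e n * f i n‖ ^ 2 ≤
      3 * (1 + Real.log N) * S := by
  have hU' : (1 : ℝ) ≤ U := by exact_mod_cast hU
  set v : ℕ → ℝ := fun n => 1 / max (n : ℝ) U with hv
  have hv0 : ∀ n, 0 < v n := fun n => one_div_pos.2 (lt_max_of_lt_right (by linarith))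
  have hanti : Antitone v := fun m n hmn => by
    simp only [hv]
    have : (m : ℝ) ≤ n := by exact_mod_cast hmn
    gcongr
  have hS0 : 0 ≤ S := (Finset.sum_nonneg fun n _ => by positivity).trans hS
  refine (weighted_large_sieve s f hf hE0 hE hanti hv0 _ N).trans ?_
  refine mul_le_mul ?_ (le_trans (le_of_eq ?_) hS) (Finset.sum_nonneg fun n _ => by
    have := hv0 n; positivity) (by have := one_le_one_add_log (N := N); positivity)
  · have h1 : ∑ n ∈ Finset.range N, v n ≤ ∑ n ∈ Finset.range N, ((if n = 0 then 1 else 0) +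
        (1 : ℝ) / n) := by
      refine Finset.sum_le_sum fun n _ => ?_
      rcases Nat.eq_zero_or_pos n with rfl | hn
      · simp only [hv, if_true, Nat.cast_zero, div_zero, add_zero]
        exact div_le_one_of_le₀ (le_max_of_le_right hU') (by positivity)
      · rw [if_neg hn.ne', zero_add]
        have : (0 : ℝ) < n := by exact_mod_cast hn
        exact one_div_le_one_div_of_le this (le_max_left _ _)
    rw [Finset.sum_add_distrib] at h1
    have h5 : ∑ m ∈ Finset.range N, (if m = 0 then (1 : ℝ) else 0) ≤ 1 := by
      rw [Finset.sum_ite_eq']; split_ifs <;> norm_num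
    have h6 := sum_inv_le N
    have h7 : s.card * (E * v 0) ≤ 1 := by
      simp only [hv, Nat.cast_zero]
      rw [max_eq_right (by linarith), ← mul_assoc, mul_one_div]
      exact div_le_one_of_le₀ hs (by linarith)
    have := one_le_one_add_log (N := N)
    linarith
  · refine Finset.sum_congr rfl fun n _ => ?_
    rw [norm_mul, he, mul_one, Complex.norm_real, Real.norm_eq_abs, sq_abs]
    rcases le_or_gt n U with h | h
    · rw [ha n h]; simp
    · have : (0 : ℝ) < n := by exact_mod_cast (by omega : 0 < n)
      simp only [hv]
      rw [max_eq_left (by exact_mod_cast h.le)]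
      field_simp

lemma type_two_bound : ∃ C : ℝ, 0 ≤ C ∧ ∀ {ι : Type} {s : Finset ι} {f : ι → ℕ → ℂ},
    (∀ i m n, f i (m * n) = f i m * f i n) → (∀ i n, ‖f i n‖ ≤ 1) → ∀ {E : ℝ}, 0 ≤ E →
    (∀ i ∈ s, ∀ j ∈ s, i ≠ j → ∀ N, ‖∑ n ∈ Finset.range N,
      f i n * starRingEnd ℂ (f j n)‖ ≤ E) → ∀ {U : ℕ}, 1 ≤ U → s.card * E ≤ U →
    ∀ {x : ℝ}, 0 < x → ∀ {a b : ArithmeticFunction ℝ}, (∀ n, n ≤ U → a n = 0) →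
    (∀ n, n ≤ U → b n = 0) → (∀ n, n < cut x → |a n| ≤ 1 + Real.log (cut x)) →
    (∀ n, |b n| ≤ n.divisors.card) →
    ∑ i ∈ s, ‖∑ n ∈ Finset.range (cut x), (((a * b) n : ℝ) : ℂ) * (f i n * (wt x n : ℂ))‖ ≤
      C * x * (1 + Real.log (cut x)) ^ 5 := by
  set φ : ℝ → ℂ := fun u => ((bump u * Real.exp u : ℝ) : ℂ) with hφ
  have hsm : ContDiff ℝ (⊤ : ℕ∞) φ :=
    Complex.ofRealCLM.contDiff.comp (bump.contDiff.mul Real.contDiff_exp)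
  have hcs : HasCompactSupport φ :=
    HasCompactSupport.comp_left (g := fun t : ℝ => (t : ℂ)) bump.hasCompactSupport.mul_right (by simp)
  obtain ⟨K, hKc, hKi, hK⟩ := exists_kernel hcs hsm
  have hKint : MeasureTheory.Integrable K := by
    have := hKi 0
    simp only [pow_zero, one_mul] at this
    exact (MeasureTheory.integrable_norm_iff hKc.aestronglyMeasurable).1 this
  refine ⟨3 * ∫ t, ‖K t‖, mul_nonneg (by norm_num)
    (MeasureTheory.integral_nonneg fun t => norm_nonneg _), ?_⟩
  intro ι s f hmul hf E hE0 hE U hU hs x hx a b haU hbU ha hb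
  set N := cut x with hN
  set L := 1 + Real.log N with hL
  have hL1 : 1 ≤ L := one_le_one_add_log
  set e : ℝ → ℕ → ℂ := fun t n => Complex.exp ((2 * Real.pi * t * Real.log n : ℝ) * Complex.I) with he
  have hen : ∀ t n, ‖e t n‖ = 1 := fun t n => Complex.norm_exp_ofReal_mul_I _
  set S : (ℕ → ℝ) → ι → ℝ → ℂ := fun a i t =>
    ∑ n ∈ Finset.range N, ((a n / n : ℝ) : ℂ) * e t n * f i n with hS
  set e0 : ℝ → ℂ := fun t => Complex.exp ((-(2 * Real.pi * t * Real.log x) : ℝ) * Complex.I) with he0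
  have he0n : ∀ t, ‖e0 t‖ = 1 := fun t => Complex.norm_exp_ofReal_mul_I _
  have hrep : ∀ i, ∑ n ∈ Finset.range N, (((a * b) n : ℝ) : ℂ) * (f i n * (wt x n : ℂ)) =
      ∫ t, K t * (x * e0 t * S a i t * S b i t) := by
    intro i
    rw [sum_convolution a b _ N (fun n hn => by rw [wt_eq_zero_of_cut_le hx hn]; simp)]
    have e1 : ∀ t, K t * (x * e0 t * S a i t * S b i t) = ∑ d ∈ Finset.range N,
        ∑ m ∈ Finset.range N, (x * ((a d / d : ℝ) : ℂ) * ((b m / m : ℝ) : ℂ) * f i d * f i m) *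
          (K t * (e0 t * e t d * e t m)) := by
      intro t
      simp only [hS]
      rw [mul_assoc, Finset.sum_mul_sum, Finset.mul_sum, Finset.mul_sum]
      refine Finset.sum_congr rfl fun d _ => ?_
      rw [Finset.mul_sum, Finset.mul_sum]
      refine Finset.sum_congr rfl fun m _ => ?_
      ring
    simp_rw [e1]
    have h_int : ∀ d m : ℕ, MeasureTheory.Integrable fun t =>
        (x * ((a d / d : ℝ) : ℂ) * ((b m / m : ℝ) : ℂ) * f i d * f i m) *
          (K t * (e0 t * e t d * e t m)) := by
      intro d m
      refine MeasureTheory.Integrable.const_mul ?_ _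
      refine hKint.mul_bdd (c := 1) ?_ (Eventually.of_forall fun t => ?_)
      · exact Continuous.aestronglyMeasurable (by fun_prop)
      · rw [norm_mul, norm_mul, hen, hen, he0n]; norm_num
    rw [MeasureTheory.integral_finsetSum _ fun d _ =>
      MeasureTheory.integrable_finsetSum _ fun m _ => h_int d m]
    refine Finset.sum_congr rfl fun d _ => ?_
    rw [MeasureTheory.integral_finsetSum _ fun m _ => h_int d m]
    refine Finset.sum_congr rfl fun m _ => ?_
    rw [MeasureTheory.integral_const_mul]
    rcases Nat.eq_zero_or_pos d with rfl | hd
    · simp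
    rcases Nat.eq_zero_or_pos m with rfl | hm
    · simp
    have hd' : (0 : ℝ) < d := by exact_mod_cast hd
    have hm' : (0 : ℝ) < m := by exact_mod_cast hm
    have hdc : (d : ℂ) ≠ 0 := by exact_mod_cast hd.ne'
    have hmc : (m : ℂ) ≠ 0 := by exact_mod_cast hm.ne'
    have hxc : (x : ℂ) ≠ 0 := by exact_mod_cast hx.ne'
    have e2 : ∀ t, K t * (e0 t * e t d * e t m) = K t * Complex.exp
        ((2 * Real.pi * t * Real.log ((d * m : ℕ) / x) : ℝ) * Complex.I) := by
      intro t
      simp only [he0, he]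
      rw [← Complex.exp_add, ← Complex.exp_add]
      congr 2
      push_cast
      rw [Real.log_div (by positivity) hx.ne', Real.log_mul hd'.ne' hm'.ne']
      push_cast
      ring
    simp_rw [e2]
    rw [← hK]
    simp only [hφ]
    rw [Real.exp_log (by positivity), hmul, ← wt]
    push_cast
    field_simp
  have hside : ∀ {a : ℕ → ℝ}, (∀ n, n ≤ U → a n = 0) → ∀ {B : ℝ},
      ∑ n ∈ Finset.range N, (a n) ^ 2 / n ≤ B → ∀ t, ∑ i ∈ s, ‖S a i t‖ ^ 2 ≤ 3 * L * B :=
    fun ha B hB t => large_sieve_side hf hE0 hE hU hs ha N hB (hen t)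
  have hA : ∑ n ∈ Finset.range N, (a n) ^ 2 / n ≤ L ^ 4 := by
    calc _ ≤ ∑ n ∈ Finset.range N, L ^ 2 * ((1 : ℝ) / n) := by
          refine Finset.sum_le_sum fun n hn => ?_
          rw [mul_one_div, ← sq_abs]
          gcongr
          exact ha n (Finset.mem_range.1 hn)
      _ ≤ L ^ 2 * L := by
          rw [← Finset.mul_sum]
          exact mul_le_mul_of_nonneg_left (sum_inv_le N) (by positivity)
      _ ≤ L ^ 4 := by
          rw [← pow_succ]; exact pow_le_pow_right₀ hL1 (by norm_num)
  have hB : ∑ n ∈ Finset.range N, (b n) ^ 2 / n ≤ L ^ 4 := by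
    calc _ ≤ ∑ n ∈ Finset.range N, (n.divisors.card : ℝ) ^ 2 / n := by
          refine Finset.sum_le_sum fun n _ => ?_
          rw [← sq_abs]
          gcongr
          exact hb n
      _ ≤ (∑ n ∈ Finset.range N, (1 : ℝ) / n) ^ 2 ^ 2 := sum_card_divisors_pow_div_le 2 N
      _ ≤ L ^ 4 := by
          rw [show 2 ^ 2 = 4 by norm_num]
          exact pow_le_pow_left₀ (Finset.sum_nonneg fun n _ => by positivity) (sum_inv_le N) 4
  have hpt : ∀ t, ∑ i ∈ s, ‖K t * (x * e0 t * S a i t * S b i t)‖ ≤ (3 * x * L ^ 5) * ‖K t‖ := by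
    intro t
    calc _ ≤ ∑ i ∈ s, ‖K t‖ * x * ((‖S a i t‖ ^ 2 + ‖S b i t‖ ^ 2) / 2) := by
          refine Finset.sum_le_sum fun i _ => ?_
          rw [norm_mul, norm_mul, norm_mul, norm_mul, he0n, Complex.norm_real,
            Real.norm_of_nonneg hx.le, mul_one, mul_assoc x, ← mul_assoc]
          gcongr
          nlinarith [sq_nonneg (‖S a i t‖ - ‖S b i t‖)]
      _ = ‖K t‖ * x * ((∑ i ∈ s, ‖S a i t‖ ^ 2 + ∑ i ∈ s, ‖S b i t‖ ^ 2) / 2) := by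
          rw [← Finset.sum_add_distrib, ← Finset.mul_sum, Finset.sum_div]
      _ ≤ ‖K t‖ * x * ((3 * L * L ^ 4 + 3 * L * L ^ 4) / 2) := by
          gcongr
          · exact hside haU hA t
          · exact hside hbU hB t
      _ = _ := by ring
  have hcont : ∀ (a : ℕ → ℝ) i, Continuous (S a i) := by
    intro a i
    simp only [hS, he]
    fun_prop
  have hcts : ∀ i, Continuous fun t => K t * (x * e0 t * S a i t * S b i t) := by
    intro i
    have h1 := hcont a i
    have h2 := hcont b i
    simp only [he0]
    fun_prop
  have hintF : ∀ i ∈ s, MeasureTheory.Integrable fun t => ‖K t * (x * e0 t * S a i t * S b i t)‖ := by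
    intro i hi
    refine MeasureTheory.Integrable.mono' (hKint.norm.const_mul (3 * x * L ^ 5))
      (hcts i).norm.aestronglyMeasurable (Eventually.of_forall fun t => ?_)
    rw [norm_norm]
    exact (Finset.single_le_sum (f := fun i => ‖K t * (x * e0 t * S a i t * S b i t)‖)
      (fun i _ => norm_nonneg _) hi).trans (hpt t)
  calc _ ≤ ∑ i ∈ s, ∫ t, ‖K t * (x * e0 t * S a i t * S b i t)‖ := by
        refine Finset.sum_le_sum fun i _ => ?_
        rw [hrep]
        exact MeasureTheory.norm_integral_le_integral_norm _
    _ = ∫ t, ∑ i ∈ s, ‖K t * (x * e0 t * S a i t * S b i t)‖ :=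
        (MeasureTheory.integral_finsetSum _ hintF).symm
    _ ≤ ∫ t, (3 * x * L ^ 5) * ‖K t‖ :=
        MeasureTheory.integral_mono (MeasureTheory.integrable_finsetSum _ hintF)
          (hKint.norm.const_mul _) hpt
    _ = _ := by rw [MeasureTheory.integral_const_mul]; ring

open ArithmeticFunction in
/-- Restriction of an arithmetic function to `n ≤ U`. -/
noncomputable def lo (a : ArithmeticFunction ℝ) (U : ℕ) : ArithmeticFunction ℝ :=
  ⟨fun n => if n ≤ U then a n else 0, by simp⟩

/-- Restriction of an arithmetic function to `n > U`. -/
noncomputable def hi (a : ArithmeticFunction ℝ) (U : ℕ) : ArithmeticFunction ℝ :=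
  ⟨fun n => if n ≤ U then 0 else a n, by simp⟩

lemma lo_apply (a : ArithmeticFunction ℝ) (U n : ℕ) : lo a U n = if n ≤ U then a n else 0 := rfl

lemma hi_apply (a : ArithmeticFunction ℝ) (U n : ℕ) : hi a U n = if n ≤ U then 0 else a n := rfl

lemma lo_add_hi (a : ArithmeticFunction ℝ) (U : ℕ) : lo a U + hi a U = a := by
  ext n
  rw [ArithmeticFunction.add_apply, lo_apply, hi_apply]
  split_ifs <;> simp

/-- The Möbius function with real values. -/
noncomputable abbrev muR : ArithmeticFunction ℝ := ((ArithmeticFunction.moebius : ArithmeticFunction ℤ) :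
  ArithmeticFunction ℝ)

/-- The constant function `1` with real values. -/
noncomputable abbrev zetaR : ArithmeticFunction ℝ := ((ArithmeticFunction.zeta : ArithmeticFunction ℕ) :
  ArithmeticFunction ℝ)

lemma abs_muR_le (n : ℕ) : |muR n| ≤ 1 := by
  rw [ArithmeticFunction.intCoe_apply, ← Int.cast_abs]
  exact_mod_cast ArithmeticFunction.abs_moebius_le_one

/-- Vaughan's identity. -/
lemma vaughan_identity (U : ℕ) : ArithmeticFunction.vonMangoldt +
      (lo muR U * lo ArithmeticFunction.vonMangoldt U) * zetaR =
    lo ArithmeticFunction.vonMangoldt U + lo muR U * ArithmeticFunction.log +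
      hi ArithmeticFunction.vonMangoldt U * (hi muR U * zetaR) := by
  have h1 : ArithmeticFunction.vonMangoldt * zetaR = ArithmeticFunction.log :=
    ArithmeticFunction.vonMangoldt_mul_zeta
  have h2 : muR * zetaR = 1 := ArithmeticFunction.coe_moebius_mul_coe_zeta
  have h3 := lo_add_hi ArithmeticFunction.vonMangoldt U
  have h4 := lo_add_hi muR U
  rw [← h1]
  have e3 : hi ArithmeticFunction.vonMangoldt U =
    ArithmeticFunction.vonMangoldt - lo ArithmeticFunction.vonMangoldt U := by
    rw [eq_sub_iff_add_eq, add_comm]; exact h3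
  have e4 : hi muR U = muR - lo muR U := by rw [eq_sub_iff_add_eq, add_comm]; exact h4
  rw [e3, e4]
  linear_combination (-ArithmeticFunction.vonMangoldt + lo ArithmeticFunction.vonMangoldt U) * h2

lemma abs_mul_apply_le {a b : ArithmeticFunction ℝ} {g : ℕ → ℕ → ℝ} {n : ℕ}
    (h : ∀ p ∈ n.divisorsAntidiagonal, |a p.1| * |b p.2| ≤ g p.1 p.2) :
    |(a * b) n| ≤ ∑ p ∈ n.divisorsAntidiagonal, g p.1 p.2 := by
  rw [ArithmeticFunction.mul_apply]
  refine (Finset.abs_sum_le_sum_abs _ _).trans (Finset.sum_le_sum fun p hp => ?_)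
  rw [abs_mul]
  exact h p hp

lemma log_le_log_cut {N n : ℕ} (h : n < N) : Real.log n ≤ 1 + Real.log N := by
  rcases Nat.eq_zero_or_pos n with rfl | hn
  · have := Real.log_natCast_nonneg N
    simp only [Nat.cast_zero, Real.log_zero]; linarith
  · have : Real.log n ≤ Real.log N :=
      Real.log_le_log (by exact_mod_cast hn) (by exact_mod_cast h.le)
    linarith

open ArithmeticFunction in
lemma vaughan_bound : ∃ C : ℝ, 0 ≤ C ∧ ∀ {ι : Type} {s : Finset ι} {f : ι → ℕ → ℂ},
    (∀ i m n, f i (m * n) = f i m * f i n) → (∀ i n, ‖f i n‖ ≤ 1) → ∀ {E : ℝ}, 0 ≤ E →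
    (∀ i ∈ s, ∀ N, ‖∑ n ∈ Finset.range N, f i n‖ ≤ E) →
    (∀ i ∈ s, ∀ j ∈ s, i ≠ j → ∀ N, ‖∑ n ∈ Finset.range N,
      f i n * starRingEnd ℂ (f j n)‖ ≤ E) → ∀ {U : ℕ}, 3 ≤ U → s.card * E ≤ U →
    ∀ {x : ℝ}, (U : ℝ) ^ 3 ≤ x →
    ∑ i ∈ s, ‖∑ n ∈ Finset.range (cut x), (f i n * (vonMangoldt n : ℂ)) * (wt x n : ℂ)‖ ≤
      C * x * (1 + Real.log (cut x)) ^ 5 := by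
  obtain ⟨C₁, hC₁, hlip⟩ := exists_bump_lipschitz
  obtain ⟨C₂, hC₂, htwo⟩ := type_two_bound
  refine ⟨4 * (2 + C₁) + C₂, by positivity, ?_⟩
  intro ι s f hmul hf E hE0 hE1 hE U hU hs x hx
  have hU' : (3 : ℝ) ≤ U := by exact_mod_cast hU
  have hx0 : 0 < x := lt_of_lt_of_le (by positivity) hx
  set N := cut x with hN
  set L := 1 + Real.log N with hL
  have hL1 : 1 ≤ L := one_le_one_add_log
  have hlo0 : ∀ n ∈ Finset.range N, lo vonMangoldt U n * wt x n = 0 := by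
    intro n _
    rw [lo_apply]
    split_ifs with h
    · rcases Nat.eq_zero_or_pos n with rfl | hn
      · simp
      have hn' : (0 : ℝ) < n := by exact_mod_cast hn
      have h1 : (n : ℝ) ≤ U := by exact_mod_cast h
      have : wt x n = 0 := by
        refine bump_eq_zero (le_trans ?_ (neg_le_abs _))
        rw [← Real.log_inv, inv_div, Real.le_log_iff_exp_le (by positivity), le_div_iff₀ hn']
        have h2 : Real.exp 2 ≤ 9 := by
          have := Real.exp_one_lt_d9
          have e : Real.exp 2 = Real.exp 1 ^ 2 := by rw [← Real.exp_nat_mul]; norm_num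
          rw [e]
          nlinarith [Real.exp_pos 1]
        calc Real.exp 2 * n ≤ 9 * U := by gcongr
          _ ≤ (U : ℝ) ^ 3 := by
            have h3 : (9 : ℝ) ≤ U ^ 2 := by nlinarith
            calc (9 : ℝ) * U ≤ U ^ 2 * U := by gcongr
              _ = (U : ℝ) ^ 3 := by ring
          _ ≤ x := hx
      rw [this, mul_zero]
    · simp
  have hsplit : ∀ i, ∑ n ∈ Finset.range N, (f i n * (vonMangoldt n : ℂ)) * (wt x n : ℂ) =
      ∑ n ∈ Finset.range N, (((lo muR U * log) n : ℝ) : ℂ) * (f i n * (wt x n : ℂ)) -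
      ∑ n ∈ Finset.range N, ((((lo muR U * lo vonMangoldt U) * zetaR) n : ℝ) : ℂ) *
        (f i n * (wt x n : ℂ)) +
      ∑ n ∈ Finset.range N, (((hi vonMangoldt U * (hi muR U * zetaR)) n : ℝ) : ℂ) *
        (f i n * (wt x n : ℂ)) := by
    intro i
    rw [← Finset.sum_sub_distrib, ← Finset.sum_add_distrib]
    refine Finset.sum_congr rfl fun n hn => ?_
    have h1 : vonMangoldt n = lo vonMangoldt U n + (lo muR U * log) n -
        ((lo muR U * lo vonMangoldt U) * zetaR) n + (hi vonMangoldt U * (hi muR U * zetaR)) n := by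
      have := congrArg (fun g : ArithmeticFunction ℝ => g n) (vaughan_identity U)
      simp only [ArithmeticFunction.add_apply] at this
      linarith
    have h2 : (lo vonMangoldt U n : ℂ) * (wt x n : ℂ) = 0 := by exact_mod_cast hlo0 n hn
    rw [h1]
    push_cast
    linear_combination f i n * h2
  have hzeta : ∀ n, zetaR n = if n = 0 then 0 else 1 := fun n => by
    rw [natCoe_apply, zeta_apply]; split_ifs <;> simp
  have hloM : ∀ n, |lo muR U n| ≤ 1 := fun n => by
    rw [lo_apply]; split_ifs
    · exact abs_muR_le n
    · simp
  have hhiM : ∀ n, |hi muR U n| ≤ 1 := fun n => by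
    rw [hi_apply]; split_ifs
    · simp
    · exact abs_muR_le n
  have hzle : ∀ n, |zetaR n| ≤ 1 := fun n => by rw [hzeta]; split_ifs <;> simp
  have hloL : ∀ n, |lo vonMangoldt U n| ≤ vonMangoldt n := fun n => by
    rw [lo_apply]; split_ifs
    · rw [abs_of_nonneg vonMangoldt_nonneg]
    · simp [vonMangoldt_nonneg]
  have hT1 : ∀ i ∈ s, ‖∑ n ∈ Finset.range N, (((lo muR U * log) n : ℝ) : ℂ) *
      (f i n * (wt x n : ℂ))‖ ≤ (U + 1) * (E * ((2 + C₁) * L ^ 3)) := by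
    intro i hi
    refine type_one_bound hC₁ hlip (hmul i) (hf i) (hE1 i hi) hx0 (fun d hd => ?_) (fun d hd => ?_)
      (fun d hd => ?_) (by simp) (fun m hm => ?_)
    · rw [lo_apply, if_neg (by omega)]
    · exact (hloM d).trans hL1
    · rw [log_apply, abs_of_nonneg (Real.log_natCast_nonneg d)]
      exact log_le_log_cut hd
    · rw [log_apply, log_apply]
      push_cast
      exact log_succ_sub_log_le hm
  have hT2 : ∀ i ∈ s, ‖∑ n ∈ Finset.range N, ((((lo muR U * lo vonMangoldt U) * zetaR) n : ℝ) : ℂ) *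
        (f i n * (wt x n : ℂ))‖ ≤ ((U * U : ℕ) + 1) * (E * ((2 + C₁) * L ^ 3)) := by
    intro i hi
    refine type_one_bound hC₁ hlip (hmul i) (hf i) (hE1 i hi) hx0 (fun d hd => ?_) (fun d hd => ?_)
      (fun d hd => (hzle d).trans hL1) (hzle 1) (fun m hm => ?_)
    · rw [mul_apply]
      refine Finset.sum_eq_zero fun p hp => ?_
      rw [Nat.mem_divisorsAntidiagonal] at hp
      rw [lo_apply, lo_apply]
      by_cases h1 : p.1 ≤ U
      · have h2 : ¬ p.2 ≤ U := fun h2 => by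
          have := Nat.mul_le_mul h1 h2
          omega
        rw [if_neg h2, mul_zero]
      · rw [if_neg h1, zero_mul]
    · refine (abs_mul_apply_le (g := fun _ m => vonMangoldt m) fun p _ => ?_).trans ?_
      · calc _ ≤ 1 * vonMangoldt p.2 := mul_le_mul (hloM _) (hloL _) (abs_nonneg _) zero_le_one
          _ = _ := one_mul _
      · rw [Nat.sum_divisorsAntidiagonal' (f := fun _ m => vonMangoldt m), vonMangoldt_sum]
        exact log_le_log_cut hd
    · rw [hzeta, hzeta, if_neg (by omega), if_neg (by omega)]
      simp
  have hT3 := htwo hmul hf hE0 hE (by omega : 1 ≤ U) hs hx0 (a := hi vonMangoldt U)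
    (b := hi muR U * zetaR) (fun n hn => by rw [hi_apply, if_pos hn]) (fun n hn => by
      rw [mul_apply]
      refine Finset.sum_eq_zero fun p hp => ?_
      rw [Nat.mem_divisorsAntidiagonal] at hp
      have : p.1 ≤ n := Nat.le_of_dvd (Nat.pos_of_ne_zero hp.2) ⟨_, hp.1.symm⟩
      rw [hi_apply, if_pos (this.trans hn), zero_mul]) (fun n hn => by
      rw [hi_apply]
      split_ifs
      · simp only [abs_zero]; linarith
      · rw [abs_of_nonneg vonMangoldt_nonneg]
        exact vonMangoldt_le_log.trans (log_le_log_cut hn)) (fun n => by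
      refine (abs_mul_apply_le (g := fun _ _ => 1) fun p _ => ?_).trans (le_of_eq ?_)
      · exact mul_le_one₀ (hhiM _) (abs_nonneg _) (hzle _)
      · rw [Finset.sum_const, nsmul_eq_mul, mul_one, ← Nat.map_div_right_divisors,
          Finset.card_map])
  simp_rw [hsplit]
  calc _ ≤ ∑ i ∈ s, ((U + 1) * (E * ((2 + C₁) * L ^ 3)) +
        ((U * U : ℕ) + 1) * (E * ((2 + C₁) * L ^ 3)) +
        ‖∑ n ∈ Finset.range N, (((hi vonMangoldt U * (hi muR U * zetaR)) n : ℝ) : ℂ) *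
        (f i n * (wt x n : ℂ))‖) := by
        refine Finset.sum_le_sum fun i hi => ?_
        refine (norm_add_le _ _).trans (add_le_add_left ((norm_sub_le _ _).trans ?_) _)
        exact add_le_add (hT1 i hi) (hT2 i hi)
    _ = (s.card * E) * ((U + 1 + ((U : ℝ) * U + 1)) * ((2 + C₁) * L ^ 3)) +
        ∑ i ∈ s, ‖∑ n ∈ Finset.range N, (((hi vonMangoldt U * (hi muR U * zetaR)) n : ℝ) : ℂ) *
        (f i n * (wt x n : ℂ))‖ := by
        rw [Finset.sum_add_distrib, Finset.sum_const, nsmul_eq_mul]; push_cast; ring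
    _ ≤ U * ((U + 1 + ((U : ℝ) * U + 1)) * ((2 + C₁) * L ^ 3)) + C₂ * x * L ^ 5 := by
        refine add_le_add (mul_le_mul_of_nonneg_right hs (by positivity)) hT3
    _ ≤ (4 * x) * ((2 + C₁) * L ^ 5) + C₂ * x * L ^ 5 := by
        have h1 : (U : ℝ) * (U + 1 + ((U : ℝ) * U + 1)) ≤ 4 * x := by nlinarith
        have h2 : L ^ 3 ≤ L ^ 5 := pow_le_pow_right₀ hL1 (by norm_num)
        rw [← mul_assoc]
        gcongr
    _ = _ := by ring

/-- The nonprincipal primitive characters of conductor at most `Q`. -/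
noncomputable def primSet (Q : ℕ) : Finset (Σ r : ℕ, DirichletCharacter ℂ r) :=
  (Finset.Icc 1 Q).sigma fun _ => Finset.univ.filter fun χ => χ.IsPrimitive ∧ χ ≠ 1

lemma mem_primSet {Q : ℕ} {p : Σ r : ℕ, DirichletCharacter ℂ r} :
    p ∈ primSet Q ↔ (1 ≤ p.1 ∧ p.1 ≤ Q) ∧ p.2.IsPrimitive ∧ p.2 ≠ 1 := by
  simp [primSet]

lemma card_characters_le (r : ℕ) [NeZero r] : Fintype.card (DirichletCharacter ℂ r) ≤ r := by
  rw [← Nat.card_eq_fintype_card,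
    DirichletCharacter.card_eq_totient_of_hasEnoughRootsOfUnity]
  exact Nat.totient_le r

lemma card_primSet_le (Q : ℕ) : (primSet Q).card ≤ Q ^ 2 := by
  rw [primSet, Finset.card_sigma]
  refine (Finset.sum_le_card_nsmul _ _ Q fun r hr => ?_).trans (by simp [sq])
  rw [Finset.mem_Icc] at hr
  have : NeZero r := ⟨by omega⟩
  exact (Finset.card_le_univ _).trans ((card_characters_le r).trans hr.2)

/-- A weak mean value theorem for primes in progressions, for primitive characters. -/
theorem sum_primSet_psiW_le : ∃ C : ℝ, 0 ≤ C ∧ ∀ Q : ℕ, 2 ≤ Q → ∀ x : ℝ, (Q : ℝ) ^ 12 ≤ x →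
    ∑ p ∈ primSet Q, ‖psiW x p.2‖ ≤ C * x * (1 + Real.log (cut x)) ^ 5 := by
  obtain ⟨C, hC, h⟩ := vaughan_bound
  refine ⟨C, hC, fun Q hQ x hx => ?_⟩
  have hQ1 : (1 : ℝ) ≤ Q := by exact_mod_cast (by omega : 1 ≤ Q)
  have := h (s := primSet Q) (f := fun p n => p.2 (n : ZMod p.1)) (fun p m n => by
      rw [Nat.cast_mul, map_mul]) (fun p n => p.2.norm_le_one _) (E := (Q : ℝ) ^ 2) (by positivity)
    (fun p hp N => ?_) (fun p hp p' hp' hne N => ?_) (U := Q ^ 4) ?_ ?_ (x := x) ?_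
  · exact this
  · rw [mem_primSet] at hp
    have : NeZero p.1 := ⟨by omega⟩
    refine (norm_sum_range_char_le hp.2.2 N).trans ?_
    have : (p.1 : ℝ) ≤ Q := by exact_mod_cast hp.1.2
    nlinarith
  · rw [mem_primSet] at hp hp'
    have : NeZero p.1 := ⟨by omega⟩
    have : NeZero p'.1 := ⟨by omega⟩
    have hne1 : mulLift p.2 p'.2⁻¹ ≠ 1 := fun h1 =>
      hne (sigma_eq_of_mulLift_inv_eq_one hp.2.1 hp'.2.1 h1)
    have e : ∀ n : ℕ, p.2 (n : ZMod p.1) * starRingEnd ℂ (p'.2 (n : ZMod p'.1)) =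
        mulLift p.2 p'.2⁻¹ (n : ZMod (p.1 * p'.1)) := by
      intro n
      rw [mulLift_natCast, ← MulChar.star_apply']; rfl
    simp only [e]
    refine (norm_sum_range_char_le hne1 N).trans ?_
    rw [sq]
    exact_mod_cast Nat.mul_le_mul hp.1.2 hp'.1.2
  · calc 3 ≤ 2 ^ 4 := by norm_num
      _ ≤ Q ^ 4 := Nat.pow_le_pow_left hQ 4
  · have : ((primSet Q).card : ℝ) ≤ (Q : ℝ) ^ 2 := by exact_mod_cast card_primSet_le Q
    push_cast
    calc _ ≤ (Q : ℝ) ^ 2 * (Q : ℝ) ^ 2 := by gcongr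
      _ = _ := by ring
  · push_cast
    rw [← pow_mul]
    exact hx

lemma wt_eq_zero_of_le {x : ℝ} {n : ℕ} (hn : 0 < n) (h : Real.exp 2 * n ≤ x) : wt x n = 0 := by
  have hn' : (0 : ℝ) < n := by exact_mod_cast hn
  have hx : 0 < x := lt_of_lt_of_le (by positivity) h
  refine bump_eq_zero (le_trans ?_ (neg_le_abs _))
  rw [← Real.log_inv, inv_div, Real.le_log_iff_exp_le (by positivity), le_div_iff₀ hn']
  exact h

/-- Smoothly localised logarithmic weight on primes. -/
noncomputable def thw (x : ℝ) (n : ℕ) : ℝ := if n.Prime then Real.log n * wt x n else 0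

lemma thw_nonneg (x : ℝ) (n : ℕ) : 0 ≤ thw x n := by
  rw [thw]
  split_ifs
  · exact mul_nonneg (Real.log_natCast_nonneg n) (wt_nonneg x n)
  · exact le_rfl

lemma prime_of_thw_ne_zero {x : ℝ} {n : ℕ} (h : thw x n ≠ 0) : n.Prime := by
  by_contra h'
  exact h (if_neg h')

lemma lt_of_thw_ne_zero {x : ℝ} {n : ℕ} (h : thw x n ≠ 0) : x < Real.exp 2 * n := by
  have hp := prime_of_thw_ne_zero h
  by_contra h'
  rw [thw, if_pos hp, wt_eq_zero_of_le hp.pos (not_lt.1 h'), mul_zero] at h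
  exact h rfl

lemma thw_eq_zero_of_cut_le {x : ℝ} (hx : 0 < x) {n : ℕ} (hn : cut x ≤ n) : thw x n = 0 := by
  rw [thw, wt_eq_zero_of_cut_le hx hn]; simp

lemma coprime_of_thw_ne_zero {x : ℝ} {n m : ℕ} (hm : 0 < m) (hmx : Real.exp 2 * m ≤ x)
    (h : thw x n ≠ 0) : n.Coprime m := by
  rw [Nat.Prime.coprime_iff_not_dvd (prime_of_thw_ne_zero h)]
  intro hd
  have h1 : (n : ℝ) ≤ m := by exact_mod_cast Nat.le_of_dvd hm hd
  have h2 := lt_of_thw_ne_zero h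
  have := mul_le_mul_of_nonneg_left h1 (Real.exp_pos 2).le
  linarith

/-- Smoothed sum of a character over primes. -/
noncomputable def thetaW {q : ℕ} (x : ℝ) (χ : DirichletCharacter ℂ q) : ℂ :=
  ∑ n ∈ Finset.range (cut x), χ (n : ZMod q) * (thw x n : ℂ)

/-- Smoothed prime counting sum. -/
noncomputable def totalW (x : ℝ) : ℝ := ∑ n ∈ Finset.range (cut x), thw x n

/-- The nonprincipal characters modulo `m`. -/
noncomputable def nonprincipal (m : ℕ) : Finset (DirichletCharacter ℂ m) := Finset.univ.erase 1

lemma mem_nonprincipal {m : ℕ} {χ : DirichletCharacter ℂ m} : χ ∈ nonprincipal m ↔ χ ≠ 1 := by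
  simp [nonprincipal]

/-- Bound for the error term in the prime number theorem in progressions modulo `m`. -/
noncomputable def err (x : ℝ) (m : ℕ) : ℝ :=
  1 / (m.totient : ℝ) * ∑ χ ∈ nonprincipal m, ‖thetaW x χ‖

lemma err_nonneg (x : ℝ) (m : ℕ) : 0 ≤ err x m :=
  mul_nonneg (by positivity) (Finset.sum_nonneg fun _ _ => norm_nonneg _)

lemma thetaW_one {m : ℕ} (hm : 0 < m) {x : ℝ} (hmx : Real.exp 2 * m ≤ x) :
    thetaW x (1 : DirichletCharacter ℂ m) = totalW x := by
  rw [thetaW, totalW]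
  push_cast
  refine Finset.sum_congr rfl fun n _ => ?_
  by_cases h : thw x n = 0
  · simp [h]
  · rw [MulChar.one_apply ((ZMod.isUnit_iff_coprime _ _).2 (coprime_of_thw_ne_zero hm hmx h)),
      one_mul]

lemma progression_sum {m : ℕ} [NeZero m] {x : ℝ} (hmx : Real.exp 2 * m ≤ x) {a : ZMod m}
    (ha : IsUnit a) :
    |∑ n ∈ Finset.range (cut x), (if (n : ZMod m) = a then thw x n else 0) -
      totalW x / m.totient| ≤ err x m := by
  have hm : 0 < m := Nat.pos_of_ne_zero (NeZero.ne m)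
  have hφ : (m.totient : ℂ) ≠ 0 := by exact_mod_cast (Nat.totient_pos.2 hm).ne'
  have e1 : ((∑ n ∈ Finset.range (cut x), (if (n : ZMod m) = a then thw x n else 0) : ℝ) : ℂ) =
      1 / (m.totient : ℂ) * ∑ χ : DirichletCharacter ℂ m, χ a⁻¹ * thetaW x χ := by
    simp only [thetaW, Finset.mul_sum]
    rw [Finset.sum_comm]
    push_cast
    refine Finset.sum_congr rfl fun n _ => ?_
    have := DirichletCharacter.sum_char_inv_mul_char_eq ℂ ha (n : ZMod m)
    have e2 : ∑ χ : DirichletCharacter ℂ m, 1 / (m.totient : ℂ) *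
        (χ a⁻¹ * (χ (n : ZMod m) * (thw x n : ℂ))) =
        1 / (m.totient : ℂ) * (thw x n : ℂ) * ∑ χ : DirichletCharacter ℂ m,
          χ a⁻¹ * χ (n : ZMod m) := by
      rw [Finset.mul_sum]
      exact Finset.sum_congr rfl fun χ _ => by ring
    rw [e2, this]
    by_cases h : (n : ZMod m) = a
    · rw [if_pos h, if_pos h.symm]; field_simp
    · rw [if_neg h, if_neg (fun h' => h h'.symm)]; simp
  have e3 : ((∑ n ∈ Finset.range (cut x), (if (n : ZMod m) = a then thw x n else 0) -
      totalW x / m.totient : ℝ) : ℂ) = 1 / (m.totient : ℂ) *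
        ∑ χ ∈ nonprincipal m, χ a⁻¹ * thetaW x χ := by
    rw [Complex.ofReal_sub, e1]
    have hinv : IsUnit (a⁻¹) := by
      obtain ⟨u, rfl⟩ := ha
      rw [ZMod.inv_coe_unit]; exact Units.isUnit _
    rw [nonprincipal, ← Finset.add_sum_erase _ _ (Finset.mem_univ (1 : DirichletCharacter ℂ m)),
      thetaW_one hm hmx, MulChar.one_apply hinv]
    push_cast
    ring_nf
    congr!
  have e4 := congrArg norm e3
  rw [Complex.norm_real, Real.norm_eq_abs] at e4
  rw [e4, err, norm_mul, norm_div, norm_one, Complex.norm_natCast]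
  refine mul_le_mul_of_nonneg_left ((norm_sum_le _ _).trans (Finset.sum_le_sum fun χ _ => ?_))
    (by positivity)
  rw [norm_mul]
  exact mul_le_of_le_one_left (norm_nonneg _) (χ.norm_le_one _)

lemma thetaW_primitiveCharacter {m : ℕ} (hm : 0 < m) {x : ℝ} (hmx : Real.exp 2 * m ≤ x)
    (χ : DirichletCharacter ℂ m) : thetaW x χ.primitiveCharacter = thetaW x χ := by
  rw [thetaW, thetaW]
  refine Finset.sum_congr rfl fun n _ => ?_
  by_cases h : thw x n = 0
  · simp [h]
  · congr 1
    have hc := coprime_of_thw_ne_zero hm hmx h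
    conv_rhs => rw [← χ.changeLevel_primitiveCharacter]
    rw [changeLevel_natCast _ _ hc]

lemma norm_thetaW_sub_psiW_le {q : ℕ} (x : ℝ) (χ : DirichletCharacter ℂ q) :
    ‖thetaW x χ - psiW x χ‖ ≤ 2 * Real.sqrt (cut x) * Real.log (cut x) := by
  have hN : (1 : ℝ) ≤ cut x := by exact_mod_cast Nat.succ_pos _
  refine le_trans ?_ (Chebyshev.abs_psi_sub_theta_le_sqrt_mul_log hN)
  refine le_trans ?_ (le_abs_self _)
  have h1 : Chebyshev.psi (cut x) - Chebyshev.theta (cut x) =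
      ∑ n ∈ Finset.Ioc 0 (cut x), (ArithmeticFunction.vonMangoldt n -
        if n.Prime then Real.log n else 0) := by
    rw [Chebyshev.psi, Chebyshev.theta, Nat.floor_natCast, Finset.sum_filter,
      ← Finset.sum_sub_distrib]
  have h2 : ∀ n : ℕ, 0 ≤ ArithmeticFunction.vonMangoldt n - if n.Prime then Real.log n else 0 := by
    intro n
    split_ifs with hp
    · rw [ArithmeticFunction.vonMangoldt_apply_prime hp, sub_self]
    · simp [ArithmeticFunction.vonMangoldt_nonneg]
  have h3 : ∑ n ∈ Finset.range (cut x), (ArithmeticFunction.vonMangoldt n -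
        if n.Prime then Real.log n else 0) ≤ Chebyshev.psi (cut x) - Chebyshev.theta (cut x) := by
    rw [h1, Finset.range_eq_Ico]
    rw [Finset.sum_eq_sum_Ico_succ_bot (show 0 < cut x from Nat.succ_pos _)]
    simp only [ArithmeticFunction.map_zero, Nat.not_prime_zero, if_false, sub_self, zero_add]
    refine Finset.sum_le_sum_of_subset_of_nonneg ?_ fun n _ _ => h2 n
    intro n hn
    rw [Finset.mem_Ico] at hn
    rw [Finset.mem_Ioc]
    omega
  refine le_trans ?_ h3
  rw [thetaW, psiW, ← Finset.sum_sub_distrib]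
  refine (norm_sum_le _ _).trans (Finset.sum_le_sum fun n _ => ?_)
  have e : χ (n : ZMod q) * (thw x n : ℂ) - twist χ n * (wt x n : ℂ) =
      -(χ (n : ZMod q) * (((ArithmeticFunction.vonMangoldt n -
        if n.Prime then Real.log n else 0) * wt x n : ℝ) : ℂ)) := by
    rw [thw, twist]
    simp only [Pi.mul_apply]
    split_ifs <;> push_cast <;> ring
  rw [e, norm_neg, norm_mul, Complex.norm_real, Real.norm_of_nonneg (mul_nonneg (h2 n) (wt_nonneg _ _))]
  calc _ ≤ 1 * ((ArithmeticFunction.vonMangoldt n - if n.Prime then Real.log n else 0) * 1) := by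
        refine mul_le_mul (χ.norm_le_one _) (mul_le_mul_of_nonneg_left (wt_le_one _ _) (h2 n))
          (mul_nonneg (h2 n) (wt_nonneg _ _)) zero_le_one
    _ = _ := by ring

lemma err_le_sum_primSet {m M : ℕ} (hm : 0 < m) (hmM : m ≤ M) {x : ℝ}
    (hmx : Real.exp 2 * M ≤ x) :
    err x m ≤ 1 / (m.totient : ℝ) * ∑ p ∈ primSet M, if p.1 ∣ m then ‖thetaW x p.2‖ else 0 := by
  have : NeZero m := ⟨hm.ne'⟩
  have hmx' : Real.exp 2 * m ≤ x := by
    have : (m : ℝ) ≤ M := by exact_mod_cast hmM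
    have := mul_le_mul_of_nonneg_left this (Real.exp_pos 2).le
    linarith
  refine mul_le_mul_of_nonneg_left ?_ (by positivity)
  rw [← Finset.sum_filter]
  set P : DirichletCharacter ℂ m → Σ r : ℕ, DirichletCharacter ℂ r :=
    fun χ => ⟨χ.conductor, χ.primitiveCharacter⟩ with hP
  have hinj : Function.Injective P := by
    refine Function.LeftInverse.injective (g := fun p => if h : p.1 ∣ m then
      DirichletCharacter.changeLevel h p.2 else 1) fun χ => ?_
    simp only [hP]
    rw [dif_pos χ.conductor_dvd_level]
    exact χ.changeLevel_primitiveCharacter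
  have e : ∑ χ ∈ nonprincipal m, ‖thetaW x χ‖ =
      ∑ p ∈ (nonprincipal m).image P,
        ‖thetaW x p.2‖ := by
    rw [Finset.sum_image fun _ _ _ _ h => hinj h]
    refine Finset.sum_congr rfl fun χ _ => ?_
    rw [thetaW_primitiveCharacter hm hmx']
  rw [e]
  refine Finset.sum_le_sum_of_subset_of_nonneg ?_ fun _ _ _ => norm_nonneg _
  intro p hp
  rw [Finset.mem_image] at hp
  obtain ⟨χ, hχ, rfl⟩ := hp
  rw [mem_nonprincipal] at hχ
  rw [Finset.mem_filter, mem_primSet]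
  have hd := χ.conductor_dvd_level
  have hpos : 0 < χ.conductor := Nat.pos_of_dvd_of_pos hd hm
  refine ⟨⟨⟨hpos, (Nat.le_of_dvd hm hd).trans hmM⟩, χ.primitiveCharacter_isPrimitive, ?_⟩, hd⟩
  intro h
  apply hχ
  rw [← χ.changeLevel_primitiveCharacter]
  change DirichletCharacter.changeLevel hd χ.primitiveCharacter = 1
  have h : χ.primitiveCharacter = 1 := h
  rw [h, map_one]

lemma le_two_pow_mul_totient (n : ℕ) : n ≤ 2 ^ n.primeFactors.card * n.totient := by
  have h := Nat.totient_mul_prod_primeFactors n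
  have h1 : ∏ p ∈ n.primeFactors, p ≤ 2 ^ n.primeFactors.card * ∏ p ∈ n.primeFactors, (p - 1) := by
    rw [← Finset.prod_const, ← Finset.prod_mul_distrib]
    refine Finset.prod_le_prod' fun p hp => ?_
    have := (Nat.prime_of_mem_primeFactors hp).two_le
    omega
  have h2 : 0 < ∏ p ∈ n.primeFactors, p :=
    Finset.prod_pos fun p hp => (Nat.prime_of_mem_primeFactors hp).pos
  refine Nat.le_of_mul_le_mul_right ?_ h2
  calc _ ≤ n * (2 ^ n.primeFactors.card * ∏ p ∈ n.primeFactors, (p - 1)) :=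
        Nat.mul_le_mul_left _ h1
    _ = 2 ^ n.primeFactors.card * (n * ∏ p ∈ n.primeFactors, (p - 1)) := by ring
    _ = _ := by rw [← h]; ring

lemma sq_pow_card_primeFactors_le (K : ℕ) (hK : 0 < K) {n : ℕ} (hn : 0 < n) :
    (K ^ n.primeFactors.card) ^ 2 ≤ (K ^ 2) ^ (K ^ 2) * n := by
  have hK2 : 1 ≤ K ^ 2 := Nat.one_le_pow _ _ hK
  calc (K ^ n.primeFactors.card) ^ 2 = ∏ p ∈ n.primeFactors, K ^ 2 := by
        rw [Finset.prod_const]; ring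
    _ ≤ ∏ p ∈ n.primeFactors, ((if p < K ^ 2 then K ^ 2 else 1) * p) := by
        refine Finset.prod_le_prod' fun p hp => ?_
        have := (Nat.prime_of_mem_primeFactors hp).pos
        split_ifs with h
        · exact Nat.le_mul_of_pos_right _ this
        · rw [one_mul]; omega
    _ = (K ^ 2) ^ (n.primeFactors.filter (· < K ^ 2)).card * ∏ p ∈ n.primeFactors, p := by
        rw [Finset.prod_mul_distrib, ← Finset.prod_filter, Finset.prod_const]
    _ ≤ _ := by
        refine Nat.mul_le_mul (Nat.pow_le_pow_right hK2 ?_)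
          (Nat.le_of_dvd hn (Nat.prod_primeFactors_dvd n))
        refine (Finset.card_le_card (t := Finset.range (K ^ 2)) ?_).trans (by simp)
        intro p hp
        simpa using (Finset.mem_filter.1 hp).2

lemma pow_card_primeFactors_le (K : ℕ) (hK : 0 < K) {n : ℕ} (hn : 0 < n) :
    (K : ℝ) ^ n.primeFactors.card ≤ (K : ℝ) ^ (K ^ 2) * Real.sqrt n := by
  have h : (((K : ℝ) ^ n.primeFactors.card) ^ 2) ≤ ((K : ℝ) ^ (K ^ 2)) ^ 2 * n := by
    have := sq_pow_card_primeFactors_le K hK hn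
    rw [pow_right_comm K 2] at this
    exact_mod_cast this
  refine abs_le_of_sq_le_sq' ?_ (by positivity) |>.2
  rw [mul_pow, Real.sq_sqrt (Nat.cast_nonneg n)]
  exact h

lemma card_primeFactors_mul_le (a b : ℕ) (ha : a ≠ 0) (hb : b ≠ 0) :
    (a * b).primeFactors.card ≤ a.primeFactors.card + b.primeFactors.card := by
  rw [Nat.primeFactors_mul ha hb]
  exact Finset.card_union_le _ _

lemma two_pow_card_primeFactors_le {n : ℕ} (hn : n ≠ 0) :
    2 ^ n.primeFactors.card ≤ n.divisors.card := by
  rw [Nat.card_divisors hn, ← Finset.prod_const]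
  refine Finset.prod_le_prod' fun p hp => ?_
  have := (Nat.prime_of_mem_primeFactors hp).factorization_pos_of_dvd hn
    (Nat.dvd_of_mem_primeFactors hp)
  omega

lemma pow_card_primeFactors_le_divisors {K c n : ℕ} (hc : K ≤ 2 ^ c) (hn : n ≠ 0) :
    K ^ n.primeFactors.card ≤ n.divisors.card ^ c :=
  calc _ ≤ (2 ^ c) ^ n.primeFactors.card := Nat.pow_le_pow_left hc _
    _ = (2 ^ n.primeFactors.card) ^ c := by rw [← pow_mul, ← pow_mul, mul_comm]
    _ ≤ _ := Nat.pow_le_pow_left (two_pow_card_primeFactors_le hn) _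

lemma sum_pow_card_primeFactors_div_le {K c : ℕ} (hc : K ≤ 2 ^ c) (Y : ℕ) :
    ∑ l ∈ Finset.Icc 1 Y, (K : ℝ) ^ l.primeFactors.card / l ≤
      (1 + Real.log (Y + 1 : ℕ)) ^ (2 ^ c) := by
  have h1 : ∑ l ∈ Finset.Icc 1 Y, (K : ℝ) ^ l.primeFactors.card / l ≤
      ∑ l ∈ Finset.range (Y + 1), (l.divisors.card : ℝ) ^ c / l := by
    refine (Finset.sum_le_sum fun l hl => ?_).trans
      (Finset.sum_le_sum_of_subset_of_nonneg ?_ fun _ _ _ => by positivity)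
    · rw [Finset.mem_Icc] at hl
      refine div_le_div_of_nonneg_right ?_ (by positivity)
      exact_mod_cast pow_card_primeFactors_le_divisors hc (by omega)
    · intro l hl
      rw [Finset.mem_Icc] at hl
      rw [Finset.mem_range]; omega
  refine h1.trans ((sum_card_divisors_pow_div_le c (Y + 1)).trans ?_)
  exact pow_le_pow_left₀ (Finset.sum_nonneg fun _ _ => by positivity) (sum_inv_le _) _

/-- Sums of multiplicative weights over moduli divisible by a given conductor. -/
lemma sum_moduli_le (W K : ℕ) (hW : 0 < W) (hK : 0 < K) : ∃ C : ℝ, ∃ c : ℕ, 0 ≤ C ∧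
    ∀ r : ℕ, 0 < r → ∀ Y : ℕ,
      ∑ q ∈ (Finset.Icc 1 Y).filter (fun q => r ∣ W * q),
        (K : ℝ) ^ q.primeFactors.card / ((W * q).totient : ℝ) ≤
      C / Real.sqrt r * (1 + Real.log (Y + 1 : ℕ)) ^ c := by
  obtain ⟨c, hc⟩ : ∃ c : ℕ, 2 * K ≤ 2 ^ c := ⟨2 * K, Nat.lt_two_pow_self.le⟩
  refine ⟨((2 * K : ℕ) : ℝ) ^ ((2 * K) ^ 2) * Real.sqrt W, 2 ^ c, by positivity, fun r hr Y => ?_⟩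
  set r' := r / r.gcd W with hr'
  have hg : 0 < r.gcd W := Nat.gcd_pos_of_pos_left _ hr
  have hgr : r.gcd W * r' = r := Nat.mul_div_cancel' (Nat.gcd_dvd_left _ _)
  have hr'0 : 0 < r' := by
    rcases Nat.eq_zero_or_pos r' with h | h
    · rw [h, mul_zero] at hgr; omega
    · exact h
  have hrW : r ≤ W * r' := by
    conv_lhs => rw [← hgr]
    exact Nat.mul_le_mul_right _ (Nat.le_of_dvd hW (Nat.gcd_dvd_right _ _))
  have hsub : (Finset.Icc 1 Y).filter (fun q => r ∣ W * q) ⊆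
      (Finset.Icc 1 Y).image (fun l => r' * l) := by
    intro q hq
    rw [Finset.mem_filter, Finset.mem_Icc] at hq
    have : r' ∣ q := by
      have h1 : r' ∣ (W / r.gcd W) * q := by
        refine Nat.dvd_of_mul_dvd_mul_left hg ?_
        rw [hgr, ← mul_assoc, Nat.mul_div_cancel' (Nat.gcd_dvd_right _ _)]
        exact hq.2
      exact (Nat.coprime_div_gcd_div_gcd hg).dvd_of_dvd_mul_left h1
    obtain ⟨l, rfl⟩ := this
    rw [Finset.mem_image]
    refine ⟨l, ?_, rfl⟩
    have hl : 0 < l := Nat.pos_of_ne_zero (by rintro rfl; simp at hq)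
    rw [Finset.mem_Icc]
    exact ⟨hl, (Nat.le_mul_of_pos_left l hr'0).trans hq.1.2⟩
  have hterm : ∀ l ∈ Finset.Icc 1 Y, (K : ℝ) ^ (r' * l).primeFactors.card /
      ((W * (r' * l)).totient : ℝ) ≤ (((2 * K : ℕ) : ℝ) ^ r'.primeFactors.card / r') *
        (((2 * K : ℕ) : ℝ) ^ l.primeFactors.card / l) := by
    intro l hl
    rw [Finset.mem_Icc] at hl
    have hl0 : 0 < l := hl.1
    set n := r' * l with hn
    have hn0 : 0 < n := Nat.mul_pos hr'0 hl0
    have h1 : n ≤ 2 ^ n.primeFactors.card * (W * n).totient :=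
      calc n ≤ 2 ^ n.primeFactors.card * n.totient := le_two_pow_mul_totient n
        _ ≤ _ := Nat.mul_le_mul_left _ (by
          calc n.totient ≤ W.totient * n.totient :=
                Nat.le_mul_of_pos_left _ (Nat.totient_pos.2 hW)
            _ ≤ _ := Nat.totient_super_multiplicative W n)
    have hφ : (0 : ℝ) < (W * n).totient := by
      exact_mod_cast Nat.totient_pos.2 (Nat.mul_pos hW hn0)
    have hn0' : (0 : ℝ) < n := by exact_mod_cast hn0
    have h1' : (n : ℝ) ≤ 2 ^ n.primeFactors.card * (W * n).totient := by exact_mod_cast h1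
    have h2 : (K : ℝ) ^ n.primeFactors.card / ((W * n).totient : ℝ) ≤
        ((2 * K : ℕ) : ℝ) ^ n.primeFactors.card / n := by
      rw [div_le_div_iff₀ hφ hn0']
      push_cast
      rw [mul_pow]
      calc _ ≤ (K : ℝ) ^ n.primeFactors.card * (2 ^ n.primeFactors.card * (W * n).totient) := by
            gcongr
        _ = _ := by ring
    refine h2.trans ?_
    rw [div_mul_div_comm, ← pow_add, hn]
    push_cast
    refine div_le_div_of_nonneg_right ?_ (by positivity)
    refine pow_le_pow_right₀ ?_ (card_primeFactors_mul_le _ _ hr'0.ne' hl0.ne')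
    have : (1 : ℝ) ≤ K := by exact_mod_cast hK
    linarith
  calc _ ≤ ∑ q ∈ (Finset.Icc 1 Y).image (fun l => r' * l),
        (K : ℝ) ^ q.primeFactors.card / ((W * q).totient : ℝ) :=
        Finset.sum_le_sum_of_subset_of_nonneg hsub fun _ _ _ => by positivity
    _ = ∑ l ∈ Finset.Icc 1 Y, (K : ℝ) ^ (r' * l).primeFactors.card /
      ((W * (r' * l)).totient : ℝ) := Finset.sum_image fun a _ b _ h =>
        Nat.eq_of_mul_eq_mul_left hr'0 h
    _ ≤ _ := Finset.sum_le_sum hterm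
    _ = (((2 * K : ℕ) : ℝ) ^ r'.primeFactors.card / r') * ∑ l ∈ Finset.Icc 1 Y,
        (((2 * K : ℕ) : ℝ) ^ l.primeFactors.card / l) := by rw [Finset.mul_sum]
    _ ≤ (((2 * K : ℕ) : ℝ) ^ ((2 * K) ^ 2) * Real.sqrt W / Real.sqrt r) *
        (1 + Real.log (Y + 1 : ℕ)) ^ (2 ^ c) := by
        refine mul_le_mul ?_ (sum_pow_card_primeFactors_div_le hc Y)
          (Finset.sum_nonneg fun _ _ => by positivity) (by positivity)
        have hs : Real.sqrt r ≤ Real.sqrt W * Real.sqrt r' := by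
          rw [← Real.sqrt_mul (Nat.cast_nonneg W)]
          exact Real.sqrt_le_sqrt (by exact_mod_cast hrW)
        have hsr : 0 < Real.sqrt r := Real.sqrt_pos.2 (by exact_mod_cast hr)
        have hr'p : (0 : ℝ) < r' := by exact_mod_cast hr'0
        rw [div_le_div_iff₀ hr'p hsr]
        calc _ ≤ (((2 * K : ℕ) : ℝ) ^ ((2 * K) ^ 2) * Real.sqrt r') *
              (Real.sqrt W * Real.sqrt r') :=
              mul_le_mul (pow_card_primeFactors_le _ (by omega) hr'0) hs (by positivity)
                (by positivity)
          _ = ((2 * K : ℕ) : ℝ) ^ ((2 * K) ^ 2) * Real.sqrt W *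
            (Real.sqrt r' * Real.sqrt r') := by ring
          _ = _ := by rw [Real.mul_self_sqrt hr'p.le]

lemma eventually_mul_pow_le_exp (C : ℝ) (a : ℕ) {b : ℝ} (hb : 0 < b) :
    ∀ᶠ l : ℝ in atTop, C * l ^ a ≤ Real.exp (b * l) := by
  have h1 := (isLittleO_pow_exp_pos_mul_atTop a hb).const_mul_left C
  have h2 := h1.bound (c := 1) one_pos
  filter_upwards [h2] with l hl
  rw [one_mul, Real.norm_eq_abs, Real.norm_eq_abs, abs_of_pos (Real.exp_pos _)] at hl
  exact (le_abs_self _).trans hl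

lemma sum_err_le {W K c Y : ℕ} {C x T E S A : ℝ} (hW : 0 < W) (hC : 0 ≤ C) (hT : 0 < T)
    (hg : ∀ r : ℕ, 0 < r → ∑ q ∈ (Finset.Icc 1 Y).filter (fun q => r ∣ W * q),
        (K : ℝ) ^ q.primeFactors.card / ((W * q).totient : ℝ) ≤
      C / Real.sqrt r * (1 + Real.log (Y + 1 : ℕ)) ^ c)
    (hx : Real.exp 2 * (W * Y : ℕ) ≤ x)
    (hE : 2 * Real.sqrt (cut x) * Real.log (cut x) ≤ E)
    (hS : ∀ p ∈ primSet (W * Y), (p.1 : ℝ) ≤ T → ‖psiW x p.2‖ ≤ S) (hS0 : 0 ≤ S)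
    (hA : ∑ p ∈ primSet (W * Y), ‖psiW x p.2‖ ≤ A) :
    ∑ q ∈ Finset.Icc 1 Y, (K : ℝ) ^ q.primeFactors.card * err x (W * q) ≤
      C * (1 + Real.log (Y + 1 : ℕ)) ^ c *
        (E * ((W * Y : ℕ) : ℝ) ^ 2 + T ^ 2 * S + A / Real.sqrt T) := by
  set M := W * Y with hM
  set G := C * (1 + Real.log (Y + 1 : ℕ)) ^ c with hG
  have hlog : 0 ≤ 1 + Real.log (Y + 1 : ℕ) := zero_le_one.trans one_le_one_add_log
  have hG0 : 0 ≤ G := by positivity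
  have hE0 : 0 ≤ E := le_trans (by have := Real.log_natCast_nonneg (cut x); positivity) hE
  have step1 : ∑ q ∈ Finset.Icc 1 Y, (K : ℝ) ^ q.primeFactors.card * err x (W * q) ≤
      ∑ p ∈ primSet M, ‖thetaW x p.2‖ * (G / Real.sqrt p.1) := by
    calc _ ≤ ∑ q ∈ Finset.Icc 1 Y, ∑ p ∈ primSet M, ‖thetaW x p.2‖ *
          (if p.1 ∣ W * q then (K : ℝ) ^ q.primeFactors.card / ((W * q).totient : ℝ) else 0) := by
          refine Finset.sum_le_sum fun q hq => ?_
          rw [Finset.mem_Icc] at hq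
          refine (mul_le_mul_of_nonneg_left (err_le_sum_primSet (M := M) (Nat.mul_pos hW hq.1)
            (Nat.mul_le_mul_left _ hq.2) hx) (by positivity)).trans (le_of_eq ?_)
          rw [Finset.mul_sum, Finset.mul_sum]
          refine Finset.sum_congr rfl fun p _ => ?_
          split_ifs <;> ring
      _ = ∑ p ∈ primSet M, ‖thetaW x p.2‖ * ∑ q ∈ (Finset.Icc 1 Y).filter (fun q => p.1 ∣ W * q),
          (K : ℝ) ^ q.primeFactors.card / ((W * q).totient : ℝ) := by
          rw [Finset.sum_comm]
          refine Finset.sum_congr rfl fun p _ => ?_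
          rw [Finset.sum_filter, Finset.mul_sum]
      _ ≤ _ := by
          refine Finset.sum_le_sum fun p hp => mul_le_mul_of_nonneg_left ?_ (norm_nonneg _)
          refine (hg p.1 (mem_primSet.1 hp).1.1).trans (le_of_eq ?_)
          rw [hG]; ring
  have hr : ∀ p ∈ primSet M, G / Real.sqrt p.1 ≤ G := by
    intro p hp
    have : (1 : ℝ) ≤ p.1 := by exact_mod_cast (mem_primSet.1 hp).1.1
    exact div_le_self hG0 (Real.one_le_sqrt.2 this)
  have step2 : ∀ p ∈ primSet M, ‖thetaW x p.2‖ * (G / Real.sqrt p.1) ≤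
      E * G + (if (p.1 : ℝ) ≤ T then S * G else 0) + ‖psiW x p.2‖ * (G / Real.sqrt T) := by
    intro p hp
    have h1 : ‖thetaW x p.2‖ ≤ ‖psiW x p.2‖ + E := by
      have h := norm_add_le (thetaW x p.2 - psiW x p.2) (psiW x p.2)
      rw [sub_add_cancel] at h
      have := (norm_thetaW_sub_psiW_le x p.2).trans hE
      linarith
    have h2 : ‖thetaW x p.2‖ * (G / Real.sqrt p.1) ≤
        ‖psiW x p.2‖ * (G / Real.sqrt p.1) + E * G := by
      calc _ ≤ (‖psiW x p.2‖ + E) * (G / Real.sqrt p.1) :=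
            mul_le_mul_of_nonneg_right h1 (by positivity)
        _ ≤ _ := by
            rw [add_mul]
            have := mul_le_mul_of_nonneg_left (hr p hp) hE0
            linarith
    refine h2.trans ?_
    split_ifs with h
    · have h3 : ‖psiW x p.2‖ * (G / Real.sqrt p.1) ≤ S * G :=
        mul_le_mul (hS p hp h) (hr p hp) (by positivity) hS0
      have h4 : 0 ≤ ‖psiW x p.2‖ * (G / Real.sqrt T) := by positivity
      linarith
    · have h3 : ‖psiW x p.2‖ * (G / Real.sqrt p.1) ≤ ‖psiW x p.2‖ * (G / Real.sqrt T) := by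
        refine mul_le_mul_of_nonneg_left ?_ (norm_nonneg _)
        exact div_le_div_of_nonneg_left hG0 (Real.sqrt_pos.2 hT) (Real.sqrt_le_sqrt (not_le.1 h).le)
      linarith
  have hcard : (((primSet M).filter (fun p => (p.1 : ℝ) ≤ T)).card : ℝ) ≤ T ^ 2 := by
    have h1 : ((primSet M).filter (fun p => (p.1 : ℝ) ≤ T)).card ≤ (primSet ⌊T⌋₊).card := by
      refine Finset.card_le_card fun p hp => ?_
      rw [Finset.mem_filter, mem_primSet] at hp
      rw [mem_primSet]
      exact ⟨⟨hp.1.1.1, Nat.le_floor hp.2⟩, hp.1.2⟩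
    calc _ ≤ ((⌊T⌋₊ ^ 2 : ℕ) : ℝ) := by exact_mod_cast h1.trans (card_primSet_le _)
      _ ≤ _ := by
        push_cast
        exact pow_le_pow_left₀ (Nat.cast_nonneg _) (Nat.floor_le hT.le) 2
  have hcard2 : ((primSet M).card : ℝ) ≤ (M : ℝ) ^ 2 := by exact_mod_cast card_primSet_le M
  refine step1.trans ((Finset.sum_le_sum step2).trans ?_)
  rw [Finset.sum_add_distrib, Finset.sum_add_distrib, ← Finset.sum_filter,
    Finset.sum_const, Finset.sum_const, nsmul_eq_mul, nsmul_eq_mul, ← Finset.sum_mul]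
  have e1 := mul_le_mul_of_nonneg_right hcard2 (mul_nonneg hE0 hG0)
  have e2 := mul_le_mul_of_nonneg_right hcard (mul_nonneg hS0 hG0)
  have e3 := mul_le_mul_of_nonneg_right hA (show 0 ≤ G / Real.sqrt T by positivity)
  have e4 : G * (E * (M : ℝ) ^ 2 + T ^ 2 * S + A / Real.sqrt T) =
    (M : ℝ) ^ 2 * (E * G) + T ^ 2 * (S * G) + A * (G / Real.sqrt T) := by ring
  rw [e4]
  exact add_le_add (add_le_add e1 e2) e3

lemma cut_exp_le {t : ℝ} (ht : 0 ≤ t) : (cut (Real.exp t) : ℝ) ≤ Real.exp (t + 3) := by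
  rw [cut]
  push_cast
  have h1 := Nat.floor_le (show 0 ≤ Real.exp 2 * Real.exp t by positivity)
  have h2 : Real.exp (t + 3) = Real.exp 2 * Real.exp t * Real.exp 1 := by
    rw [← Real.exp_add, ← Real.exp_add]; ring_nf
  have h3 : (2 : ℝ) ≤ Real.exp 1 := by have := Real.add_one_le_exp 1; linarith
  have h4 : 1 ≤ Real.exp 2 * Real.exp t := by
    rw [← Real.exp_add]; exact Real.one_le_exp (by linarith)
  rw [h2]
  nlinarith

/-- Along a sequence of scales, primes are well distributed in progressions on average. -/
theorem exists_scale_sum_err_le (W K : ℕ) (hW : 0 < W) (hK : 0 < K) (t₀ : ℝ) : ∃ t ≥ t₀,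
    ∑ q ∈ Finset.Icc 1 ⌊Real.exp (t / 24)⌋₊, (K : ℝ) ^ q.primeFactors.card *
      err (Real.exp t) (W * q) ≤ Real.exp t := by
  obtain ⟨C₁, c, hC₁, hg⟩ := sum_moduli_le W K hW hK
  obtain ⟨C₂, hC₂, hLS⟩ := sum_primSet_psiW_le
  set B : ℕ := 2 * (c + 6) with hB
  set j : ℕ := 2 * B + c + 1 with hj
  obtain ⟨C₃, hC₃, hSW⟩ := siegel_walfisz j
  set a := 17 * (j + 2) with ha
  have hB0 : (0 : ℝ) < B := by rw [hB]; positivity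
  have hb : (0 : ℝ) < (B : ℝ)⁻¹ := by positivity
  -- the three smallness conditions in terms of `t = exp (l / B)`
  have htend : Tendsto (fun l : ℝ => Real.exp ((B : ℝ)⁻¹ * l)) atTop atTop :=
    Real.tendsto_exp_atTop.comp (tendsto_id.const_mul_atTop hb)
  have hev : ∀ᶠ l : ℝ in atTop, 1 ≤ l ∧ 3 * (C₁ * 2 ^ c * C₃) * l ^ a ≤ Real.exp ((B : ℝ)⁻¹ * l) ∧
      t₀ ≤ Real.exp ((B : ℝ)⁻¹ * l) ∧ 24 ≤ Real.exp ((B : ℝ)⁻¹ * l) ∧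
      3 * (C₁ * 2 ^ c * (C₂ * 5 ^ 5)) ≤ Real.exp ((B : ℝ)⁻¹ * l) ∧
      3 * (C₁ * 2 ^ c * (10 * Real.exp 2 * W ^ 2)) * (Real.exp ((B : ℝ)⁻¹ * l)) ^ (c + 1) ≤
        Real.exp (5 / 12 * Real.exp ((B : ℝ)⁻¹ * l)) ∧
      (Real.exp 2 * W) * (Real.exp ((B : ℝ)⁻¹ * l)) ^ 0 ≤
        Real.exp (1 / 24 * Real.exp ((B : ℝ)⁻¹ * l)) := by
    refine (eventually_ge_atTop 1).and ((eventually_mul_pow_le_exp _ a hb).and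
      ((htend.eventually_ge_atTop _).and ((htend.eventually_ge_atTop _).and
      ((htend.eventually_ge_atTop _).and ((htend.eventually
        (eventually_mul_pow_le_exp _ (c + 1) (by norm_num))).and (htend.eventually
        (eventually_mul_pow_le_exp _ 0 (by norm_num))))))))
  obtain ⟨l₀, hl₀⟩ := eventually_atTop.1 hev
  obtain ⟨n₀, hn₀⟩ := pow_unbounded_of_one_lt l₀ (one_lt_two : (1 : ℝ) < 2)
  obtain ⟨n, hn, hgood⟩ := exists_good n₀
  have hnl : l₀ ≤ (2 : ℝ) ^ n := hn₀.le.trans (pow_le_pow_right₀ one_le_two hn)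
  obtain ⟨hl1, h1, h2, h3, h4, h5, h6⟩ := hl₀ _ hnl
  set l : ℝ := 2 ^ n with hl
  set t := Real.exp ((B : ℝ)⁻¹ * l) with ht
  clear_value t l
  rw [pow_zero, mul_one] at h6
  have ht0 : 0 < t := by linarith
  have hT : Real.exp l = t ^ B := by
    rw [ht, ← Real.exp_nat_mul]; congr 1; field_simp
  have hx1 : 1 ≤ Real.exp t := Real.one_le_exp ht0.le
  set Y := ⌊Real.exp (t / 24)⌋₊ with hY
  have hYle : (Y : ℝ) ≤ Real.exp (t / 24) := Nat.floor_le (Real.exp_pos _).le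
  have hY2 : 2 ≤ Y := by
    refine Nat.le_floor ?_
    have := Real.add_one_le_exp (t / 24)
    push_cast; linarith
  have hWle : (W : ℝ) ≤ Real.exp (t / 24) := by
    have : (1 : ℝ) ≤ Real.exp 2 := Real.one_le_exp (by norm_num)
    calc (W : ℝ) ≤ Real.exp 2 * W := le_mul_of_one_le_left (Nat.cast_nonneg _) this
      _ ≤ _ := by rw [div_eq_inv_mul, ← one_div]; exact h6
  have hMle : ((W * Y : ℕ) : ℝ) ≤ Real.exp (t / 12) := by
    push_cast
    calc _ ≤ Real.exp (t / 24) * Real.exp (t / 24) := by gcongr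
      _ = _ := by rw [← Real.exp_add]; ring_nf
  have hM2 : 2 ≤ W * Y := hY2.trans (Nat.le_mul_of_pos_left _ hW)
  have hcut := cut_exp_le ht0.le
  have hcut1 : (1 : ℝ) ≤ cut (Real.exp t) := by exact_mod_cast Nat.succ_pos _
  have hlogcut : Real.log (cut (Real.exp t)) ≤ t + 3 := by
    rw [← Real.log_exp (t + 3)]
    exact Real.log_le_log (by linarith) hcut
  have hlogcut0 := Real.log_natCast_nonneg (cut (Real.exp t))
  have hlogY : 1 + Real.log (Y + 1 : ℕ) ≤ 2 * t := by
    have : Real.log (Y + 1 : ℕ) ≤ t / 24 + 1 := by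
      rw [← Real.log_exp (t / 24 + 1)]
      refine Real.log_le_log (by positivity) ?_
      push_cast
      rw [Real.exp_add]
      have h7 : (2 : ℝ) ≤ Real.exp 1 := by have := Real.add_one_le_exp 1; linarith
      have h8 : 1 ≤ Real.exp (t / 24) := Real.one_le_exp (by positivity)
      nlinarith
    linarith
  have hlogY0 : 0 ≤ 1 + Real.log (Y + 1 : ℕ) := zero_le_one.trans one_le_one_add_log
  refine ⟨t, h2, ?_⟩
  have hmain := sum_err_le (K := K) (c := c) (Y := Y) (C := C₁) (x := Real.exp t) (T := t ^ B)
    (E := 10 * Real.exp 2 * Real.exp (t / 2) * t) (S := C₃ * Real.exp t * l ^ a / t ^ j)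
    (A := C₂ * Real.exp t * (5 * t) ^ 5) hW hC₁ (by positivity) (fun r hr => hg r hr Y) ?_ ?_ ?_
    (by positivity) ?_
  · refine hmain.trans ?_
    have hsq : Real.sqrt (t ^ B) = t ^ (c + 6) := by
      rw [hB, mul_comm, pow_mul, Real.sqrt_sq (by positivity)]
    rw [hsq]
    have hpre : C₁ * (1 + Real.log (Y + 1 : ℕ)) ^ c ≤ C₁ * 2 ^ c * t ^ c := by
      rw [mul_assoc, ← mul_pow]
      gcongr
    set x := Real.exp t with hx
    have k1 : C₁ * 2 ^ c * t ^ c * (10 * Real.exp 2 * Real.exp (t / 2) * t *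
        ((W * Y : ℕ) : ℝ) ^ 2) ≤ x / 3 := by
      have e1 : ((W * Y : ℕ) : ℝ) ^ 2 ≤ W ^ 2 * Real.exp (t / 12) := by
        push_cast
        rw [mul_pow]
        have : (Y : ℝ) ^ 2 ≤ Real.exp (t / 12) := by
          calc (Y : ℝ) ^ 2 ≤ Real.exp (t / 24) ^ 2 := by gcongr
            _ = _ := by rw [← Real.exp_nat_mul]; congr 1; push_cast; ring
        gcongr
      calc _ ≤ C₁ * 2 ^ c * t ^ c * (10 * Real.exp 2 * Real.exp (t / 2) * t *
            (W ^ 2 * Real.exp (t / 12))) := by gcongr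
        _ = (Real.exp (t / 2) * Real.exp (t / 12)) *
            (3 * (C₁ * 2 ^ c * (10 * Real.exp 2 * W ^ 2)) * t ^ (c + 1)) / 3 := by ring
        _ ≤ (Real.exp (t / 2) * Real.exp (t / 12)) * Real.exp (5 / 12 * t) / 3 := by gcongr
        _ = x / 3 := by rw [hx, ← Real.exp_add, ← Real.exp_add]; ring_nf
    have k2 : C₁ * 2 ^ c * t ^ c * ((t ^ B) ^ 2 * (C₃ * x * l ^ a / t ^ j)) ≤ x / 3 := by
      have e1 : t ^ j = t ^ c * (t ^ B) ^ 2 * t := by rw [hj]; ring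
      rw [e1]
      have e2 : C₁ * 2 ^ c * t ^ c * ((t ^ B) ^ 2 * (C₃ * x * l ^ a / (t ^ c * (t ^ B) ^ 2 * t))) =
          x * (3 * (C₁ * 2 ^ c * C₃) * l ^ a / t) / 3 := by field_simp
      rw [e2]
      have e3 : 3 * (C₁ * 2 ^ c * C₃) * l ^ a / t ≤ 1 := (div_le_one ht0).2 h1
      have : x * (3 * (C₁ * 2 ^ c * C₃) * l ^ a / t) ≤ x := mul_le_of_le_one_right (by positivity) e3
      linarith
    have k3 : C₁ * 2 ^ c * t ^ c * (C₂ * x * (5 * t) ^ 5 / t ^ (c + 6)) ≤ x / 3 := by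
      have e2 : C₁ * 2 ^ c * t ^ c * (C₂ * x * (5 * t) ^ 5 / t ^ (c + 6)) =
          x * (3 * (C₁ * 2 ^ c * (C₂ * 5 ^ 5)) / t) / 3 := by
        rw [pow_add, mul_pow]; field_simp
      rw [e2]
      have e3 : 3 * (C₁ * 2 ^ c * (C₂ * 5 ^ 5)) / t ≤ 1 := (div_le_one ht0).2 h4
      have : x * (3 * (C₁ * 2 ^ c * (C₂ * 5 ^ 5)) / t) ≤ x :=
        mul_le_of_le_one_right (by positivity) e3
      linarith
    refine (mul_le_mul_of_nonneg_right hpre (by positivity)).trans ?_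
    rw [mul_add, mul_add]
    linarith
  · have : Real.exp t = Real.exp (t / 24) * Real.exp (t * 23 / 24) := by
      rw [← Real.exp_add]; ring_nf
    rw [this]
    push_cast
    rw [← mul_assoc]
    refine mul_le_mul ?_ ?_ (Nat.cast_nonneg _) (Real.exp_pos _).le
    · rw [div_eq_inv_mul, ← one_div]; exact h6
    · exact hYle.trans (Real.exp_le_exp.2 (by linarith))
  · have e1 : Real.sqrt (cut (Real.exp t)) ≤ Real.exp 2 * Real.exp (t / 2) := by
      rw [← Real.exp_add]
      refine Real.sqrt_le_iff.2 ⟨(Real.exp_pos _).le, hcut.trans ?_⟩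
      rw [← Real.exp_nat_mul]
      refine Real.exp_le_exp.2 ?_
      push_cast; linarith
    have e2 : Real.log (cut (Real.exp t)) ≤ 5 * t := by linarith
    calc _ ≤ 2 * (Real.exp 2 * Real.exp (t / 2)) * (5 * t) := by gcongr
      _ = _ := by ring
  · intro p hp hpT
    have hp' := mem_primSet.1 hp
    have : NeZero p.1 := ⟨by omega⟩
    have := hSW p.1 p.2 l hl1 hgood (hpT.trans hT.ge) hp'.2.2 hp'.2.1 (Real.exp t) hx1
    rw [Real.log_exp] at this
    rw [le_div_iff₀ (by positivity)]
    exact this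
  · refine (hLS _ hM2 _ ?_).trans ?_
    · calc _ ≤ Real.exp (t / 12) ^ 12 := by gcongr
        _ = _ := by rw [← Real.exp_nat_mul]; congr 1; push_cast; ring
    · have : 1 + Real.log (cut (Real.exp t)) ≤ 5 * t := by linarith
      gcongr

section QuadraticForms

variable {ι O : Type*} [Fintype ι] [DecidableEq ι] [Fintype O]

lemma posSemidef_of_sum_nonneg {n : Type*} [Fintype n] {M : Matrix n n ℝ}
    (hM : ∀ a b, M a b = M b a) (h : ∀ x : n → ℝ, 0 ≤ ∑ a, ∑ b, x a * x b * M a b) :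
    M.PosSemidef := by
  refine Matrix.PosSemidef.of_dotProduct_mulVec_nonneg ?_ fun x => ?_
  · ext a b
    simpa [Matrix.conjTranspose_apply] using hM b a
  · refine (h x).trans (le_of_eq ?_)
    simp only [dotProduct, Matrix.mulVec, Finset.mul_sum, star_trivial]
    exact Finset.sum_congr rfl fun a _ => Finset.sum_congr rfl fun b _ => by ring

lemma sum_nonneg_of_posSemidef {n : Type*} [Fintype n] {M : Matrix n n ℝ}
    (hM : M.PosSemidef) (x : n → ℝ) : 0 ≤ ∑ a, ∑ b, x a * x b * M a b := by
  refine (hM.dotProduct_mulVec_nonneg x).trans (le_of_eq ?_)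
  simp only [dotProduct, Matrix.mulVec, Finset.mul_sum, star_trivial]
  exact Finset.sum_congr rfl fun a _ => Finset.sum_congr rfl fun b _ => by ring

/-- The tensor product of a family of matrices, restricted to some of the factors. -/
def tensor (A : ι → Matrix O O ℝ) (S : Finset ι) : Matrix (ι → O) (ι → O) ℝ :=
  Matrix.of fun s t => ∏ p ∈ S, A p (s p) (t p)

lemma tensor_posSemidef {A : ι → Matrix O O ℝ} (hA : ∀ p, (A p).PosSemidef) (S : Finset ι) :
    (tensor A S).PosSemidef := by
  induction S using Finset.induction_on with
  | empty =>
    refine posSemidef_of_sum_nonneg (fun _ _ => rfl) fun x => ?_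
    simp only [tensor, Finset.prod_empty, Matrix.of_apply, mul_one, ← Finset.mul_sum,
      ← Finset.sum_mul]
    exact mul_self_nonneg _
  | insert p S hp ih =>
    have : tensor A (insert p S) =
        Matrix.hadamard ((A p).submatrix (fun s : ι → O => s p) fun s => s p) (tensor A S) := by
      ext s t
      simp [tensor, Finset.prod_insert hp]
    rw [this]
    exact ((hA p).submatrix _).hadamard ih

lemma tensor_sub_posSemidef {A B : ι → Matrix O O ℝ} (hA : ∀ p, (A p).PosSemidef)
    (hB : ∀ p, (B p).PosSemidef) (hAB : ∀ p, (A p - B p).PosSemidef) (S : Finset ι) :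
    (tensor A S - tensor B S).PosSemidef := by
  induction S using Finset.induction_on with
  | empty =>
    have : tensor A ∅ - tensor B ∅ = 0 := by ext s t; simp [tensor]
    rw [this]; exact Matrix.PosSemidef.zero
  | insert p S hp ih =>
    have : tensor A (insert p S) - tensor B (insert p S) =
        Matrix.hadamard ((A p - B p).submatrix (fun s : ι → O => s p) fun s => s p) (tensor A S) +
        Matrix.hadamard ((B p).submatrix (fun s : ι → O => s p) fun s => s p)
          (tensor A S - tensor B S) := by
      ext s t
      simp [tensor, Finset.prod_insert hp]
      ring
    rw [this]
    exact (((hAB p).submatrix _).hadamard (tensor_posSemidef hA S)).add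
      (((hB p).submatrix _).hadamard ih)

/-- Lower bound for a tensor product quadratic form by a diagonal one. -/
lemma sum_sq_le_tensor {A : ι → O → O → ℝ} {d : ι → O → ℝ} (hA : ∀ p a b, A p a b = A p b a)
    (hd : ∀ p a, 0 ≤ d p a)
    (hAd : ∀ p (x : O → ℝ), ∑ a, x a ^ 2 * d p a ≤ ∑ a, ∑ b, x a * x b * A p a b)
    (z : (ι → O) → ℝ) :
    ∑ s, z s ^ 2 * ∏ p, d p (s p) ≤ ∑ s, ∑ t, z s * z t * ∏ p, A p (s p) (t p) := by
  have hdiag : ∀ (p : ι) (x : O → ℝ), ∑ a, ∑ b, x a * x b * Matrix.diagonal (d p) a b =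
      ∑ a, x a ^ 2 * d p a := by
    intro p x
    refine Finset.sum_congr rfl fun a _ => ?_
    rw [Finset.sum_eq_single a]
    · rw [Matrix.diagonal_apply_eq]; ring
    · intro b _ hb
      rw [Matrix.diagonal_apply_ne _ hb.symm, mul_zero]
    · simp
  have h1 := tensor_sub_posSemidef (A := fun p => Matrix.of (A p))
    (B := fun p => Matrix.diagonal (d p)) (fun p => posSemidef_of_sum_nonneg (hA p) fun x =>
      (Finset.sum_nonneg fun a _ => mul_nonneg (sq_nonneg _) (hd p a)).trans (hAd p x))
    (fun p => Matrix.PosSemidef.diagonal (hd p))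
    (fun p => posSemidef_of_sum_nonneg (fun a b => ?_) fun x => ?_) Finset.univ
  · have h2 := sum_nonneg_of_posSemidef h1 z
    have h3 : ∑ s, ∑ t, z s * z t * tensor (fun p => Matrix.diagonal (d p)) Finset.univ s t =
        ∑ s, z s ^ 2 * ∏ p, d p (s p) := by
      refine Finset.sum_congr rfl fun s _ => ?_
      rw [Finset.sum_eq_single s]
      · simp only [tensor, Matrix.of_apply, Matrix.diagonal_apply_eq]; ring
      · intro t _ ht
        obtain ⟨p, hp⟩ := Function.ne_iff.1 ht
        have : tensor (fun p => Matrix.diagonal (d p)) Finset.univ s t = 0 :=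
          Finset.prod_eq_zero (Finset.mem_univ p) (Matrix.diagonal_apply_ne _ hp.symm)
        rw [this, mul_zero]
      · simp
    simp only [Matrix.sub_apply, mul_sub, Finset.sum_sub_distrib] at h2
    rw [h3] at h2
    simp only [tensor, Matrix.of_apply] at h2
    linarith
  · simp only [Matrix.sub_apply, Matrix.of_apply, hA p a b]
    by_cases h : a = b
    · rw [h]
    · rw [Matrix.diagonal_apply_ne _ h, Matrix.diagonal_apply_ne _ (Ne.symm h)]
  · simp only [Matrix.sub_apply, mul_sub, Finset.sum_sub_distrib, Matrix.of_apply]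
    rw [hdiag]
    linarith [hAd p x]

/-- Schur's test for a tensor product quadratic form. -/
lemma tensor_le_sum_sq {A : ι → O → O → ℝ} {d : ι → O → ℝ} (hA : ∀ p a b, A p a b = A p b a)
    (hd : ∀ p a, ∑ b, |A p a b| ≤ d p a) (y : (ι → O) → ℝ) :
    ∑ s, ∑ t, y s * y t * ∏ p, A p (s p) (t p) ≤ ∑ s, y s ^ 2 * ∏ p, d p (s p) := by
  have h1 : ∀ s t : ι → O, y s * y t * ∏ p, A p (s p) (t p) ≤
      1 / 2 * (y s ^ 2 * ∏ p, |A p (s p) (t p)|) + 1 / 2 * (y t ^ 2 * ∏ p, |A p (t p) (s p)|) := by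
    intro s t
    have e : ∏ p, |A p (t p) (s p)| = ∏ p, |A p (s p) (t p)| :=
      Finset.prod_congr rfl fun p _ => by rw [hA]
    rw [e]
    have h2 : y s * y t * ∏ p, A p (s p) (t p) ≤ |y s| * |y t| * ∏ p, |A p (s p) (t p)| := by
      rw [← Finset.abs_prod, ← abs_mul, ← abs_mul]
      exact le_abs_self _
    have h3 : 0 ≤ ∏ p, |A p (s p) (t p)| := Finset.prod_nonneg fun _ _ => abs_nonneg _
    nlinarith [mul_nonneg (sq_nonneg (|y s| - |y t|)) h3, sq_abs (y s), sq_abs (y t)]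
  have h4 : ∀ s : ι → O, ∑ t : ι → O, ∏ p, |A p (s p) (t p)| ≤ ∏ p, d p (s p) := by
    intro s
    rw [← Fintype.prod_sum fun p b => |A p (s p) b|]
    exact Finset.prod_le_prod (fun p _ => Finset.sum_nonneg fun _ _ => abs_nonneg _)
      fun p _ => hd p _
  have h5 : ∑ s : ι → O, ∑ t : ι → O, y s ^ 2 * ∏ p, |A p (s p) (t p)| ≤
      ∑ s, y s ^ 2 * ∏ p, d p (s p) := by
    refine Finset.sum_le_sum fun s _ => ?_
    rw [← Finset.mul_sum]
    exact mul_le_mul_of_nonneg_left (h4 s) (sq_nonneg _)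
  calc _ ≤ ∑ s : ι → O, ∑ t : ι → O, (1 / 2 * (y s ^ 2 * ∏ p, |A p (s p) (t p)|) +
        1 / 2 * (y t ^ 2 * ∏ p, |A p (t p) (s p)|)) :=
        Finset.sum_le_sum fun s _ => Finset.sum_le_sum fun t _ => h1 s t
    _ = ∑ s : ι → O, ∑ t : ι → O, y s ^ 2 * ∏ p, |A p (s p) (t p)| := by
        simp only [Finset.sum_add_distrib]
        rw [Finset.sum_comm (f := fun s t : ι → O => 1 / 2 * (y t ^ 2 * ∏ p, |A p (t p) (s p)|))]
        simp only [← Finset.mul_sum]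
        ring
    _ ≤ _ := h5

end QuadraticForms

lemma exists_int_modEq_and {W p : ℕ} (h : W.Coprime p) (v c : ℤ) :
    ∃ u : ℤ, u ≡ v [ZMOD W] ∧ u ≡ c [ZMOD p] := by
  obtain ⟨a, b, hab⟩ := Nat.isCoprime_iff_coprime.2 h
  refine ⟨c * (a * W) + v * (b * p), ?_, ?_⟩
  · rw [Int.modEq_iff_dvd]
    refine ⟨v * a - c * a, ?_⟩
    linear_combination v * hab.symm
  · rw [Int.modEq_iff_dvd]
    refine ⟨c * b - v * b, ?_⟩
    linear_combination c * hab.symm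

/-- Distribution in residue classes implies asymptotics for sums of products of local
functions. -/
lemma abs_sum_prod_sub_le {a : ℤ → ℝ} {I : Finset ℤ} {f : ℕ → ℤ → ℝ} {C : ℕ → Finset ℕ} {T ε : ℝ}
    (S : Finset ℕ) (hS : ∀ p ∈ S, p.Prime) (hC : ∀ p, C p ⊆ Finset.range p)
    (hf : ∀ p ∈ S, ∀ n c : ℤ, n ≡ c [ZMOD p] → f p n = f p c)
    (ha : ∀ n ∈ I, a n ≠ 0 → ∀ p ∈ S, ∃ c ∈ C p, n ≡ (c : ℤ) [ZMOD p])
    (W : ℕ) (v : ℤ) (hW : ∀ p ∈ S, W.Coprime p)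
    (h : ∀ u : ℤ, u ≡ v [ZMOD W] → (∀ p ∈ S, ∃ c ∈ C p, u ≡ (c : ℤ) [ZMOD p]) →
      |∑ n ∈ I, (if n ≡ u [ZMOD ((W * ∏ p ∈ S, p : ℕ) : ℤ)] then a n else 0) - T| ≤ ε) :
    |∑ n ∈ I, (if n ≡ v [ZMOD W] then a n * ∏ p ∈ S, f p n else 0) -
      T * ∏ p ∈ S, ∑ c ∈ C p, f p c| ≤ ε * ∏ p ∈ S, ∑ c ∈ C p, |f p c| := by
  induction S using Finset.induction_on generalizing W v with
  | empty => simpa using h v rfl (by simp)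
  | insert p S hp ih =>
    have hpp := hS p (Finset.mem_insert_self _ _)
    have hWp := hW p (Finset.mem_insert_self _ _)
    choose u hu1 hu2 using fun c : ℤ => exists_int_modEq_and hWp v c
    have key : ∑ n ∈ I, (if n ≡ v [ZMOD W] then a n * ∏ p ∈ insert p S, f p n else 0) =
        ∑ c ∈ C p, f p c * ∑ n ∈ I,
          (if n ≡ u c [ZMOD ((W * p : ℕ) : ℤ)] then a n * ∏ p ∈ S, f p n else 0) := by
      simp only [Finset.mul_sum]
      rw [Finset.sum_comm]
      refine Finset.sum_congr rfl fun n hn => ?_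
      have hiff : ∀ c : ℕ, n ≡ u c [ZMOD ((W * p : ℕ) : ℤ)] ↔
          n ≡ v [ZMOD W] ∧ n ≡ c [ZMOD p] := by
        intro c
        rw [Nat.cast_mul, ← Int.modEq_and_modEq_iff_modEq_mul (by simpa using hWp)]
        exact and_congr ⟨fun h => h.trans (hu1 c), fun h => h.trans (hu1 c).symm⟩
          ⟨fun h => h.trans (hu2 c), fun h => h.trans (hu2 c).symm⟩
      simp only [hiff]
      by_cases hv : n ≡ v [ZMOD W]
      · simp only [hv, true_and, if_true]
        by_cases h0 : a n = 0
        · simp [h0]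
        · obtain ⟨c, hc, hnc⟩ := ha n hn h0 p (Finset.mem_insert_self _ _)
          rw [Finset.sum_eq_single c]
          · rw [if_pos hnc, Finset.prod_insert hp,
              hf p (Finset.mem_insert_self _ _) n c hnc]
            ring
          · intro b hb hbc
            rw [if_neg, mul_zero]
            intro hnb
            apply hbc
            have h1 := hnb.symm.trans hnc
            rw [Int.natCast_modEq_iff] at h1
            exact Nat.ModEq.eq_of_lt_of_lt h1 (Finset.mem_range.1 (hC p hb))
              (Finset.mem_range.1 (hC p hc))
          · exact fun h => absurd hc h
      · simp [hv]
    rw [key, Finset.prod_insert hp, Finset.prod_insert hp]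
    have hbound : ∀ c ∈ C p, |∑ n ∈ I,
        (if n ≡ u c [ZMOD ((W * p : ℕ) : ℤ)] then a n * ∏ p ∈ S, f p n else 0) -
          T * ∏ p ∈ S, ∑ c ∈ C p, f p c| ≤ ε * ∏ p ∈ S, ∑ c ∈ C p, |f p c| := by
      intro c hc
      refine ih (fun q hq => hS q (Finset.mem_insert_of_mem hq))
        (fun q hq => hf q (Finset.mem_insert_of_mem hq))
        (fun n hn h0 q hq => ha n hn h0 q (Finset.mem_insert_of_mem hq)) (W * p) (u c)
        (fun q hq => ?_) fun w hw hwS => ?_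
      · refine Nat.Coprime.mul_left (hW q (Finset.mem_insert_of_mem hq)) ?_
        exact (Nat.coprime_primes hpp (hS q (Finset.mem_insert_of_mem hq))).2
          (by rintro rfl; exact hp hq)
      · have hw1 : w ≡ v [ZMOD W] := (Int.ModEq.of_dvd ⟨(p : ℤ), by push_cast; rfl⟩ hw).trans (hu1 c)
        have hw2 : w ≡ c [ZMOD p] := (Int.ModEq.of_dvd ⟨(W : ℤ), by push_cast; ring⟩ hw).trans (hu2 c)
        have := h w hw1 fun q hq => ?_
        · rw [Finset.prod_insert hp, ← mul_assoc] at this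
          exact this
        · rcases Finset.mem_insert.1 hq with rfl | hq
          · exact ⟨c, hc, hw2⟩
          · exact hwS q hq
    have e : ∑ c ∈ C p, f p c * ∑ n ∈ I,
          (if n ≡ u c [ZMOD ((W * p : ℕ) : ℤ)] then a n * ∏ p ∈ S, f p n else 0) -
        T * ((∑ c ∈ C p, f p c) * ∏ p ∈ S, ∑ c ∈ C p, f p c) =
        ∑ c ∈ C p, f p c * (∑ n ∈ I,
          (if n ≡ u c [ZMOD ((W * p : ℕ) : ℤ)] then a n * ∏ p ∈ S, f p n else 0) -
          T * ∏ p ∈ S, ∑ c ∈ C p, f p c) := by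
      simp only [mul_sub, Finset.sum_sub_distrib, ← Finset.sum_mul]
      ring
    rw [e]
    refine (Finset.abs_sum_le_sum_abs _ _).trans ?_
    calc _ ≤ ∑ c ∈ C p, |f p c| * (ε * ∏ p ∈ S, ∑ c ∈ C p, |f p c|) := by
          refine Finset.sum_le_sum fun c hc => ?_
          rw [abs_mul]
          exact mul_le_mul_of_nonneg_left (hbound c hc) (abs_nonneg _)
      _ = _ := by rw [← Finset.sum_mul]; ring

section Local

variable {κ : Type*}

/-- Centred indicator functions of the residue classes `-h i` modulo `p`. -/
noncomputable def xi (h : κ → ℤ) (p : ℕ) : Option κ → ℤ → ℝ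
  | none, _ => 1
  | some i, n => (if (p : ℤ) ∣ n + h i then 1 else 0) - 1 / ((p : ℝ) - 1)

lemma xi_congr (h : κ → ℤ) (p : ℕ) (a : Option κ) {n c : ℤ} (hnc : n ≡ c [ZMOD p]) :
    xi h p a n = xi h p a c := by
  cases a with
  | none => rfl
  | some i =>
    have : (p : ℤ) ∣ n + h i ↔ (p : ℤ) ∣ c + h i := (hnc.add_right (h i)).dvd_iff
    simp only [xi, this]

lemma inv_sub_one_bounds {p : ℕ} (hp : 2 ≤ p) :
    0 < 1 / ((p : ℝ) - 1) ∧ 1 / ((p : ℝ) - 1) ≤ 1 ∧ 1 / ((p : ℝ) - 1) ≤ 2 / p ∧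
      1 / ((p : ℝ) - 1) * (p - 1) = 1 := by
  have hp' : (2 : ℝ) ≤ p := by exact_mod_cast hp
  have h1 : (0 : ℝ) < (p : ℝ) - 1 := by linarith
  refine ⟨by positivity, (div_le_one h1).2 (by linarith), ?_, by field_simp⟩
  rw [div_le_div_iff₀ h1 (by linarith)]
  linarith

lemma abs_xi_le (h : κ → ℤ) {p : ℕ} (hp : 2 ≤ p) (a : Option κ) (n : ℤ) : |xi h p a n| ≤ 1 := by
  obtain ⟨h1, h2, -, -⟩ := inv_sub_one_bounds hp
  cases a with
  | none => simp [xi]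
  | some i =>
    rw [xi, abs_le]
    split_ifs <;> constructor <;> linarith

lemma sum_range_dvd {p : ℕ} (hp : 2 ≤ p) (b : ℤ) :
    ∑ c ∈ Finset.range p, (if (p : ℤ) ∣ (c : ℤ) + b then (1 : ℝ) else 0) = 1 := by
  have hp0 : (0 : ℤ) < p := by exact_mod_cast (by omega : 0 < p)
  have h0 := Int.emod_nonneg (-b) hp0.ne'
  have h1 := Int.emod_lt_of_pos (-b) hp0
  have h2 : (((-b) % p).toNat : ℤ) = (-b) % p := Int.toNat_of_nonneg h0
  rw [Finset.sum_eq_single ((-b) % p).toNat]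
  · rw [if_pos]
    rw [h2]
    refine Int.dvd_of_emod_eq_zero ?_
    rw [Int.emod_add_emod]
    simp
  · intro c hc hne
    rw [if_neg]
    intro hd
    apply hne
    rw [Finset.mem_range] at hc
    have h3 : (c : ℤ) ≡ -b [ZMOD p] := by
      rw [Int.modEq_iff_dvd]
      have h5 : -b - (c : ℤ) = -(c + b) := by ring
      rw [h5]
      exact (dvd_neg (α := ℤ)).2 hd
    have h4 : (c : ℤ) % p = c := Int.emod_eq_of_lt (by positivity) (by exact_mod_cast hc)
    have : (c : ℤ) = (((-b) % p).toNat : ℤ) := by rw [h2, ← h3, h4]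
    exact_mod_cast this
  · intro hc
    rw [Finset.mem_range] at hc
    omega

lemma not_both_dvd {p : ℕ} {a b n : ℤ} (hab : ¬ (p : ℤ) ∣ a - b) (h1 : (p : ℤ) ∣ n + a) :
    ¬ (p : ℤ) ∣ n + b := fun h2 => hab (by simpa using dvd_sub h1 h2)

/-- Correlations of the local functions over all residues. -/
noncomputable def gramAll (h : κ → ℤ) (p : ℕ) (a b : Option κ) : ℝ :=
  1 / (p : ℝ) * ∑ c ∈ Finset.range p, xi h p a c * xi h p b c

lemma gramAll_comm (h : κ → ℤ) (p : ℕ) (a b : Option κ) : gramAll h p a b = gramAll h p b a := by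
  simp only [gramAll, mul_comm]

lemma gramAll_none_none (h : κ → ℤ) {p : ℕ} (hp : 2 ≤ p) : gramAll h p none none = 1 := by
  have : (p : ℝ) ≠ 0 := by exact_mod_cast (by omega : p ≠ 0)
  simp [gramAll, xi, this]

lemma gramAll_none_some (h : κ → ℤ) {p : ℕ} (hp : 2 ≤ p) (i : κ) :
    gramAll h p none (some i) = - (1 / ((p : ℝ) - 1)) / p := by
  obtain ⟨-, -, -, h4⟩ := inv_sub_one_bounds hp
  have hp0 : (p : ℝ) ≠ 0 := by exact_mod_cast (by omega : p ≠ 0)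
  simp only [gramAll, xi, one_mul, Finset.sum_sub_distrib, sum_range_dvd hp, Finset.sum_const,
    Finset.card_range, nsmul_eq_mul]
  linear_combination (-1 / (p : ℝ)) * h4

lemma sum_range_some_mul_some (h : κ → ℤ) {p : ℕ} (hp : 2 ≤ p)
    (hh : ∀ i j, i ≠ j → ¬ (p : ℤ) ∣ h i - h j) (i j : κ) :
    ∑ c ∈ Finset.range p, xi h p (some i) c * xi h p (some j) c =
      (if i = j then 1 else 0) - 2 * (1 / ((p : ℝ) - 1)) + p * (1 / ((p : ℝ) - 1)) ^ 2 := by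
  have e : ∀ c : ℕ, xi h p (some i) c * xi h p (some j) c =
      (if i = j then 1 else 0) * (if (p : ℤ) ∣ (c : ℤ) + h i then (1 : ℝ) else 0) -
      (1 / ((p : ℝ) - 1)) * (if (p : ℤ) ∣ (c : ℤ) + h i then (1 : ℝ) else 0) -
      (1 / ((p : ℝ) - 1)) * (if (p : ℤ) ∣ (c : ℤ) + h j then (1 : ℝ) else 0) +
      (1 / ((p : ℝ) - 1)) ^ 2 := by
    intro c
    simp only [xi]
    by_cases hij : i = j
    · subst hij
      rw [if_pos rfl]
      split_ifs <;> ring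
    · rw [if_neg hij]
      by_cases h1 : (p : ℤ) ∣ (c : ℤ) + h i
      · rw [if_pos h1, if_neg (not_both_dvd (hh i j hij) h1)]; ring
      · rw [if_neg h1]; ring
  simp only [e, Finset.sum_add_distrib, Finset.sum_sub_distrib, ← Finset.mul_sum,
    sum_range_dvd hp, Finset.sum_const, Finset.card_range, nsmul_eq_mul]
  ring

/-- Upper bounds for the rows of the correlation matrix. -/
noncomputable def rowAll (k p : ℕ) : Option κ → ℝ
  | none => 1 + 2 * k / (p : ℝ) ^ 2
  | some _ => 1 / (p : ℝ) * (1 + 2 * k / p)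

lemma sum_abs_gramAll_le [Fintype κ] (h : κ → ℤ) {p : ℕ} (hp : 2 ≤ p)
    (hh : ∀ i j, i ≠ j → ¬ (p : ℤ) ∣ h i - h j) (a : Option κ) :
    ∑ b, |gramAll h p a b| ≤ rowAll (Fintype.card κ) p a := by
  obtain ⟨h1, h2, h3, h4⟩ := inv_sub_one_bounds hp
  have hp0 : (0 : ℝ) < p := by exact_mod_cast (by omega : 0 < p)
  have hp2 : (2 : ℝ) ≤ p := by exact_mod_cast hp
  have hns : ∀ i, |gramAll h p none (some i)| ≤ 2 / (p : ℝ) ^ 2 := by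
    intro i
    rw [gramAll_none_some h hp, abs_div, abs_neg, abs_of_pos h1, abs_of_pos hp0, sq, ← div_div]
    exact div_le_div_of_nonneg_right h3 hp0.le
  rw [Fintype.sum_option]
  cases a with
  | none =>
    rw [gramAll_none_none h hp, abs_one, rowAll]
    refine add_le_add le_rfl ?_
    refine (Finset.sum_le_card_nsmul _ _ _ fun i _ => hns i).trans (le_of_eq ?_)
    rw [Finset.card_univ, nsmul_eq_mul]; ring
  | some i =>
    have hk1 : (1 : ℝ) ≤ Fintype.card κ := by
      exact_mod_cast Fintype.card_pos_iff.2 ⟨i⟩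
    have hss : ∀ j, |gramAll h p (some i) (some j)| ≤
        (if i = j then 1 / (p : ℝ) else 0) + if i = j then 0 else 2 / (p : ℝ) ^ 2 := by
      intro j
      set δ := 1 / ((p : ℝ) - 1) with hδ
      have e : 0 ≤ 2 * δ - p * δ ^ 2 ∧ 2 * δ - p * δ ^ 2 ≤ δ := by
        have : p * δ ^ 2 = δ + δ ^ 2 := by linear_combination δ * h4
        rw [this]
        constructor <;> nlinarith
      rw [gramAll, sum_range_some_mul_some h hp hh, ← hδ, abs_mul,
        abs_of_pos (show 0 < 1 / (p : ℝ) by positivity)]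
      split_ifs
      · rw [add_zero]
        refine mul_le_of_le_one_right (by positivity) ?_
        rw [abs_le]
        constructor <;> linarith
      · have : |0 - 2 * δ + p * δ ^ 2| ≤ 2 / (p : ℝ) := by
          rw [abs_le]
          constructor <;> linarith
        calc _ ≤ 1 / (p : ℝ) * (2 / p) := mul_le_mul_of_nonneg_left this (by positivity)
          _ = _ := by field_simp; ring
    rw [gramAll_comm h p (some i) none, rowAll]
    calc _ ≤ 2 / (p : ℝ) ^ 2 + ∑ j, ((if i = j then 1 / (p : ℝ) else 0) +
          if i = j then 0 else 2 / (p : ℝ) ^ 2) :=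
          add_le_add (hns i) (Finset.sum_le_sum fun j _ => hss j)
      _ = 2 / (p : ℝ) ^ 2 + (1 / p + (Fintype.card κ - 1) * (2 / (p : ℝ) ^ 2)) := by
          have : ∀ j : κ, (if i = j then (0 : ℝ) else 2 / (p : ℝ) ^ 2) =
              2 / (p : ℝ) ^ 2 - if i = j then 2 / (p : ℝ) ^ 2 else 0 := by
            intro j; split_ifs <;> ring
          simp only [this, Finset.sum_add_distrib, Finset.sum_sub_distrib, Finset.sum_ite_eq,
            Finset.mem_univ, if_true, Finset.sum_const, Finset.card_univ, nsmul_eq_mul]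
          ring
      _ = _ := by field_simp; ring

/-- Correlations of the local functions over residues `c` with `p ∤ c + h m`. -/
noncomputable def gramUnit (p : ℕ) : Option κ → Option κ → ℝ
  | none, none => 1
  | some i, some j => (if i = j then 1 / ((p : ℝ) - 1) else 0) - (1 / ((p : ℝ) - 1)) ^ 2
  | _, _ => 0

lemma gramUnit_comm (p : ℕ) (a b : Option κ) : gramUnit p a b = gramUnit p b a := by
  rcases a with _ | i <;> rcases b with _ | j <;> simp [gramUnit, eq_comm]

/-- Residues of `n` for which `n + h m` is coprime to `p`. -/
noncomputable def unitResidues (h : κ → ℤ) (m : κ) (p : ℕ) : Finset ℕ :=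
  (Finset.range p).filter fun c => ¬ (p : ℤ) ∣ (c : ℤ) + h m

lemma sum_unitResidues (h : κ → ℤ) (m : κ) (p : ℕ) (f : ℤ → ℝ) :
    ∑ c ∈ unitResidues h m p, f c = ∑ c ∈ Finset.range p, f c -
      ∑ c ∈ Finset.range p, f c * (if (p : ℤ) ∣ (c : ℤ) + h m then 1 else 0) := by
  rw [unitResidues, Finset.sum_filter, ← Finset.sum_sub_distrib]
  refine Finset.sum_congr rfl fun c _ => ?_
  split_ifs <;> simp_all

lemma sum_unitResidues_eq (h : κ → ℤ) {p : ℕ} (hp : 2 ≤ p)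
    (hh : ∀ i j, i ≠ j → ¬ (p : ℤ) ∣ h i - h j) {m : κ} {a b : Option κ} (ha : a ≠ some m)
    (hb : b ≠ some m) :
    ∑ c ∈ unitResidues h m p, xi h p a c * xi h p b c = ((p : ℝ) - 1) * gramUnit p a b := by
  obtain ⟨-, -, -, h4⟩ := inv_sub_one_bounds hp
  set δ := 1 / ((p : ℝ) - 1) with hδ
  have hx : ∀ i, i ≠ m → ∀ c : ℕ, (p : ℤ) ∣ (c : ℤ) + h m → xi h p (some i) c = -δ := by
    intro i hi c hc
    rw [xi, if_neg (not_both_dvd (hh m i hi.symm) hc), zero_sub]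
  rw [sum_unitResidues h m p fun n => xi h p a n * xi h p b n]
  have hk : ∀ t : ℝ, (∀ c : ℕ, (p : ℤ) ∣ (c : ℤ) + h m → xi h p a c * xi h p b c = t) →
      ∑ c ∈ Finset.range p, xi h p a c * xi h p b c *
        (if (p : ℤ) ∣ (c : ℤ) + h m then 1 else 0) = t := by
    intro t ht
    trans t * ∑ c ∈ Finset.range p, (if (p : ℤ) ∣ (c : ℤ) + h m then (1 : ℝ) else 0)
    swap
    · rw [sum_range_dvd hp, mul_one]
    rw [Finset.mul_sum]
    refine Finset.sum_congr rfl fun c _ => ?_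
    split_ifs with hc
    · rw [ht c hc]
    · simp
  have hs : ∀ i, ∑ c ∈ Finset.range p, xi h p (some i) c = 1 - p * δ := by
    intro i
    simp only [xi, Finset.sum_sub_distrib, sum_range_dvd hp, Finset.sum_const, Finset.card_range,
      nsmul_eq_mul, hδ]
  rcases a with _ | i <;> rcases b with _ | j
  · rw [hk 1 fun c _ => by simp [xi]]
    simp [xi, gramUnit]
  · have hj : j ≠ m := fun h => hb (by rw [h])
    rw [hk (-δ) fun c hc => by rw [hx j hj c hc]; simp [xi]]
    have := hs j
    simp only [xi, one_mul] at this ⊢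
    rw [this, gramUnit]
    · linear_combination -h4
    · simp
    · simp
  · have hi : i ≠ m := fun h => ha (by rw [h])
    rw [hk (-δ) fun c hc => by rw [hx i hi c hc]; simp [xi]]
    have := hs i
    simp only [xi, mul_one] at this ⊢
    rw [this, gramUnit]
    · linear_combination -h4
    · simp
    · simp
  · have hi : i ≠ m := fun h => ha (by rw [h])
    have hj : j ≠ m := fun h => hb (by rw [h])
    rw [hk (δ ^ 2) fun c hc => by rw [hx i hi c hc, hx j hj c hc]; ring,
      sum_range_some_mul_some h hp hh, ← hδ]
    simp only [gramUnit, ← hδ]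
    split_ifs
    · linear_combination (2 * δ - 1) * h4
    · linear_combination (2 * δ) * h4

/-- Diagonal lower bound for `gramUnit`. -/
noncomputable def diagUnit (k p : ℕ) : Option κ → ℝ
  | none => 1
  | some _ => 1 / ((p : ℝ) - 1) * (1 - k * (1 / ((p : ℝ) - 1)))

lemma diagUnit_le [Fintype κ] (p : ℕ) (x : Option κ → ℝ) :
    ∑ a, x a ^ 2 * diagUnit (Fintype.card κ) p a ≤ ∑ a, ∑ b, x a * x b * gramUnit p a b := by
  set δ := 1 / ((p : ℝ) - 1) with hδ
  simp only [Fintype.sum_option]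
  have e : ∑ i : κ, ∑ j : κ, x (some i) * x (some j) * gramUnit p (some i) (some j) =
      δ * ∑ i : κ, x (some i) ^ 2 - δ ^ 2 * (∑ i : κ, x (some i)) ^ 2 := by
    simp only [gramUnit, mul_sub, Finset.sum_sub_distrib, mul_ite, mul_zero, Finset.sum_ite_eq,
      Finset.mem_univ, if_true, ← hδ]
    rw [sq (∑ i : κ, x (some i)), Finset.sum_mul_sum, Finset.mul_sum, Finset.mul_sum]
    congr 1
    · exact Finset.sum_congr rfl fun i _ => by ring
    · refine Finset.sum_congr rfl fun i _ => ?_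
      rw [Finset.mul_sum]
      exact Finset.sum_congr rfl fun j _ => by ring
  have hcs : (∑ i : κ, x (some i)) ^ 2 ≤ Fintype.card κ * ∑ i : κ, x (some i) ^ 2 :=
    sq_sum_le_card_mul_sum_sq
  rw [Finset.sum_add_distrib, e]
  simp only [gramUnit, diagUnit, ← hδ, mul_zero, Finset.sum_const_zero, ← Finset.sum_mul]
  nlinarith [mul_le_mul_of_nonneg_left hcs (sq_nonneg δ)]

lemma sum_abs_xi_mul_le (h : κ → ℤ) {p : ℕ} (hp : 2 ≤ p) {a b : Option κ}
    (hab : a ≠ none ∨ b ≠ none) {C : Finset ℕ} (hC : C ⊆ Finset.range p) :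
    ∑ c ∈ C, |xi h p a c * xi h p b c| ≤ 3 := by
  obtain ⟨h1, h2, h3, h4⟩ := inv_sub_one_bounds hp
  have key : ∀ i : κ, ∑ c ∈ Finset.range p, |xi h p (some i) c| ≤ 3 := by
    intro i
    calc _ ≤ ∑ c ∈ Finset.range p, ((if (p : ℤ) ∣ (c : ℤ) + h i then (1 : ℝ) else 0) +
          1 / ((p : ℝ) - 1)) := by
          refine Finset.sum_le_sum fun c _ => ?_
          rw [xi]
          refine (abs_sub _ _).trans ?_
          rw [abs_of_pos h1]
          split_ifs <;> simp
      _ = 1 + p * (1 / ((p : ℝ) - 1)) := by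
          simp only [Finset.sum_add_distrib, sum_range_dvd hp, Finset.sum_const,
            Finset.card_range, nsmul_eq_mul]
      _ ≤ 3 := by linarith
  refine (Finset.sum_le_sum_of_subset_of_nonneg hC fun _ _ _ => abs_nonneg _).trans ?_
  rcases a with _ | i
  · rcases b with _ | j
    · simp at hab
    · simpa [xi] using key j
  · refine (Finset.sum_le_sum fun c _ => ?_).trans (key i)
    rw [abs_mul]
    exact mul_le_of_le_one_right (abs_nonneg _) (abs_xi_le h hp b c)

end Local

section Forms

variable {P : Finset ℕ} {κ : Type*}

/-- Product of the primes in a set of primes. -/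
def nrm (A : Finset P) : ℕ := ∏ p ∈ A, (p : ℕ)

lemma nrm_pos (hP : ∀ p ∈ P, p.Prime) (A : Finset P) : 0 < nrm A :=
  Finset.prod_pos fun p _ => (hP p p.2).pos

lemma nrm_mono (hP : ∀ p ∈ P, p.Prime) {A B : Finset P} (h : A ⊆ B) : nrm A ≤ nrm B :=
  Finset.prod_le_prod_of_subset_of_one_le' h fun p _ _ => (hP p p.2).one_le

lemma nrm_union_of_disjoint {A B : Finset P} (h : Disjoint A B) :
    nrm (A ∪ B) = nrm A * nrm B := Finset.prod_union h

lemma nrm_union_le (hP : ∀ p ∈ P, p.Prime) (A B : Finset P) :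
    nrm (A ∪ B) ≤ nrm A * nrm B := by
  rw [← Finset.union_sdiff_self_eq_union, nrm_union_of_disjoint Finset.disjoint_sdiff]
  exact Nat.mul_le_mul_left _ (nrm_mono hP Finset.sdiff_subset)

lemma nrm_injective (hP : ∀ p ∈ P, p.Prime) : Function.Injective (nrm (P := P)) := by
  have key : ∀ (A : Finset P) (p : P), p ∈ A ↔ (p : ℕ) ∣ nrm A := by
    intro A p
    refine ⟨fun h => Finset.dvd_prod_of_mem (fun p : P => (p : ℕ)) h, fun h => ?_⟩
    obtain ⟨q, hq, hpq⟩ := ((hP p p.2).prime.dvd_finsetProd_iff _).1 h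
    rw [Nat.prime_dvd_prime_iff_eq (hP p p.2) (hP q q.2)] at hpq
    rwa [Subtype.ext hpq]
  intro A B h
  ext p
  rw [key, key, h]

lemma primeFactors_nrm (hP : ∀ p ∈ P, p.Prime) (A : Finset P) :
    (nrm A).primeFactors = A.map (Function.Embedding.subtype _) := by
  have : nrm A = ∏ p ∈ A.map (Function.Embedding.subtype _), p := by rw [Finset.prod_map]; rfl
  rw [this]
  refine Nat.primeFactors_prod fun p hp => ?_
  obtain ⟨q, -, rfl⟩ := Finset.mem_map.1 hp
  exact hP q q.2

lemma card_primeFactors_nrm (hP : ∀ p ∈ P, p.Prime) (A : Finset P) :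
    (nrm A).primeFactors.card = A.card := by
  rw [primeFactors_nrm hP, Finset.card_map]

/-- The primes to which a configuration assigns a colour. -/
noncomputable def supp (s : P → Option κ) : Finset P := Finset.univ.filter fun p => s p ≠ none

lemma mem_supp {s : P → Option κ} {p : P} : p ∈ supp s ↔ s p ≠ none := by simp [supp]

/-- The product of local functions attached to a configuration. -/
noncomputable def xiProd (h : κ → ℤ) (s : P → Option κ) (n : ℤ) : ℝ := ∏ p : P, xi h p (s p) n

lemma quad_form_approx [Fintype κ] (hP : ∀ p ∈ P, p.Prime) (h : κ → ℤ) {a : ℤ → ℝ} {I : Finset ℤ}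
    {C : ℕ → Finset ℕ} (hC : ∀ p, C p ⊆ Finset.range p)
    (ha : ∀ n ∈ I, a n ≠ 0 → ∀ p ∈ P, ∃ c ∈ C p, n ≡ c [ZMOD p])
    {W : ℕ} {v : ℤ} (hW : ∀ p ∈ P, W.Coprime p) {w : ℕ → ℝ} (hw : ∀ p ∈ P, w p * (C p).card = 1)
    {T : ℝ} {er : ℕ → ℝ} (her : ∀ q, 0 ≤ er q) {R : ℕ}
    (H : ∀ S : Finset P, nrm S ≤ R ^ 2 → ∀ u : ℤ, u ≡ v [ZMOD W] →
      (∀ p ∈ S, ∃ c ∈ C p, u ≡ c [ZMOD (p : ℕ)]) →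
      |∑ n ∈ I, (if n ≡ u [ZMOD ((W * nrm S : ℕ) : ℤ)] then a n else 0) -
        T * ∏ p ∈ S, w p| ≤ er (nrm S)) (z : (P → Option κ) → ℝ)
    (hz : ∀ s, z s ≠ 0 → nrm (supp s) ≤ R) :
    |∑ n ∈ I, (if n ≡ v [ZMOD W] then a n * (∑ s, z s * xiProd h s n) ^ 2 else 0) -
      T * ∑ s, ∑ t, z s * z t * ∏ p : P, (w p * ∑ c ∈ C p, xi h p (s p) c * xi h p (t p) c)| ≤
    ∑ s, ∑ t, |z s| * |z t| * (3 ^ (supp s ∪ supp t).card * er (nrm (supp s ∪ supp t))) := by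
  have key : ∀ s t : P → Option κ, nrm (supp s ∪ supp t) ≤ R ^ 2 →
      |∑ n ∈ I, (if n ≡ v [ZMOD W] then a n * (xiProd h s n * xiProd h t n) else 0) -
        T * ∏ p : P, (w p * ∑ c ∈ C p, xi h p (s p) c * xi h p (t p) c)| ≤
      3 ^ (supp s ∪ supp t).card * er (nrm (supp s ∪ supp t)) := by
    intro s t hst
    set A := supp s ∪ supp t with hA
    have hA' : ∀ p, p ∉ A → s p = none ∧ t p = none := by
      intro p hp
      simpa [hA, mem_supp] using hp
    set S : Finset ℕ := A.map (Function.Embedding.subtype _) with hS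
    have hSn : ∏ p ∈ S, p = nrm A := by rw [hS, Finset.prod_map]; rfl
    have hSP : ∀ p ∈ S, p ∈ P := by
      intro p hp
      rw [hS, Finset.mem_map] at hp
      obtain ⟨q, -, rfl⟩ := hp
      exact q.2
    set f : ℕ → ℤ → ℝ := fun p n => if hp : p ∈ P then
      xi h p (s ⟨p, hp⟩) n * xi h p (t ⟨p, hp⟩) n else 1 with hf
    have hfp : ∀ (p : P) (n : ℤ), f p n = xi h p (s p) n * xi h p (t p) n := by
      intro p n
      simp [hf]
    have h1 : ∀ g : ℕ → ℝ, ∏ p ∈ S, g p = ∏ p ∈ A, g p := fun g => by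
      rw [hS, Finset.prod_map]; rfl
    have h2 : ∀ n : ℤ, ∏ p ∈ S, f p n = xiProd h s n * xiProd h t n := by
      intro n
      rw [h1, xiProd, xiProd, ← Finset.prod_mul_distrib]
      simp only [hfp]
      refine Finset.prod_subset (Finset.subset_univ _) fun p _ hp => ?_
      simp [hA' p hp, xi]
    have main := abs_sum_prod_sub_le (a := a) (I := I) (f := f) (C := C)
      (T := T * ∏ p ∈ A, w p) (ε := er (nrm A)) S (fun p hp => hP p (hSP p hp)) hC ?_ ?_ W v ?_ ?_
    · simp only [h2] at main
      refine (le_of_eq ?_).trans (main.trans ?_)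
      · congr 2
        rw [h1, mul_assoc, ← Finset.prod_mul_distrib]
        congr 1
        symm
        simp only [hfp]
        refine Finset.prod_subset (Finset.subset_univ _) fun p _ hp => ?_
        simp [hA' p hp, xi, hw p p.2]
      · rw [mul_comm]
        refine mul_le_mul_of_nonneg_right ?_ (her _)
        rw [h1]
        refine (Finset.prod_le_prod (fun _ _ => Finset.sum_nonneg fun _ _ => abs_nonneg _)
          (fun p hp => ?_)).trans (by rw [Finset.prod_const])
        simp only [hfp]
        refine sum_abs_xi_mul_le h (hP p p.2).two_le ?_ (hC p)
        by_contra! hn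
        exact (Finset.mem_union.1 hp).elim (fun h => mem_supp.1 h hn.1) fun h => mem_supp.1 h hn.2
    · intro p hp n c hnc
      simp only [hf, dif_pos (hSP p hp)]
      rw [xi_congr h p _ hnc, xi_congr h p _ hnc]
    · exact fun n hn hn' p hp => ha n hn hn' p (hSP p hp)
    · exact fun p hp => hW p (hSP p hp)
    · intro u hu hu'
      rw [hSn]
      refine H A hst u hu fun p hp => hu' p ?_
      rw [hS]
      exact Finset.mem_map.2 ⟨p, hp, rfl⟩
  have e : ∀ n : ℤ, (if n ≡ v [ZMOD W] then a n * (∑ s, z s * xiProd h s n) ^ 2 else 0) =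
      ∑ s, ∑ t, z s * z t *
        (if n ≡ v [ZMOD W] then a n * (xiProd h s n * xiProd h t n) else 0) := by
    intro n
    split_ifs
    · rw [sq, Finset.sum_mul_sum, Finset.mul_sum]
      refine Finset.sum_congr rfl fun s _ => ?_
      rw [Finset.mul_sum]
      exact Finset.sum_congr rfl fun t _ => by ring
    · simp
  simp only [e]
  rw [Finset.sum_comm, Finset.mul_sum, ← Finset.sum_sub_distrib]
  refine (Finset.abs_sum_le_sum_abs _ _).trans (Finset.sum_le_sum fun s _ => ?_)
  rw [Finset.sum_comm, Finset.mul_sum, ← Finset.sum_sub_distrib]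
  refine (Finset.abs_sum_le_sum_abs _ _).trans (Finset.sum_le_sum fun t _ => ?_)
  rw [← Finset.mul_sum]
  calc _ = |z s| * |z t| * |∑ n ∈ I, (if n ≡ v [ZMOD W] then
        a n * (xiProd h s n * xiProd h t n) else 0) -
        T * ∏ p : P, (w p * ∑ c ∈ C p, xi h p (s p) c * xi h p (t p) c)| := by
        rw [← abs_mul, ← abs_mul]
        congr 1
        ring
    _ ≤ _ := by
        by_cases hs : z s = 0
        · simp [hs]
        by_cases ht : z t = 0
        · simp [ht]
        refine mul_le_mul_of_nonneg_left (key s t ?_) (by positivity)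
        calc _ ≤ nrm (supp s) * nrm (supp t) := nrm_union_le hP _ _
          _ ≤ R * R := Nat.mul_le_mul (hz s hs) (hz t ht)
          _ = R ^ 2 := (sq R).symm

end Forms

section SieveSums

variable {P : Finset ℕ} {κ : Type*}

lemma abs_card_modEq_sub_le (A B : ℤ) (hAB : A ≤ B) {q : ℕ} (hq : 0 < q) (u : ℤ) :
    |∑ n ∈ Finset.Ioc A B, (if n ≡ u [ZMOD q] then (1 : ℝ) else 0) - ((B - A : ℤ) : ℝ) / q| ≤
      1 := by
  have hq' : (0 : ℝ) < q := by exact_mod_cast hq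
  rw [← Finset.sum_filter, Finset.sum_const, nsmul_eq_mul, mul_one]
  have h := Int.Ioc_filter_modEq_card A B (r := (q : ℤ)) (by exact_mod_cast hq) u
  have h' : (((Finset.Ioc A B).filter fun n => n ≡ u [ZMOD q]).card : ℤ) =
      ⌊((B - u : ℤ) : ℚ) / (q : ℚ)⌋ - ⌊((A - u : ℤ) : ℚ) / (q : ℚ)⌋ := by
    have hm : ⌊((A - u : ℤ) : ℚ) / (q : ℚ)⌋ ≤ ⌊((B - u : ℤ) : ℚ) / (q : ℚ)⌋ := by
      refine Int.floor_le_floor (div_le_div_of_nonneg_right ?_ (by positivity))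
      exact_mod_cast by omega
    rw [← max_eq_left (sub_nonneg.2 hm)]
    convert h using 3 <;> push_cast <;> rfl
  have h1 := Int.floor_le (((B - u : ℤ) : ℚ) / (q : ℚ))
  have h2 := Int.lt_floor_add_one (((B - u : ℤ) : ℚ) / (q : ℚ))
  have h3 := Int.floor_le (((A - u : ℤ) : ℚ) / (q : ℚ))
  have h4 := Int.lt_floor_add_one (((A - u : ℤ) : ℚ) / (q : ℚ))
  set b := ⌊((B - u : ℤ) : ℚ) / (q : ℚ)⌋
  set a := ⌊((A - u : ℤ) : ℚ) / (q : ℚ)⌋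
  have key : |(((Finset.Ioc A B).filter fun n => n ≡ u [ZMOD q]).card : ℚ) -
      ((B - A : ℤ) : ℚ) / (q : ℚ)| ≤ 1 := by
    have e : (((Finset.Ioc A B).filter fun n => n ≡ u [ZMOD q]).card : ℚ) = b - a := by
      exact_mod_cast h'
    have e2 : ((B - A : ℤ) : ℚ) / (q : ℚ) = ((B - u : ℤ) : ℚ) / (q : ℚ) -
        ((A - u : ℤ) : ℚ) / (q : ℚ) := by push_cast; ring
    rw [e, e2, abs_le]
    constructor <;> linarith
  exact_mod_cast key

lemma sum_square_le [Fintype κ] (hP : ∀ p ∈ P, p.Prime) (h : κ → ℤ)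
    (hh : ∀ p ∈ P, ∀ i j, i ≠ j → ¬ (p : ℤ) ∣ h i - h j) {W : ℕ} (hW0 : 0 < W) (v : ℤ)
    (hW : ∀ p ∈ P, W.Coprime p) (A B : ℤ) (hAB : A ≤ B) (z : (P → Option κ) → ℝ) :
    ∑ n ∈ Finset.Ioc A B, (if n ≡ v [ZMOD W] then (∑ s, z s * xiProd h s n) ^ 2 else 0) ≤
      ((B - A : ℤ) : ℝ) / W * ∑ s, z s ^ 2 * ∏ p : P, rowAll (Fintype.card κ) p (s p) +
        (∑ s, |z s| * 3 ^ (supp s).card) ^ 2 := by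
  have key := quad_form_approx hP h (a := fun _ => 1) (I := Finset.Ioc A B)
    (C := fun p => Finset.range p) (fun _ => subset_rfl) ?_ (W := W) (v := v) hW
    (w := fun p => 1 / (p : ℝ)) ?_ (T := ((B - A : ℤ) : ℝ) / W) (er := fun _ => 1)
    (fun _ => zero_le_one) (R := Finset.univ.sup fun s : P → Option κ => nrm (supp s)) ?_ z
    (fun s _ => Finset.le_sup (f := fun s : P → Option κ => nrm (supp s)) (Finset.mem_univ s))
  · simp only [one_mul, mul_one] at key
    have hmain : ∑ s, ∑ t, z s * z t * ∏ p : P, (1 / (p : ℝ) *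
        ∑ c ∈ Finset.range p, xi h p (s p) c * xi h p (t p) c) ≤
        ∑ s, z s ^ 2 * ∏ p : P, rowAll (Fintype.card κ) p (s p) :=
      tensor_le_sum_sq (A := fun p : P => gramAll h p) (d := fun p : P => rowAll (Fintype.card κ) p)
        (fun p a b => gramAll_comm h p a b)
        (fun p a => sum_abs_gramAll_le h (hP p p.2).two_le (hh p p.2) a) z
    have herr : ∑ s, ∑ t, |z s| * |z t| * (3 : ℝ) ^ (supp s ∪ supp t).card ≤
        (∑ s, |z s| * 3 ^ (supp s).card) ^ 2 := by
      rw [sq, Finset.sum_mul_sum]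
      refine Finset.sum_le_sum fun s _ => Finset.sum_le_sum fun t _ => ?_
      calc _ ≤ |z s| * |z t| * (3 : ℝ) ^ ((supp s).card + (supp t).card) := by
            refine mul_le_mul_of_nonneg_left ?_ (by positivity)
            exact pow_le_pow_right₀ (by norm_num) (Finset.card_union_le _ _)
        _ = _ := by rw [pow_add]; ring
    have hT : 0 ≤ ((B - A : ℤ) : ℝ) / W := by
      have : (0 : ℝ) ≤ ((B - A : ℤ) : ℝ) := by exact_mod_cast by omega
      positivity
    have := (abs_le.1 key).2
    have := mul_le_mul_of_nonneg_left hmain hT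
    linarith
  · intro n _ _ p hp
    have hp0 : (0 : ℤ) < p := by exact_mod_cast (hP p hp).pos
    refine ⟨(n % p).toNat, ?_, ?_⟩
    · have := Int.emod_nonneg n hp0.ne'
      have := Int.emod_lt_of_pos n hp0
      rw [Finset.mem_range]; omega
    · rw [Int.toNat_of_nonneg (Int.emod_nonneg n hp0.ne')]
      exact (Int.mod_modEq n p).symm
  · intro p hp
    have : (p : ℝ) ≠ 0 := by exact_mod_cast (hP p hp).ne_zero
    simp [this]
  · intro S _ u _ _
    have e : ((B - A : ℤ) : ℝ) / W * ∏ p ∈ S, 1 / ((p : ℕ) : ℝ) =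
        ((B - A : ℤ) : ℝ) / ((W * nrm S : ℕ) : ℝ) := by
      rw [nrm]
      push_cast
      rw [Finset.prod_div_distrib, Finset.prod_const_one, div_mul_div_comm, mul_one]
    have := abs_card_modEq_sub_le A B hAB (Nat.mul_pos hW0 (nrm_pos hP S)) u
    rw [← e] at this
    exact this

end SieveSums

section PrimeSums

variable {P : Finset ℕ} {κ : Type*}

lemma shifted_progression_sum {m : ℕ} (hm : 0 < m) {x : ℝ} (hmx : Real.exp 2 * m ≤ x) (b : ℤ)
    {I : Finset ℤ} (hI : ∀ n : ℕ, thw x n ≠ 0 → (n : ℤ) - b ∈ I) {u : ℤ}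
    (hu : IsCoprime (u + b) m) :
    |∑ n ∈ I, (if n ≡ u [ZMOD m] then thw x (n + b).toNat else 0) - totalW x / m.totient| ≤
      err x m := by
  have : NeZero m := ⟨hm.ne'⟩
  have hx : 0 < x := lt_of_lt_of_le (by positivity) hmx
  have ha : IsUnit ((u + b : ℤ) : ZMod m) := by
    rwa [ZMod.coe_int_isUnit_iff_isCoprime, isCoprime_comm]
  refine le_trans (le_of_eq ?_) (progression_sum hmx ha)
  congr 2
  have hpos : ∀ n : ℤ, thw x n.toNat ≠ 0 → 0 ≤ n := by
    intro n hn
    have := (prime_of_thw_ne_zero hn).pos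
    omega
  have hcond : ∀ n : ℤ, 0 ≤ n + b →
      (((n + b).toNat : ZMod m) = ((u + b : ℤ) : ZMod m) ↔ n ≡ u [ZMOD m]) := by
    intro n hn
    have h1 : (((n + b).toNat : ℕ) : ZMod m) = ((n + b : ℤ) : ZMod m) := by
      rw [← Int.cast_natCast, Int.toNat_of_nonneg hn]
    rw [h1, ZMod.intCast_eq_intCast_iff]
    exact ⟨fun h => Int.ModEq.add_right_cancel' b h, fun h => h.add_right b⟩
  refine Finset.sum_bij_ne_zero (fun n _ _ => (n + b).toNat) ?_ ?_ ?_ ?_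
  · intro n hn h0
    have h1 : thw x (n + b).toNat ≠ 0 := by
      intro h; simp [h] at h0
    rw [Finset.mem_range]
    by_contra hc
    exact h1 (thw_eq_zero_of_cut_le hx (not_lt.1 hc))
  · intro n₁ h₁ h₁' n₂ h₂ h₂' he
    have e1 := hpos (n₁ + b) fun h => by simp [h] at h₁'
    have e2 := hpos (n₂ + b) fun h => by simp [h] at h₂'
    omega
  · intro n hn h0
    have h1 : thw x n ≠ 0 := by
      intro h; simp [h] at h0
    have e : ((n : ℤ) - b + b).toNat = n := by simp
    refine ⟨(n : ℤ) - b, hI n h1, ?_, e⟩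
    have hc := hcond ((n : ℤ) - b) (by simp)
    rw [e] at hc ⊢
    rw [if_congr hc.symm rfl rfl]
    exact h0
  · intro n hn h0
    have h1 : thw x (n + b).toNat ≠ 0 := by
      intro h; simp [h] at h0
    rw [if_congr (hcond n (hpos _ h1)).symm rfl rfl]

lemma totient_nrm (hP : ∀ p ∈ P, p.Prime) (S : Finset P) :
    ((nrm S).totient : ℝ) = ∏ p ∈ S, (((p : ℕ) : ℝ) - 1) := by
  induction S using Finset.induction_on with
  | empty => simp [nrm]
  | insert p S hp ih =>
    have e : nrm (insert p S) = p * nrm S := Finset.prod_insert hp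
    have hc : (p : ℕ).Coprime (nrm S) := Nat.Coprime.prod_right fun q hq =>
      (Nat.coprime_primes (hP p p.2) (hP q q.2)).2 fun h => hp (Subtype.ext h ▸ hq)
    rw [e, Nat.totient_mul hc, Finset.prod_insert hp, Nat.totient_prime (hP p p.2), Nat.cast_mul,
      ih, Nat.cast_sub (hP p p.2).one_le, Nat.cast_one]

lemma card_supp_subset [Fintype κ] (A : Finset P) :
    (Finset.univ.filter fun s : P → Option κ => supp s ⊆ A).card = (Fintype.card κ + 1) ^ A.card := by
  have : (Finset.univ.filter fun s : P → Option κ => supp s ⊆ A) =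
      Fintype.piFinset fun p => if p ∈ A then Finset.univ else {none} := by
    ext s
    rw [Finset.mem_filter, Fintype.mem_piFinset]
    constructor
    · rintro ⟨-, h⟩ p
      split_ifs with hp
      · exact Finset.mem_univ _
      · rw [Finset.mem_singleton]
        by_contra hs
        exact hp (h (mem_supp.2 hs))
    · intro h
      refine ⟨Finset.mem_univ _, fun p hp => ?_⟩
      by_contra hpA
      have := h p
      rw [if_neg hpA, Finset.mem_singleton] at this
      exact mem_supp.1 hp this
  rw [this, Fintype.card_piFinset, ← Finset.prod_subset (Finset.subset_univ A)]
  · rw [← Finset.prod_const]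
    exact Finset.prod_congr rfl fun p hp => by
      rw [if_pos hp, Finset.card_univ, Fintype.card_option]
  · intro p _ hp
    rw [if_neg hp, Finset.card_singleton]

lemma sum_abs_mul_abs_le [Fintype κ] (hP : ∀ p ∈ P, p.Prime) {z : (P → Option κ) → ℝ} {Z : ℝ}
    (hZ : ∀ s, |z s| ≤ Z) {R : ℕ} (hz : ∀ s, z s ≠ 0 → nrm (supp s) ≤ R) {er : ℕ → ℝ}
    (her : ∀ q, 0 ≤ er q) :
    ∑ s, ∑ t, |z s| * |z t| * (3 ^ (supp s ∪ supp t).card * er (nrm (supp s ∪ supp t))) ≤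
      Z ^ 2 * ∑ q ∈ Finset.Icc 1 (R ^ 2),
        ((3 * (Fintype.card κ + 1) ^ 2 : ℕ) : ℝ) ^ q.primeFactors.card * er q := by
  set k := Fintype.card κ
  have hZ0 : 0 ≤ Z := (abs_nonneg _).trans (hZ fun _ => none)
  set F : Finset P → ℝ := fun A => if nrm A ≤ R ^ 2 then 3 ^ A.card * er (nrm A) else 0 with hF
  have hF0 : ∀ A, 0 ≤ F A := by
    intro A
    simp only [hF]
    split_ifs
    · exact mul_nonneg (by positivity) (her _)
    · exact le_rfl
  have h1 : ∀ s t : P → Option κ,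
      |z s| * |z t| * (3 ^ (supp s ∪ supp t).card * er (nrm (supp s ∪ supp t))) ≤
        Z ^ 2 * F (supp s ∪ supp t) := by
    intro s t
    by_cases hs : z s = 0
    · rw [hs, abs_zero, zero_mul, zero_mul]; exact mul_nonneg (by positivity) (hF0 _)
    by_cases ht : z t = 0
    · rw [ht, abs_zero, mul_zero, zero_mul]; exact mul_nonneg (by positivity) (hF0 _)
    have hn : nrm (supp s ∪ supp t) ≤ R ^ 2 :=
      (nrm_union_le hP _ _).trans ((Nat.mul_le_mul (hz s hs) (hz t ht)).trans (sq R).ge)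
    simp only [hF, if_pos hn]
    refine mul_le_mul_of_nonneg_right ?_ (mul_nonneg (by positivity) (her _))
    rw [sq]
    exact mul_le_mul (hZ s) (hZ t) (abs_nonneg _) hZ0
  have h2 : ∑ s : P → Option κ, ∑ t : P → Option κ, F (supp s ∪ supp t) ≤
      ∑ A : Finset P, ((k + 1) ^ A.card) ^ 2 * F A := by
    calc _ ≤ ∑ s : P → Option κ, ∑ t : P → Option κ, ∑ A : Finset P,
          (if supp s ⊆ A then 1 else 0) * (if supp t ⊆ A then 1 else 0) * F A := by
          refine Finset.sum_le_sum fun s _ => Finset.sum_le_sum fun t _ => ?_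
          refine le_trans (le_of_eq ?_) (Finset.single_le_sum (fun A _ => ?_)
            (Finset.mem_univ (supp s ∪ supp t)))
          · rw [if_pos Finset.subset_union_left, if_pos Finset.subset_union_right]; simp
          · exact mul_nonneg (mul_nonneg (by split_ifs <;> simp) (by split_ifs <;> simp)) (hF0 A)
      _ = ∑ A : Finset P, ∑ s : P → Option κ, ∑ t : P → Option κ,
          (if supp s ⊆ A then 1 else 0) * (if supp t ⊆ A then 1 else 0) * F A := by
          rw [Finset.sum_comm]
          rw [Finset.sum_congr rfl fun s _ => Finset.sum_comm, Finset.sum_comm]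
          exact Finset.sum_congr rfl fun A _ => Finset.sum_comm
      _ = _ := by
          refine Finset.sum_congr rfl fun A _ => ?_
          have := card_supp_subset (κ := κ) A
          simp only [← Finset.sum_mul, ← Finset.sum_mul_sum, Finset.sum_boole]
          rw [this]
          push_cast
          ring
  have h3 : ∑ A : Finset P, (((k : ℝ) + 1) ^ A.card) ^ 2 * F A ≤ ∑ q ∈ Finset.Icc 1 (R ^ 2),
      ((3 * (k + 1) ^ 2 : ℕ) : ℝ) ^ q.primeFactors.card * er q := by
    have e : ∀ A : Finset P, (((k : ℝ) + 1) ^ A.card) ^ 2 * F A = if nrm A ≤ R ^ 2 then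
        ((3 * (k + 1) ^ 2 : ℕ) : ℝ) ^ (nrm A).primeFactors.card * er (nrm A) else 0 := by
      intro A
      simp only [hF, card_primeFactors_nrm hP]
      split_ifs
      · push_cast
        rw [mul_pow, ← pow_mul, ← pow_mul, mul_comm A.card]
        ring
      · simp
    simp only [e]
    rw [← Finset.sum_filter]
    rw [← Finset.sum_image (f := fun q : ℕ => ((3 * (k + 1) ^ 2 : ℕ) : ℝ) ^ q.primeFactors.card *
      er q) (g := nrm) fun A _ B _ h => nrm_injective hP h]
    refine Finset.sum_le_sum_of_subset_of_nonneg ?_ fun q _ _ => mul_nonneg (by positivity) (her q)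
    intro q hq
    obtain ⟨A, hA, rfl⟩ := Finset.mem_image.1 hq
    exact Finset.mem_Icc.2 ⟨nrm_pos hP A, (Finset.mem_filter.1 hA).2⟩
  calc _ ≤ ∑ s : P → Option κ, ∑ t : P → Option κ, Z ^ 2 * F (supp s ∪ supp t) :=
        Finset.sum_le_sum fun s _ => Finset.sum_le_sum fun t _ => h1 s t
    _ = Z ^ 2 * ∑ s : P → Option κ, ∑ t : P → Option κ, F (supp s ∪ supp t) := by
        simp only [Finset.mul_sum]
    _ ≤ _ := mul_le_mul_of_nonneg_left (h2.trans h3) (by positivity)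

lemma le_sum_thw_mul_square [Fintype κ] (hP : ∀ p ∈ P, p.Prime) (h : κ → ℤ)
    (hh : ∀ p ∈ P, ∀ i j, i ≠ j → ¬ (p : ℤ) ∣ h i - h j) (m : κ)
    (hk : ∀ p ∈ P, Fintype.card κ + 1 ≤ p) {W : ℕ} (hW0 : 0 < W)
    {v : ℤ} (hv : IsCoprime (v + h m) W) (hW : ∀ p ∈ P, W.Coprime p) {x : ℝ} {R : ℕ}
    (hR : Real.exp 2 * (W * R ^ 2 : ℕ) ≤ x) (hPR : ∀ p ∈ P, Real.exp 2 * p ≤ x) {I : Finset ℤ}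
    (hI : ∀ n : ℕ, thw x n ≠ 0 → (n : ℤ) - h m ∈ I)
    {z : (P → Option κ) → ℝ} (hzm : ∀ s p, s p = some m → z s = 0) {Z : ℝ}
    (hZ : ∀ s, |z s| ≤ Z) (hz : ∀ s, z s ≠ 0 → nrm (supp s) ≤ R) :
    totalW x / W.totient * ∑ s, z s ^ 2 * ∏ p : P, diagUnit (Fintype.card κ) p (s p) -
      Z ^ 2 * ∑ q ∈ Finset.Icc 1 (R ^ 2),
        ((3 * (Fintype.card κ + 1) ^ 2 : ℕ) : ℝ) ^ q.primeFactors.card * err x (W * q) ≤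
    ∑ n ∈ I, (if n ≡ v [ZMOD W] then
      thw x (n + h m).toNat * (∑ s, z s * xiProd h s n) ^ 2 else 0) := by
  have hsub : ∀ p, unitResidues h m p ⊆ Finset.range p := fun p => Finset.filter_subset _ _
  have hcard : ∀ p ∈ P, (1 / ((p : ℝ) - 1)) * (unitResidues h m p).card = 1 := by
    intro p hp
    have e := sum_unitResidues_eq h (hP p hp).two_le (hh p hp) (m := m) (a := none) (b := none)
      (by simp) (by simp)
    simp only [xi, mul_one, gramUnit, Finset.sum_const, nsmul_eq_mul] at e
    rw [e]
    exact (inv_sub_one_bounds (hP p hp).two_le).2.2.2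
  have key := quad_form_approx hP h (a := fun n => thw x (n + h m).toNat) (I := I)
    (C := unitResidues h m) hsub ?_ (W := W) (v := v) hW
    (w := fun p => 1 / ((p : ℝ) - 1)) hcard (T := totalW x / W.totient)
    (er := fun q => err x (W * q)) (fun q => err_nonneg x _) (R := R) ?_ z hz
  · have herr := sum_abs_mul_abs_le hP hZ hz (er := fun q => err x (W * q))
      fun q => err_nonneg x _
    have hmain : ∑ s, z s ^ 2 * ∏ p : P, diagUnit (Fintype.card κ) p (s p) ≤
        ∑ s, ∑ t, z s * z t * ∏ p : P, (1 / ((p : ℝ) - 1) *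
        ∑ c ∈ unitResidues h m p, xi h p (s p) c * xi h p (t p) c) := by
      refine (sum_sq_le_tensor (A := fun p : P => gramUnit p)
        (d := fun p : P => diagUnit (Fintype.card κ) p)
        (fun p a b => gramUnit_comm p a b) ?_ (fun p => diagUnit_le p) z).trans (le_of_eq ?_)
      · intro p a
        obtain ⟨h1, -, -, h4⟩ := inv_sub_one_bounds (hP p p.2).two_le
        cases a with
        | none => simp [diagUnit]
        | some i =>
          have : (Fintype.card κ : ℝ) + 1 ≤ p := by exact_mod_cast hk p p.2
          refine mul_nonneg h1.le ?_
          nlinarith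
      · refine Finset.sum_congr rfl fun s _ => Finset.sum_congr rfl fun t _ => ?_
        by_cases hs : ∃ p, s p = some m
        · obtain ⟨p, hp⟩ := hs
          simp [hzm s p hp]
        by_cases ht : ∃ p, t p = some m
        · obtain ⟨p, hp⟩ := ht
          simp [hzm t p hp]
        push Not at hs ht
        congr 1
        refine Finset.prod_congr rfl fun p _ => ?_
        obtain ⟨-, -, -, h4⟩ := inv_sub_one_bounds (hP p p.2).two_le
        rw [sum_unitResidues_eq h (hP p p.2).two_le (hh p p.2) (hs p) (ht p), ← mul_assoc, h4,
          one_mul]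
    have hT : 0 ≤ totalW x / W.totient :=
      div_nonneg (Finset.sum_nonneg fun n _ => thw_nonneg x n) (by positivity)
    have := (abs_le.1 key).1
    have := mul_le_mul_of_nonneg_left hmain hT
    linarith
  · intro n _ hn p hp
    have hp0 : (0 : ℤ) < p := by exact_mod_cast (hP p hp).pos
    have e0 : ((n % p).toNat : ℤ) = n % p := Int.toNat_of_nonneg (Int.emod_nonneg n hp0.ne')
    have e : n ≡ (n % p).toNat [ZMOD p] := by
      rw [e0]; exact (Int.mod_modEq n p).symm
    refine ⟨(n % p).toNat, ?_, e⟩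
    rw [unitResidues, Finset.mem_filter, Finset.mem_range]
    constructor
    · have := Int.emod_lt_of_pos n hp0
      omega
    · rw [← (e.add_right (h m)).dvd_iff]
      intro hd
      have hc := coprime_of_thw_ne_zero (hP p hp).pos (hPR p hp) hn
      have hpos := (prime_of_thw_ne_zero hn).pos
      have : p ∣ (n + h m).toNat := by
        rw [← Int.natCast_dvd_natCast, Int.toNat_of_nonneg (by omega)]
        exact hd
      exact (Nat.Prime.coprime_iff_not_dvd (hP p hp)).1 hc.symm this
  · intro S hS u hu hu'
    have hcop : W.Coprime (nrm S) := Nat.Coprime.prod_right fun p _ => hW p p.2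
    have hpos : 0 < W * nrm S := Nat.mul_pos hW0 (nrm_pos hP S)
    have e : totalW x / W.totient * ∏ p ∈ S, 1 / (((p : ℕ) : ℝ) - 1) =
        totalW x / ((W * nrm S).totient : ℝ) := by
      rw [Nat.totient_mul hcop]
      rw [Nat.cast_mul, totient_nrm hP, Finset.prod_div_distrib, Finset.prod_const_one, div_mul_div_comm,
        mul_one]
    have hle : Real.exp 2 * (W * nrm S : ℕ) ≤ x := by
      refine le_trans (mul_le_mul_of_nonneg_left ?_ (Real.exp_pos 2).le) hR
      exact_mod_cast Nat.mul_le_mul_left _ hS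
    have hco : IsCoprime (u + h m) ((W * nrm S : ℕ) : ℤ) := by
      rw [Nat.cast_mul]
      refine IsCoprime.mul_right ?_ ?_
      · obtain ⟨c, hc⟩ := hu.symm.dvd
        have : u + h m = v + h m + W * c := by linarith
        rw [this]
        exact hv.add_mul_left_left c
      · rw [nrm, Nat.cast_prod]
        refine IsCoprime.prod_right fun p hp => ?_
        obtain ⟨c, hc, huc⟩ := hu' p hp
        rw [isCoprime_comm, Prime.coprime_iff_not_dvd (Nat.prime_iff_prime_int.1 (hP p p.2)),
          (huc.add_right (h m)).dvd_iff]
        exact (Finset.mem_filter.1 hc).2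
    have := shifted_progression_sum hpos hle (h m) hI hco
    rw [← e] at this
    exact this

end PrimeSums

section Colourings

variable {P : Finset ℕ} {κ : Type*}

/-- The primes to which a configuration assigns the colour `i`. -/
noncomputable def cls (s : P → Option κ) (i : κ) : Finset P :=
  Finset.univ.filter fun p => s p = some i

lemma mem_cls {s : P → Option κ} {i : κ} {p : P} : p ∈ cls s i ↔ s p = some i := by simp [cls]

lemma cls_injective : Function.Injective (cls (P := P) (κ := κ)) := by
  intro s t h
  funext p
  have key : ∀ i, s p = some i ↔ t p = some i := fun i => by rw [← mem_cls, ← mem_cls, h]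
  cases hs : s p with
  | some i => exact ((key i).1 hs).symm
  | none =>
    cases ht : t p with
    | none => rfl
    | some i => rw [(key i).2 ht] at hs; cases hs

lemma sum_supp_eq [Fintype κ] {M : Type*} [AddCommMonoid M] (s : P → Option κ) (f : P → M) :
    ∑ p ∈ supp s, f p = ∑ i, ∑ p ∈ cls s i, f p := by
  simp only [cls, supp, Finset.sum_filter]
  rw [Finset.sum_comm]
  refine Finset.sum_congr rfl fun p _ => ?_
  cases s p with
  | none => simp
  | some j => simp [Finset.sum_ite_eq]

lemma prod_supp_eq [Fintype κ] {M : Type*} [CommMonoid M] (s : P → Option κ) (f : P → M) :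
    ∏ p ∈ supp s, f p = ∏ i, ∏ p ∈ cls s i, f p :=
  sum_supp_eq (M := Additive M) s f

lemma sum_prod_cls_le [Fintype κ] (F : κ → Finset P → ℝ) (hF : ∀ i A, 0 ≤ F i A) :
    ∑ s : P → Option κ, ∏ i, F i (cls s i) ≤ ∏ i, ∑ A, F i A := by
  rw [Fintype.prod_sum, ← Finset.sum_image (f := fun r : κ → Finset P => ∏ i, F i (r i)) (g := cls)
    fun s _ t _ h => cls_injective h]
  exact Finset.sum_le_sum_of_subset_of_nonneg (Finset.subset_univ _) fun r _ _ =>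
    Finset.prod_nonneg fun i _ => hF i _

lemma exists_cls_eq {r : κ → Finset P} (hr : ∀ i j, i ≠ j → Disjoint (r i) (r j)) :
    ∃ s : P → Option κ, cls s = r := by
  refine ⟨fun p => if h : ∃ i, p ∈ r i then some h.choose else none, ?_⟩
  funext i
  ext p
  rw [mem_cls]
  constructor
  · intro h
    split_ifs at h with hp
    · rw [← Option.some.inj h]; exact hp.choose_spec
  · intro h
    have hp : ∃ i, p ∈ r i := ⟨i, h⟩
    rw [dif_pos hp]
    congr 1
    by_contra hne
    exact Finset.disjoint_left.1 (hr _ _ hne) hp.choose_spec h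

lemma le_sum_prod_cls [Fintype κ] (F : κ → Finset P → ℝ) (hF : ∀ i A, 0 ≤ F i A) {w b : P → ℝ}
    (hb0 : ∀ p, 0 ≤ b p)
    (hw : ∀ i p, ∑ A, (if p ∈ A then F i A else 0) ≤ w p * ∑ A, F i A) {β : ℝ}
    (hβ : ∀ i, ∑ A, F i A * ∑ p ∈ A, b p ≤ β * ∑ A, F i A) :
    (1 - (Fintype.card κ : ℝ) ^ 2 * ∑ p, w p ^ 2 - Fintype.card κ * β) * ∏ i, ∑ A, F i A ≤
      ∑ s : P → Option κ, (∏ i, F i (cls s i)) * max 0 (1 - ∑ p ∈ supp s, b p) := by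
  set Γ := ∏ i, ∑ A, F i A with hΓ
  have hS0 : ∀ i, 0 ≤ ∑ A, F i A := fun i => Finset.sum_nonneg fun A _ => hF i A
  have hr0 : ∀ r : κ → Finset P, 0 ≤ ∏ i, F i (r i) := fun r => Finset.prod_nonneg fun i _ => hF i _
  have e1 : ∑ r : κ → Finset P, ∏ i, F i (r i) = Γ := by rw [hΓ, Fintype.prod_sum]
  have e2 : ∀ i j p, i ≠ j → ∑ r : κ → Finset P, (∏ l, F l (r l)) *
      (if p ∈ r i ∧ p ∈ r j then 1 else 0) ≤ w p ^ 2 * Γ := by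
    intro i j p hij
    calc _ = ∑ r : κ → Finset P, ∏ l, (if (l = i ∨ l = j) then
            (if p ∈ r l then F l (r l) else 0) else F l (r l)) := by
          refine Finset.sum_congr rfl fun r _ => ?_
          split_ifs with h
          · rw [mul_one]
            refine Finset.prod_congr rfl fun l _ => ?_
            by_cases hl : l = i ∨ l = j
            · rw [if_pos hl, if_pos]
              rcases hl with rfl | rfl
              exacts [h.1, h.2]
            · rw [if_neg hl]
          · rw [mul_zero]
            symm
            by_cases h1 : p ∈ r i
            · exact Finset.prod_eq_zero (Finset.mem_univ j) (by
                simp [show p ∉ r j from fun h2 => h ⟨h1, h2⟩])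
            · exact Finset.prod_eq_zero (Finset.mem_univ i) (by simp [h1])
      _ = ∏ l, ∑ A, (if (l = i ∨ l = j) then (if p ∈ A then F l A else 0) else F l A) := by
          rw [Fintype.prod_sum]
      _ ≤ ∏ l, ((if (l = i ∨ l = j) then w p else 1) * ∑ A, F l A) := by
          refine Finset.prod_le_prod (fun l _ => Finset.sum_nonneg fun A _ => ?_) fun l _ => ?_
          · split_ifs <;> first | exact hF l A | exact le_rfl
          · split_ifs
            · exact hw l p
            · rw [one_mul]
      _ = _ := by
          rw [Finset.prod_mul_distrib, ← hΓ]
          congr 1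
          rw [← Finset.prod_filter, Finset.prod_const]
          congr 1
          have : (Finset.univ.filter fun l => l = i ∨ l = j) = {i, j} := by ext l; simp
          rw [this, Finset.card_pair hij]
  have e3 : ∀ i, ∑ r : κ → Finset P, (∏ l, F l (r l)) * ∑ p ∈ r i, b p ≤ β * Γ := by
    intro i
    calc _ = ∑ r : κ → Finset P, ∏ l, (F l (r l) * if l = i then ∑ p ∈ r l, b p else 1) := by
          refine Finset.sum_congr rfl fun r _ => ?_
          rw [Finset.prod_mul_distrib, Finset.prod_ite_eq' Finset.univ i fun l => ∑ p ∈ r l, b p,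
            if_pos (Finset.mem_univ i)]
      _ = ∏ l, ∑ A, (F l A * if l = i then ∑ p ∈ A, b p else 1) := by rw [Fintype.prod_sum]
      _ ≤ ∏ l, ((if l = i then β else 1) * ∑ A, F l A) := by
          refine Finset.prod_le_prod (fun l _ => Finset.sum_nonneg fun A _ => ?_) fun l _ => ?_
          · refine mul_nonneg (hF l A) ?_
            split_ifs
            · exact Finset.sum_nonneg fun p _ => hb0 p
            · exact zero_le_one
          · split_ifs
            · exact hβ l
            · simp
      _ = _ := by
          rw [Finset.prod_mul_distrib, Finset.prod_ite_eq' Finset.univ i fun _ => β,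
            if_pos (Finset.mem_univ i)]
  have main : ∀ r : κ → Finset P, (∏ i, F i (r i)) * (1 - (∑ i, ∑ j, ∑ p, if i = j then 0 else
      if p ∈ r i ∧ p ∈ r j then (1 : ℝ) else 0) - ∑ i, ∑ p ∈ r i, b p) ≤
      if r ∈ Finset.univ.image (cls (P := P) (κ := κ)) then
        (∏ i, F i (r i)) * max 0 (1 - ∑ i, ∑ p ∈ r i, b p) else 0 := by
    intro r
    have h0 : ∀ i j p, (0 : ℝ) ≤ if i = j then 0 else
      if p ∈ r i ∧ p ∈ r j then (1 : ℝ) else 0 := fun i j p => by split_ifs <;> norm_num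
    have h0' : ∀ i j, (0 : ℝ) ≤ ∑ p, if i = j then 0 else
      if p ∈ r i ∧ p ∈ r j then (1 : ℝ) else 0 := fun i j => Finset.sum_nonneg fun p _ => h0 i j p
    have h0'' : ∀ i, (0 : ℝ) ≤ ∑ j, ∑ p, if i = j then 0 else
      if p ∈ r i ∧ p ∈ r j then (1 : ℝ) else 0 := fun i => Finset.sum_nonneg fun j _ => h0' i j
    have hb' : 0 ≤ ∑ i, ∑ p ∈ r i, b p :=
      Finset.sum_nonneg fun i _ => Finset.sum_nonneg fun p _ => hb0 p
    split_ifs with hr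
    · refine mul_le_mul_of_nonneg_left ?_ (hr0 r)
      refine le_trans ?_ (le_max_right _ _)
      have := Finset.sum_nonneg fun i (_ : i ∈ Finset.univ) => h0'' i
      linarith
    · refine mul_nonpos_of_nonneg_of_nonpos (hr0 r) ?_
      have : ∃ i j, i ≠ j ∧ ¬ Disjoint (r i) (r j) := by
        by_contra! hd
        obtain ⟨s, hs⟩ := exists_cls_eq hd
        exact hr (Finset.mem_image.2 ⟨s, Finset.mem_univ _, hs⟩)
      obtain ⟨i, j, hij, hd⟩ := this
      obtain ⟨p, hp1, hp2⟩ := Finset.not_disjoint_iff.1 hd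
      have h1 := Finset.single_le_sum (fun i _ => h0'' i) (Finset.mem_univ i)
      have h2 := Finset.single_le_sum (fun j _ => h0' i j) (Finset.mem_univ j)
      have h3 := Finset.single_le_sum (fun p _ => h0 i j p) (Finset.mem_univ p)
      rw [if_neg hij, if_pos ⟨hp1, hp2⟩] at h3
      linarith
  have hsum := Finset.sum_le_sum fun r (_ : r ∈ Finset.univ) => main r
  rw [← Finset.sum_filter, Finset.filter_mem_eq_inter, Finset.univ_inter,
    Finset.sum_image fun s _ t _ h => cls_injective h] at hsum
  simp only [← sum_supp_eq] at hsum
  refine le_trans ?_ hsum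
  simp only [mul_sub, mul_one, Finset.sum_sub_distrib, e1]
  have f1 : ∑ r : κ → Finset P, (∏ i, F i (r i)) * (∑ i, ∑ j, ∑ p, if i = j then 0 else
      if p ∈ r i ∧ p ∈ r j then (1 : ℝ) else 0) ≤
      (Fintype.card κ : ℝ) ^ 2 * (∑ p, w p ^ 2) * Γ := by
    simp only [Finset.mul_sum]
    rw [Finset.sum_comm]
    calc _ ≤ ∑ i : κ, ∑ j : κ, ∑ p, w p ^ 2 * Γ := by
          refine Finset.sum_le_sum fun i _ => ?_
          rw [Finset.sum_comm]
          refine Finset.sum_le_sum fun j _ => ?_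
          rw [Finset.sum_comm]
          refine Finset.sum_le_sum fun p _ => ?_
          by_cases hij : i = j
          · simp only [if_pos hij, mul_zero, Finset.sum_const_zero]
            exact mul_nonneg (sq_nonneg _) (Finset.prod_nonneg fun i _ => hS0 i)
          · simp only [if_neg hij]
            exact e2 i j p hij
      _ = _ := by
          simp only [Finset.sum_const, Finset.card_univ, nsmul_eq_mul, ← Finset.sum_mul,
            ← Finset.mul_sum]
          ring
  have f2 : ∑ r : κ → Finset P, (∏ i, F i (r i)) * (∑ i, ∑ p ∈ r i, b p) ≤
      Fintype.card κ * β * Γ := by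
    calc _ = ∑ i, ∑ r : κ → Finset P, (∏ i, F i (r i)) * ∑ p ∈ r i, b p := by
          rw [Finset.sum_comm]
          exact Finset.sum_congr rfl fun r _ => by rw [Finset.mul_sum]
      _ ≤ ∑ i : κ, β * Γ := Finset.sum_le_sum fun i _ => e3 i
      _ = _ := by
          simp only [Finset.sum_const, Finset.card_univ, nsmul_eq_mul]
          ring
  linarith

end Colourings

section Subsets

variable {P : Finset ℕ}

lemma sum_disjoint_ge (F : Finset P → ℝ) (hF0 : ∀ A, 0 ≤ F A)
    (hF : ∀ A B, A ⊆ B → F B ≤ F A) {w : P → ℝ} (hw : ∀ p, 0 ≤ w p) (S : Finset P) :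
    ∑ A, F A * ∏ p ∈ A, w p ≤
      (∏ p ∈ S, (1 + w p)) * ∑ A, if Disjoint A S then F A * ∏ p ∈ A, w p else 0 := by
  rw [Finset.prod_one_add, Finset.sum_mul]
  have hmap : ∀ A ∈ (Finset.univ : Finset (Finset P)), A ∩ S ∈ S.powerset := fun A _ =>
    Finset.mem_powerset.2 Finset.inter_subset_right
  rw [← Finset.sum_fiberwise_of_maps_to hmap]
  refine Finset.sum_le_sum fun B hB => ?_
  rw [← Finset.sum_filter, Finset.mul_sum]
  have hw' : ∀ A : Finset P, 0 ≤ ∏ p ∈ A, w p := fun A => Finset.prod_nonneg fun p _ => hw p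
  calc _ ≤ ∑ A ∈ Finset.univ.filter fun A => A ∩ S = B,
        (∏ p ∈ B, w p) * (F (A \ S) * ∏ p ∈ A \ S, w p) := by
        refine Finset.sum_le_sum fun A hA => ?_
        have hA' := (Finset.mem_filter.1 hA).2
        have e : ∏ p ∈ A, w p = (∏ p ∈ B, w p) * ∏ p ∈ A \ S, w p := by
          rw [← hA', Finset.prod_inter_mul_prod_sdiff]
        rw [e]
        calc _ = F A * ((∏ p ∈ B, w p) * ∏ p ∈ A \ S, w p) := rfl
          _ ≤ F (A \ S) * ((∏ p ∈ B, w p) * ∏ p ∈ A \ S, w p) :=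
            mul_le_mul_of_nonneg_right (hF _ _ Finset.sdiff_subset) (mul_nonneg (hw' _) (hw' _))
          _ = _ := by ring
    _ = ∑ A ∈ (Finset.univ.filter fun A : Finset P => A ∩ S = B).image (· \ S),
        (∏ p ∈ B, w p) * (F A * ∏ p ∈ A, w p) := by
        rw [Finset.sum_image]
        intro A hA A' hA' h
        have h1 := (Finset.mem_filter.1 hA).2
        have h2 := (Finset.mem_filter.1 hA').2
        simp only at h
        rw [← Finset.sdiff_union_inter A S, ← Finset.sdiff_union_inter A' S, h, h1, h2]
    _ ≤ _ := by
        refine Finset.sum_le_sum_of_subset_of_nonneg ?_ fun A _ _ =>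
          mul_nonneg (hw' _) (mul_nonneg (hF0 _) (hw' _))
        intro A hA
        obtain ⟨A', -, rfl⟩ := Finset.mem_image.1 hA
        exact Finset.mem_filter.2 ⟨Finset.mem_univ _, Finset.sdiff_disjoint⟩

lemma sum_mul_prod_one_add_le (F : Finset P → ℝ) (hF0 : ∀ A, 0 ≤ F A)
    (hF : ∀ A B, A ⊆ B → F B ≤ F A) {w x : P → ℝ} (hw : ∀ p, 0 ≤ w p) (hx : ∀ p, 0 ≤ x p) :
    ∑ A, F A * ∏ p ∈ A, (w p * (1 + x p)) ≤
      (∏ p, (1 + w p * x p)) * ∑ A, F A * ∏ p ∈ A, w p := by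
  have hw' : ∀ A : Finset P, 0 ≤ ∏ p ∈ A, w p := fun A => Finset.prod_nonneg fun p _ => hw p
  have hwx : ∀ A : Finset P, 0 ≤ ∏ p ∈ A, (w p * x p) :=
    fun A => Finset.prod_nonneg fun p _ => mul_nonneg (hw p) (hx p)
  have e : ∀ A : Finset P, F A * ∏ p ∈ A, (w p * (1 + x p)) =
      ∑ B : Finset P, if B ⊆ A then F A * ((∏ p ∈ B, (w p * x p)) * ∏ p ∈ A \ B, w p) else 0 := by
    intro A
    have : ∀ p, w p * (1 + x p) = w p * x p + w p := fun p => by ring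
    simp only [this]
    rw [Finset.prod_add, Finset.mul_sum, ← Finset.sum_filter]
    refine Finset.sum_congr ?_ fun _ _ => rfl
    ext B
    simp
  simp only [e]
  rw [Finset.sum_comm, Finset.prod_one_add, Finset.sum_mul, Finset.powerset_univ]
  refine Finset.sum_le_sum fun B _ => ?_
  rw [← Finset.sum_filter, Finset.mul_sum]
  calc _ ≤ ∑ A ∈ Finset.univ.filter fun A => B ⊆ A,
        (∏ p ∈ B, (w p * x p)) * (F (A \ B) * ∏ p ∈ A \ B, w p) := by
        refine Finset.sum_le_sum fun A _ => ?_
        calc _ ≤ F (A \ B) * ((∏ p ∈ B, (w p * x p)) * ∏ p ∈ A \ B, w p) :=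
            mul_le_mul_of_nonneg_right (hF _ _ Finset.sdiff_subset) (mul_nonneg (hwx _) (hw' _))
          _ = _ := by ring
    _ = ∑ A ∈ (Finset.univ.filter fun A : Finset P => B ⊆ A).image (· \ B),
        (∏ p ∈ B, (w p * x p)) * (F A * ∏ p ∈ A, w p) := by
        rw [Finset.sum_image]
        intro A hA A' hA' h
        have h1 := (Finset.mem_filter.1 hA).2
        have h2 := (Finset.mem_filter.1 hA').2
        simp only at h
        rw [← Finset.sdiff_union_of_subset h1, ← Finset.sdiff_union_of_subset h2, h]
    _ ≤ _ := Finset.sum_le_sum_of_subset_of_nonneg (Finset.subset_univ _) fun A _ _ =>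
        mul_nonneg (hwx _) (mul_nonneg (hF0 _) (hw' _))

lemma sum_mem_le (F : Finset P → ℝ) (hF0 : ∀ A, 0 ≤ F A) (hF : ∀ A B, A ⊆ B → F B ≤ F A)
    {w : P → ℝ} (hw : ∀ p, 0 ≤ w p) (q : P) :
    ∑ A, (if q ∈ A then F A * ∏ p ∈ A, w p else 0) ≤ w q * ∑ A, F A * ∏ p ∈ A, w p := by
  have hw' : ∀ A : Finset P, 0 ≤ ∏ p ∈ A, w p := fun A => Finset.prod_nonneg fun p _ => hw p
  rw [← Finset.sum_filter, Finset.mul_sum]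
  calc _ ≤ ∑ A ∈ Finset.univ.filter fun A : Finset P => q ∈ A,
        w q * (F (A.erase q) * ∏ p ∈ A.erase q, w p) := by
        refine Finset.sum_le_sum fun A hA => ?_
        have hq := (Finset.mem_filter.1 hA).2
        rw [← Finset.mul_prod_erase A w hq]
        calc _ ≤ F (A.erase q) * (w q * ∏ p ∈ A.erase q, w p) :=
            mul_le_mul_of_nonneg_right (hF _ _ (Finset.erase_subset _ _))
              (mul_nonneg (hw q) (hw' _))
          _ = _ := by ring
    _ = ∑ A ∈ (Finset.univ.filter fun A : Finset P => q ∈ A).image (fun A => A.erase q),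
        w q * (F A * ∏ p ∈ A, w p) := by
        rw [Finset.sum_image]
        intro A hA A' hA' h
        have h1 := (Finset.mem_filter.1 hA).2
        have h2 := (Finset.mem_filter.1 hA').2
        simp only at h
        rw [← Finset.insert_erase h1, ← Finset.insert_erase h2, h]
    _ ≤ _ := Finset.sum_le_sum_of_subset_of_nonneg (Finset.subset_univ _) fun A _ _ =>
        mul_nonneg (hw q) (mul_nonneg (hF0 _) (hw' _))

end Subsets

section SieveWeight

variable {P : Finset ℕ} {κ : Type*}

lemma one_sub_sum_le_prod {ι : Type*} (S : Finset ι) (a : ι → ℝ) (h0 : ∀ i ∈ S, 0 ≤ a i)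
    (h1 : ∀ i ∈ S, a i ≤ 1) : 1 - ∑ i ∈ S, a i ≤ ∏ i ∈ S, (1 - a i) := by
  induction S using Finset.induction_on with
  | empty => simp
  | insert i S hi ih =>
    rw [Finset.sum_insert hi, Finset.prod_insert hi]
    have h2 := ih (fun j hj => h0 j (Finset.mem_insert_of_mem hj))
      fun j hj => h1 j (Finset.mem_insert_of_mem hj)
    have h3 := h0 i (Finset.mem_insert_self _ _)
    have h4 := h1 i (Finset.mem_insert_self _ _)
    have h5 : 0 ≤ ∑ j ∈ S, a j :=
      Finset.sum_nonneg fun j hj => h0 j (Finset.mem_insert_of_mem hj)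
    nlinarith [mul_le_mul_of_nonneg_left h2 (sub_nonneg.2 h4)]

/-- Logarithm of the product of a set of primes. -/
noncomputable def ell (A : Finset P) : ℝ := ∑ p ∈ A, Real.log (p : ℕ)

lemma ell_eq_log (hP : ∀ p ∈ P, p.Prime) (A : Finset P) : ell A = Real.log (nrm A) := by
  rw [ell, nrm, Nat.cast_prod, Real.log_prod]
  exact fun p _ => by exact_mod_cast (hP p p.2).ne_zero

/-- Unsigned sieve coefficients. -/
noncomputable def Yw [Fintype κ] (L : ℝ) (g : Finset P → ℝ) (s : P → Option κ) : ℝ :=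
  if ell (supp s) ≤ L then ∏ i, g (cls s i) else 0

/-- Signed sieve coefficients. -/
noncomputable def yw [Fintype κ] (L : ℝ) (g : Finset P → ℝ) (s : P → Option κ) : ℝ :=
  (-1) ^ (supp s).card * Yw L g s

/-- Forget the colour `m`. -/
noncomputable def strip (m : κ) (s : P → Option κ) : P → Option κ :=
  fun p => if s p = some m then none else s p

/-- Sieve coefficients after summation over the colour `m`. -/
noncomputable def zw [Fintype κ] (L : ℝ) (g : Finset P → ℝ) (m : κ) (s : P → Option κ) : ℝ :=
  (-1) ^ (supp s).card * ∑ t ∈ Finset.univ.filter (fun t => strip m t = s),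
    Yw L g t * ∏ p ∈ cls t m, 1 / (((p : ℕ) : ℝ) - 1)

lemma Yw_nonneg [Fintype κ] {L : ℝ} {g : Finset P → ℝ} (hg : ∀ A, 0 ≤ g A) (s : P → Option κ) :
    0 ≤ Yw L g s := by
  rw [Yw]
  split_ifs
  · exact Finset.prod_nonneg fun i _ => hg _
  · exact le_rfl

lemma supp_eq_strip_union (m : κ) (s : P → Option κ) : supp s = supp (strip m s) ∪ cls s m := by
  ext p
  rw [Finset.mem_union, mem_supp, mem_supp, mem_cls, strip]
  by_cases h : s p = some m <;> simp [h]

lemma disjoint_strip_cls (m : κ) (s : P → Option κ) : Disjoint (supp (strip m s)) (cls s m) := by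
  rw [Finset.disjoint_left]
  intro p h1 h2
  rw [mem_supp, strip, if_pos (mem_cls.1 h2)] at h1
  exact h1 rfl

lemma sum_yw_eq_sum_zw [Fintype κ] (h : κ → ℤ) (L : ℝ) (g : Finset P → ℝ) (m : κ) {n : ℤ}
    (hn : ∀ p ∈ P, ¬ (p : ℤ) ∣ n + h m) :
    ∑ s, yw L g s * xiProd h s n = ∑ s, zw L g m s * xiProd h s n := by
  rw [← Finset.sum_fiberwise (s := Finset.univ) (g := strip m)]
  refine Finset.sum_congr rfl fun s _ => ?_
  rw [zw, Finset.mul_sum, Finset.sum_mul]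
  refine Finset.sum_congr rfl fun t ht => ?_
  have hs := (Finset.mem_filter.1 ht).2
  have hx : xiProd h t n = xiProd h s n * ((-1) ^ (cls t m).card *
      ∏ p ∈ cls t m, 1 / (((p : ℕ) : ℝ) - 1)) := by
    rw [← Finset.prod_const, ← Finset.prod_mul_distrib, xiProd, xiProd, cls, Finset.prod_filter,
      ← Finset.prod_mul_distrib]
    refine Finset.prod_congr rfl fun p _ => ?_
    rw [← hs, strip]
    split_ifs with hp
    · rw [hp, xi, xi, if_neg (hn p p.2)]
      ring
    · rw [mul_one]
  have hc : (supp t).card = (supp s).card + (cls t m).card := by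
    rw [supp_eq_strip_union m t, Finset.card_union_of_disjoint (disjoint_strip_cls m t), hs]
  rw [hx, yw, hc, pow_add]
  have e : ((-1 : ℝ) ^ (cls t m).card) * (-1) ^ (cls t m).card = 1 := by
    rw [← mul_pow]; simp
  linear_combination ((-1 : ℝ) ^ (supp s).card * Yw L g t * xiProd h s n *
    ∏ p ∈ cls t m, 1 / (((p : ℕ) : ℝ) - 1)) * e

lemma zw_eq_zero_of_eq_some [Fintype κ] (L : ℝ) (g : Finset P → ℝ) {m : κ} {s : P → Option κ} {p : P}
    (h : s p = some m) : zw L g m s = 0 := by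
  rw [zw, Finset.sum_eq_zero, mul_zero]
  intro t ht
  exfalso
  have hs := (Finset.mem_filter.1 ht).2
  rw [← hs, strip] at h
  split_ifs at h with h'
  exact h' h

lemma ell_nonneg (A : Finset P) : 0 ≤ ell A :=
  Finset.sum_nonneg fun _ _ => Real.log_natCast_nonneg _

lemma ell_mono {A B : Finset P} (h : A ⊆ B) : ell A ≤ ell B :=
  Finset.sum_le_sum_of_subset_of_nonneg h fun _ _ _ => Real.log_natCast_nonneg _

lemma ell_union {A B : Finset P} (h : Disjoint A B) : ell (A ∪ B) = ell A + ell B :=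
  Finset.sum_union h

lemma ell_supp_le_of_zw_ne_zero [Fintype κ] {L : ℝ} {g : Finset P → ℝ}
    {m : κ} {s : P → Option κ} (h : zw L g m s ≠ 0) : ell (supp s) ≤ L := by
  by_contra hL
  apply h
  rw [zw, Finset.sum_eq_zero, mul_zero]
  intro t ht
  have hs := (Finset.mem_filter.1 ht).2
  rw [Yw, if_neg, zero_mul]
  intro hle
  refine hL (le_trans (ell_mono ?_) hle)
  rw [supp_eq_strip_union m t, hs]
  exact Finset.subset_union_left

lemma cls_strip_inj {m : κ} {s t : P → Option κ} (h : strip m s = strip m t)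
    (h' : cls s m = cls t m) : s = t := by
  funext p
  have h1 := congrFun h p
  have h2 : s p = some m ↔ t p = some m := by rw [← mem_cls, ← mem_cls, h']
  rw [strip, strip] at h1
  by_cases hs : s p = some m
  · rw [hs, h2.1 hs]
  · rwa [if_neg hs, if_neg fun ht => hs (h2.2 ht)] at h1

lemma one_div_sub_one_nonneg (hP : ∀ p ∈ P, p.Prime) (p : P) : 0 ≤ 1 / (((p : ℕ) : ℝ) - 1) :=
  (inv_sub_one_bounds (hP p p.2).two_le).1.le

lemma abs_zw_le [Fintype κ] (hP : ∀ p ∈ P, p.Prime) {L M : ℝ} {g : Finset P → ℝ}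
    (hg : ∀ A, 0 ≤ g A) (hM : ∀ A, g A ≤ M) (m : κ) (s : P → Option κ) :
    |zw L g m s| ≤ M ^ Fintype.card κ *
      ∑ A : Finset P, (if ell A ≤ L then ∏ p ∈ A, 1 / (((p : ℕ) : ℝ) - 1) else 0) := by
  have hM0 : 0 ≤ M := (hg ∅).trans (hM ∅)
  have hd : ∀ A : Finset P, 0 ≤ ∏ p ∈ A, 1 / (((p : ℕ) : ℝ) - 1) := fun A =>
    Finset.prod_nonneg fun p _ => one_div_sub_one_nonneg hP p
  rw [zw, abs_mul, abs_pow, abs_neg, abs_one, one_pow, one_mul, abs_of_nonneg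
    (Finset.sum_nonneg fun t _ => mul_nonneg (Yw_nonneg hg t) (hd _)), Finset.mul_sum]
  set G : Finset P → ℝ := fun A => M ^ Fintype.card κ *
    (if ell A ≤ L then ∏ p ∈ A, 1 / (((p : ℕ) : ℝ) - 1) else 0) with hG
  have hG0 : ∀ A, 0 ≤ G A := by
    intro A
    refine mul_nonneg (by positivity) ?_
    split_ifs
    · exact hd A
    · exact le_rfl
  calc _ ≤ ∑ t ∈ Finset.univ.filter (fun t => strip m t = s), G (cls t m) := by
        refine Finset.sum_le_sum fun t _ => ?_
        rw [Yw]
        split_ifs with hL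
        · simp only [hG]
          rw [if_pos (le_trans (ell_mono ?_) hL)]
          · refine mul_le_mul_of_nonneg_right ?_ (hd _)
            rw [← Finset.card_univ, ← Finset.prod_const]
            exact Finset.prod_le_prod (fun i _ => hg _) fun i _ => hM _
          · rw [supp_eq_strip_union m t]
            exact Finset.subset_union_right
        · rw [zero_mul]; exact hG0 _
    _ = ∑ A ∈ (Finset.univ.filter (fun t => strip m t = s)).image fun t => cls t m, G A := by
        rw [Finset.sum_image]
        intro t ht t' ht' h
        exact cls_strip_inj ((Finset.mem_filter.1 ht).2.trans (Finset.mem_filter.1 ht').2.symm) h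
    _ ≤ ∑ A, G A := Finset.sum_le_sum_of_subset_of_nonneg (Finset.subset_univ _) fun A _ _ => hG0 A

lemma le_abs_zw [Fintype κ] (hP : ∀ p ∈ P, p.Prime) {L : ℝ} {g : Finset P → ℝ}
    (hg : ∀ A, 0 ≤ g A) (hgL : ∀ A, g A ≠ 0 → ell A ≤ L / 2) (hga : ∀ A B, A ⊆ B → g B ≤ g A)
    {m : κ} {s : P → Option κ} (hs : ∀ p, s p ≠ some m) (hsL : ell (supp s) ≤ L / 2) :
    (∏ i ∈ Finset.univ.erase m, g (cls s i)) * (∑ A, g A * ∏ p ∈ A, 1 / ((p : ℕ) : ℝ)) ≤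
      (∏ p ∈ supp s, (1 + 1 / ((p : ℕ) : ℝ))) * |zw L g m s| := by
  have hd : ∀ A : Finset P, 0 ≤ ∏ p ∈ A, 1 / (((p : ℕ) : ℝ) - 1) := fun A =>
    Finset.prod_nonneg fun p _ => one_div_sub_one_nonneg hP p
  have hH : 0 ≤ ∏ i ∈ Finset.univ.erase m, g (cls s i) := Finset.prod_nonneg fun i _ => hg _
  have h1 := sum_disjoint_ge g hg hga (w := fun p : P => 1 / ((p : ℕ) : ℝ))
    (fun p => by positivity) (supp s)
  refine (mul_le_mul_of_nonneg_left h1 hH).trans ?_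
  rw [mul_left_comm]
  refine mul_le_mul_of_nonneg_left ?_ (Finset.prod_nonneg fun p _ => by positivity)
  rw [zw, abs_mul, abs_pow, abs_neg, abs_one, one_pow, one_mul, abs_of_nonneg
    (Finset.sum_nonneg fun t _ => mul_nonneg (Yw_nonneg hg t) (hd _)), ← Finset.sum_filter,
    Finset.mul_sum]
  set rec : Finset P → P → Option κ := fun A p => if p ∈ A then some m else s p with hrec
  have hcm : ∀ A, cls (rec A) m = A := by
    intro A
    ext p
    rw [mem_cls]
    simp only [hrec]
    split_ifs with hp <;> simp [hp, hs p]
  have hci : ∀ A, Disjoint A (supp s) → ∀ i, i ≠ m → cls (rec A) i = cls s i := by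
    intro A hA i hi
    ext p
    rw [mem_cls, mem_cls]
    simp only [hrec]
    split_ifs with hp
    · have := Finset.disjoint_left.1 hA hp
      rw [mem_supp, not_not] at this
      simp [this, hi.symm]
    · rfl
  have hst : ∀ A, Disjoint A (supp s) → strip m (rec A) = s := by
    intro A hA
    funext p
    simp only [strip, hrec]
    by_cases hp : p ∈ A
    · have := Finset.disjoint_left.1 hA hp
      rw [mem_supp, not_not] at this
      simp [hp, this]
    · simp [hp, hs p]
  calc _ ≤ ∑ A ∈ Finset.univ.filter fun A => Disjoint A (supp s),
        Yw L g (rec A) * ∏ p ∈ cls (rec A) m, 1 / (((p : ℕ) : ℝ) - 1) := by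
        refine Finset.sum_le_sum fun A hA => ?_
        have hA' := (Finset.mem_filter.1 hA).2
        rw [hcm]
        by_cases hgA : g A = 0
        · rw [hgA, zero_mul, mul_zero]
          exact mul_nonneg (Yw_nonneg hg _) (hd _)
        have hell : ell (supp (rec A)) ≤ L := by
          rw [supp_eq_strip_union m, hst A hA', hcm, ell_union hA'.symm]
          linarith [hgL A hgA]
        have he : ∏ i ∈ Finset.univ.erase m, g (cls (rec A) i) =
            ∏ i ∈ Finset.univ.erase m, g (cls s i) :=
          Finset.prod_congr rfl fun i hi => by rw [hci A hA' i (Finset.ne_of_mem_erase hi)]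
        rw [Yw, if_pos hell, ← mul_assoc, mul_comm _ (g A),
          ← Finset.mul_prod_erase Finset.univ (fun i => g (cls (rec A) i)) (Finset.mem_univ m), hcm,
          he]
        refine mul_le_mul_of_nonneg_left ?_ (mul_nonneg (hg A) hH)
        refine Finset.prod_le_prod (fun p _ => by positivity) fun p _ => ?_
        have : (2 : ℝ) ≤ (p : ℕ) := by exact_mod_cast (hP p p.2).two_le
        exact one_div_le_one_div_of_le (by linarith) (by linarith)
    _ = ∑ t ∈ (Finset.univ.filter fun A => Disjoint A (supp s)).image rec,
        Yw L g t * ∏ p ∈ cls t m, 1 / (((p : ℕ) : ℝ) - 1) := by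
        rw [Finset.sum_image]
        intro A _ B _ h
        rw [← hcm A, ← hcm B, h]
    _ ≤ _ := by
        refine Finset.sum_le_sum_of_subset_of_nonneg ?_ fun t _ _ =>
          mul_nonneg (Yw_nonneg hg t) (hd _)
        intro t ht
        obtain ⟨A, hA, rfl⟩ := Finset.mem_image.1 ht
        exact Finset.mem_filter.2 ⟨Finset.mem_univ _, hst A (Finset.mem_filter.1 hA).2⟩

end SieveWeight

section MainTerms

variable {P : Finset ℕ} {κ : Type*}

lemma prod_diagUnit (k : ℕ) (s : P → Option κ) :
    ∏ p : P, diagUnit k p (s p) =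
      ∏ p ∈ supp s, (1 / (((p : ℕ) : ℝ) - 1) * (1 - k * (1 / (((p : ℕ) : ℝ) - 1)))) := by
  rw [supp, Finset.prod_filter]
  refine Finset.prod_congr rfl fun p _ => ?_
  cases s p <;> simp [diagUnit]

variable [Fintype κ]

lemma prod_one_div_nonneg (A : Finset P) : 0 ≤ ∏ p ∈ A, 1 / ((p : ℕ) : ℝ) :=
  Finset.prod_nonneg fun _ _ => by positivity

lemma one_div_mul_one_sub_le {k p : ℕ} (hp : 2 ≤ p) (hk : 2 * k + 2 ≤ p) :
    1 / (p : ℝ) * (1 - (2 * k + 2) / p) * (1 + 1 / (p : ℝ)) ^ 2 ≤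
      1 / ((p : ℝ) - 1) * (1 - k * (1 / ((p : ℝ) - 1))) := by
  obtain ⟨h1, h2, h3, h4⟩ := inv_sub_one_bounds hp
  have hp2 : (2 : ℝ) ≤ p := by exact_mod_cast hp
  have hk' : (2 * k + 2 : ℝ) ≤ p := by exact_mod_cast hk
  have hk0 : (0 : ℝ) ≤ k := by positivity
  set δ := 1 / ((p : ℝ) - 1)
  set u := 1 / (p : ℝ) with hu
  have hu0 : 0 < u := by positivity
  have hup : u * p = 1 := by rw [hu]; field_simp
  have e1 : (2 * k + 2 : ℝ) / p = (2 * k + 2) * u := by rw [hu]; ring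
  have h3' : δ ≤ 2 * u := by rw [hu]; linarith [h3, show 2 * (1 / (p : ℝ)) = 2 / p by ring]
  have hδu : u ≤ δ := one_div_le_one_div_of_le (by linarith) (by linarith)
  have hx1 : (2 * k + 2) * u ≤ 1 := by nlinarith
  rw [e1]
  have h5 : (1 - (2 * k + 2) * u) * (1 + u) ^ 2 ≤ 1 - k * δ := by
    have h6 : (1 - (2 * k + 2) * u) * (1 + u) ^ 2 ≤ 1 - 2 * k * u := by
      have : (1 - 2 * k * u) - (1 - (2 * k + 2) * u) * (1 + u) ^ 2 =
          u ^ 2 * (4 * k + 3 + (2 * k + 2) * u) := by ring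
      have : 0 ≤ u ^ 2 * (4 * k + 3 + (2 * k + 2) * u) := by positivity
      linarith
    nlinarith
  have h7 : 0 ≤ 1 - k * δ := le_trans (mul_nonneg (by linarith) (sq_nonneg _)) h5
  calc _ = u * ((1 - (2 * k + 2) * u) * (1 + u) ^ 2) := by ring
    _ ≤ δ * (1 - k * δ) := mul_le_mul hδu h5 (mul_nonneg (by linarith) (sq_nonneg _)) h1.le

lemma main_term_ge (hP : ∀ p ∈ P, p.Prime) {L : ℝ} (hL : 0 < L) {g : Finset P → ℝ}
    (hg : ∀ A, 0 ≤ g A) (hgL : ∀ A, g A ≠ 0 → ell A ≤ L / 2) (hga : ∀ A B, A ⊆ B → g B ≤ g A)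
    (m : κ) (hk : ∀ p ∈ P, 2 * Fintype.card κ + 2 ≤ p) {β : ℝ} (hβ0 : 0 ≤ β)
    (hβ : ∑ A, (g A ^ 2 * ∏ p ∈ A, 1 / ((p : ℕ) : ℝ)) *
      ∑ p ∈ A, ((2 * Fintype.card κ + 2) / ((p : ℕ) : ℝ) + 2 / L * Real.log (p : ℕ)) ≤
      β * ∑ A, g A ^ 2 * ∏ p ∈ A, 1 / ((p : ℕ) : ℝ)) :
    (∑ A, g A * ∏ p ∈ A, 1 / ((p : ℕ) : ℝ)) ^ 2 *
      ((1 - (Fintype.card κ : ℝ) ^ 2 * ∑ p : P, (1 / ((p : ℕ) : ℝ)) ^ 2 - Fintype.card κ * β) *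
        (∑ A, g A ^ 2 * ∏ p ∈ A, 1 / ((p : ℕ) : ℝ)) ^ (Fintype.card κ - 1)) ≤
      ∑ s, zw L g m s ^ 2 * ∏ p : P, diagUnit (Fintype.card κ) p (s p) := by
  set k := Fintype.card κ with hkdef
  set γ := ∑ A, g A ^ 2 * ∏ p ∈ A, 1 / ((p : ℕ) : ℝ) with hγ
  set B := ∑ A, g A * ∏ p ∈ A, 1 / ((p : ℕ) : ℝ) with hB
  set b : P → ℝ := fun p => (2 * k + 2) / ((p : ℕ) : ℝ) + 2 / L * Real.log (p : ℕ) with hb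
  have hb0 : ∀ p, 0 ≤ b p := fun p =>
    add_nonneg (by positivity) (mul_nonneg (by positivity) (Real.log_natCast_nonneg _))
  have hB0 : 0 ≤ B := Finset.sum_nonneg fun A _ => mul_nonneg (hg A) (prod_one_div_nonneg A)
  set F : κ → Finset P → ℝ := fun i A => if i = m then (if A = ∅ then 1 else 0) else
    g A ^ 2 * ∏ p ∈ A, 1 / ((p : ℕ) : ℝ) with hF
  have hF0 : ∀ i A, 0 ≤ F i A := by
    intro i A
    simp only [hF]
    split_ifs
    · exact zero_le_one
    · exact le_rfl
    · exact mul_nonneg (sq_nonneg _) (prod_one_div_nonneg A)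
  have hFm : ∑ A, F m A = 1 := by simp [hF]
  have hFi : ∀ i, i ≠ m → ∑ A, F i A = γ := by
    intro i hi
    simp only [hF, if_neg hi, hγ]
  have hprod : ∏ i, ∑ A, F i A = γ ^ (k - 1) := by
    rw [← Finset.mul_prod_erase Finset.univ _ (Finset.mem_univ m), hFm, one_mul,
      Finset.prod_congr rfl fun i hi => hFi i (Finset.ne_of_mem_erase hi), Finset.prod_const,
      Finset.card_erase_of_mem (Finset.mem_univ m), Finset.card_univ]
  have key := le_sum_prod_cls F hF0 (w := fun p : P => 1 / ((p : ℕ) : ℝ)) hb0 ?_ (β := β) ?_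
  · rw [hprod] at key
    refine (mul_le_mul_of_nonneg_left key (sq_nonneg B)).trans ?_
    rw [Finset.mul_sum]
    refine Finset.sum_le_sum fun s _ => ?_
    have hdiag0 : 0 ≤ ∏ p : P, diagUnit k p (s p) := by
      rw [prod_diagUnit]
      refine Finset.prod_nonneg fun p _ => le_trans ?_
        (one_div_mul_one_sub_le (hP p p.2).two_le (hk p p.2))
      have : (2 * k + 2 : ℝ) ≤ (p : ℕ) := by exact_mod_cast hk p p.2
      have : (2 * k + 2 : ℝ) / (p : ℕ) ≤ 1 := div_le_one_of_le₀ this (by positivity)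
      exact mul_nonneg (mul_nonneg (by positivity) (by linarith)) (sq_nonneg _)
    have hz0 : 0 ≤ zw L g m s ^ 2 * ∏ p : P, diagUnit k p (s p) := mul_nonneg (sq_nonneg _) hdiag0
    by_cases hs : ∃ p, s p = some m
    · obtain ⟨p, hp⟩ := hs
      have : F m (cls s m) = 0 := by
        simp only [hF, if_true]
        rw [if_neg]
        exact Finset.ne_empty_of_mem (mem_cls.2 hp)
      rw [Finset.prod_eq_zero (Finset.mem_univ m) this, zero_mul, mul_zero]
      exact hz0
    push Not at hs
    by_cases hb1 : 1 - ∑ p ∈ supp s, b p ≤ 0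
    · rw [max_eq_left hb1, mul_zero, mul_zero]
      exact hz0
    rw [max_eq_right (not_le.1 hb1).le]
    have hx0 : 0 ≤ ∑ p ∈ supp s, (2 * k + 2 : ℝ) / ((p : ℕ) : ℝ) :=
      Finset.sum_nonneg fun p _ => by positivity
    have hbs : ∑ p ∈ supp s, b p = ∑ p ∈ supp s, (2 * k + 2 : ℝ) / ((p : ℕ) : ℝ) +
        2 / L * ell (supp s) := by
      rw [ell, Finset.mul_sum, ← Finset.sum_add_distrib]
    have hell0 := ell_nonneg (supp s)
    have hellL : ell (supp s) ≤ L / 2 := by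
      have : 2 / L * ell (supp s) ≤ 1 := by linarith
      rw [div_mul_eq_mul_div, div_le_one hL] at this
      linarith
    have h1 := le_abs_zw hP hg hgL hga hs hellL
    set H := ∏ i ∈ Finset.univ.erase m, g (cls s i) with hH
    have hH0 : 0 ≤ H := Finset.prod_nonneg fun i _ => hg _
    have hFs : ∏ i, F i (cls s i) = H ^ 2 * ∏ p ∈ supp s, 1 / ((p : ℕ) : ℝ) := by
      have hcm : cls s m = ∅ := by
        rw [Finset.eq_empty_iff_forall_notMem]
        exact fun p hp => hs p (mem_cls.1 hp)
      rw [prod_supp_eq, ← Finset.mul_prod_erase Finset.univ (fun i => F i (cls s i))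
        (Finset.mem_univ m), ← Finset.mul_prod_erase Finset.univ
        (fun i => ∏ p ∈ cls s i, 1 / ((p : ℕ) : ℝ)) (Finset.mem_univ m), hcm, hH,
        ← Finset.prod_pow]
      simp only [hF, if_true, one_mul, Finset.prod_empty]
      rw [← Finset.prod_mul_distrib]
      exact Finset.prod_congr rfl fun i hi => if_neg (Finset.ne_of_mem_erase hi)
    set D := ∏ p ∈ supp s, (1 + 1 / ((p : ℕ) : ℝ)) with hD
    have hD0 : 0 < D := Finset.prod_pos fun p _ => by positivity
    have h2 : (H * B) ^ 2 ≤ D ^ 2 * zw L g m s ^ 2 := by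
      rw [← sq_abs (zw L g m s), ← mul_pow]
      exact pow_le_pow_left₀ (mul_nonneg hH0 hB0) h1 2
    have h3 : (∏ p ∈ supp s, 1 / ((p : ℕ) : ℝ)) * (1 - ∑ p ∈ supp s, b p) * D ^ 2 ≤
        ∏ p : P, diagUnit k p (s p) := by
      have h4 : 1 - ∑ p ∈ supp s, b p ≤ ∏ p ∈ supp s, (1 - (2 * k + 2) / ((p : ℕ) : ℝ)) := by
        refine le_trans ?_ (one_sub_sum_le_prod (supp s)
          (fun p => (2 * k + 2 : ℝ) / ((p : ℕ) : ℝ)) (fun p _ => by positivity) fun p _ => ?_)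
        · have : 0 ≤ 2 / L * ell (supp s) := by positivity
          linarith
        · have : (2 * k + 2 : ℝ) ≤ (p : ℕ) := by exact_mod_cast hk p p.2
          exact div_le_one_of_le₀ this (by positivity)
      calc _ ≤ (∏ p ∈ supp s, 1 / ((p : ℕ) : ℝ)) *
            (∏ p ∈ supp s, (1 - (2 * k + 2) / ((p : ℕ) : ℝ))) * D ^ 2 :=
            mul_le_mul_of_nonneg_right (mul_le_mul_of_nonneg_left h4 (prod_one_div_nonneg _))
              (sq_nonneg _)
        _ = ∏ p ∈ supp s, (1 / ((p : ℕ) : ℝ) * (1 - (2 * k + 2) / ((p : ℕ) : ℝ)) *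
            (1 + 1 / ((p : ℕ) : ℝ)) ^ 2) := by
            rw [hD, ← Finset.prod_pow, ← Finset.prod_mul_distrib, ← Finset.prod_mul_distrib]
        _ ≤ _ := by
            rw [prod_diagUnit]
            refine Finset.prod_le_prod (fun p _ => ?_) fun p _ =>
              one_div_mul_one_sub_le (hP p p.2).two_le (hk p p.2)
            have : (2 * k + 2 : ℝ) ≤ (p : ℕ) := by exact_mod_cast hk p p.2
            have : (2 * k + 2 : ℝ) / (p : ℕ) ≤ 1 := div_le_one_of_le₀ this (by positivity)
            exact mul_nonneg (mul_nonneg (by positivity) (by linarith)) (sq_nonneg _)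
    rw [hFs]
    set U := (∏ p ∈ supp s, 1 / ((p : ℕ) : ℝ)) * (1 - ∑ p ∈ supp s, b p) with hU
    have hU0 : 0 ≤ U := mul_nonneg (prod_one_div_nonneg _) (not_le.1 hb1).le
    calc _ = (H * B) ^ 2 * U := by rw [hU]; ring
      _ ≤ D ^ 2 * zw L g m s ^ 2 * U := mul_le_mul_of_nonneg_right h2 hU0
      _ = zw L g m s ^ 2 * (U * D ^ 2) := by ring
      _ ≤ _ := mul_le_mul_of_nonneg_left h3 (sq_nonneg _)
  · intro i p
    by_cases hi : i = m
    · subst hi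
      rw [hFm, mul_one, Finset.sum_eq_zero]
      · positivity
      · intro A _
        simp only [hF, if_true]
        split_ifs with h1 h2
        · simp [h2] at h1
        · rfl
        · rfl
    · simp only [hF, if_neg hi]
      exact sum_mem_le (fun A => g A ^ 2) (fun A => sq_nonneg _)
        (fun A C h => pow_le_pow_left₀ (hg C) (hga A C h) 2) (fun p => by positivity) p
  · intro i
    by_cases hi : i = m
    · subst hi
      rw [hFm, mul_one, Finset.sum_eq_zero]
      · exact hβ0
      · intro A _
        simp only [hF, if_true]
        split_ifs with h1
        · simp [h1]
        · simp
    · simp only [hF, if_neg hi]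
      exact hβ

lemma sum_sq_rowAll_le {L : ℝ} {g : Finset P → ℝ}
    (hg : ∀ A, 0 ≤ g A) (hga : ∀ A B, A ⊆ B → g B ≤ g A) :
    ∑ s : P → Option κ, yw L g s ^ 2 * ∏ p : P, rowAll (Fintype.card κ) p (s p) ≤
      (∏ p : P, (1 + 2 * Fintype.card κ / ((p : ℕ) : ℝ) ^ 2)) *
        ((∏ p : P, (1 + 2 * Fintype.card κ / ((p : ℕ) : ℝ) ^ 2)) *
          ∑ A, g A ^ 2 * ∏ p ∈ A, 1 / ((p : ℕ) : ℝ)) ^ Fintype.card κ := by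
  set k := Fintype.card κ with hkdef
  set Q := ∏ p : P, (1 + 2 * k / ((p : ℕ) : ℝ) ^ 2) with hQ
  have hQ0 : 0 ≤ Q := Finset.prod_nonneg fun p _ => by positivity
  set F : Finset P → ℝ := fun A => g A ^ 2 * ∏ p ∈ A, (1 / ((p : ℕ) : ℝ) * (1 + 2 * k / (p : ℕ)))
    with hF
  have hF0 : ∀ A, 0 ≤ F A := fun A => mul_nonneg (sq_nonneg _)
    (Finset.prod_nonneg fun p _ => by positivity)
  have hFs : ∑ A, F A ≤ Q * ∑ A, g A ^ 2 * ∏ p ∈ A, 1 / ((p : ℕ) : ℝ) := by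
    refine (sum_mul_prod_one_add_le (fun A => g A ^ 2) (fun A => sq_nonneg _)
        (fun A C h => pow_le_pow_left₀ (hg C) (hga A C h) 2)
        (w := fun p : P => 1 / ((p : ℕ) : ℝ)) (x := fun p : P => 2 * k / ((p : ℕ) : ℝ))
        (fun p => by positivity) fun p => by positivity).trans (le_of_eq ?_)
    congr 1
    refine Finset.prod_congr rfl fun p _ => ?_
    rw [div_mul_div_comm, one_mul, sq]
  have hterm : ∀ s : P → Option κ, yw L g s ^ 2 * ∏ p : P, rowAll k p (s p) ≤
      Q * ∏ i, F (cls s i) := by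
    intro s
    have h1 : yw L g s ^ 2 ≤ ∏ i, g (cls s i) ^ 2 := by
      rw [yw, mul_pow, ← pow_mul, mul_comm _ 2, pow_mul, neg_one_sq, one_pow, one_mul, Yw,
        Finset.prod_pow]
      split_ifs
      · exact le_rfl
      · rw [zero_pow two_ne_zero]; exact sq_nonneg _
    have h2 : ∏ p : P, rowAll k p (s p) ≤ Q * ∏ p ∈ supp s, (1 / ((p : ℕ) : ℝ) *
        (1 + 2 * k / (p : ℕ))) := by
      rw [supp, Finset.prod_filter, hQ, ← Finset.prod_mul_distrib]
      refine Finset.prod_le_prod (fun p _ => ?_) fun p _ => ?_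
      · cases s p <;> simp only [rowAll] <;> positivity
      · cases s p with
        | none => simp [rowAll]
        | some i =>
          simp only [rowAll, ne_eq, reduceCtorEq, not_false_eq_true, if_true]
          refine le_mul_of_one_le_left (by positivity) ?_
          have : (0 : ℝ) ≤ 2 * k / ((p : ℕ) : ℝ) ^ 2 := by positivity
          linarith
    have h3 : ∏ i, F (cls s i) = (∏ i, g (cls s i) ^ 2) * ∏ p ∈ supp s, (1 / ((p : ℕ) : ℝ) *
        (1 + 2 * k / (p : ℕ))) := by
      rw [prod_supp_eq, ← Finset.prod_mul_distrib]
    rw [h3]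
    calc _ ≤ (∏ i, g (cls s i) ^ 2) * (Q * ∏ p ∈ supp s, (1 / ((p : ℕ) : ℝ) *
        (1 + 2 * k / (p : ℕ)))) := by
          refine mul_le_mul h1 h2 (Finset.prod_nonneg fun p _ => ?_)
            (Finset.prod_nonneg fun i _ => sq_nonneg _)
          cases s p <;> simp only [rowAll] <;> positivity
      _ = _ := by ring
  refine (Finset.sum_le_sum fun s _ => hterm s).trans ?_
  rw [← Finset.mul_sum]
  refine mul_le_mul_of_nonneg_left ?_ hQ0
  refine (sum_prod_cls_le (fun _ : κ => F) fun _ A => hF0 A).trans ?_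
  rw [Finset.prod_const, Finset.card_univ]
  exact pow_le_pow_left₀ (Finset.sum_nonneg fun A _ => hF0 A) hFs _

lemma nrm_le_floor_exp (hP : ∀ p ∈ P, p.Prime) {A : Finset P} {L : ℝ} (h : ell A ≤ L) :
    nrm A ≤ ⌊Real.exp L⌋₊ := by
  refine Nat.le_floor ?_
  rw [ell_eq_log hP, Real.log_le_iff_le_exp (by exact_mod_cast nrm_pos hP A)] at h
  exact h

lemma sum_ell_le (hP : ∀ p ∈ P, p.Prime) (L : ℝ) {f : ℕ → ℝ} (hf : ∀ q, 0 ≤ f q) :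
    ∑ A : Finset P, (if ell A ≤ L then f (nrm A) else 0) ≤
      ∑ q ∈ Finset.Icc 1 ⌊Real.exp L⌋₊, f q := by
  rw [← Finset.sum_filter, ← Finset.sum_image (f := f) (g := nrm)
    fun A _ B _ h => nrm_injective hP h]
  refine Finset.sum_le_sum_of_subset_of_nonneg ?_ fun q _ _ => hf q
  intro q hq
  obtain ⟨A, hA, rfl⟩ := Finset.mem_image.1 hq
  exact Finset.mem_Icc.2 ⟨nrm_pos hP A, nrm_le_floor_exp hP (Finset.mem_filter.1 hA).2⟩

lemma sum_abs_yw_le (hP : ∀ p ∈ P, p.Prime) {L M : ℝ} {g : Finset P → ℝ}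
    (hg : ∀ A, 0 ≤ g A) (hM : ∀ A, g A ≤ M) :
    ∑ s : P → Option κ, |yw L g s| * 3 ^ (supp s).card ≤ M ^ Fintype.card κ *
      ∑ q ∈ Finset.Icc 1 ⌊Real.exp L⌋₊,
        ((3 * (Fintype.card κ + 1) : ℕ) : ℝ) ^ q.primeFactors.card := by
  have hM0 : 0 ≤ M := (hg ∅).trans (hM ∅)
  have h1 : ∀ s : P → Option κ, |yw L g s| * 3 ^ (supp s).card ≤
      M ^ Fintype.card κ * (if ell (supp s) ≤ L then (3 : ℝ) ^ (supp s).card else 0) := by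
    intro s
    rw [yw, abs_mul, abs_pow, abs_neg, abs_one, one_pow, one_mul, abs_of_nonneg (Yw_nonneg hg s), Yw]
    split_ifs
    · refine mul_le_mul_of_nonneg_right ?_ (by positivity)
      rw [← Finset.card_univ, ← Finset.prod_const]
      exact Finset.prod_le_prod (fun i _ => hg _) fun i _ => hM _
    · simp
  refine (Finset.sum_le_sum fun s _ => h1 s).trans ?_
  rw [← Finset.mul_sum]
  refine mul_le_mul_of_nonneg_left ?_ (by positivity)
  refine le_trans ?_ (sum_ell_le hP L
    (f := fun q => ((3 * (Fintype.card κ + 1) : ℕ) : ℝ) ^ q.primeFactors.card)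
    fun q => by positivity)
  rw [← Finset.sum_fiberwise (s := Finset.univ) (g := supp)]
  refine Finset.sum_le_sum fun A _ => ?_
  have : ∀ s ∈ Finset.univ.filter (fun s : P → Option κ => supp s = A),
      (if ell (supp s) ≤ L then (3 : ℝ) ^ (supp s).card else 0) =
      if ell A ≤ L then (3 : ℝ) ^ A.card else 0 := fun s hs => by
    rw [(Finset.mem_filter.1 hs).2]
  rw [Finset.sum_congr rfl this, Finset.sum_const, nsmul_eq_mul, card_primeFactors_nrm hP]
  split_ifs
  · push_cast
    rw [mul_pow, mul_comm]
    refine mul_le_mul_of_nonneg_left ?_ (by positivity)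
    have h2 : (Finset.univ.filter (fun s : P → Option κ => supp s = A)).card ≤
        (Finset.univ.filter (fun s : P → Option κ => supp s ⊆ A)).card := by
      refine Finset.card_le_card fun s hs => ?_
      rw [Finset.mem_filter] at hs ⊢
      exact ⟨hs.1, hs.2.subset⟩
    rw [card_supp_subset] at h2
    exact_mod_cast h2
  · simp

lemma sum_ell_prod_le (hP : ∀ p ∈ P, p.Prime) (L : ℝ) :
    ∑ A : Finset P, (if ell A ≤ L then ∏ p ∈ A, 1 / (((p : ℕ) : ℝ) - 1) else 0) ≤
      ∑ q ∈ Finset.Icc 1 ⌊Real.exp L⌋₊, ((2 : ℕ) : ℝ) ^ q.primeFactors.card / q := by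
  refine le_trans (Finset.sum_le_sum fun A _ => ?_) (sum_ell_le hP L
    (f := fun q => ((2 : ℕ) : ℝ) ^ q.primeFactors.card / q) fun q => by positivity)
  split_ifs
  · rw [card_primeFactors_nrm hP, nrm, Nat.cast_prod, ← Finset.prod_const, ← Finset.prod_div_distrib]
    exact Finset.prod_le_prod (fun p _ => one_div_sub_one_nonneg hP p) fun p _ =>
      (inv_sub_one_bounds (hP p p.2).two_le).2.2.1
  · exact le_rfl

end MainTerms

/-- The sum of reciprocals of the integers in `[1, N]` coprime to `W`. -/
noncomputable def coprimeSum (W N : ℕ) : ℝ :=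
  ∑ n ∈ (Finset.Ico 1 (N + 1)).filter W.Coprime, 1 / (n : ℝ)

lemma coprimeSum_mono (W : ℕ) {M N : ℕ} (h : M ≤ N) : coprimeSum W M ≤ coprimeSum W N :=
  Finset.sum_le_sum_of_subset_of_nonneg
    (Finset.filter_subset_filter _ (Finset.Ico_subset_Ico_right (by omega)))
    fun _ _ _ => by positivity

lemma coprimeSum_succ (W M : ℕ) : coprimeSum W (W * (M + 1)) = coprimeSum W (W * M) +
    ∑ n ∈ (Finset.Ico (W * M + 1) (W * M + 1 + W)).filter W.Coprime, 1 / (n : ℝ) := by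
  rw [coprimeSum, coprimeSum, ← Finset.sum_union]
  · rw [← Finset.filter_union, Finset.Ico_union_Ico_eq_Ico (by omega) (by omega)]
    congr 3
    ring
  · exact Finset.disjoint_filter_filter (Finset.Ico_disjoint_Ico_consecutive _ _ _)

lemma le_coprimeSum_mul {W : ℕ} (hW : 0 < W) (M : ℕ) :
    W.totient / (W : ℝ) * Real.log (M + 1 : ℕ) ≤ coprimeSum W (W * M) := by
  have h : ∀ M : ℕ, W.totient / (W : ℝ) * (harmonic M : ℚ) ≤ coprimeSum W (W * M) := by
    intro M
    induction M with
    | zero => simp [coprimeSum]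
    | succ M ih =>
      rw [coprimeSum_succ, harmonic_succ]
      push_cast
      rw [mul_add]
      refine add_le_add (by exact_mod_cast ih) ?_
      have h1 : ∀ n ∈ (Finset.Ico (W * M + 1) (W * M + 1 + W)).filter W.Coprime,
          1 / ((W : ℝ) * (M + 1)) ≤ 1 / (n : ℝ) := by
        intro n hn
        rw [Finset.mem_filter, Finset.mem_Ico] at hn
        have h0 : (0 : ℝ) < n := by exact_mod_cast (by omega : 0 < n)
        refine one_div_le_one_div_of_le h0 ?_
        have : n ≤ W * (M + 1) := by rw [mul_add]; omega
        exact_mod_cast this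
      have := Finset.card_nsmul_le_sum _ _ _ h1
      rw [Nat.filter_coprime_Ico_eq_totient, nsmul_eq_mul] at this
      refine le_trans (le_of_eq ?_) this
      have : (W : ℝ) ≠ 0 := by positivity
      field_simp
  refine le_trans ?_ (h M)
  exact mul_le_mul_of_nonneg_left (by exact_mod_cast log_add_one_le_harmonic M) (by positivity)

lemma coprimeSum_mul_le {W : ℕ} (hW : 0 < W) (M : ℕ) :
    coprimeSum W (W * (M + 1)) ≤ W + W.totient / (W : ℝ) * (1 + Real.log M) := by
  have h : ∀ M : ℕ, coprimeSum W (W * (M + 1)) ≤ W + W.totient / (W : ℝ) * (harmonic M : ℚ) := by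
    intro M
    induction M with
    | zero =>
      rw [coprimeSum_succ]
      have h1 : ∀ n ∈ (Finset.Ico (W * 0 + 1) (W * 0 + 1 + W)).filter W.Coprime,
          1 / (n : ℝ) ≤ 1 := by
        intro n hn
        rw [Finset.mem_filter, Finset.mem_Ico] at hn
        exact (div_le_one (by exact_mod_cast (by omega : 0 < n))).2
          (by exact_mod_cast (by omega : 1 ≤ n))
      have := Finset.sum_le_card_nsmul _ _ _ h1
      rw [Nat.filter_coprime_Ico_eq_totient, nsmul_eq_mul, mul_one] at this
      have h2 : (W.totient : ℝ) ≤ W := by exact_mod_cast Nat.totient_le W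
      simp [coprimeSum] at this ⊢
      linarith
    | succ M ih =>
      rw [coprimeSum_succ, harmonic_succ]
      push_cast
      rw [mul_add (W.totient / (W : ℝ)), ← add_assoc]
      refine add_le_add (by exact_mod_cast ih) ?_
      have h1 : ∀ n ∈ (Finset.Ico (W * (M + 1) + 1) (W * (M + 1) + 1 + W)).filter W.Coprime,
          1 / (n : ℝ) ≤ 1 / ((W : ℝ) * (M + 1)) := by
        intro n hn
        rw [Finset.mem_filter, Finset.mem_Ico] at hn
        refine one_div_le_one_div_of_le (by positivity) ?_
        exact_mod_cast (by omega : W * (M + 1) ≤ n)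
      have := Finset.sum_le_card_nsmul _ _ _ h1
      rw [Nat.filter_coprime_Ico_eq_totient, nsmul_eq_mul] at this
      refine this.trans (le_of_eq ?_)
      have : (W : ℝ) ≠ 0 := by positivity
      field_simp
  refine (h M).trans ?_
  gcongr
  exact_mod_cast harmonic_le_one_add_log M

lemma le_coprimeSum {W : ℕ} (hW : 0 < W) {t : ℝ} :
    W.totient / (W : ℝ) * t - W ≤ coprimeSum W ⌊Real.exp t⌋₊ := by
  set N := ⌊Real.exp t⌋₊
  have h1 := (le_coprimeSum_mul hW (N / W)).trans
    (coprimeSum_mono W (Nat.mul_div_le N W))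
  have hWr : (0 : ℝ) < W := by exact_mod_cast hW
  have h2 : Real.exp t / W ≤ (N / W + 1 : ℕ) := by
    rw [div_le_iff₀ hWr]
    have h3 : N + 1 ≤ (N / W + 1) * W := by
      have := Nat.lt_div_mul_add (a := N) hW
      rw [add_mul, one_mul]; omega
    have h4 : ((N + 1 : ℕ) : ℝ) ≤ ((N / W + 1) * W : ℕ) := by exact_mod_cast h3
    have h5 := (Nat.lt_floor_add_one (Real.exp t)).le
    push_cast at h4 ⊢
    linarith
  have h3 := Real.log_le_log (by positivity) h2
  rw [Real.log_div (Real.exp_pos t).ne' hWr.ne', Real.log_exp] at h3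
  have hκ0 : (0 : ℝ) ≤ W.totient / (W : ℝ) := by positivity
  have hκ1 : W.totient / (W : ℝ) ≤ 1 :=
    (div_le_one hWr).2 (by exact_mod_cast Nat.totient_le W)
  have h4 : Real.log W ≤ W := (Real.log_le_sub_one_of_pos hWr).trans (by linarith)
  have h5 : 0 ≤ Real.log W := Real.log_natCast_nonneg W
  have := mul_le_mul_of_nonneg_left h3 hκ0
  nlinarith

lemma coprimeSum_le {W : ℕ} (hW : 0 < W) {t : ℝ} (ht : 0 ≤ t) :
    coprimeSum W ⌊Real.exp t⌋₊ ≤ W.totient / (W : ℝ) * t + (W + 1) := by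
  set N := ⌊Real.exp t⌋₊
  have hWr : (0 : ℝ) < W := by exact_mod_cast hW
  have h0 : N ≤ W * (N / W + 1) := by
    have := Nat.lt_div_mul_add (a := N) hW
    rw [mul_add, mul_one, mul_comm]; omega
  have h1 := (coprimeSum_mono W h0).trans (coprimeSum_mul_le hW (N / W))
  have h2 : Real.log (N / W : ℕ) ≤ t := by
    rcases Nat.eq_zero_or_pos (N / W) with h | h
    · rw [h]; simpa
    · rw [Real.log_le_iff_le_exp (by exact_mod_cast h)]
      refine le_trans ?_ (Nat.floor_le (Real.exp_pos t).le)
      exact_mod_cast Nat.div_le_self _ _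
  have hκ0 : (0 : ℝ) ≤ W.totient / (W : ℝ) := by positivity
  have hκ1 : W.totient / (W : ℝ) ≤ 1 :=
    (div_le_one hWr).2 (by exact_mod_cast Nat.totient_le W)
  have := mul_le_mul_of_nonneg_left h2 hκ0
  nlinarith

section

variable {P : Finset ℕ}

lemma prod_one_div_eq (A : Finset P) : ∏ p ∈ A, 1 / ((p : ℕ) : ℝ) = 1 / (nrm A : ℝ) := by
  rw [nrm, Nat.cast_prod, Finset.prod_div_distrib, Finset.prod_const_one]

lemma sum_ell_inv_le (hP : ∀ p ∈ P, p.Prime) {W : ℕ} (hW : 0 < W)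
    (hPW : ∀ p ∈ P, W.Coprime p) {t : ℝ} (ht : 0 ≤ t) :
    ∑ A : Finset P, (if ell A ≤ t then ∏ p ∈ A, 1 / ((p : ℕ) : ℝ) else 0) ≤
      W.totient / (W : ℝ) * t + (W + 1) := by
  have h := sum_ell_le hP t (f := fun n => if W.Coprime n then 1 / (n : ℝ) else 0)
    (fun q => by positivity)
  refine le_trans (le_of_eq ?_) (h.trans (le_trans (le_of_eq ?_) (coprimeSum_le hW ht)))
  · refine Finset.sum_congr rfl fun A _ => ?_
    have hc : W.Coprime (nrm A) := Nat.Coprime.prod_right fun (p : P) _ => hPW p p.2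
    rw [prod_one_div_eq, if_pos hc]
  · rw [← Finset.sum_filter, coprimeSum]
    rfl

lemma exists_nrm_eq (hP : ∀ p ∈ P, p.Prime) {a : ℕ} (ha : Squarefree a)
    (h : ∀ p, p.Prime → p ∣ a → p ∈ P) : ∃ A : Finset P, nrm A = a := by
  refine ⟨Finset.univ.filter fun p : P => (p : ℕ) ∣ a, ?_⟩
  rw [nrm, Finset.prod_filter, Finset.prod_coe_sort P (fun p => if p ∣ a then p else 1),
    ← Finset.prod_filter]
  conv_rhs => rw [← Nat.prod_primeFactors_of_squarefree ha]
  refine Finset.prod_congr ?_ fun _ _ => rfl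
  ext p
  rw [Finset.mem_filter, Nat.mem_primeFactors]
  exact ⟨fun hp => ⟨hP p hp.1, hp.2, ha.ne_zero⟩, fun hp => ⟨h p hp.1 hp.2.1, hp.2.1⟩⟩

lemma le_sum_ell_inv (hP : ∀ p ∈ P, p.Prime) {W : ℕ} (hW : 0 < W) {t : ℝ}
    (hPW : ∀ p : ℕ, p.Prime → W.Coprime p → p ≤ ⌊Real.exp t⌋₊ → p ∈ P) :
    W.totient / (W : ℝ) * t / 2 - W ≤
      ∑ A : Finset P, (if ell A ≤ t then ∏ p ∈ A, 1 / ((p : ℕ) : ℝ) else 0) := by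
  set N := ⌊Real.exp t⌋₊
  set S := Finset.univ.filter fun A : Finset P => ell A ≤ t with hS
  have h1 : coprimeSum W N ≤ ∑ c ∈ Finset.Ioo 0 (N + 1) ×ˢ S,
      1 / ((c.1 ^ 2 * nrm c.2 : ℕ) : ℝ) := by
    rw [coprimeSum]
    have key : (Finset.Ico 1 (N + 1)).filter W.Coprime ⊆
        (Finset.Ioo 0 (N + 1) ×ˢ S).image (fun c => c.1 ^ 2 * nrm c.2) := by
      intro n hn
      rw [Finset.mem_filter, Finset.mem_Ico] at hn
      obtain ⟨a, b, ha, hb, hab, hsq⟩ := Nat.sq_mul_squarefree_of_pos (by omega : 0 < n)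
      have hadvd : a ∣ n := ⟨b ^ 2, by rw [← hab, mul_comm]⟩
      have hbdvd : b ∣ n := ⟨b * a, by rw [← hab]; ring⟩
      have han := Nat.le_of_dvd (by omega) hadvd
      have hbn := Nat.le_of_dvd (by omega) hbdvd
      obtain ⟨A, hA⟩ := exists_nrm_eq hP hsq fun p hp hpa => hPW p hp
        (hn.2.coprime_dvd_right (hpa.trans hadvd)) (by have := Nat.le_of_dvd ha hpa; omega)
      rw [Finset.mem_image]
      refine ⟨(b, A), ?_, by rw [hA, hab]⟩
      rw [Finset.mem_product, Finset.mem_Ioo, hS, Finset.mem_filter]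
      refine ⟨⟨hb, by dsimp; omega⟩, Finset.mem_univ _, ?_⟩
      rw [ell_eq_log hP, hA, Real.log_le_iff_le_exp (by exact_mod_cast ha)]
      exact (Nat.le_floor_iff (Real.exp_pos t).le).1 (by omega)
    refine (Finset.sum_le_sum_of_subset_of_nonneg key fun _ _ _ => by positivity).trans ?_
    exact Finset.sum_image_le_of_nonneg fun _ _ => by positivity
  rw [Finset.sum_product] at h1
  have h2 : ∑ b ∈ Finset.Ioo 0 (N + 1), ∑ A ∈ S, 1 / ((b ^ 2 * nrm A : ℕ) : ℝ) =
      (∑ b ∈ Finset.Ioo 0 (N + 1), ((b : ℝ) ^ 2)⁻¹) * ∑ A ∈ S, ∏ p ∈ A, 1 / ((p : ℕ) : ℝ) := by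
    rw [Finset.sum_mul_sum]
    refine Finset.sum_congr rfl fun b _ => Finset.sum_congr rfl fun A _ => ?_
    rw [prod_one_div_eq]
    push_cast
    rw [one_div, one_div, mul_inv]
  have h3 : ∑ b ∈ Finset.Ioo 0 (N + 1), ((b : ℝ) ^ 2)⁻¹ ≤ 2 := by
    have := sum_Ioo_inv_sq_le (α := ℝ) 0 (N + 1)
    norm_num at this
    exact_mod_cast this
  have h4 : 0 ≤ ∑ A ∈ S, ∏ p ∈ A, 1 / ((p : ℕ) : ℝ) :=
    Finset.sum_nonneg fun A _ => prod_one_div_nonneg A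
  have h5 := le_coprimeSum hW (t := t)
  rw [h2] at h1
  have h6 := mul_le_mul_of_nonneg_right h3 h4
  have hWr : (0 : ℝ) ≤ W := by positivity
  rw [← Finset.sum_filter]
  linarith

end

/-- A step function approximating `1 / x` between the scales `L / 2 ^ (J + 1)` and `L / 2`. -/
noncomputable def stepG (J : ℕ) (L x : ℝ) : ℝ :=
  ∑ j ∈ Finset.range (J + 1), 2 ^ j * (if x ≤ L / 2 ^ (j + 1) then 1 else 0)

lemma stepG_nonneg (J : ℕ) (L x : ℝ) : 0 ≤ stepG J L x :=
  Finset.sum_nonneg fun _ _ => by positivity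

lemma stepG_antitone (J : ℕ) (L : ℝ) {x y : ℝ} (h : x ≤ y) : stepG J L y ≤ stepG J L x := by
  refine Finset.sum_le_sum fun j _ => mul_le_mul_of_nonneg_left ?_ (by positivity)
  split_ifs with h1 h2
  · rfl
  · exact absurd (h.trans h1) h2
  · exact zero_le_one
  · rfl

lemma le_of_stepG_ne_zero {J : ℕ} {L x : ℝ} (hL : 0 ≤ L) (h : stepG J L x ≠ 0) : x ≤ L / 2 := by
  obtain ⟨j, -, hj⟩ := Finset.exists_ne_zero_of_sum_ne_zero h
  have h1 : x ≤ L / 2 ^ (j + 1) := by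
    by_contra h2
    simp [h2] at hj
  refine h1.trans (div_le_div_of_nonneg_left hL two_pos ?_)
  exact le_self_pow₀ one_le_two (by omega)

lemma sum_two_pow_mul_sq_le (n : ℕ) (i : ℕ → ℝ) (hi : ∀ j, i j = 0 ∨ i j = 1) :
    (∑ j ∈ Finset.range n, 2 ^ j * i j) ^ 2 ≤ ∑ j ∈ Finset.range n, 4 ^ (j + 1) * i j := by
  have h0 : ∀ n, 0 ≤ ∑ j ∈ Finset.range n, 2 ^ j * i j ∧
      ∑ j ∈ Finset.range n, 2 ^ j * i j ≤ 2 ^ n := by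
    intro n
    induction n with
    | zero => simp
    | succ n ih =>
      rw [Finset.sum_range_succ, pow_succ]
      have : (0 : ℝ) < 2 ^ n := by positivity
      rcases hi n with h | h <;> rw [h] <;> constructor <;> linarith
  induction n with
  | zero => simp
  | succ n ih =>
    have h1 := h0 (n + 1)
    have h2 : 0 ≤ ∑ j ∈ Finset.range n, (4 : ℝ) ^ (j + 1) * i j :=
      Finset.sum_nonneg fun j _ => by rcases hi j with h | h <;> rw [h] <;> positivity
    rw [Finset.sum_range_succ _ n] at h1 ⊢
    rw [Finset.sum_range_succ _ n]
    rcases hi n with h | h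
    · simpa [h] using ih
    · have h3 : (4 : ℝ) ^ (n + 1) = (2 ^ (n + 1)) ^ 2 := by
        rw [← pow_mul, mul_comm, pow_mul]; norm_num
      rw [h] at h1 ⊢
      have := pow_le_pow_left₀ h1.1 h1.2 2
      rw [← h3] at this
      linarith

lemma stepG_sq_le (J : ℕ) (L x : ℝ) :
    stepG J L x ^ 2 ≤
      ∑ j ∈ Finset.range (J + 1), 4 ^ (j + 1) * (if x ≤ L / 2 ^ (j + 1) then 1 else 0) := by
  refine sum_two_pow_mul_sq_le _ _ fun j => ?_
  split_ifs <;> simp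

lemma stepG_le (J : ℕ) (L x : ℝ) : stepG J L x ≤ 2 ^ (J + 1) := by
  have h : stepG J L x ≤ ∑ j ∈ Finset.range (J + 1), (2 : ℝ) ^ j :=
    Finset.sum_le_sum fun j _ => by split_ifs <;> simp
  refine h.trans ?_
  rw [geom_sum_eq (by norm_num)]
  norm_num

lemma stepG_sq_ge (J : ℕ) (L x : ℝ) :
    4 ^ J * (if x ≤ L / 2 ^ (J + 1) then 1 else 0) ≤ stepG J L x ^ 2 := by
  have h : 2 ^ J * (if x ≤ L / 2 ^ (J + 1) then 1 else 0) ≤ stepG J L x :=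
    Finset.single_le_sum (f := fun j => (2 : ℝ) ^ j * (if x ≤ L / 2 ^ (j + 1) then 1 else 0))
      (fun _ _ => by positivity) (Finset.self_mem_range_succ J)
  have h2 := pow_le_pow_left₀ (by positivity) h 2
  refine le_trans (le_of_eq ?_) h2
  rw [mul_pow, ← pow_mul, mul_comm J, pow_mul]
  split_ifs <;> norm_num

section

variable {α : Type*} [Fintype α] {w ℓ : α → ℝ} {J : ℕ} {L K C : ℝ}

lemma two_pow_mul_le (hC : 0 ≤ C) (hLC : 2 ^ (J + 3) * C ≤ K * L) {j : ℕ}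
    (hj : j ∈ Finset.range (J + 1)) : 2 ^ j * C ≤ K * L / 8 := by
  have h1 : (2 : ℝ) ^ j ≤ 2 ^ J :=
    pow_le_pow_right₀ one_le_two (by rw [Finset.mem_range] at hj; omega)
  have h2 := mul_le_mul_of_nonneg_right h1 hC
  rw [pow_add] at hLC
  linarith

lemma le_sum_stepG (hC : 0 ≤ C) (hLC : 2 ^ (J + 3) * C ≤ K * L)
    (hV : ∀ j ∈ Finset.range (J + 1), K * (L / 2 ^ (j + 1)) / 2 - C ≤
      ∑ a, if ℓ a ≤ L / 2 ^ (j + 1) then w a else 0) :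
    (J + 1) * (K * L / 8) ≤ ∑ a, stepG J L (ℓ a) * w a := by
  simp only [stepG, Finset.sum_mul]
  rw [Finset.sum_comm]
  have h : ∀ j ∈ Finset.range (J + 1), K * L / 8 ≤
      ∑ a, 2 ^ j * (if ℓ a ≤ L / 2 ^ (j + 1) then 1 else 0) * w a := by
    intro j hj
    have h1 := mul_le_mul_of_nonneg_left (hV j hj) (by positivity : (0 : ℝ) ≤ 2 ^ j)
    have h2 := two_pow_mul_le hC hLC hj
    have h3 : (2 : ℝ) ^ j * (K * (L / 2 ^ (j + 1)) / 2 - C) = K * L / 4 - 2 ^ j * C := by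
      rw [pow_succ]; field_simp; ring
    rw [h3, Finset.mul_sum] at h1
    refine le_trans (by linarith) (h1.trans (le_of_eq ?_))
    refine Finset.sum_congr rfl fun a _ => ?_
    split_ifs <;> simp
  have := Finset.card_nsmul_le_sum _ _ _ h
  rw [Finset.card_range, nsmul_eq_mul] at this
  exact_mod_cast this

lemma le_sum_stepG_sq (hw : ∀ a, 0 ≤ w a) (hC : 0 ≤ C) (hLC : 2 ^ (J + 3) * C ≤ K * L)
    (hV : K * (L / 2 ^ (J + 1)) / 2 - C ≤ ∑ a, if ℓ a ≤ L / 2 ^ (J + 1) then w a else 0) :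
    2 ^ J * (K * L / 8) ≤ ∑ a, stepG J L (ℓ a) ^ 2 * w a := by
  have h1 := mul_le_mul_of_nonneg_left hV (by positivity : (0 : ℝ) ≤ 4 ^ J)
  have h2 := two_pow_mul_le hC hLC (Finset.self_mem_range_succ J)
  have h3 : (4 : ℝ) ^ J * (K * (L / 2 ^ (J + 1)) / 2 - C) =
      2 ^ J * (K * L / 4 - 2 ^ J * C) := by
    rw [show (4 : ℝ) ^ J = 2 ^ J * 2 ^ J by rw [← mul_pow]; norm_num, pow_succ]
    field_simp; ring
  rw [h3] at h1
  refine le_trans (mul_le_mul_of_nonneg_left (by linarith) (by positivity)) (h1.trans ?_)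
  rw [Finset.mul_sum]
  refine Finset.sum_le_sum fun a _ => ?_
  refine le_trans (le_of_eq ?_) (mul_le_mul_of_nonneg_right (stepG_sq_ge J L (ℓ a)) (hw a))
  split_ifs <;> simp

lemma sum_stepG_sq_le (hw : ∀ a, 0 ≤ w a) (hC : 0 ≤ C) (hLC : 2 ^ (J + 3) * C ≤ K * L)
    (hV : ∀ j ∈ Finset.range (J + 1),
      (∑ a, if ℓ a ≤ L / 2 ^ (j + 1) then w a else 0) ≤ K * (L / 2 ^ (j + 1)) + C) :
    ∑ a, stepG J L (ℓ a) ^ 2 * w a ≤ 2 ^ J * (8 * (K * L)) := by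
  have hKL : 0 ≤ K * L := le_trans (by positivity) hLC
  calc _ ≤ ∑ a, ∑ j ∈ Finset.range (J + 1),
        4 ^ (j + 1) * (if ℓ a ≤ L / 2 ^ (j + 1) then w a else 0) := by
        refine Finset.sum_le_sum fun a _ => ?_
        refine (mul_le_mul_of_nonneg_right (stepG_sq_le J L (ℓ a)) (hw a)).trans (le_of_eq ?_)
        rw [Finset.sum_mul]
        exact Finset.sum_congr rfl fun j _ => by split_ifs <;> simp
    _ = ∑ j ∈ Finset.range (J + 1), 4 ^ (j + 1) *
        ∑ a, (if ℓ a ≤ L / 2 ^ (j + 1) then w a else 0) := by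
        rw [Finset.sum_comm]
        exact Finset.sum_congr rfl fun j _ => by rw [Finset.mul_sum]
    _ ≤ ∑ j ∈ Finset.range (J + 1), 2 ^ j * (4 * (K * L)) := by
        refine Finset.sum_le_sum fun j hj => ?_
        have h1 := mul_le_mul_of_nonneg_left (hV j hj) (by positivity : (0 : ℝ) ≤ 4 ^ (j + 1))
        have h3 : (4 : ℝ) ^ (j + 1) * (K * (L / 2 ^ (j + 1)) + C) =
            2 ^ j * (2 * (K * L) + 4 * (2 ^ j * C)) := by
          rw [show (4 : ℝ) ^ (j + 1) = 4 * (2 ^ j * 2 ^ j) by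
            rw [← mul_pow, pow_succ]; norm_num; ring, pow_succ]
          field_simp; ring
        rw [h3] at h1
        refine h1.trans (mul_le_mul_of_nonneg_left ?_ (by positivity))
        linarith [two_pow_mul_le hC hLC hj]
    _ ≤ _ := by
        rw [← Finset.sum_mul, geom_sum_eq (by norm_num)]
        have : (0 : ℝ) < 2 ^ J := by positivity
        rw [pow_succ]
        nlinarith

lemma sum_stepG_sq_mul_le (hw : ∀ a, 0 ≤ w a) (hL : 0 ≤ L) (hC : 0 ≤ C)
    (hLC : 2 ^ (J + 3) * C ≤ K * L)
    (hV : ∀ j ∈ Finset.range (J + 1),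
      (∑ a, if ℓ a ≤ L / 2 ^ (j + 1) then w a else 0) ≤ K * (L / 2 ^ (j + 1)) + C) :
    ∑ a, stepG J L (ℓ a) ^ 2 * w a * ℓ a ≤ (J + 1) * (2 * K * L ^ 2) := by
  have hKL : 0 ≤ K * L := le_trans (by positivity) hLC
  calc _ ≤ ∑ a, ∑ j ∈ Finset.range (J + 1),
        4 ^ (j + 1) * (L / 2 ^ (j + 1) * if ℓ a ≤ L / 2 ^ (j + 1) then w a else 0) := by
        refine Finset.sum_le_sum fun a _ => ?_
        rcases le_or_gt (ℓ a) 0 with h | h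
        · refine le_trans (mul_nonpos_of_nonneg_of_nonpos
            (mul_nonneg (sq_nonneg _) (hw a)) h) (Finset.sum_nonneg fun j _ => ?_)
          have := hw a
          split_ifs <;> positivity
        have h0 : 0 ≤ w a * ℓ a := mul_nonneg (hw a) h.le
        rw [mul_assoc]
        refine (mul_le_mul_of_nonneg_right (stepG_sq_le J L (ℓ a)) h0).trans ?_
        rw [Finset.sum_mul]
        refine Finset.sum_le_sum fun j _ => ?_
        rw [mul_assoc]
        refine mul_le_mul_of_nonneg_left ?_ (by positivity)
        split_ifs with h2
        · rw [one_mul, mul_comm]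
          exact mul_le_mul_of_nonneg_right h2 (hw a)
        · simp
    _ = ∑ j ∈ Finset.range (J + 1), 4 ^ (j + 1) * (L / 2 ^ (j + 1) *
        ∑ a, (if ℓ a ≤ L / 2 ^ (j + 1) then w a else 0)) := by
        rw [Finset.sum_comm]
        exact Finset.sum_congr rfl fun j _ => by rw [Finset.mul_sum, Finset.mul_sum]
    _ ≤ ∑ j ∈ Finset.range (J + 1), 2 * K * L ^ 2 := by
        refine Finset.sum_le_sum fun j hj => ?_
        have h1 := mul_le_mul_of_nonneg_left (hV j hj)
          (by positivity : (0 : ℝ) ≤ 4 ^ (j + 1) * (L / 2 ^ (j + 1)))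
        have h3 : (4 : ℝ) ^ (j + 1) * (L / 2 ^ (j + 1)) * (K * (L / 2 ^ (j + 1)) + C) =
            L * (K * L + 2 * (2 ^ j * C)) := by
          rw [show (4 : ℝ) ^ (j + 1) = 4 * (2 ^ j * 2 ^ j) by
            rw [← mul_pow, pow_succ]; norm_num; ring, pow_succ]
          field_simp; ring
        rw [h3, mul_assoc] at h1
        have := mul_le_mul_of_nonneg_left (two_pow_mul_le hC hLC hj) hL
        nlinarith [mul_nonneg hL hKL]
    _ = _ := by simp

end

/-- The standing assumptions on the set of sieving primes `P`, the presieving modulus `W`,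
the logarithmic level `L`, the number of forms `k` and the number of steps `J`. -/
structure SieveSetup (P : Finset ℕ) (W : ℕ) (L : ℝ) (k J : ℕ) : Prop where
  prime : ∀ p ∈ P, p.Prime
  W_pos : 0 < W
  coprime : ∀ p ∈ P, W.Coprime p
  mem : ∀ p : ℕ, p.Prime → W.Coprime p → p ≤ ⌊Real.exp L⌋₊ → p ∈ P
  le : ∀ p ∈ P, p ≤ ⌊Real.exp L⌋₊
  large : ∀ p ∈ P, 2 * k + 2 ≤ p
  L_pos : 0 < L
  sum_sq : ∑ p : P, (1 / ((p : ℕ) : ℝ)) ^ 2 ≤ 1 / (16 * ((k : ℝ) + 1) ^ 2)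
  long : 2 ^ (J + 3) * ((W : ℝ) + 1) ≤ W.totient / (W : ℝ) * L
  steps : (128 : ℝ) * (J + 1) * k ≤ 2 ^ J

/-- The one-dimensional sieve weight. -/
noncomputable def gw {P : Finset ℕ} (J : ℕ) (L : ℝ) (A : Finset P) : ℝ := stepG J L (ell A)

/-- The first moment of the one-dimensional sieve weight. -/
noncomputable def gsum (P : Finset ℕ) (J : ℕ) (L : ℝ) : ℝ :=
  ∑ A : Finset P, gw J L A * ∏ p ∈ A, 1 / ((p : ℕ) : ℝ)

/-- The second moment of the one-dimensional sieve weight. -/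
noncomputable def gsq (P : Finset ℕ) (J : ℕ) (L : ℝ) : ℝ :=
  ∑ A : Finset P, gw J L A ^ 2 * ∏ p ∈ A, 1 / ((p : ℕ) : ℝ)

/-- The linear form whose square is the sieve weight. -/
noncomputable def sieveForm {κ : Type*} [Fintype κ] (P : Finset ℕ) (J : ℕ) (L : ℝ) (h : κ → ℤ)
    (n : ℤ) : ℝ := ∑ s : P → Option κ, yw L (gw J L) s * xiProd h s n

section

variable {P : Finset ℕ} {W J k : ℕ} {L : ℝ}

lemma gw_nonneg (A : Finset P) : 0 ≤ gw J L A := stepG_nonneg _ _ _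

lemma gw_anti (A B : Finset P) (h : A ⊆ B) : gw J L B ≤ gw J L A := stepG_antitone _ _ (ell_mono h)

lemma gw_le (A : Finset P) : gw J L A ≤ 2 ^ (J + 1) := stepG_le _ _ _

lemma gsq_nonneg : 0 ≤ gsq P J L :=
  Finset.sum_nonneg fun A _ => mul_nonneg (sq_nonneg _) (prod_one_div_nonneg A)

namespace SieveSetup

lemma scale_le (H : SieveSetup P W L k J) (j : ℕ) : L / 2 ^ (j + 1) ≤ L :=
  div_le_self H.L_pos.le (one_le_pow₀ one_le_two)

lemma upper (H : SieveSetup P W L k J) (j : ℕ) :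
    ∑ A : Finset P, (if ell A ≤ L / 2 ^ (j + 1) then ∏ p ∈ A, 1 / ((p : ℕ) : ℝ) else 0) ≤
      W.totient / (W : ℝ) * (L / 2 ^ (j + 1)) + (W + 1) :=
  sum_ell_inv_le H.prime H.W_pos H.coprime (div_nonneg H.L_pos.le (by positivity))

lemma lower (H : SieveSetup P W L k J) (j : ℕ) :
    W.totient / (W : ℝ) * (L / 2 ^ (j + 1)) / 2 - (W + 1) ≤
    ∑ A : Finset P, (if ell A ≤ L / 2 ^ (j + 1) then ∏ p ∈ A, 1 / ((p : ℕ) : ℝ) else 0) := by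
  have := le_sum_ell_inv H.prime H.W_pos (t := L / 2 ^ (j + 1)) fun p hp hW hpL => H.mem p hp hW
    (hpL.trans (Nat.floor_mono (Real.exp_le_exp.2 (H.scale_le j))))
  linarith

lemma gsum_ge (H : SieveSetup P W L k J) :
    (J + 1) * (W.totient / (W : ℝ) * L / 8) ≤ gsum P J L :=
  le_sum_stepG (C := W + 1) (by positivity) H.long fun j _ => H.lower j

lemma gsq_ge (H : SieveSetup P W L k J) :
    2 ^ J * (W.totient / (W : ℝ) * L / 8) ≤ gsq P J L :=
  le_sum_stepG_sq (C := W + 1) prod_one_div_nonneg (by positivity) H.long (H.lower J)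

lemma gsq_le (H : SieveSetup P W L k J) :
    gsq P J L ≤ 2 ^ J * (8 * (W.totient / (W : ℝ) * L)) :=
  sum_stepG_sq_le (C := W + 1) prod_one_div_nonneg (by positivity) H.long fun j _ => H.upper j

lemma gsq_ell_le (H : SieveSetup P W L k J) :
    ∑ A : Finset P, gw J L A ^ 2 * (∏ p ∈ A, 1 / ((p : ℕ) : ℝ)) * ell A ≤
      (J + 1) * (2 * (W.totient / (W : ℝ)) * L ^ 2) :=
  sum_stepG_sq_mul_le (C := W + 1) prod_one_div_nonneg H.L_pos.le (by positivity) H.long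
    fun j _ => H.upper j

lemma steps_ell (H : SieveSetup P W L k J) :
    k * (2 / L * ∑ A : Finset P, gw J L A ^ 2 * (∏ p ∈ A, 1 / ((p : ℕ) : ℝ)) * ell A) ≤
      1 / 4 * gsq P J L := by
  have hL := H.L_pos
  set K := W.totient / (W : ℝ)
  have hK : 0 ≤ K := by positivity
  calc _ ≤ k * (2 / L * ((J + 1) * (2 * K * L ^ 2))) := by
        gcongr; exact H.gsq_ell_le
    _ = (128 * (J + 1) * k) * (K * L / 32) := by field_simp; ring
    _ ≤ 2 ^ J * (K * L / 32) := mul_le_mul_of_nonneg_right H.steps (by positivity)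
    _ = 1 / 4 * (2 ^ J * (K * L / 8)) := by ring
    _ ≤ _ := mul_le_mul_of_nonneg_left H.gsq_ge (by norm_num)

lemma sum_mem_bound (H : SieveSetup P W L k J) :
    ∑ A : Finset P, (gw J L A ^ 2 * ∏ p ∈ A, 1 / ((p : ℕ) : ℝ)) *
      ∑ p ∈ A, (2 * k + 2) / ((p : ℕ) : ℝ) ≤ 1 / (8 * ((k : ℝ) + 1)) * gsq P J L := by
  calc _ = ∑ p : P, (2 * k + 2) / ((p : ℕ) : ℝ) * ∑ A : Finset P,
        (if p ∈ A then gw J L A ^ 2 * ∏ p ∈ A, 1 / ((p : ℕ) : ℝ) else 0) := by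
        simp only [Finset.mul_sum]
        rw [Finset.sum_comm' (t' := Finset.univ) (s' := fun p => Finset.univ.filter (p ∈ ·))
          (by simp)]
        refine Finset.sum_congr rfl fun p _ => ?_
        rw [Finset.sum_filter]
        exact Finset.sum_congr rfl fun A _ => by split_ifs <;> ring
    _ ≤ ∑ p : P, (2 * k + 2) / ((p : ℕ) : ℝ) * (1 / ((p : ℕ) : ℝ) * gsq P J L) := by
        refine Finset.sum_le_sum fun p _ => mul_le_mul_of_nonneg_left ?_ (by positivity)
        exact sum_mem_le (fun A => gw J L A ^ 2) (fun A => sq_nonneg _)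
          (fun A B h => pow_le_pow_left₀ (gw_nonneg B) (gw_anti A B h) 2)
          (fun p => by positivity) p
    _ = (2 * k + 2) * gsq P J L * ∑ p : P, (1 / ((p : ℕ) : ℝ)) ^ 2 := by
        rw [Finset.mul_sum]
        exact Finset.sum_congr rfl fun p _ => by ring
    _ ≤ (2 * k + 2) * gsq P J L * (1 / (16 * ((k : ℝ) + 1) ^ 2)) :=
        mul_le_mul_of_nonneg_left H.sum_sq (mul_nonneg (by positivity) gsq_nonneg)
    _ = _ := by field_simp; ring

lemma gsq_pos (H : SieveSetup P W L k J) : 0 < gsq P J L := by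
  refine lt_of_lt_of_le ?_ H.gsq_ge
  have := H.L_pos
  have h1 : (0 : ℝ) < W := by exact_mod_cast H.W_pos
  have h2 : (0 : ℝ) < W.totient := by exact_mod_cast Nat.totient_pos.2 H.W_pos
  positivity

variable {κ : Type*} [Fintype κ]

lemma main_ge (H : SieveSetup P W L (Fintype.card κ) J) (m : κ) :
    gsum P J L ^ 2 * (gsq P J L ^ (Fintype.card κ - 1) / 2) ≤
      ∑ s, zw L (gw J L) m s ^ 2 * ∏ p : P, diagUnit (Fintype.card κ) p (s p) := by
  set k := Fintype.card κ with hk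
  have hγ := H.gsq_pos
  set E := ∑ A : Finset P, gw J L A ^ 2 * (∏ p ∈ A, 1 / ((p : ℕ) : ℝ)) * ell A with hE
  have hE0 : 0 ≤ E := Finset.sum_nonneg fun A _ =>
    mul_nonneg (mul_nonneg (sq_nonneg _) (prod_one_div_nonneg A)) (ell_nonneg A)
  have hL := H.L_pos
  set β := 1 / (8 * ((k : ℝ) + 1)) + 2 / L * E / gsq P J L with hβ
  have hβ0 : 0 ≤ β := by positivity
  have key := main_term_ge H.prime H.L_pos (g := gw J L) gw_nonneg
    (fun A hA => le_of_stepG_ne_zero H.L_pos.le hA) gw_anti m H.large hβ0 ?_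
  · refine le_trans ?_ key
    refine mul_le_mul_of_nonneg_left ?_ (sq_nonneg _)
    rw [div_eq_mul_one_div, mul_comm]
    refine mul_le_mul_of_nonneg_right ?_ (pow_nonneg gsq_nonneg _)
    rw [← hk]
    have h1 : (k : ℝ) ^ 2 * ∑ p : P, (1 / ((p : ℕ) : ℝ)) ^ 2 ≤ 1 / 16 := by
      refine (mul_le_mul_of_nonneg_left H.sum_sq (sq_nonneg _)).trans ?_
      rw [mul_one_div, div_le_div_iff₀ (by positivity) (by norm_num)]
      have : (0 : ℝ) ≤ k := by positivity
      nlinarith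
    have h2 : k * β ≤ 3 / 8 := by
      have h3 := H.steps_ell
      have h4 : k * (2 / L * E / gsq P J L) ≤ 1 / 4 := by
        rw [mul_div_assoc', div_le_iff₀ hγ]
        exact h3
      have h5 : k * (1 / (8 * ((k : ℝ) + 1))) ≤ 1 / 8 := by
        rw [mul_one_div, div_le_div_iff₀ (by positivity) (by norm_num)]
        linarith
      rw [hβ, mul_add]
      linarith
    linarith
  · simp only [Finset.sum_add_distrib, mul_add]
    have h1 := H.sum_mem_bound
    change _ ≤ β * gsq P J L
    rw [hβ, add_mul, div_mul_cancel₀ _ hγ.ne']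
    refine add_le_add h1 (le_of_eq ?_)
    rw [hE, Finset.mul_sum]
    refine Finset.sum_congr rfl fun A _ => ?_
    rw [← Finset.mul_sum, ell]
    ring

lemma prod_one_add_le (H : SieveSetup P W L k J) :
    (∏ p : P, (1 + 2 * k / ((p : ℕ) : ℝ) ^ 2)) ^ (k + 1) ≤ 4 := by
  have h1 : ∏ p : P, (1 + 2 * k / ((p : ℕ) : ℝ) ^ 2) ≤ Real.exp (1 / (8 * ((k : ℝ) + 1))) := by
    calc _ ≤ ∏ p : P, Real.exp (2 * k * (1 / ((p : ℕ) : ℝ)) ^ 2) := by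
          refine Finset.prod_le_prod (fun p _ => by positivity) fun p _ => ?_
          have := Real.add_one_le_exp (2 * k * (1 / ((p : ℕ) : ℝ)) ^ 2)
          refine le_trans (le_of_eq ?_) this
          ring
      _ = Real.exp (2 * k * ∑ p : P, (1 / ((p : ℕ) : ℝ)) ^ 2) := by
          rw [← Real.exp_sum, Finset.mul_sum]
      _ ≤ _ := by
          rw [Real.exp_le_exp]
          refine (mul_le_mul_of_nonneg_left H.sum_sq (by positivity)).trans ?_
          rw [mul_one_div, div_le_div_iff₀ (by positivity) (by positivity)]
          have : (0 : ℝ) ≤ k := by positivity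
          nlinarith
  calc _ ≤ Real.exp (1 / (8 * ((k : ℝ) + 1))) ^ (k + 1) :=
        pow_le_pow_left₀ (Finset.prod_nonneg fun p _ => by positivity) h1 _
    _ = Real.exp (1 / 8) := by
        rw [← Real.exp_nat_mul]
        congr 1
        push_cast
        field_simp
    _ ≤ Real.exp 1 := Real.exp_le_exp.2 (by norm_num)
    _ ≤ 4 := by linarith [Real.exp_one_lt_d9]

/-- Upper bound for the sum of the squared sieve weights over an interval. -/
lemma sum_square_upper (H : SieveSetup P W L (Fintype.card κ) J) (h : κ → ℤ)
    (hh : ∀ p ∈ P, ∀ i j, i ≠ j → ¬ (p : ℤ) ∣ h i - h j) (v A B : ℤ) (hAB : A ≤ B) :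
    ∑ n ∈ Finset.Ioc A B,
      (if n ≡ v [ZMOD W] then sieveForm P J L h n ^ 2 else 0) ≤
    ((B - A : ℤ) : ℝ) / W * (4 * gsq P J L ^ Fintype.card κ) +
      ((2 ^ (J + 1)) ^ Fintype.card κ * ((3 * (Fintype.card κ + 1) : ℕ) : ℝ) ^
        ((3 * (Fintype.card κ + 1)) ^ 2) * Real.exp L ^ 2) ^ 2 := by
  set k := Fintype.card κ with hk
  refine (sum_square_le H.prime h hh H.W_pos v H.coprime A B hAB _).trans ?_
  refine add_le_add (mul_le_mul_of_nonneg_left ?_ ?_) ?_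
  · refine (sum_sq_rowAll_le gw_nonneg gw_anti).trans ?_
    rw [mul_pow, ← mul_assoc, ← pow_succ', ← hk]
    exact mul_le_mul_of_nonneg_right H.prod_one_add_le (pow_nonneg gsq_nonneg _)
  · exact div_nonneg (by exact_mod_cast sub_nonneg.2 hAB) (by positivity)
  · refine pow_le_pow_left₀ (Finset.sum_nonneg fun _ _ => by positivity) ?_ 2
    refine (sum_abs_yw_le H.prime gw_nonneg gw_le).trans ?_
    rw [mul_assoc]
    refine mul_le_mul_of_nonneg_left ?_ (by positivity)
    set K := 3 * (k + 1)
    have h1 : ∀ q ∈ Finset.Icc 1 ⌊Real.exp L⌋₊, (K : ℝ) ^ q.primeFactors.card ≤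
        (K : ℝ) ^ K ^ 2 * Real.exp L := by
      intro q hq
      rw [Finset.mem_Icc] at hq
      refine (pow_card_primeFactors_le K (by omega) hq.1).trans ?_
      refine mul_le_mul_of_nonneg_left ?_ (by positivity)
      have hq' := (Nat.le_floor_iff (Real.exp_pos L).le).1 hq.2
      have hq1 : (1 : ℝ) ≤ q := by exact_mod_cast hq.1
      exact (Real.sqrt_le_iff.2 ⟨by linarith, by nlinarith⟩).trans hq'
    refine (Finset.sum_le_card_nsmul _ _ _ h1).trans ?_
    rw [Nat.card_Icc, nsmul_eq_mul, Nat.add_sub_cancel]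
    have h2 := Nat.floor_le (Real.exp_pos L).le
    have := mul_le_mul_of_nonneg_right h2
      (by positivity : 0 ≤ (K : ℝ) ^ K ^ 2 * Real.exp L)
    refine this.trans (le_of_eq (by ring))

lemma abs_zw_le' (H : SieveSetup P W L (Fintype.card κ) J) (m : κ) (s : P → Option κ) :
    |zw L (gw J L) m s| ≤ (2 ^ (J + 1)) ^ Fintype.card κ * (2 + L) ^ 2 := by
  refine (abs_zw_le H.prime gw_nonneg gw_le m s).trans ?_
  refine mul_le_mul_of_nonneg_left ?_ (by positivity)
  refine (sum_ell_prod_le H.prime L).trans ?_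
  refine (sum_pow_card_primeFactors_div_le (c := 1) le_rfl _).trans ?_
  have hL := H.L_pos
  refine pow_le_pow_left₀ (add_nonneg zero_le_one (Real.log_natCast_nonneg _)) ?_ 2
  have h1 : ((⌊Real.exp L⌋₊ + 1 : ℕ) : ℝ) ≤ Real.exp (L + 1) := by
    have h2 := Nat.floor_le (Real.exp_pos L).le
    have h3 := Real.add_one_le_exp (1 : ℝ)
    have h4 := Real.one_le_exp hL.le
    rw [Real.exp_add]
    push_cast
    nlinarith
  have h2 := Real.log_le_log (by positivity) h1
  rw [Real.log_exp] at h2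
  linarith

/-- Lower bound for the sum of the squared sieve weights over shifted primes. -/
lemma sum_thw_square_lower (H : SieveSetup P W L (Fintype.card κ) J) (h : κ → ℤ)
    (hh : ∀ p ∈ P, ∀ i j, i ≠ j → ¬ (p : ℤ) ∣ h i - h j) (m : κ) {v : ℤ}
    (hv : IsCoprime (v + h m) W) {x : ℝ} (hR : Real.exp 2 * (W * ⌊Real.exp L⌋₊ ^ 2 : ℕ) ≤ x)
    (hRx : Real.exp 2 * Real.exp L ≤ x) {I : Finset ℤ}
    (hI : ∀ n : ℕ, thw x n ≠ 0 → (n : ℤ) - h m ∈ I) :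
    totalW x / W.totient * (gsum P J L ^ 2 * (gsq P J L ^ (Fintype.card κ - 1) / 2)) -
      ((2 ^ (J + 1)) ^ Fintype.card κ * (2 + L) ^ 2) ^ 2 *
        ∑ q ∈ Finset.Icc 1 (⌊Real.exp L⌋₊ ^ 2),
        ((3 * (Fintype.card κ + 1) ^ 2 : ℕ) : ℝ) ^ q.primeFactors.card * err x (W * q) ≤
    ∑ n ∈ I, (if n ≡ v [ZMOD W] then
      thw x (n + h m).toNat * sieveForm P J L h n ^ 2 else 0) := by
  have hPR : ∀ p ∈ P, Real.exp 2 * p ≤ x := fun p hp => le_trans (mul_le_mul_of_nonneg_left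
    ((Nat.le_floor_iff (Real.exp_pos L).le).1 (H.le p hp)) (Real.exp_pos 2).le) hRx
  have key := le_sum_thw_mul_square H.prime h hh m
    (fun p hp => by have := H.large p hp; omega) H.W_pos hv H.coprime hR hPR hI
    (z := zw L (gw J L) m) (fun s p hs => zw_eq_zero_of_eq_some L _ hs)
    (H.abs_zw_le' m) fun s hs => nrm_le_floor_exp H.prime (ell_supp_le_of_zw_ne_zero hs)
  have htot : 0 ≤ totalW x / W.totient :=
    div_nonneg (Finset.sum_nonneg fun n _ => thw_nonneg x n) (by positivity)
  refine le_trans (sub_le_sub_right (mul_le_mul_of_nonneg_left (H.main_ge m) htot) _)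
    (key.trans (le_of_eq ?_))
  refine Finset.sum_congr rfl fun n _ => ?_
  split_ifs with hn
  swap
  · rfl
  by_cases ht : thw x (n + h m).toNat = 0
  · rw [ht, zero_mul, zero_mul]
  rw [sieveForm, sum_yw_eq_sum_zw h L _ m]
  intro p hp hdvd
  have hpr := prime_of_thw_ne_zero ht
  have h0 : ((n + h m).toNat : ℤ) = n + h m := by
    refine Int.toNat_of_nonneg ?_
    by_contra hneg
    rw [Int.toNat_of_nonpos (by omega)] at hpr
    exact Nat.not_prime_zero hpr
  rw [← h0, Int.natCast_dvd_natCast, Nat.prime_dvd_prime_iff_eq (H.prime p hp) hpr] at hdvd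
  have h1 := lt_of_thw_ne_zero ht
  rw [← hdvd] at h1
  linarith [hPR p hp]

end SieveSetup

end

lemma theta_sub_theta_le_totalW (t : ℝ) :
    Chebyshev.theta (Real.exp (t + 1)) - Chebyshev.theta (Real.exp (t - 1)) ≤
      totalW (Real.exp t) := by
  have h1 : ⌊Real.exp (t - 1)⌋₊ ≤ ⌊Real.exp (t + 1)⌋₊ :=
    Nat.floor_mono (Real.exp_le_exp.2 (by linarith))
  have e : Chebyshev.theta (Real.exp (t + 1)) - Chebyshev.theta (Real.exp (t - 1)) =
      ∑ n ∈ Finset.Ioc ⌊Real.exp (t - 1)⌋₊ ⌊Real.exp (t + 1)⌋₊,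
        (if n.Prime then Real.log n else 0) := by
    rw [Chebyshev.theta, Chebyshev.theta, Finset.sum_filter, Finset.sum_filter,
      ← Finset.Ioc_union_Ioc_eq_Ioc (Nat.zero_le _) h1, Finset.sum_union
        (Finset.Ioc_disjoint_Ioc_of_le le_rfl), add_sub_cancel_left]
  rw [e, totalW]
  refine le_trans (Finset.sum_le_sum (g := thw (Real.exp t)) fun n hn => le_of_eq ?_)
    (Finset.sum_le_sum_of_subset_of_nonneg ?_ fun n _ _ => thw_nonneg _ n)
  · rw [Finset.mem_Ioc] at hn
    rw [thw]
    split_ifs with hp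
    swap
    · rfl
    have hn0 : (0 : ℝ) < n := by exact_mod_cast hp.pos
    have h2 := (Nat.le_floor_iff (Real.exp_pos _).le).1 hn.2
    have h3 := (Nat.floor_lt (Real.exp_pos _).le).1 hn.1
    rw [← Real.lt_log_iff_exp_lt hn0] at h3
    rw [← Real.log_le_iff_le_exp hn0] at h2
    rw [wt, bump_eq_one, mul_one]
    rw [Real.log_div hn0.ne' (Real.exp_pos _).ne', Real.log_exp, abs_le]
    constructor <;> linarith
  · intro n hn
    rw [Finset.mem_Ioc] at hn
    rw [Finset.mem_range, cut, Nat.lt_succ_iff]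
    refine hn.2.trans (Nat.floor_mono ?_)
    rw [← Real.exp_add]
    exact Real.exp_le_exp.2 (by linarith)

lemma eventually_exp_le_totalW : ∀ᶠ t : ℝ in atTop, Real.exp t ≤ totalW (Real.exp t) := by
  filter_upwards [eventually_mul_pow_le_exp 40 1 (by norm_num : (0 : ℝ) < 1 / 2),
    eventually_ge_atTop (2 : ℝ)] with t ht ht2
  refine le_trans ?_ (theta_sub_theta_le_totalW t)
  have h1 := Chebyshev.theta_ge' (x := Real.exp (t + 1)) (Real.one_le_exp (by linarith))
  have h2 := Chebyshev.theta_le_log4_mul_x (x := Real.exp (t - 1)) (Real.exp_pos _).le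
  have hs : Real.sqrt (Real.exp (t + 1)) = Real.exp (1 / 2 * t) * Real.exp (1 / 2) := by
    rw [Real.sqrt_eq_iff_mul_self_eq (Real.exp_pos _).le (by positivity), ← Real.exp_add,
      ← Real.exp_add]
    ring_nf
  have hl : Real.log (Real.exp (t + 1) + 2) ≤ t + 2 := by
    rw [Real.log_le_iff_le_exp (by positivity)]
    have h3 : Real.exp (t + 2) = Real.exp (t + 1) * Real.exp 1 := by rw [← Real.exp_add]; ring_nf
    have h4 := Real.add_one_le_exp (t + 1)
    have h5 := Real.add_one_le_exp (1 : ℝ)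
    nlinarith
  have he : Real.exp (1 / 2 : ℝ) ≤ 2 := by
    have h3 : Real.exp (1 / 2 : ℝ) * Real.exp (1 / 2) = Real.exp 1 := by
      rw [← Real.exp_add]; norm_num
    nlinarith [Real.exp_one_lt_d9, Real.exp_pos (1 / 2 : ℝ)]
  have hT : Real.exp t = Real.exp (1 / 2 * t) * Real.exp (1 / 2 * t) := by
    rw [← Real.exp_add]; ring_nf
  rw [hs, Real.log_exp] at h1
  have e1 : Real.exp (t + 1) = Real.exp t * Real.exp 1 := Real.exp_add _ _
  have e2 : Real.exp (t - 1) * Real.exp 1 = Real.exp t := by rw [← Real.exp_add]; ring_nf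
  have hl4 : Real.log 4 = 2 * Real.log 2 := by
    rw [show (4 : ℝ) = 2 ^ 2 by norm_num, Real.log_pow]; norm_num
  have hl2 := Real.log_two_gt_d9
  have hl2' := Real.log_two_lt_d9
  have hE1 := Real.exp_one_gt_d9
  set y := Real.exp (1 / 2 * t) with hy
  have hy1 : 1 ≤ y := Real.one_le_exp (by linarith)
  have hx0 : 0 < Real.exp t := Real.exp_pos t
  have herr : 2 * (y * Real.exp (1 / 2)) * (t + 1) ≤ 6 * t * y := by
    have : Real.exp (1 / 2 : ℝ) * (t + 1) ≤ 2 * (1.5 * t) :=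
      mul_le_mul he (by linarith) (by linarith) (by norm_num)
    nlinarith
  have hsmall : 40 * (t * y) ≤ Real.exp t := by
    rw [hT]
    rw [pow_one] at ht
    nlinarith
  have hty : t ≤ t * y := by nlinarith
  have hlow : 1.8 * Real.exp t ≤ Real.exp (t + 1) * Real.log 2 := by
    rw [e1, mul_assoc]
    have : 1.8 ≤ Real.exp 1 * Real.log 2 := by nlinarith
    nlinarith
  have hup : Real.log 4 * Real.exp (t - 1) ≤ 0.52 * Real.exp t := by
    rw [hl4, ← e2]
    have h0 : 0 < Real.exp (t - 1) := Real.exp_pos _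
    have : 2 * Real.log 2 ≤ 0.52 * Real.exp 1 := by linarith
    nlinarith
  linarith

/-- The product of the primes up to `D`. -/
def smallPrimeProduct (D : ℕ) : ℕ := ∏ p ∈ (Finset.range (D + 1)).filter Nat.Prime, p

lemma smallPrimeProduct_pos (D : ℕ) : 0 < smallPrimeProduct D :=
  Finset.prod_pos fun _ hp => (Finset.mem_filter.1 hp).2.pos

lemma coprime_smallPrimeProduct_iff {D p : ℕ} (hp : p.Prime) :
    (smallPrimeProduct D).Coprime p ↔ D < p := by
  rw [smallPrimeProduct, Nat.coprime_prod_left_iff]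
  constructor
  · intro h
    by_contra hD
    have := h p (Finset.mem_filter.2 ⟨Finset.mem_range.2 (by omega), hp⟩)
    rw [Nat.coprime_self] at this
    exact hp.one_lt.ne' this
  · intro h q hq
    rw [Finset.mem_filter, Finset.mem_range] at hq
    rw [Nat.coprime_primes hq.2 hp]
    omega

lemma exists_residue {κ : Type*} (h : κ → ℤ)
    (hadm : ∀ p : ℕ, p.Prime → ∃ n : ℤ, ∀ i, ¬ (p : ℤ) ∣ n + h i) (D : ℕ) :
    ∃ v : ℤ, ∀ i, IsCoprime (v + h i) (smallPrimeProduct D : ℤ) := by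
  choose! n hn using hadm
  obtain ⟨v, hv⟩ := Nat.chineseRemainderOfFinset (fun p => (n p % p).toNat) id
    ((Finset.range (D + 1)).filter Nat.Prime)
    (fun p hp => (Finset.mem_filter.1 hp).2.ne_zero) (fun p hp q hq hpq =>
      (Nat.coprime_primes (Finset.mem_filter.1 hp).2 (Finset.mem_filter.1 hq).2).2 hpq)
  refine ⟨v, fun i => ?_⟩
  rw [smallPrimeProduct, Nat.cast_prod]
  refine IsCoprime.prod_right fun p hp => ?_
  have hpp := (Finset.mem_filter.1 hp).2
  rw [isCoprime_comm, (Nat.prime_iff_prime_int.1 hpp).irreducible.coprime_iff_not_dvd]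
  intro hdvd
  refine hn p hpp i ?_
  have h1 : (v : ℤ) ≡ n p [ZMOD p] := by
    have h2 : (v : ℤ) ≡ ((n p % p).toNat : ℤ) [ZMOD p] := by
      have := hv p hp
      rw [id] at this
      exact (Int.natCast_modEq_iff).2 this
    rw [Int.toNat_of_nonneg (Int.emod_nonneg _ (by exact_mod_cast hpp.ne_zero))] at h2
    exact h2.trans (Int.mod_modEq _ _)
  exact (Int.ModEq.dvd_iff (h1.add_right (h i))).1 hdvd

lemma exists_sieveSetup {κ : Type*} [Fintype κ] (h : κ → ℤ) (hinj : Function.Injective h)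
    (hadm : ∀ p : ℕ, p.Prime → ∃ n : ℤ, ∀ i, ¬ (p : ℤ) ∣ n + h i) (J : ℕ)
    (hJ : (128 : ℝ) * (J + 1) * Fintype.card κ ≤ 2 ^ J) :
    ∃ (W : ℕ) (v : ℤ), 0 < W ∧ (∀ i, IsCoprime (v + h i) W) ∧
      ∀ᶠ L : ℝ in atTop, ∃ P, SieveSetup P W L (Fintype.card κ) J ∧
        ∀ p ∈ P, ∀ i j, i ≠ j → ¬ (p : ℤ) ∣ h i - h j := by
  set k := Fintype.card κ
  set D := 2 * k + 2 + 32 * (k + 1) ^ 2 + ∑ i, ∑ j, (h i - h j).natAbs with hD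
  obtain ⟨v, hv⟩ := exists_residue h hadm D
  have hW := smallPrimeProduct_pos D
  set W := smallPrimeProduct D with hWdef
  refine ⟨W, v, hW, hv, ?_⟩
  have hWr : (0 : ℝ) < W := by exact_mod_cast hW
  have hφ : (0 : ℝ) < W.totient := by exact_mod_cast Nat.totient_pos.2 hW
  filter_upwards [(tendsto_id.const_mul_atTop (div_pos hφ hWr)).eventually_ge_atTop
    (2 ^ (J + 3) * ((W : ℝ) + 1)), eventually_gt_atTop (0 : ℝ)] with L hL hL0
  set N := ⌊Real.exp L⌋₊ with hN
  refine ⟨(Finset.Ioo D (N + 1)).filter Nat.Prime, ?_, ?_⟩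
  · refine ⟨fun p hp => (Finset.mem_filter.1 hp).2, hW, fun p hp => ?_, fun p hp hpW hpL => ?_,
      fun p hp => ?_, fun p hp => ?_, hL0, ?_, hL, hJ⟩
    · rw [Finset.mem_filter, Finset.mem_Ioo] at hp
      exact (coprime_smallPrimeProduct_iff hp.2).2 hp.1.1
    · rw [Finset.mem_filter, Finset.mem_Ioo]
      exact ⟨⟨(coprime_smallPrimeProduct_iff hp).1 hpW, by omega⟩, hp⟩
    · rw [Finset.mem_filter, Finset.mem_Ioo] at hp
      omega
    · rw [Finset.mem_filter, Finset.mem_Ioo] at hp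
      omega
    · rw [Finset.sum_coe_sort _ fun p : ℕ => (1 / (p : ℝ)) ^ 2]
      calc _ ≤ ∑ p ∈ Finset.Ioo D (N + 1), (1 / (p : ℝ)) ^ 2 :=
            Finset.sum_le_sum_of_subset_of_nonneg (Finset.filter_subset _ _)
              fun _ _ _ => by positivity
        _ = ∑ p ∈ Finset.Ioo D (N + 1), ((p : ℝ) ^ 2)⁻¹ :=
            Finset.sum_congr rfl fun p _ => by rw [div_pow, one_pow, one_div]
        _ ≤ 2 / (D + 1) := sum_Ioo_inv_sq_le D (N + 1)
        _ ≤ _ := by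
            rw [div_le_div_iff₀ (by positivity) (by positivity)]
            have : 32 * (k + 1) ^ 2 ≤ D := by
              rw [hD, add_assoc, add_comm (2 * k + 2), add_assoc]
              exact Nat.le_add_right _ _
            have : 32 * ((k : ℝ) + 1) ^ 2 ≤ D := by exact_mod_cast this
            linarith
  · intro p hp i j hij hdvd
    rw [Finset.mem_filter, Finset.mem_Ioo] at hp
    have h1 : h i - h j ≠ 0 := sub_ne_zero.2 fun e => hij (hinj e)
    have h2 := Nat.le_of_dvd (Int.natAbs_pos.2 h1) (Int.natCast_dvd.1 hdvd)
    have h3 : (h i - h j).natAbs ≤ ∑ i, ∑ j, (h i - h j).natAbs :=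
      (Finset.single_le_sum (f := fun j => (h i - h j).natAbs) (fun _ _ => Nat.zero_le _)
        (Finset.mem_univ j)).trans (Finset.single_le_sum
          (f := fun i => ∑ j, (h i - h j).natAbs) (fun _ _ => Nat.zero_le _) (Finset.mem_univ i))
    have h4 : ∑ i, ∑ j, (h i - h j).natAbs ≤ D := Nat.le_add_left _ _
    omega

namespace SieveSetup

variable {P : Finset ℕ} {W J k : ℕ} {L t x : ℝ}

lemma gain (H : SieveSetup P W L k J) (hk : 0 < k)
    (hJk : 2 ^ 26 * (2 : ℝ) ^ J ≤ k * ((J : ℝ) + 1) ^ 2) (hLt : t = 48 * L) (ht : 3 ≤ t)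
    (hx : 0 < x) :
    2 * ((t + 3) * (Real.exp 4 * x / W * (4 * gsq P J L ^ k))) ≤
      k * (x / W.totient * (gsum P J L ^ 2 * (gsq P J L ^ (k - 1) / 2))) := by
  have hL := H.L_pos
  have hW : (0 : ℝ) < W := by exact_mod_cast H.W_pos
  have hφ : (0 : ℝ) < W.totient := by exact_mod_cast Nat.totient_pos.2 H.W_pos
  have h1 := H.gsum_ge
  have h2 := H.gsq_le
  have hγ : 0 ≤ gsq P J L ^ (k - 1) := pow_nonneg gsq_nonneg _
  obtain ⟨j, rfl⟩ : ∃ j, k = j + 1 := ⟨k - 1, by omega⟩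
  rw [Nat.add_sub_cancel] at hγ ⊢
  rw [pow_succ]
  set γ := gsq P J L
  set G := gsum P J L
  set K : ℝ := W.totient / (W : ℝ) with hK
  have hK0 : 0 < K := by positivity
  have hG2 : ((J + 1) * (K * L / 8)) ^ 2 ≤ G ^ 2 := pow_le_pow_left₀ (by positivity) h1 2
  have he : Real.exp 4 ≤ 64 := by
    have e : Real.exp 4 = Real.exp 1 ^ 4 := by rw [← Real.exp_nat_mul]; norm_num
    rw [e]
    calc _ ≤ (2.8 : ℝ) ^ 4 :=
          pow_le_pow_left₀ (Real.exp_pos 1).le (by linarith [Real.exp_one_lt_d9]) 4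
      _ ≤ 64 := by norm_num
  have hWφ : 1 / (W : ℝ) = K / W.totient := by rw [hK]; field_simp
  calc _ = (t + 3) * (Real.exp 4) * γ * (8 * γ ^ j * x * (1 / W)) := by ring
    _ ≤ (2 * (48 * L)) * 64 * (2 ^ J * (8 * (K * L))) * (8 * γ ^ j * x * (1 / W)) := by
        have hγ0 : 0 ≤ γ := gsq_nonneg
        refine mul_le_mul_of_nonneg_right ?_ (by positivity)
        refine mul_le_mul (mul_le_mul (by linarith) he (by positivity) (by positivity)) h2 hγ0
          (by positivity)
    _ = (393216 * 2 ^ J) * (K ^ 2 * L ^ 2 * γ ^ j * x / W.totient) := by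
        rw [hWφ]; ring
    _ ≤ ((j + 1 : ℕ) * ((J : ℝ) + 1) ^ 2 / 128) * (K ^ 2 * L ^ 2 * γ ^ j * x / W.totient) := by
        refine mul_le_mul_of_nonneg_right ?_ (by positivity)
        have : (0 : ℝ) < 2 ^ J := by positivity
        norm_num at hJk ⊢
        linarith
    _ = (j + 1 : ℕ) * (x / W.totient * (((J + 1) * (K * L / 8)) ^ 2 * (γ ^ j / 2))) := by ring
    _ ≤ _ := by gcongr

lemma main_size (H : SieveSetup P W L k J) (hk : 0 < k) (hLt : t = 48 * L) (hx : 0 < x) :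
    k * (1 / W.totient * (((J + 1) * (W.totient / (W : ℝ) / 384)) ^ 2 *
      ((2 ^ J * (W.totient / (W : ℝ) / 384)) ^ (k - 1) / 2))) * (t ^ (k + 1) * x) ≤
      k * (x / W.totient * (gsum P J L ^ 2 * (gsq P J L ^ (k - 1) / 2))) := by
  have hL := H.L_pos
  have h1 := H.gsum_ge
  have h2 := H.gsq_ge
  obtain ⟨j, rfl⟩ : ∃ j, k = j + 1 := ⟨k - 1, by omega⟩
  rw [Nat.add_sub_cancel]
  set γ := gsq P J L
  set G := gsum P J L
  set K : ℝ := W.totient / (W : ℝ) with hK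
  have hK0 : 0 ≤ K := by positivity
  have hG2 : ((J + 1) * (K * L / 8)) ^ 2 ≤ G ^ 2 := pow_le_pow_left₀ (by positivity) h1 2
  have hγj : (2 ^ J * (K * L / 8)) ^ j ≤ γ ^ j := pow_le_pow_left₀ (by positivity) h2 j
  calc _ = (j + 1 : ℕ) * (x / W.totient * (((J + 1) * (K * L / 8)) ^ 2 *
        ((2 ^ J * (K * L / 8)) ^ j / 2))) := by
        have e1 : (2 : ℝ) ^ J * (K * L / 8) = 2 ^ J * (K / 384) * t := by rw [hLt]; ring
        have e2 : ((J : ℝ) + 1) * (K * L / 8) = (J + 1) * (K / 384) * t := by rw [hLt]; ring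
        rw [e1, e2, mul_pow _ t j, mul_pow _ t 2]
        ring
    _ ≤ _ := by gcongr

end SieveSetup

lemma sum_thw_le {κ : Type*} [Fintype κ] {t : ℝ} (ht : 0 ≤ t) (h : κ → ℤ) (n : ℤ)
    (hn : ∀ i j, i ≠ j → (n + h i).toNat.Prime → ¬ (n + h j).toNat.Prime) :
    ∑ m, thw (Real.exp t) (n + h m).toNat ≤ t + 3 := by
  by_cases H : ∃ i, thw (Real.exp t) (n + h i).toNat ≠ 0
  swap
  · push Not at H
    rw [Finset.sum_eq_zero fun i _ => H i]
    linarith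
  obtain ⟨i, hi⟩ := H
  have hp := prime_of_thw_ne_zero hi
  rw [Finset.sum_eq_single i (fun j _ hj => ?_) (by simp)]
  · rw [thw, if_pos hp]
    have h1 : (n + h i).toNat < cut (Real.exp t) := by
      by_contra hcut
      exact hi (thw_eq_zero_of_cut_le (Real.exp_pos t) (not_lt.1 hcut))
    have h2 : ((n + h i).toNat : ℝ) ≤ Real.exp (t + 3) :=
      le_trans (by exact_mod_cast h1.le) (cut_exp_le ht)
    have h3 := Real.log_le_log (by exact_mod_cast hp.pos) h2
    rw [Real.log_exp] at h3
    exact (mul_le_of_le_one_right (Real.log_natCast_nonneg _) (wt_le_one _ _)).trans h3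
  · rw [thw, if_neg (hn i j hj.symm hp)]

set_option maxHeartbeats 3200000 in
/-- A tuple which is long enough compared with the number of steps of the sieve weight
contains two primes infinitely often. -/
lemma exists_two_primes {κ : Type*} [Fintype κ] (h : κ → ℤ) (hinj : Function.Injective h)
    (hadm : ∀ p : ℕ, p.Prime → ∃ n : ℤ, ∀ i, ¬ (p : ℤ) ∣ n + h i) (J : ℕ)
    (hJ : (128 : ℝ) * (J + 1) * Fintype.card κ ≤ 2 ^ J)
    (hJk : 2 ^ 26 * (2 : ℝ) ^ J ≤ Fintype.card κ * ((J : ℝ) + 1) ^ 2)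
    (hk4 : 4 ≤ Fintype.card κ) (N : ℕ) :
    ∃ n : ℤ, N < n ∧ ∃ i j, i ≠ j ∧ (n + h i).toNat.Prime ∧ (n + h j).toNat.Prime := by
  obtain ⟨W, v, hW, hv, hev⟩ := exists_sieveSetup h hinj hadm J hJ
  set k := Fintype.card κ with hk
  have hWr : (0 : ℝ) < W := by exact_mod_cast hW
  have hφ : (0 : ℝ) < W.totient := by exact_mod_cast Nat.totient_pos.2 hW
  set M : ℕ := ∑ i, (h i).natAbs with hM
  have hMi : ∀ i, |h i| ≤ M := fun i => by
    rw [Int.abs_eq_natAbs]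
    exact_mod_cast Finset.single_le_sum (f := fun i => (h i).natAbs) (fun _ _ => Nat.zero_le _)
      (Finset.mem_univ i)
  set D : ℝ := k * (1 / W.totient * (((J + 1) * (W.totient / (W : ℝ) / 384)) ^ 2 *
      ((2 ^ J * (W.totient / (W : ℝ) / 384)) ^ (k - 1) / 2))) with hD
  have hk0 : (0 : ℝ) < k := by exact_mod_cast (by omega : 0 < k)
  have hD0 : 0 < D := by positivity
  set C₁ : ℝ := (2 ^ (J + 1)) ^ k with hC₁
  set C₂ : ℝ := C₁ * ((3 * (k + 1) : ℕ) : ℝ) ^ ((3 * (k + 1)) ^ 2) with hC₂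
  have hC₁0 : 0 < C₁ := by positivity
  have hC₂0 : 0 < C₂ := by positivity
  have hev48 := (tendsto_id.atTop_div_const (by norm_num : (0 : ℝ) < 48)).eventually hev
  obtain ⟨t₀, ht₀⟩ := eventually_atTop.1 (hev48.and (eventually_exp_le_totalW.and
    ((eventually_mul_pow_le_exp (Real.exp 2 * W) 0 (by norm_num : (0 : ℝ) < 1 / 2)).and
    ((eventually_mul_pow_le_exp (2 * C₂ ^ 2) 1 (by norm_num : (0 : ℝ) < 1 / 2)).and
    ((eventually_mul_pow_le_exp (Real.exp 2 * (N + M + 1)) 0 one_pos).and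
    ((eventually_gt_atTop (2 * (k * C₁ ^ 2 + 1) / D)).and
    (eventually_ge_atTop (6 : ℝ))))))))
  obtain ⟨t, htt₀, herr⟩ := exists_scale_sum_err_le W (3 * (k + 1) ^ 2) hW (by positivity) t₀
  obtain ⟨⟨P, H, hh⟩, htot, hWx, hC₂x, hNx, htD, ht6⟩ := ht₀ t htt₀
  simp only [id, pow_zero, mul_one, pow_one, one_mul] at H hWx hC₂x hNx
  set x := Real.exp t with hx
  have hx0 : 0 < x := Real.exp_pos t
  set L := t / 48 with hL
  have hLt : t = 48 * L := by rw [hL]; ring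
  have hLp := H.L_pos
  set γ := gsq P J L with hγ
  set G := gsum P J L with hG
  have hexpL : Real.exp L ^ 2 = Real.exp (t / 24) := by
    rw [← Real.exp_nat_mul, hL]; congr 1; push_cast; ring
  have hhalf : Real.exp (1 / 2 * t) * Real.exp (1 / 2 * t) = x := by
    rw [← Real.exp_add, hx]; ring_nf
  have hR2 : ((⌊Real.exp L⌋₊ ^ 2 : ℕ) : ℝ) ≤ Real.exp (t / 24) := by
    rw [← hexpL]
    push_cast
    exact pow_le_pow_left₀ (by positivity) (Nat.floor_le (Real.exp_pos L).le) 2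
  have hR : Real.exp 2 * (W * ⌊Real.exp L⌋₊ ^ 2 : ℕ) ≤ x := by
    rw [Nat.cast_mul, ← mul_assoc, ← hhalf]
    refine mul_le_mul hWx (hR2.trans (Real.exp_le_exp.2 (by linarith))) (by positivity)
      (Real.exp_pos _).le
  have hRx : Real.exp 2 * Real.exp L ≤ x := by
    rw [← Real.exp_add, hx]
    exact Real.exp_le_exp.2 (by rw [hL]; linarith)
  set B : ℤ := cut x + M with hB
  have hNM : (N : ℝ) + M + 1 ≤ x := by
    refine le_trans ?_ hNx
    have := Real.one_le_exp (by norm_num : (0 : ℝ) ≤ 2)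
    nlinarith [(by positivity : (0 : ℝ) ≤ N + M + 1)]
  have hcut : (cut x : ℝ) ≤ Real.exp 3 * x := by
    rw [← Real.exp_add, add_comm]; exact cut_exp_le (by linarith)
  have hBx : ((B - N : ℤ) : ℝ) ≤ Real.exp 4 * x := by
    have e : Real.exp 4 = Real.exp 3 * Real.exp 1 := by rw [← Real.exp_add]; norm_num
    have h3 := Real.add_one_le_exp (3 : ℝ)
    have h1 := Real.add_one_le_exp (1 : ℝ)
    have h2 : Real.exp 3 + 1 ≤ Real.exp 4 := by rw [e]; nlinarith
    have := mul_le_mul_of_nonneg_right h2 hx0.le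
    rw [hB]
    push_cast
    have : (0 : ℝ) ≤ N := by positivity
    linarith
  have hNB : (N : ℤ) ≤ B := by
    have h1 : x ≤ cut x := by
      rw [cut]
      push_cast
      have h2 := (Nat.lt_floor_add_one (Real.exp 2 * x)).le
      have := Real.one_le_exp (by norm_num : (0 : ℝ) ≤ 2)
      nlinarith
    have h2 : (N : ℝ) ≤ cut x := by
      have : (0 : ℝ) ≤ M := by positivity
      linarith
    have h3 : N ≤ cut x := by exact_mod_cast h2
    rw [hB]; omega
  have hI : ∀ m, ∀ n : ℕ, thw x n ≠ 0 → (n : ℤ) - h m ∈ Finset.Ioc (N : ℤ) B := by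
    intro m n hn
    have h1 := lt_of_thw_ne_zero hn
    have h2 : n < cut x := by
      by_contra hcut
      exact hn (thw_eq_zero_of_cut_le hx0 (not_lt.1 hcut))
    have h3 : ((N + M + 1 : ℕ) : ℝ) ≤ n := by
      push_cast
      have := hNx.trans h1.le
      exact le_of_mul_le_mul_left this (Real.exp_pos 2)
    have h4 : N + M + 1 ≤ n := by exact_mod_cast h3
    have h5 := abs_le.1 (hMi m)
    rw [Finset.mem_Ioc, hB]
    constructor <;> omega
  by_contra hcon
  push Not at hcon
  have hS1 := H.sum_square_upper h hh v N B hNB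
  have hS2 := fun m => H.sum_thw_square_lower h hh m (hv m) hR hRx (hI m)
  rw [← hk, ← hγ, ← hC₁, ← hC₂] at hS1
  simp only [← hk, ← hγ, ← hG, ← hC₁] at hS2
  have hS2sum := Finset.sum_le_sum fun m (_ : m ∈ Finset.univ) => hS2 m
  rw [Finset.sum_const, Finset.card_univ, ← hk, nsmul_eq_mul, Finset.sum_comm] at hS2sum
  have hcomp : ∑ n ∈ Finset.Ioc (N : ℤ) B, ∑ m, (if n ≡ v [ZMOD W] then
      thw x (n + h m).toNat * sieveForm P J L h n ^ 2 else 0) ≤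
      (t + 3) * ∑ n ∈ Finset.Ioc (N : ℤ) B,
        (if n ≡ v [ZMOD W] then sieveForm P J L h n ^ 2 else 0) := by
    rw [Finset.mul_sum]
    refine Finset.sum_le_sum fun n hn => ?_
    split_ifs
    · rw [← Finset.sum_mul]
      refine mul_le_mul_of_nonneg_right (sum_thw_le (by linarith) h n fun i j hij => ?_)
        (sq_nonneg _)
      exact hcon n (Finset.mem_Ioc.1 hn).1 i j hij
    · simp
  have hgain := H.gain (x := x) (by omega) hJk hLt (by linarith) hx0
  have hsize := H.main_size (x := x) (by omega) hLt hx0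
  rw [← hγ, ← hG] at hgain hsize
  rw [← hD] at hsize
  have hG0 : 0 ≤ G ^ 2 * (γ ^ (k - 1) / 2) :=
    mul_nonneg (sq_nonneg _) (div_nonneg (pow_nonneg gsq_nonneg _) two_pos.le)
  have hγk : 0 ≤ γ ^ k := pow_nonneg gsq_nonneg _
  set Er := ∑ q ∈ Finset.Icc 1 (⌊Real.exp L⌋₊ ^ 2),
        ((3 * (k + 1) ^ 2 : ℕ) : ℝ) ^ q.primeFactors.card * err x (W * q) with hEr
  have hEr0 : 0 ≤ Er := Finset.sum_nonneg fun q _ => mul_nonneg (by positivity) (err_nonneg _ _)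
  have hErx : Er ≤ x := by
    refine le_trans (Finset.sum_le_sum_of_subset_of_nonneg ?_ fun q _ _ =>
      mul_nonneg (by positivity) (err_nonneg _ _)) herr
    exact Finset.Icc_subset_Icc_right (Nat.le_floor hR2)
  have hmain : k * (x / W.totient * (G ^ 2 * (γ ^ (k - 1) / 2))) ≤
      k * (totalW x / W.totient * (G ^ 2 * (γ ^ (k - 1) / 2))) := by gcongr
  have hZ : k * ((C₁ * (2 + L) ^ 2) ^ 2 * Er) ≤ k * C₁ ^ 2 * t ^ 4 * x := by
    have h1 : (2 + L) ^ 2 ≤ t ^ 2 := pow_le_pow_left₀ (by linarith) (by linarith) 2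
    calc _ ≤ k * ((C₁ * t ^ 2) ^ 2 * x) := by gcongr
      _ = _ := by ring
  have hE1 : (t + 3) * (C₂ * Real.exp L ^ 2) ^ 2 ≤ t ^ 4 * x := by
    have h1 : Real.exp (t / 24) ^ 2 ≤ Real.exp (1 / 2 * t) := by
      rw [← Real.exp_nat_mul]
      exact Real.exp_le_exp.2 (by push_cast; linarith)
    have h2 : x ≤ t ^ 4 * x := le_mul_of_one_le_left hx0.le (one_le_pow₀ (by linarith))
    refine le_trans ?_ h2
    rw [mul_pow, hexpL, ← hhalf]
    calc _ ≤ (2 * t) * (C₂ ^ 2 * Real.exp (1 / 2 * t)) := by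
          refine mul_le_mul (by linarith) (mul_le_mul_of_nonneg_left h1 (by positivity))
            (by positivity) (by linarith)
      _ = 2 * C₂ ^ 2 * t * Real.exp (1 / 2 * t) := by ring
      _ ≤ _ := mul_le_mul_of_nonneg_right hC₂x (Real.exp_pos _).le
  have h_int : (t + 3) * (((B - N : ℤ) : ℝ) / W * (4 * γ ^ k)) ≤
      (t + 3) * (Real.exp 4 * x / W * (4 * γ ^ k)) := by gcongr
  have hS1' := mul_le_mul_of_nonneg_left hS1 (by linarith : 0 ≤ t + 3)
  rw [mul_add] at hS1'
  rw [mul_sub] at hS2sum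
  have htk : t ^ 4 * t ≤ t ^ (k + 1) := by
    rw [← pow_succ]
    exact pow_le_pow_right₀ (by linarith) (by omega)
  have hfin : 2 * (k * C₁ ^ 2 + 1) * (t ^ 4 * x) < D * (t ^ (k + 1) * x) := by
    rw [div_lt_iff₀ hD0] at htD
    have h4 : 0 < t ^ 4 * x := by positivity
    calc _ < t * D * (t ^ 4 * x) := mul_lt_mul_of_pos_right htD h4
      _ = D * (t ^ 4 * t * x) := by ring
      _ ≤ _ := by gcongr
  push_cast at h_int hS1'
  linarith

lemma exists_tuple_length : ∃ J K : ℕ, (128 : ℝ) * (J + 1) * K ≤ 2 ^ J ∧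
    2 ^ 26 * (2 : ℝ) ^ J ≤ K * ((J : ℝ) + 1) ^ 2 ∧ 4 ≤ K := by
  have h : Tendsto (fun J : ℕ => (J : ℝ) * (1 / 2) ^ J) atTop (nhds 0) :=
    tendsto_self_mul_const_pow_of_lt_one (by norm_num) (by norm_num)
  obtain ⟨J, h1, h2⟩ := ((h.eventually (gt_mem_nhds (by norm_num : (0 : ℝ) < 1 / 2048))).and
    (eventually_ge_atTop (2 ^ 34 : ℕ))).exists
  have hJ : (2 : ℝ) ^ 34 ≤ J := by exact_mod_cast h2
  have hJ0 : (1 : ℝ) ≤ J := by exact_mod_cast (one_le_pow₀ (by norm_num)).trans h2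
  have hA : (0 : ℝ) < 2 ^ J := by positivity
  have hJ1 : (J : ℝ) * 2048 ≤ 2 ^ J := by
    rw [div_pow, one_pow, mul_one_div, div_lt_iff₀ hA] at h1
    linarith
  refine ⟨J, ⌊(2 : ℝ) ^ J / (128 * ((J : ℝ) + 1))⌋₊, ?_⟩
  generalize (2 : ℝ) ^ J = A at hA hJ1 ⊢
  have hb : (0 : ℝ) < 128 * (J + 1) := by positivity
  have hfl := Nat.floor_le (div_nonneg hA.le hb.le)
  have hfl' := Nat.lt_floor_add_one (A / (128 * ((J : ℝ) + 1)))
  rw [le_div_iff₀ hb] at hfl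
  rw [div_lt_iff₀ hb] at hfl'
  have hK : 4 ≤ ⌊A / (128 * ((J : ℝ) + 1))⌋₊ := by
    refine Nat.le_floor ?_
    rw [le_div_iff₀ hb]
    push_cast
    linarith
  refine ⟨by linarith, ?_, hK⟩
  have hKr : (4 : ℝ) ≤ (⌊A / (128 * ((J : ℝ) + 1))⌋₊ : ℝ) := by exact_mod_cast hK
  set K : ℝ := (⌊A / (128 * ((J : ℝ) + 1))⌋₊ : ℝ)
  have h3 : A ≤ 256 * (K * (J + 1)) := by nlinarith
  have h4 : 0 ≤ K * ((J : ℝ) + 1) := by positivity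
  calc (2 : ℝ) ^ 26 * A ≤ 2 ^ 34 * (K * (J + 1)) := by norm_num; linarith
    _ ≤ (J + 1) * (K * (J + 1)) := mul_le_mul_of_nonneg_right (by linarith) h4
    _ = K * ((J : ℝ) + 1) ^ 2 := by ring

end BoundedGaps

/-- There exists `K` such that for every admissible `k`-tuple with `k ≥ K`, there are infinitely
many positive integers `n` such that at least two of the `n + h_i` are prime. -/
theorem exists_K_admissible_two_primes :
    ∃ K : ℕ, 0 < K ∧ ∀ k : ℕ, K ≤ k → ∀ H : Finset ℤ, H.card = k → IsAdmissible H →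
      {n : ℕ | 0 < n ∧ 2 ≤ (H.filter fun h => Prime ((n : ℤ) + h)).card}.Infinite := by
  obtain ⟨J, K, hJ, hJK, hK⟩ := BoundedGaps.exists_tuple_length
  refine ⟨K, by omega, fun k hk H hH hadm => Set.infinite_of_forall_exists_gt fun N => ?_⟩
  obtain ⟨H', hsub, hcard⟩ := Finset.exists_subset_card_eq (hk.trans hH.ge)
  have hcard' : Fintype.card H' = K := by rw [Fintype.card_coe, hcard]
  obtain ⟨n, hn, i, j, hij, hi, hj⟩ := BoundedGaps.exists_two_primes
    (fun i : H' => (i : ℤ)) Subtype.val_injective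
    (fun p hp => (hadm p hp).imp fun n hn i hdvd =>
      hn (hdvd.trans (Finset.dvd_prod_of_mem (fun h => n + h) (hsub i.2))))
    J (by rwa [hcard']) (by rwa [hcard']) (by rwa [hcard']) N
  lift n to ℕ using by omega
  have hprime : ∀ l : H', ((n : ℤ) + l).toNat.Prime → Prime ((n : ℤ) + l) := fun l hl => by
    have h0 := hl.pos
    rw [← Int.toNat_of_nonneg (by omega : 0 ≤ (n : ℤ) + l)]
    exact Nat.prime_iff_prime_int.1 hl
  have hnN : N < n := by exact_mod_cast hn
  refine ⟨n, ⟨by omega, Finset.one_lt_card.2 ⟨i, ?_, j, ?_, fun h => hij (Subtype.ext h)⟩⟩, hnN⟩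
  · exact Finset.mem_filter.2 ⟨hsub i.2, hprime i hi⟩
  · exact Finset.mem_filter.2 ⟨hsub j.2, hprime j hj⟩
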